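/- Let $d\in\{2,3\}$, let $\Omega\subset\mathbb R^d$ be an open polygonal (polyhedral) domain with Lipschitz boundary, let $k\ge 1$, and let $\{\mathcal T_h\}$ be a family of conforming simplicial triangulations of $\overline\Omega$ that is shape-regular: there is a constant $\sigma$ with $h_T\le\sigma\rho_T$ for every element $T$ of every $\mathcal T_h$, where $h_T$ is the diameter of $T$ and $\rho_T$ the diameter of the largest ball contained in $T$. Put $h=\max_{T\in\mathcal T_h}h_T$ and $\eta|_{\partial T}=h_T^{-1}$; $\boldsymbol{n}$ is the outward unit normal on $\partial T$, $(\cdot,\cdot)_{\mathcal T_h}=\sum_T\int_T$ and $\langle\cdot,\cdot\rangle_{\partial\mathcal T_h}=\sum_T\int_{\partial T}$ with norms $\|\cdot\|_{\mathcal T_h}$, $\|\cdot\|_{\partial\mathcal T_h}$. On $\partial T$, elementwise quantities are understood as traces from $T$. Write $(\nabla\boldsymbol{v})_{ij}=\partial_j v_i$ (taken elementwise for discrete fields), $(\nabla\cdot\mathbb G)_i=\sum_j\partial_j\mathbb G_{ij}$ (elementwise), and $|\boldsymbol{u}|_{m}^2=\sum_i\sum_{|\alpha|=m}\|\partial^\alpha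 u_i\|_{L^2(\Omega)}^2$. Let - $\boldsymbol\Sigma_h$ be the space of tensor fields with $\mathbb G_h|_T\in[\mathcal P_{k-1}(T)]^{d\times d}$ for all $T\in\mathcal T_h$; - $\boldsymbol{V}_h^{0}$ be the space of $\boldsymbol{v}_h\in\boldsymbol{H}(\mathrm{div};\Omega)$ with $\boldsymbol{v}_h|_T\in[\mathcal P_k(T)]^d$ for all $T$ and $\boldsymbol{v}_h\cdot\boldsymbol{n}=0$ on $\partial\Omega$; - $\widehat{\boldsymbol{V}}_h^{0}$ be the space of single-valued fields on the mesh skeleton with $\widehat{\boldsymbol{v}}_h|_E\in[\mathcal P_{k-1}(E)]^d$ on each $(d-1)$-face $E$ of $\mathcal T_h$ and $\widehat{\boldsymbol{v}}_h=0$ on $\partial\Omega$; - $\boldsymbol\Pi^o_{k-1}$ and $\boldsymbol\Pi^\partial_{k-1}$ be the componentwise $L^2$ projections onto $\mathcal P_{k-1}(T)$ on each element and onto $\mathcal P_{k-1}(E)$ on each face; - $\boldsymbol\Pi_k^{\rm BDM}\boldsymbol{v}|_T\in[\mathcal P_k(T)]^d$, for $\boldsymbol{v}\in[H^1(T)]^d$,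 be the Brezzi-Douglas-Marini projection, determined by $\langle(\boldsymbol\Pi_k^{\rm BDM}\boldsymbol{v}-\boldsymbol{v})\cdot\boldsymbol{n},w\rangle_E=0$ for all $w\in\mathcal P_k(E)$ and all faces $E$ of $T$; $(\boldsymbol\Pi_k^{\rm BDM}\boldsymbol{v}-\boldsymbol{v},\nabla p)_T=0$ for all $p\in\mathcal P_{k-1}(T)$; and, if $d=2$ and $k\ge2$, $(\boldsymbol\Pi_k^{\rm BDM}\boldsymbol{v}-\boldsymbol{v},\mathbf{curl}(b_Tp))_T=0$ for all $p\in\mathcal P_{k-2}(T)$, where $b_T$ is the product of the barycentric coordinates of $T$ and $\mathbf{curl}\,\varphi=(\partial_2\varphi,-\partial_1\varphi)$, while, if $d=3$, $(\boldsymbol\Pi_k^{\rm BDM}\boldsymbol{v}-\boldsymbol{v},\boldsymbol{w})_T=0$ for all $\boldsymbol{w}\in[\mathcal P_k(T)]^3$ with $\nabla\cdot\boldsymbol{w}=0$ in $T$ and $\boldsymbol{w}\cdot\boldsymbol{n}=0$ on $\partial T$. For $\nu>0$ define $$|\!|\!|(\mathbb G_h,\boldsymbol{v}_h,\widehat{\boldsymbol{v}}_h)|\!|\!|^2=\nu^{-1}\|\mathbb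 G_h\|_{\mathcal T_h}^2+\nu\|\nabla\boldsymbol{v}_h\|_{\mathcal T_h}^2+\nu\|\eta^{1/2}(\boldsymbol\Pi_{k-1}^\partial\boldsymbol{v}_h-\widehat{\boldsymbol{v}}_h)\|_{\partial\mathcal T_h}^2,$$ $$E(\mathbb L,\boldsymbol{u};\mathbb G_h,\boldsymbol{v}_h,\widehat{\boldsymbol{v}}_h)=\langle(\boldsymbol\Pi_{k-1}^o\mathbb L-\mathbb L)\boldsymbol{n},\widehat{\boldsymbol{v}}_h-\boldsymbol{v}_h\rangle_{\partial\mathcal T_h}+\nu\langle\eta(\boldsymbol\Pi_k^{\rm BDM}\boldsymbol{u}-\boldsymbol{u}),\boldsymbol\Pi_{k-1}^\partial\boldsymbol{v}_h-\widehat{\boldsymbol{v}}_h\rangle_{\partial\mathcal T_h}+(\boldsymbol\Pi_k^{\rm BDM}\boldsymbol{u}-\boldsymbol{u},\nabla\cdot\mathbb G_h)_{\mathcal T_h}.$$ Then there is a constant $C>0$, independent of the member $\mathcal T_h$ of the family (in particular of $h$ and all $h_T$) and of $\nu$, such that for every $\mathcal T_h$, every $\nu>0$, all $(\mathbb L,\boldsymbol{u})\in[H^k(\Omega)]^{d\times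 d}\times[H^{k+1}(\Omega)]^d$ with $\mathbb L=\nu\nabla\boldsymbol{u}$, and all $(\mathbb G_h,\boldsymbol{v}_h,\widehat{\boldsymbol{v}}_h)\in\boldsymbol\Sigma_h\times\boldsymbol{V}_h^0\times\widehat{\boldsymbol{V}}_h^0$, $$|E(\mathbb L,\boldsymbol{u};\mathbb G_h,\boldsymbol{v}_h,\widehat{\boldsymbol{v}}_h)|\le C\,\nu^{1/2}h^k|\boldsymbol{u}|_{k+1}\,|\!|\!|(\mathbb G_h,\boldsymbol{v}_h,\widehat{\boldsymbol{v}}_h)|\!|\!| .$$ -/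

import Mathlib

open MeasureTheory Filter Topology
open scoped ContDiff NNReal

noncomputable section

namespace HDG

/-- The Euclidean space `ℝ^d`. -/
abbrev Pt (d : ℕ) := EuclideanSpace ℝ (Fin d)

/-- Polynomials in `d` real variables. -/
abbrev Poly (d : ℕ) := MvPolynomial (Fin d) ℝ

/-- The value of a polynomial at a point of `ℝ^d`. -/
def pev {d : ℕ} (p : Poly d) (x : Pt d) : ℝ := MvPolynomial.eval (fun i => x i) p

/-! ### Lipschitz domains -/

/-- `Ω` is open and, near each of its boundary points, it is the region strictly below the graph
of a Lipschitz function in some rotated Cartesian coordinate system: `e` is the direction of the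
vertical axis and `y - ⟪e, y⟫ e` the horizontal part of `y`. -/
def IsLipschitzDomain {d : ℕ} (Ω : Set (Pt d)) : Prop :=
  IsOpen Ω ∧ ∀ x ∈ frontier Ω, ∃ (e : Pt d) (r : ℝ) (K : ℝ≥0) (γ : Pt d → ℝ),
    ‖e‖ = 1 ∧ 0 < r ∧ LipschitzWith K γ ∧
      ∀ y ∈ Metric.ball x r, y ∈ Ω ↔ inner ℝ e y < γ (y - inner ℝ e y • e)

/-! ### Sobolev spaces through weak derivatives -/

/-- The classical partial derivative `∂_i φ`. -/
def partialD {d : ℕ} (i : Fin d) (φ : Pt d → ℝ) : Pt d → ℝ :=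
  fun x => fderiv ℝ φ x (EuclideanSpace.single i 1)

/-- The classical derivative `∂^α φ = ∂_1^{α_1} ⋯ ∂_d^{α_d} φ`. -/
def multiD {d : ℕ} (α : Fin d → ℕ) (φ : Pt d → ℝ) : Pt d → ℝ :=
  (List.finRange d).foldr (fun i ψ => (partialD i)^[α i] ψ) φ

/-- `φ ∈ C_c^∞(Ω)`. -/
def IsTestFunction {d : ℕ} (Ω : Set (Pt d)) (φ : Pt d → ℝ) : Prop :=
  ContDiff ℝ ∞ φ ∧ HasCompactSupport φ ∧ tsupport φ ⊆ Ω

/-- `g` is the weak derivative `∂^α f` on the open set `Ω`. -/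
def HasWeakDeriv {d : ℕ} (Ω : Set (Pt d)) (α : Fin d → ℕ) (f g : Pt d → ℝ) : Prop :=
  LocallyIntegrableOn f Ω ∧ LocallyIntegrableOn g Ω ∧
    ∀ φ, IsTestFunction Ω φ →
      ∫ x in Ω, f x * multiD α φ x = (-1) ^ (∑ i, α i) * ∫ x in Ω, g x * φ x

/-- `f ∈ H^m(Ω)`. -/
def MemH {d : ℕ} (Ω : Set (Pt d)) (m : ℕ) (f : Pt d → ℝ) : Prop :=
  MemLp f 2 (volume.restrict Ω) ∧
    ∀ α : Fin d → ℕ, ∑ i, α i ≤ m →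
      ∃ g, MemLp g 2 (volume.restrict Ω) ∧ HasWeakDeriv Ω α f g

open Classical in
/-- The square-integrable weak derivative `∂^α f` (unique up to null sets). -/
def weakDeriv {d : ℕ} (Ω : Set (Pt d)) (α : Fin d → ℕ) (f : Pt d → ℝ) : Pt d → ℝ :=
  if h : ∃ g, MemLp g 2 (volume.restrict Ω) ∧ HasWeakDeriv Ω α f g then h.choose else 0

/-- The Sobolev seminorm `|u|_{m,Ω}` of a vector field,
`|u|²_{m,Ω} = ∑_i ∑_{|α| = m} ‖∂^α u_i‖²_{0,Ω}`. -/
def seminormH {d : ℕ} (Ω : Set (Pt d)) (m : ℕ) (u : Fin d → Pt d → ℝ) : ℝ :=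
  Real.sqrt (∑ i, ∑ α ∈ Finset.piAntidiag (Finset.univ : Finset (Fin d)) m,
    ∫ x in Ω, weakDeriv Ω α (u i) x ^ 2)

/-! ### Geometry of a simplex, given by its finite set of vertices -/

/-- The open simplex with vertex set `T`. -/
def cell {d : ℕ} (T : Finset (Pt d)) : Set (Pt d) := interior (convexHull ℝ (T : Set (Pt d)))

open Classical in
/-- The vertex set of the face of `T` opposite to the vertex `x`. -/
def face {d : ℕ} (T : Finset (Pt d)) (x : Pt d) : Finset (Pt d) := T.erase x

/-- The surface (`(d-1)`-dimensional) measure on the closed face with vertex set `F`. -/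
def faceMeasure {d : ℕ} (F : Finset (Pt d)) : Measure (Pt d) :=
  (μHE[d - 1] : Measure (Pt d)).restrict (convexHull ℝ (F : Set (Pt d)))

/-- The diameter `h_T`. -/
def diamT {d : ℕ} (T : Finset (Pt d)) : ℝ := Metric.diam (convexHull ℝ (T : Set (Pt d)))

/-- The diameter `ρ_T` of the largest ball inscribed in `T`. -/
def inDiam {d : ℕ} (T : Finset (Pt d)) : ℝ :=
  sSup {ρ : ℝ | 0 ≤ ρ ∧ ∃ c, Metric.closedBall c (ρ / 2) ⊆ convexHull ℝ (T : Set (Pt d))}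

/-- `n` is the outward unit normal of `T` on the face opposite to the vertex `x`. -/
def IsOutwardNormal {d : ℕ} (T : Finset (Pt d)) (x n : Pt d) : Prop :=
  ‖n‖ = 1 ∧ (∀ p ∈ face T x, ∀ q ∈ face T x, inner ℝ n (p - q) = 0) ∧
    ∀ p ∈ face T x, inner ℝ n (x - p) < 0

open Classical in
/-- The outward unit normal of `T` on the face opposite to the vertex `x`. -/
def normal {d : ℕ} (T : Finset (Pt d)) (x : Pt d) : Pt d :=
  if h : ∃ n, IsOutwardNormal T x n then h.choose else 0

/-- `l` is the barycentric coordinate of `T` belonging to the vertex `x`. -/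
def IsBary {d : ℕ} (T : Finset (Pt d)) (x : Pt d) (l : Poly d) : Prop :=
  l.totalDegree ≤ 1 ∧ pev l x = 1 ∧ ∀ y ∈ T, y ≠ x → pev l y = 0

open Classical in
/-- The barycentric coordinate of `T` belonging to the vertex `x`. -/
def bary {d : ℕ} (T : Finset (Pt d)) (x : Pt d) : Poly d :=
  if h : ∃ l, IsBary T x l then h.choose else 0

/-- The bubble function `b_T`, the product of the barycentric coordinates of `T`. -/
def bubble {d : ℕ} (T : Finset (Pt d)) : Poly d := ∏ x ∈ T, bary T x

/-! ### Traces -/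

/-- `τ` is the trace of `f ∈ H^1(T)` on the face `F` of `T`: some sequence of smooth functions
converges to `f` in `H^1(T)` while its restrictions to `F` converge to `τ` in `L^2(F)`. -/
def IsTrace {d : ℕ} (T F : Finset (Pt d)) (f τ : Pt d → ℝ) : Prop :=
  MemH (cell T) 1 f ∧ MemLp τ 2 (faceMeasure F) ∧
    ∃ φ : ℕ → Pt d → ℝ, (∀ n, ContDiff ℝ ∞ (φ n)) ∧
      Tendsto (fun n => eLpNorm (φ n - f) 2 (volume.restrict (cell T))) atTop (𝓝 0) ∧
      (∀ i, Tendsto (fun n => eLpNorm (partialD i (φ n) - weakDeriv (cell T) (Pi.single i 1) f) 2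
        (volume.restrict (cell T))) atTop (𝓝 0)) ∧
      Tendsto (fun n => eLpNorm (φ n - τ) 2 (faceMeasure F)) atTop (𝓝 0)

open Classical in
/-- The trace on the face `F` of a function of class `H^1(T)`. -/
def trace {d : ℕ} (T F : Finset (Pt d)) (f : Pt d → ℝ) : Pt d → ℝ :=
  if h : ∃ τ, IsTrace T F f τ then h.choose else 0

/-! ### Projections -/

/-- `p` is the `L²` projection of `f` onto the polynomials of degree at most `m`, with respect to
the measure `μ`. -/
def IsL2Proj {d : ℕ} (μ : Measure (Pt d)) (m : ℕ) (f : Pt d → ℝ) (p : Poly d) : Prop :=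
  p.totalDegree ≤ m ∧
    ∀ q : Poly d, q.totalDegree ≤ m → ∫ x, pev p x * pev q x ∂μ = ∫ x, f x * pev q x ∂μ

open Classical in
/-- The `L²` projection of `f` onto the polynomials of degree at most `m`. If `μ` lives on a face,
the result is a polynomial in the ambient coordinates of which only the values on the face are
determined. -/
def l2Proj {d : ℕ} (μ : Measure (Pt d)) (m : ℕ) (f : Pt d → ℝ) : Poly d :=
  if h : ∃ p, IsL2Proj μ m f p then h.choose else 0

/-- The elementwise projection `Π_m^o f` on `T`. -/
def elemProj {d : ℕ} (T : Finset (Pt d)) (m : ℕ) (f : Pt d → ℝ) : Poly d :=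
  l2Proj (volume.restrict (cell T)) m f

/-- The facewise projection `Π_m^∂ f` on `F`. -/
def faceProj {d : ℕ} (F : Finset (Pt d)) (m : ℕ) (f : Pt d → ℝ) : Poly d :=
  l2Proj (faceMeasure F) m f

/-- For `d = 2` this is `curl φ = (∂_2 φ, -∂_1 φ)`; it is used for `d = 2` only. -/
def curl2 {d : ℕ} (φ : Poly d) (i : Fin d) : Poly d :=
  ∑ j, if i < j then MvPolynomial.pderiv j φ
    else if j < i then -MvPolynomial.pderiv j φ else 0

/-- Membership in `P_k^*(T)`: divergence-free fields in `[P_k(T)]^d` whose normal component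
vanishes on `∂T`. -/
def MemPStar {d : ℕ} (T : Finset (Pt d)) (k : ℕ) (z : Fin d → Poly d) : Prop :=
  (∀ i, (z i).totalDegree ≤ k) ∧ ∑ i, MvPolynomial.pderiv i (z i) = 0 ∧
    ∀ x ∈ T, ∀ y ∈ convexHull ℝ (face T x : Set (Pt d)), ∑ i, pev (z i) y * normal T x i = 0

/-- `w` is the BDM projection `Π_k^BDM v` on the simplex `T`, `v ∈ [H^1(T)]^d`. -/
def IsBDM {d : ℕ} (T : Finset (Pt d)) (k : ℕ) (v : Fin d → Pt d → ℝ) (w : Fin d → Poly d) :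
    Prop :=
  (∀ i, (w i).totalDegree ≤ k) ∧
  (∀ x ∈ T, ∀ q : Poly d, q.totalDegree ≤ k →
    ∫ y, (∑ i, pev (w i) y * normal T x i) * pev q y ∂faceMeasure (face T x) =
      ∫ y, (∑ i, trace T (face T x) (v i) y * normal T x i) * pev q y
        ∂faceMeasure (face T x)) ∧
  (∀ p : Poly d, p.totalDegree ≤ k - 1 →
    ∫ y in cell T, ∑ i, pev (w i) y * pev (MvPolynomial.pderiv i p) y =
      ∫ y in cell T, ∑ i, v i y * pev (MvPolynomial.pderiv i p) y) ∧
  (d = 2 → 2 ≤ k → ∀ p : Poly d, p.totalDegree ≤ k - 2 →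
    ∫ y in cell T, ∑ i, pev (w i) y * pev (curl2 (bubble T * p) i) y =
      ∫ y in cell T, ∑ i, v i y * pev (curl2 (bubble T * p) i) y) ∧
  (d = 3 → ∀ z, MemPStar T k z →
    ∫ y in cell T, ∑ i, pev (w i) y * pev (z i) y = ∫ y in cell T, ∑ i, v i y * pev (z i) y)

open Classical in
/-- The BDM projection `Π_k^BDM v` on the simplex `T`. -/
def bdm {d : ℕ} (T : Finset (Pt d)) (k : ℕ) (v : Fin d → Pt d → ℝ) : Fin d → Poly d :=
  if h : ∃ w, IsBDM T k v w then h.choose else 0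

/-! ### Triangulations -/

/-- A (conforming) simplicial triangulation of `Ω ⊆ ℝ^d`: a finite simplicial complex with
underlying space the closure of `Ω`, all of whose simplices are faces of `d`-simplices. -/
structure Triangulation {d : ℕ} (Ω : Set (Pt d)) extends
    Geometry.SimplicialComplex ℝ (Pt d) where
  finite_faces : faces.Finite
  pure : ∀ s ∈ faces, ∃ t ∈ faces, s ⊆ t ∧ t.card = d + 1
  space_eq : toSimplicialComplex.space = closure Ω

namespace Triangulation

variable {d : ℕ} {Ω : Set (Pt d)} (𝒯 : Triangulation Ω)

/-- The elements `T ∈ 𝒯_h` (through their vertex sets). -/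
def elems : Finset (Finset (Pt d)) := {T ∈ 𝒯.finite_faces.toFinset | T.card = d + 1}

/-- The mesh size `h = max_T h_T`. -/
def meshSize : ℝ := ⨆ T : {T // T ∈ 𝒯.elems}, diamT T.1

/-- Shape regularity with constant `σ`: `h_T ≤ σ ρ_T` for all elements. -/
def ShapeRegular (σ : ℝ) : Prop := ∀ T ∈ 𝒯.elems, diamT T ≤ σ * inDiam T

/-! ### Discrete spaces

An elementwise polynomial field is the family of the polynomials that represent it on the
elements; a facewise polynomial field is a family of polynomials (in the ambient coordinates)
whose values on the respective faces are the values of the field. -/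

/-- Membership in `Σ_h`. -/
def MemSigma (k : ℕ) (G : Finset (Pt d) → Fin d → Fin d → Poly d) : Prop :=
  ∀ T ∈ 𝒯.elems, ∀ i j, (G T i j).totalDegree ≤ k - 1

/-- The `i`-th component, as a function on `Ω`, of an elementwise polynomial vector field. -/
def assemble (v : Finset (Pt d) → Fin d → Poly d) (i : Fin d) (x : Pt d) : ℝ :=
  ∑ T ∈ 𝒯.elems, (cell T).indicator (pev (v T i)) x

/-- Membership in `V_h^0`: elementwise in `[P_k]^d`, in `H(div; Ω)`, and with vanishing normal
component on `∂Ω`. -/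
def MemV0 (k : ℕ) (v : Finset (Pt d) → Fin d → Poly d) : Prop :=
  (∀ T ∈ 𝒯.elems, ∀ i, (v T i).totalDegree ≤ k) ∧
  (∃ g, MemLp g 2 (volume.restrict Ω) ∧ ∀ φ, IsTestFunction Ω φ →
    ∫ x in Ω, ∑ i, 𝒯.assemble v i x * partialD i φ x = -∫ x in Ω, g x * φ x) ∧
  ∀ T ∈ 𝒯.elems, ∀ x ∈ T, convexHull ℝ (face T x : Set (Pt d)) ⊆ frontier Ω →
    ∀ y ∈ convexHull ℝ (face T x : Set (Pt d)), ∑ i, pev (v T i) y * normal T x i = 0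

/-- Membership in `V̂_h^0`: one polynomial field in `[P_{k-1}]^d` on each `(d-1)`-face of the
triangulation, vanishing on the faces in `∂Ω`. -/
def MemVhat0 (k : ℕ) (vhat : Finset (Pt d) → Fin d → Poly d) : Prop :=
  ∀ F ∈ 𝒯.faces, F.card = d →
    (∀ i, (vhat F i).totalDegree ≤ k - 1) ∧
    (convexHull ℝ (F : Set (Pt d)) ⊆ frontier Ω →
      ∀ y ∈ convexHull ℝ (F : Set (Pt d)), ∀ i, pev (vhat F i) y = 0)

/-! ### The triple norm and the consistency error -/

/-- The `i`-th component of `Π_{k-1}^∂ v_h - v̂_h` on the face of `T` opposite to `x`. -/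
def jump (k : ℕ) (v vhat : Finset (Pt d) → Fin d → Poly d) (T : Finset (Pt d)) (x : Pt d)
    (i : Fin d) (y : Pt d) : ℝ :=
  pev (faceProj (face T x) (k - 1) (pev (v T i))) y - pev (vhat (face T x) i) y

/-- `⦀(G, v, v̂)⦀² = ν⁻¹‖G‖²_{𝒯_h} + ν‖∇v‖²_{𝒯_h} + ν‖η^{1/2}(Π_{k-1}^∂ v - v̂)‖²_{∂𝒯_h}`. -/
def tripleNorm (k : ℕ) (ν : ℝ) (G : Finset (Pt d) → Fin d → Fin d → Poly d)
    (v vhat : Finset (Pt d) → Fin d → Poly d) : ℝ :=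
  Real.sqrt
    (ν⁻¹ * (∑ T ∈ 𝒯.elems, ∫ y in cell T, ∑ i, ∑ j, pev (G T i j) y ^ 2)
    + ν * (∑ T ∈ 𝒯.elems, ∫ y in cell T,
        ∑ i, ∑ j, pev (MvPolynomial.pderiv j (v T i)) y ^ 2)
    + ν * ∑ T ∈ 𝒯.elems, ∑ x ∈ T, (diamT T)⁻¹ *
        ∫ y, ∑ i, jump k v vhat T x i y ^ 2 ∂faceMeasure (face T x))

/-- `E(L, u; G, v, v̂) = ⟨(Π_{k-1}^o L - L) n, v̂ - v⟩_{∂𝒯_h}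
+ ν⟨η(Π_k^BDM u - u), Π_{k-1}^∂ v - v̂⟩_{∂𝒯_h} + (Π_k^BDM u - u, ∇·G)_{𝒯_h}`. -/
def consistencyError (k : ℕ) (ν : ℝ) (L : Fin d → Fin d → Pt d → ℝ) (u : Fin d → Pt d → ℝ)
    (G : Finset (Pt d) → Fin d → Fin d → Poly d)
    (v vhat : Finset (Pt d) → Fin d → Poly d) : ℝ :=
  (∑ T ∈ 𝒯.elems, ∑ x ∈ T, ∫ y,
      ∑ i, (∑ j, (pev (elemProj T (k - 1) (L i j)) y - trace T (face T x) (L i j) y)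
          * normal T x j)
        * (pev (vhat (face T x) i) y - pev (v T i) y) ∂faceMeasure (face T x))
  + ν * (∑ T ∈ 𝒯.elems, ∑ x ∈ T, (diamT T)⁻¹ * ∫ y,
      ∑ i, (pev (bdm T k u i) y - trace T (face T x) (u i) y)
        * jump k v vhat T x i y ∂faceMeasure (face T x))
  + ∑ T ∈ 𝒯.elems, ∫ y in cell T,
      ∑ i, (pev (bdm T k u i) y - u i y) * ∑ j, pev (MvPolynomial.pderiv j (G T i j)) y

end Triangulation

end HDG

end

open MeasureTheory Filter Topology
open scoped ContDiff NNReal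

noncomputable section

namespace HDG

/-! ### Finite-dimensional linear algebra -/

section LinearAlgebra

variable {V : Type*} [AddCommGroup V] [Module ℝ V]

/-- Cauchy-Schwarz, degenerate case: a vector of zero energy lies in the kernel. -/
theorem apply_eq_zero_of_apply_self_eq_zero (B : V →ₗ[ℝ] V →ₗ[ℝ] ℝ)
    (hs : ∀ p q, B p q = B q p) (hp : ∀ p, 0 ≤ B p p) {p : V} (h : B p p = 0) (q : V) :
    B p q = 0 := by
  by_contra hne
  have key : ∀ t : ℝ, 0 ≤ 2 * t * B p q + B q q := by
    intro t
    have := hp (t • p + q)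
    simp only [map_add, map_smul, LinearMap.add_apply, LinearMap.smul_apply, smul_eq_mul, h,
      hs q p] at this
    linarith
  have h1 := key (-(B q q + 1) / (2 * B p q))
  have : 2 * (-(B q q + 1) / (2 * B p q)) * B p q = -(B q q + 1) := by field_simp
  linarith

/-- Riesz representation for a symmetric form on a finite-dimensional space. -/
theorem exists_riesz [FiniteDimensional ℝ V] (B : V →ₗ[ℝ] V →ₗ[ℝ] ℝ)
    (hs : ∀ p q, B p q = B q p) (l : V →ₗ[ℝ] ℝ)
    (hl : ∀ p, B p p = 0 → l p = 0) : ∃ w, ∀ p, B w p = l p := by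
  have hle : LinearMap.range B ≤ (LinearMap.ker B).dualAnnihilator := by
    rintro _ ⟨w, rfl⟩
    rw [Submodule.mem_dualAnnihilator]
    intro p hpk
    rw [hs, LinearMap.mem_ker.1 hpk, LinearMap.zero_apply]
  have heq : LinearMap.range B = (LinearMap.ker B).dualAnnihilator := by
    apply Submodule.eq_of_le_of_finrank_eq hle
    have h1 := LinearMap.finrank_range_add_finrank_ker B
    have h2 := Subspace.finrank_add_finrank_dualAnnihilator_eq (LinearMap.ker B)
    rw [add_comm] at h2
    exact Nat.add_right_cancel (h1.trans h2.symm)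
  have hmem : l ∈ LinearMap.range B := by
    rw [heq, Submodule.mem_dualAnnihilator]
    intro p hpk
    apply hl
    rw [LinearMap.mem_ker.1 hpk, LinearMap.zero_apply]
  obtain ⟨w, hw⟩ := hmem
  exact ⟨w, fun p => by rw [hw]⟩

theorem exists_bound_of_posDef [FiniteDimensional ℝ V] (B₁ B₂ : V →ₗ[ℝ] V →ₗ[ℝ] ℝ)
    (hpos : ∀ p, p ≠ 0 → 0 < B₂ p p) : ∃ C > (0 : ℝ), ∀ p, B₁ p p ≤ C * B₂ p p := by
  set n := Module.finrank ℝ V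
  let e := (Module.finBasis ℝ V).equivFun.symm
  have hcont : ∀ B : V →ₗ[ℝ] V →ₗ[ℝ] ℝ, Continuous (fun x : Fin n → ℝ => B (e x) (e x)) := by
    intro B
    have : ∀ x : Fin n → ℝ, B (e x) (e x) =
        ∑ i, ∑ j, x i * x j * B (Module.finBasis ℝ V i) (Module.finBasis ℝ V j) := by
      intro x
      simp only [e, Module.Basis.equivFun_symm_apply, map_sum, map_smul, LinearMap.sum_apply,
        LinearMap.smul_apply, smul_eq_mul, Finset.mul_sum]
      rw [Finset.sum_comm]
      exact Finset.sum_congr rfl fun i _ => Finset.sum_congr rfl fun j _ => by ring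
    simp_rw [this]
    fun_prop
  have hcpt : IsCompact (Metric.sphere (0 : Fin n → ℝ) 1) := isCompact_sphere _ _
  obtain ⟨M, hM⟩ := hcpt.bddAbove_image (hcont B₁).continuousOn
  obtain ⟨c, hc0, hc⟩ : ∃ c > (0 : ℝ), ∀ x ∈ Metric.sphere (0 : Fin n → ℝ) 1,
      c ≤ B₂ (e x) (e x) := by
    rcases (Metric.sphere (0 : Fin n → ℝ) 1).eq_empty_or_nonempty with h | h
    · exact ⟨1, one_pos, by simp [h]⟩
    · obtain ⟨x, hx, hmin⟩ := hcpt.exists_isMinOn h (hcont B₂).continuousOn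
      refine ⟨_, hpos (e x) ?_, fun y hy => hmin hy⟩
      intro h0
      have : x = 0 := by simpa using h0
      simp [this] at hx
  refine ⟨(|M| + 1) / c, by positivity, fun p => ?_⟩
  by_cases hp0 : p = 0
  · simp [hp0]
  obtain ⟨x, rfl⟩ := e.surjective p
  have hx0 : x ≠ 0 := by rintro rfl; simp at hp0
  have hxn : 0 < ‖x‖ := norm_pos_iff.2 hx0
  set y := ‖x‖⁻¹ • x
  have hy : y ∈ Metric.sphere (0 : Fin n → ℝ) 1 := by
    simp [y, norm_smul, hxn.ne']
  have hxy : x = ‖x‖ • y := by simp [y, smul_smul, hxn.ne']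
  have hsc : ∀ B : V →ₗ[ℝ] V →ₗ[ℝ] ℝ, B (e x) (e x) = ‖x‖ ^ 2 * B (e y) (e y) := by
    intro B
    conv_lhs => rw [hxy]
    simp only [map_smul, LinearMap.smul_apply, smul_eq_mul]
    ring
  rw [hsc B₁, hsc B₂]
  have h1 : B₁ (e y) (e y) ≤ |M| + 1 :=
    (hM ⟨y, hy, rfl⟩).trans ((le_abs_self M).trans (by linarith))
  have h2 := hc y hy
  have h3 : B₁ (e y) (e y) ≤ (|M| + 1) / c * B₂ (e y) (e y) := by
    calc _ ≤ |M| + 1 := h1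
      _ = (|M| + 1) / c * c := by field_simp
      _ ≤ _ := by gcongr
  calc _ ≤ ‖x‖ ^ 2 * ((|M| + 1) / c * B₂ (e y) (e y)) := by gcongr
    _ = _ := by ring

/-- Each vector can be changed by a vector of zero `B₂`-energy such that its `B₁`-energy is
controlled by its `B₂`-energy. -/
theorem exists_lift_bound [FiniteDimensional ℝ V] (B₁ B₂ : V →ₗ[ℝ] V →ₗ[ℝ] ℝ)
    (hs : ∀ p q, B₂ p q = B₂ q p) (hp : ∀ p, 0 ≤ B₂ p p) :
    ∃ C > (0 : ℝ), ∀ w, ∃ w₁, B₂ (w - w₁) (w - w₁) = 0 ∧ B₁ w₁ w₁ ≤ C * B₂ w w := by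
  obtain ⟨W, hW⟩ := Submodule.exists_isCompl (LinearMap.ker B₂)
  have hpos : ∀ p : W, p ≠ 0 → 0 < (B₂.compl₁₂ W.subtype W.subtype) p p := by
    intro p hp0
    refine lt_of_le_of_ne (hp p) fun h0 => hp0 ?_
    have : (p : V) ∈ LinearMap.ker B₂ := by
      rw [LinearMap.mem_ker]
      ext q
      exact apply_eq_zero_of_apply_self_eq_zero B₂ hs hp h0.symm q
    have := Submodule.disjoint_def.1 hW.disjoint p this p.2
    exact Subtype.ext this
  obtain ⟨C, hC, hb⟩ := exists_bound_of_posDef (B₁.compl₁₂ W.subtype W.subtype)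
    (B₂.compl₁₂ W.subtype W.subtype) hpos
  refine ⟨C, hC, fun w => ?_⟩
  obtain ⟨y, hy, z, hz, rfl⟩ := Submodule.mem_sup.1 (hW.sup_eq_top ▸ Submodule.mem_top : w ∈ _)
  have hy0 : B₂ y = 0 := hy
  refine ⟨z, by simp [hy0], ?_⟩
  have := hb ⟨z, hz⟩
  simp only [LinearMap.compl₁₂_apply, Submodule.subtype_apply] at this
  simpa [hy0, hs z y] using this

end LinearAlgebra

/-! ### Polynomials -/

section Polynomials

variable {d : ℕ}

@[simp] theorem pev_add (p q : Poly d) (x : Pt d) : pev (p + q) x = pev p x + pev q x := by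
  simp [pev]
@[simp] theorem pev_sub (p q : Poly d) (x : Pt d) : pev (p - q) x = pev p x - pev q x := by
  simp [pev]
@[simp] theorem pev_neg (p : Poly d) (x : Pt d) : pev (-p) x = -pev p x := by simp [pev]
@[simp] theorem pev_mul (p q : Poly d) (x : Pt d) : pev (p * q) x = pev p x * pev q x := by
  simp [pev]
@[simp] theorem pev_C (c : ℝ) (x : Pt d) : pev (MvPolynomial.C c) x = c := by simp [pev]
@[simp] theorem pev_X (i : Fin d) (x : Pt d) : pev (MvPolynomial.X i) x = x i := by simp [pev]
@[simp] theorem pev_zero (x : Pt d) : pev 0 x = 0 := by simp [pev]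
@[simp] theorem pev_one (x : Pt d) : pev 1 x = 1 := by simp [pev]
@[simp] theorem pev_smul (c : ℝ) (p : Poly d) (x : Pt d) : pev (c • p) x = c * pev p x := by
  simp [pev]
@[simp] theorem pev_sum {ι : Type*} (s : Finset ι) (p : ι → Poly d) (x : Pt d) :
    pev (∑ i ∈ s, p i) x = ∑ i ∈ s, pev (p i) x := by simp [pev]
theorem contDiff_pev (p : Poly d) {n : WithTop ℕ∞} : ContDiff ℝ n (pev p) := by
  induction p using MvPolynomial.induction_on with
  | C a => simpa [funext (pev_C a)] using contDiff_const
  | add p q hp hq =>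
    have : pev (p + q) = fun x => pev p x + pev q x := funext fun x => pev_add p q x
    rw [this]; exact hp.add hq
  | mul_X p i hp =>
    have : pev (p * MvPolynomial.X i) = fun x => pev p x * x i := funext fun x => by simp
    rw [this]; exact hp.mul (by fun_prop)

@[fun_prop]
theorem continuous_pev (p : Poly d) : Continuous (pev p) :=
  (contDiff_pev p (n := 0)).continuous

theorem fderiv_pev (p : Poly d) (x v : Pt d) :
    fderiv ℝ (pev p) x v = ∑ i, v i * pev (MvPolynomial.pderiv i p) x := by
  induction p using MvPolynomial.induction_on with
  | C a =>
    have : pev (d := d) (MvPolynomial.C a) = fun _ => a := funext fun x => pev_C a x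
    simp [this]
  | add p q hp hq =>
    have : pev (p + q) = fun x => pev p x + pev q x := funext fun x => pev_add p q x
    rw [this, fderiv_fun_add ((contDiff_pev p (n := 1)).differentiable one_ne_zero x)
      ((contDiff_pev q (n := 1)).differentiable one_ne_zero x)]
    simp [hp, hq, mul_add, Finset.sum_add_distrib]
  | mul_X p j hp =>
    have : pev (p * MvPolynomial.X j) = fun x => pev p x * x j := funext fun x => by simp
    rw [this, fderiv_fun_mul ((contDiff_pev p (n := 1)).differentiable one_ne_zero x)
      (by fun_prop)]
    have h2 : fderiv ℝ (fun x : Pt d => x j) x v = v j := by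
      have : (fun x : Pt d => x j) = EuclideanSpace.proj (𝕜 := ℝ) j := rfl
      rw [this, ContinuousLinearMap.fderiv]; rfl
    simp only [add_apply, smul_apply, smul_eq_mul,
      hp, h2]
    simp only [Derivation.leibniz, MvPolynomial.pderiv_X, smul_eq_mul, pev_add, pev_mul, pev_X,
      mul_add, Finset.sum_add_distrib, Finset.mul_sum]
    congr 1
    · rw [Finset.sum_eq_single j]
      · simp [mul_comm]
      · intro i _ hi
        simp [hi.symm]
      · simp
    · exact Finset.sum_congr rfl fun i _ => by ring

theorem partialD_pev (i : Fin d) (p : Poly d) :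
    partialD i (pev p) = pev (MvPolynomial.pderiv i p) := by
  ext x
  rw [partialD, fderiv_pev, Finset.sum_eq_single i]
  · simp
  · intro j _ hj; simp [hj]
  · simp

theorem eq_zero_of_pev_eq_zero_on_open {U : Set (Pt d)} (hU : IsOpen U) (hne : U.Nonempty)
    {p : Poly d} (h : ∀ x ∈ U, pev p x = 0) : p = 0 := by
  obtain ⟨x, hx⟩ := hne
  have hcont : Continuous (fun y : Fin d → ℝ => (WithLp.toLp 2 y : Pt d)) := by fun_prop
  have hU' := hU.preimage hcont
  obtain ⟨ε, hε, hb⟩ := Metric.isOpen_iff.1 hU' (fun i => x i) (by simpa using hx)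
  apply MvPolynomial.funext_set (fun i => Metric.ball (x i) ε)
  · intro i
    rw [Real.ball_eq_Ioo]
    exact Set.Ioo_infinite (by linarith)
  · intro y hy
    have : y ∈ Metric.ball (fun i => x i) ε := by
      rw [ball_pi _ hε]; exact hy
    simpa [pev] using h _ (hb this)

theorem poly_ext {p q : Poly d} (h : ∀ x, pev p x = pev q x) : p = q := by
  apply MvPolynomial.funext
  intro x
  simpa [pev] using h (WithLp.toLp 2 x)

/-- The polynomials of total degree at most `m`. -/
abbrev PolyLE (d m : ℕ) : Submodule ℝ (Poly d) := MvPolynomial.restrictTotalDegree (Fin d) ℝ m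

theorem mem_polyLE {m : ℕ} {p : Poly d} : p ∈ PolyLE d m ↔ p.totalDegree ≤ m :=
  MvPolynomial.mem_restrictTotalDegree _ _ _

theorem totalDegree_pderiv_le (i : Fin d) (p : Poly d) :
    (MvPolynomial.pderiv i p).totalDegree ≤ p.totalDegree - 1 := by
  conv_lhs => rw [p.as_sum, map_sum]
  refine MvPolynomial.totalDegree_finsetSum_le fun s hs => ?_
  rw [MvPolynomial.pderiv_monomial]
  by_cases h0 : s i = 0
  · simp [h0]
  refine (MvPolynomial.totalDegree_monomial_le _ _).trans ?_
  have h1 := MvPolynomial.le_totalDegree hs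
  have h2 : (s - Finsupp.single i 1).degree + 1 = s.degree := by
    have h3 : s - Finsupp.single i 1 + Finsupp.single i 1 = s := by
      apply tsub_add_cancel_of_le
      simpa [Finsupp.single_le_iff] using Nat.one_le_iff_ne_zero.2 h0
    conv_rhs => rw [← h3, map_add, Finsupp.degree_single]
  have h4 : (s.sum fun _ e => e) = s.degree := rfl
  rw [h4] at h1
  change (s - Finsupp.single i 1).degree ≤ _
  omega

/-- Substitution of polynomials of degree at most one does not raise the degree. -/
theorem totalDegree_bind₁_le {f : Fin d → Poly d} (hf : ∀ i, (f i).totalDegree ≤ 1) (p : Poly d) :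
    (MvPolynomial.bind₁ f p).totalDegree ≤ p.totalDegree := by
  conv_lhs => rw [p.as_sum, map_sum]
  refine MvPolynomial.totalDegree_finsetSum_le fun s hs => ?_
  rw [MvPolynomial.bind₁_monomial]
  refine (MvPolynomial.totalDegree_mul _ _).trans ?_
  rw [MvPolynomial.totalDegree_C, zero_add]
  refine (MvPolynomial.totalDegree_finsetProd _ _).trans ?_
  refine le_trans ?_ (MvPolynomial.le_totalDegree hs)
  refine Finset.sum_le_sum fun i _ => ?_
  refine (MvPolynomial.totalDegree_pow _ _).trans ?_
  calc s i * (f i).totalDegree ≤ s i * 1 := Nat.mul_le_mul_left _ (hf i)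
    _ = s i := mul_one _

theorem pev_bind₁ (f : Fin d → Poly d) (p : Poly d) (x : Pt d) :
    pev (MvPolynomial.bind₁ f p) x = pev p (WithLp.toLp 2 fun i => pev (f i) x) := by
  induction p using MvPolynomial.induction_on with
  | C a => simp
  | add p q hp hq => simp [hp, hq]
  | mul_X p i hp => simp [hp]

end Polynomials

/-! ### The `L²` norm as a real number -/

section L2

variable {α : Type*} [MeasurableSpace α] {μ : Measure α} {f g h : α → ℝ}

/-- The `L²(μ)` norm. -/
def nrm (μ : Measure α) (f : α → ℝ) : ℝ := (eLpNorm f 2 μ).toReal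

theorem nrm_nonneg (μ : Measure α) (f : α → ℝ) : 0 ≤ nrm μ f := ENNReal.toReal_nonneg

theorem nrm_congr (h : f =ᵐ[μ] g) : nrm μ f = nrm μ g := by rw [nrm, nrm, eLpNorm_congr_ae h]

theorem nrm_add_le (hf : MemLp f 2 μ) (hg : MemLp g 2 μ) :
    nrm μ (fun x => f x + g x) ≤ nrm μ f + nrm μ g := by
  have h := eLpNorm_add_le hf.1 hg.1 (p := 2) (by norm_num)
  rw [nrm, nrm, nrm, ← ENNReal.toReal_add hf.2.ne hg.2.ne]
  exact ENNReal.toReal_mono (ENNReal.add_ne_top.2 ⟨hf.2.ne, hg.2.ne⟩) h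

theorem nrm_sub_comm (f g : α → ℝ) :
    nrm μ (fun x => f x - g x) = nrm μ (fun x => g x - f x) := by
  have := eLpNorm_sub_comm f g 2 μ
  exact congrArg ENNReal.toReal this

theorem nrm_sub_le (hf : MemLp f 2 μ) (hg : MemLp g 2 μ) :
    nrm μ (fun x => f x - g x) ≤ nrm μ f + nrm μ g := by
  have h := eLpNorm_sub_le hf.1 hg.1 (p := 2) (by norm_num)
  rw [nrm, nrm, nrm, ← ENNReal.toReal_add hf.2.ne hg.2.ne]
  exact ENNReal.toReal_mono (ENNReal.add_ne_top.2 ⟨hf.2.ne, hg.2.ne⟩) h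

theorem nrm_sub_le_add (hf : MemLp f 2 μ) (hg : MemLp g 2 μ) (hh : MemLp h 2 μ) :
    nrm μ (fun x => f x - h x) ≤ nrm μ (fun x => f x - g x) + nrm μ (fun x => g x - h x) := by
  have := nrm_add_le (hf.sub hg) (hg.sub hh)
  simp only [Pi.sub_apply, sub_add_sub_cancel] at this
  exact this

theorem nrm_const_mul (c : ℝ) (f : α → ℝ) : nrm μ (fun x => c * f x) = |c| * nrm μ f := by
  have := eLpNorm_const_smul c f 2 μ
  rw [nrm, nrm]
  have h2 : (fun x => c * f x) = c • f := rfl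
  rw [h2, this, ENNReal.toReal_mul]
  simp

theorem nrm_zero : nrm μ (fun _ => (0 : ℝ)) = 0 := by
  have : eLpNorm (fun _ : α => (0 : ℝ)) 2 μ = 0 := eLpNorm_zero
  rw [nrm, this]; rfl

theorem nrm_sum_le {ι : Type*} (s : Finset ι) {f : ι → α → ℝ} (hf : ∀ i ∈ s, MemLp (f i) 2 μ) :
    nrm μ (fun x => ∑ i ∈ s, f i x) ≤ ∑ i ∈ s, nrm μ (f i) := by
  classical
  induction s using Finset.induction_on with
  | empty => simp [nrm_zero]
  | insert a s ha ih =>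
    simp only [Finset.sum_insert ha]
    refine (nrm_add_le (hf a (by simp)) (memLp_finsetSum s fun i hi => hf i (by simp [hi]))).trans ?_
    gcongr
    exact ih fun i hi => hf i (by simp [hi])

theorem nrm_mono (hg : MemLp g 2 μ) (h : ∀ᵐ x ∂μ, |f x| ≤ |g x|) : nrm μ f ≤ nrm μ g :=
  ENNReal.toReal_mono hg.2.ne (eLpNorm_mono_ae (by simpa using h))

theorem nrm_sq (hf : MemLp f 2 μ) : nrm μ f ^ 2 = ∫ x, f x ^ 2 ∂μ := by
  have h := hf.eLpNorm_eq_integral_rpow_norm (by norm_num) (by norm_num)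
  have hn : 0 ≤ ∫ x, f x ^ 2 ∂μ := integral_nonneg fun x => sq_nonneg _
  have h3 : (fun a => ‖f a‖ ^ (2 : ENNReal).toReal) = fun a => f a ^ 2 := by
    funext a; simp
  rw [h3] at h
  rw [nrm, h, ENNReal.toReal_ofReal (by positivity), ← Real.rpow_natCast, ← Real.rpow_mul hn]
  simp

theorem nrm_eq_sqrt (hf : MemLp f 2 μ) : nrm μ f = Real.sqrt (∫ x, f x ^ 2 ∂μ) := by
  rw [← nrm_sq hf, Real.sqrt_sq (nrm_nonneg _ _)]

theorem nrm_le_of_sq_le (hf : MemLp f 2 μ) {c : ℝ} (hc : 0 ≤ c) (h : ∫ x, f x ^ 2 ∂μ ≤ c ^ 2) :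
    nrm μ f ≤ c := by
  rw [← nrm_sq hf] at h
  exact abs_le_of_sq_le_sq h hc |> le_of_abs_le

theorem integrable_mul_of_memLp (hf : MemLp f 2 μ) (hg : MemLp g 2 μ) :
    Integrable (fun x => f x * g x) μ := hf.integrable_mul hg

theorem abs_integral_mul_le (hf : MemLp f 2 μ) (hg : MemLp g 2 μ) :
    |∫ x, f x * g x ∂μ| ≤ nrm μ f * nrm μ g := by
  have h1 := hf.integrable_sq
  have h2 := hg.integrable_sq
  have h3 := integrable_mul_of_memLp hf hg
  have key : ∀ t : ℝ, 0 ≤ (∫ x, g x ^ 2 ∂μ) * (t * t) + (2 * ∫ x, f x * g x ∂μ) * t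
      + ∫ x, f x ^ 2 ∂μ := by
    intro t
    have : ∫ x, (f x + t * g x) ^ 2 ∂μ = (∫ x, g x ^ 2 ∂μ) * (t * t)
        + (2 * ∫ x, f x * g x ∂μ) * t + ∫ x, f x ^ 2 ∂μ := by
      have e : (fun x => (f x + t * g x) ^ 2) =
          fun x => (t * t) * g x ^ 2 + ((2 * t) * (f x * g x) + f x ^ 2) := by
        funext x; ring
      have h4 : Integrable (fun x => (2 * t) * (f x * g x) + f x ^ 2) μ := (h3.const_mul _).add h1
      rw [e, integral_add (h2.const_mul _) h4,
        integral_add (h3.const_mul _) h1, integral_const_mul, integral_const_mul]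
      ring
    rw [← this]
    exact integral_nonneg fun x => sq_nonneg _
  have hd := discrim_le_zero key
  rw [discrim, ← nrm_sq hf, ← nrm_sq hg] at hd
  refine abs_le_of_sq_le_sq ?_ (mul_nonneg (nrm_nonneg _ _) (nrm_nonneg _ _))
  nlinarith

theorem memLp_of_continuous_of_compact {X : Type*} [TopologicalSpace X] [MeasurableSpace X]
    [OpensMeasurableSpace X] {μ : Measure X} [IsFiniteMeasure μ] {K : Set X}
    (hK : IsCompact K) (hμ : ∀ᵐ x ∂μ, x ∈ K) {f : X → ℝ} (hf : Continuous f) :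
    MemLp f 2 μ := by
  obtain ⟨C, hC⟩ := hK.exists_bound_of_continuousOn hf.continuousOn
  exact MemLp.of_bound hf.measurable.aestronglyMeasurable C (hμ.mono fun x hx => hC x hx)

theorem tendsto_nrm_of_tendsto_eLpNorm {f : ℕ → α → ℝ}
    (h : Tendsto (fun n => eLpNorm (f n) 2 μ) atTop (𝓝 0)) :
    Tendsto (fun n => nrm μ (f n)) atTop (𝓝 0) :=
  (ENNReal.tendsto_toReal ENNReal.zero_ne_top).comp h

end L2

/-! ### Geometry of a simplex in terms of its barycentric coordinates -/

section Geometry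

variable {d : ℕ} (b : AffineBasis (Fin (d + 1)) ℝ (Pt d))

/-- The vertex set of the simplex spanned by an affine basis. -/
def verts : Finset (Pt d) := Finset.univ.map ⟨b, b.ind.injective⟩

theorem coe_verts : (verts b : Set (Pt d)) = Set.range b := by
  ext x; simp [verts]

theorem sum_verts (f : Pt d → ℝ) : ∑ x ∈ verts b, f x = ∑ i, f (b i) := by
  simp [verts]

theorem exists_affineBasis_verts_eq {T : Finset (Pt d)}
    (hT : AffineIndependent ℝ ((↑) : T → Pt d)) (hc : T.card = d + 1) :
    ∃ b : AffineBasis (Fin (d + 1)) ℝ (Pt d), verts b = T := by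
  let e : Fin (d + 1) ≃ T := (Fin.castOrderIso hc.symm).toEquiv.trans T.equivFin.symm
  have hi : AffineIndependent ℝ (fun i => (e i : Pt d)) := hT.comp_embedding e.toEmbedding
  have ht : affineSpan ℝ (Set.range fun i => (e i : Pt d)) = ⊤ := by
    rw [hi.affineSpan_eq_top_iff_card_eq_finrank_add_one]
    simp
  refine ⟨⟨fun i => e i, hi, ht⟩, ?_⟩
  ext x
  simp only [verts, Finset.mem_map, Finset.mem_univ, true_and, Function.Embedding.coeFn_mk]
  constructor
  · rintro ⟨i, rfl⟩; exact (e i).2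
  · intro hx; exact ⟨e.symm ⟨x, hx⟩, congrArg Subtype.val (e.apply_symm_apply ⟨x, hx⟩)⟩

theorem sum_coord_smul (y : Pt d) : ∑ i, b.coord i y • b i = y :=
  b.linear_combination_coord_eq_self y

theorem hull_verts : convexHull ℝ (verts b : Set (Pt d)) = {y | ∀ i, 0 ≤ b.coord i y} := by
  rw [coe_verts, b.convexHull_eq_nonneg_coord]

theorem cell_verts : cell (verts b) = {y | ∀ i, 0 < b.coord i y} := by
  rw [cell, coe_verts, b.interior_convexHull]

theorem isOpen_cell (T : Finset (Pt d)) : IsOpen (cell T) := isOpen_interior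

theorem cell_nonempty : (cell (verts b)).Nonempty := by
  refine ⟨Finset.univ.centroid ℝ b, ?_⟩
  rw [cell, coe_verts]
  exact b.centroid_mem_interior_convexHull

theorem isCompact_hull (T : Finset (Pt d)) : IsCompact (convexHull ℝ (T : Set (Pt d))) :=
  (T.finite_toSet).isCompact_convexHull ℝ

theorem cell_subset_hull (T : Finset (Pt d)) : cell T ⊆ convexHull ℝ (T : Set (Pt d)) :=
  interior_subset

theorem mem_face_verts {i : Fin (d + 1)} {x : Pt d} :
    x ∈ face (verts b) (b i) ↔ ∃ j, j ≠ i ∧ b j = x := by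
  simp only [face, Finset.mem_erase, verts, Finset.mem_map, Finset.mem_univ, true_and,
    Function.Embedding.coeFn_mk]
  constructor
  · rintro ⟨h, j, rfl⟩
    exact ⟨j, fun hj => h (by rw [hj]), rfl⟩
  · rintro ⟨j, hj, rfl⟩
    exact ⟨fun h => hj (b.ind.injective h), j, rfl⟩

theorem hull_face_verts (i : Fin (d + 1)) :
    convexHull ℝ (face (verts b) (b i) : Set (Pt d)) =
      {y | (∀ j, 0 ≤ b.coord j y) ∧ b.coord i y = 0} := by
  apply Set.Subset.antisymm
  · apply convexHull_min
    · intro x hx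
      obtain ⟨j, hj, rfl⟩ := (mem_face_verts b).1 hx
      refine ⟨fun l => ?_, by simp [b.coord_apply, hj.symm]⟩
      rw [b.coord_apply]; split_ifs <;> norm_num
    · have h1 : Convex ℝ {y | ∀ j, 0 ≤ b.coord j y} := by
        rw [← hull_verts]; exact convex_convexHull _ _
      have h2 : Convex ℝ {y | b.coord i y = 0} := by
        have : {y | b.coord i y = 0} = (b.coord i) ⁻¹' {0} := rfl
        rw [this]; exact (convex_singleton 0).affine_preimage _
      exact h1.inter h2
  · rintro y ⟨h1, h2⟩
    rw [← sum_coord_smul b y, ← Finset.add_sum_erase _ _ (Finset.mem_univ i), h2, zero_smul,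
      zero_add]
    refine (convex_convexHull ℝ _).sum_mem (fun j _ => h1 j) ?_ ?_
    · have := b.sum_coord_apply_eq_one y
      rw [← Finset.add_sum_erase _ _ (Finset.mem_univ i), h2, zero_add] at this
      exact this
    · intro j hj
      apply subset_convexHull
      exact (mem_face_verts b).2 ⟨j, (Finset.mem_erase.1 hj).1, rfl⟩

/-- The gradient of the `i`-th barycentric coordinate. -/
def grad (i : Fin (d + 1)) : Pt d :=
  (InnerProductSpace.toDual ℝ (Pt d)).symm (b.coord i).linear.toContinuousLinearMap

theorem inner_grad (i : Fin (d + 1)) (v : Pt d) : inner ℝ (grad b i) v = (b.coord i).linear v := by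
  rw [grad, InnerProductSpace.toDual_symm_apply]; rfl

theorem coord_sub_coord (i : Fin (d + 1)) (x y : Pt d) :
    b.coord i y - b.coord i x = inner ℝ (grad b i) (y - x) := by
  rw [inner_grad]
  exact ((b.coord i).linearMap_vsub y x).symm

theorem coord_add (i : Fin (d + 1)) (x v : Pt d) :
    b.coord i (x + v) = b.coord i x + inner ℝ (grad b i) v := by
  have := coord_sub_coord b i x (x + v)
  rw [add_sub_cancel_left] at this
  linarith

theorem inner_grad_vertex_sub (i j l : Fin (d + 1)) :
    inner ℝ (grad b i) (b j - b l) = (if i = j then 1 else 0) - (if i = l then 1 else 0) := by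
  rw [← coord_sub_coord, b.coord_apply, b.coord_apply]

theorem sum_inner_grad (v : Pt d) : ∑ i, inner ℝ (grad b i) v = 0 := by
  have h1 := b.sum_coord_apply_eq_one (0 : Pt d)
  have h2 := b.sum_coord_apply_eq_one (0 + v)
  simp only [coord_add, Finset.sum_add_distrib] at h2
  linarith

theorem sum_inner_grad_smul (v : Pt d) : ∑ i, inner ℝ (grad b i) v • b i = v := by
  have h1 := sum_coord_smul b (0 : Pt d)
  have h2 := sum_coord_smul b (0 + v)
  simp only [coord_add, add_smul, Finset.sum_add_distrib] at h2
  rw [h1] at h2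
  simpa using h2

theorem sum_inner_grad_smul_sub (v x : Pt d) : ∑ i, inner ℝ (grad b i) v • (b i - x) = v := by
  simp only [smul_sub, Finset.sum_sub_distrib, ← Finset.sum_smul, sum_inner_grad, zero_smul,
    sum_inner_grad_smul, sub_zero]

theorem sum_inner_smul_grad (g x : Pt d) : ∑ i, inner ℝ g (b i - x) • grad b i = g := by
  apply ext_inner_right ℝ
  intro v
  rw [sum_inner]
  conv_rhs => rw [← sum_inner_grad_smul_sub b v x, inner_sum]
  refine Finset.sum_congr rfl fun i _ => ?_
  rw [inner_smul_left, inner_smul_right]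
  simp [mul_comm]

theorem grad_ne_zero (hd : 0 < d) (i : Fin (d + 1)) : grad b i ≠ 0 := by
  intro h
  have : Nontrivial (Fin (d + 1)) := Fin.nontrivial_iff_two_le.2 (by omega)
  obtain ⟨j, hj⟩ := exists_ne i
  have := inner_grad_vertex_sub b i i j
  simp [h, hj.symm] at this

/-- The distance of the `i`-th vertex from the opposite face. -/
def height (i : Fin (d + 1)) : ℝ := ‖grad b i‖⁻¹

theorem height_pos (hd : 0 < d) (i : Fin (d + 1)) : 0 < height b i :=
  inv_pos.2 (norm_pos_iff.2 (grad_ne_zero b hd i))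

theorem isOutwardNormal_verts (hd : 0 < d) (i : Fin (d + 1)) :
    IsOutwardNormal (verts b) (b i) (-(height b i) • grad b i) := by
  have h0 := norm_pos_iff.2 (grad_ne_zero b hd i)
  refine ⟨?_, ?_, ?_⟩
  · rw [norm_smul, norm_neg, height, norm_inv, norm_norm, inv_mul_cancel₀ h0.ne']
  · intro p hp q hq
    obtain ⟨j, hj, rfl⟩ := (mem_face_verts b).1 hp
    obtain ⟨l, hl, rfl⟩ := (mem_face_verts b).1 hq
    rw [inner_smul_left, inner_grad_vertex_sub]
    simp [hj.symm, hl.symm]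
  · intro p hp
    obtain ⟨j, hj, rfl⟩ := (mem_face_verts b).1 hp
    rw [inner_smul_left, inner_grad_vertex_sub]
    simp [hj.symm, height_pos b hd i]

theorem normal_verts (hd : 0 < d) (i : Fin (d + 1)) :
    normal (verts b) (b i) = -(height b i) • grad b i := by
  have hex : ∃ n, IsOutwardNormal (verts b) (b i) n := ⟨_, isOutwardNormal_verts b hd i⟩
  have hn : IsOutwardNormal (verts b) (b i) (normal (verts b) (b i)) := by
    rw [normal, dif_pos hex]; exact hex.choose_spec
  set n := normal (verts b) (b i)
  obtain ⟨h1, h2, h3⟩ := hn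
  have : Nontrivial (Fin (d + 1)) := Fin.nontrivial_iff_two_le.2 (by omega)
  obtain ⟨j, hj⟩ := exists_ne i
  set H := inner ℝ n (b j - b i)
  have hjf := (mem_face_verts b).2 ⟨j, hj, rfl⟩
  have hH : 0 < H := by
    have := h3 _ hjf
    rw [← neg_sub, inner_neg_right] at this
    linarith
  have hall : ∀ l, l ≠ i → inner ℝ n (b l - b i) = H := by
    intro l hl
    have := h2 _ ((mem_face_verts b).2 ⟨l, hl, rfl⟩) _ hjf
    have e : b l - b i = (b l - b j) + (b j - b i) := by abel
    rw [e, inner_add_right, this, zero_add]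
  have hexp : n = -H • grad b i := by
    conv_lhs => rw [← sum_inner_smul_grad b n (b i)]
    have h4 : ∀ l, inner ℝ n (b l - b i) • grad b l = H • grad b l -
        (if l = i then H • grad b i else 0) := by
      intro l
      by_cases hl : l = i
      · subst hl; simp
      · simp [hall l hl, hl]
    simp_rw [h4, Finset.sum_sub_distrib, ← Finset.smul_sum]
    have h5 : ∑ l, grad b l = 0 := by
      apply ext_inner_right ℝ
      intro v
      rw [sum_inner, sum_inner_grad, inner_zero_left]
    simp [h5]
  have hHh : H = height b i := by
    rw [hexp, norm_smul, norm_neg, Real.norm_of_nonneg hH.le] at h1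
    rw [height]
    exact eq_inv_of_mul_eq_one_left h1
  rw [hexp, hHh]

theorem norm_grad (i : Fin (d + 1)) : ‖grad b i‖ = (height b i)⁻¹ := by rw [height, inv_inv]

theorem dist_le_diamT {T : Finset (Pt d)} {x y : Pt d} (hx : x ∈ convexHull ℝ (T : Set (Pt d)))
    (hy : y ∈ convexHull ℝ (T : Set (Pt d))) : ‖x - y‖ ≤ diamT T := by
  rw [← dist_eq_norm]
  exact Metric.dist_le_diam_of_mem (isCompact_hull T).isBounded hx hy

theorem vertex_mem_hull (i : Fin (d + 1)) : b i ∈ convexHull ℝ (verts b : Set (Pt d)) := by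
  apply subset_convexHull
  rw [coe_verts]; exact ⟨i, rfl⟩

theorem height_le_diamT (hd : 0 < d) (i : Fin (d + 1)) : height b i ≤ diamT (verts b) := by
  have : Nontrivial (Fin (d + 1)) := Fin.nontrivial_iff_two_le.2 (by omega)
  obtain ⟨j, hj⟩ := exists_ne i
  have h1 := inner_grad_vertex_sub b i i j
  simp only [if_true, hj.symm, if_false, sub_zero] at h1
  have h2 := real_inner_le_norm (grad b i) (b i - b j)
  rw [h1, norm_grad] at h2
  have h3 := dist_le_diamT (vertex_mem_hull b i) (vertex_mem_hull b j)
  have h4 := height_pos b hd i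
  calc height b i = height b i * 1 := (mul_one _).symm
    _ ≤ height b i * ((height b i)⁻¹ * ‖b i - b j‖) := by gcongr
    _ = ‖b i - b j‖ := by field_simp
    _ ≤ _ := h3

theorem diamT_pos (hd : 0 < d) : 0 < diamT (verts b) :=
  (height_pos b hd 0).trans_le (height_le_diamT b hd 0)

theorem inDiam_le_height (hd : 0 < d) (i : Fin (d + 1)) : inDiam (verts b) ≤ height b i := by
  apply csSup_le
  · refine ⟨0, le_rfl, b 0, ?_⟩
    simpa using vertex_mem_hull b 0
  · rintro ρ ⟨h0, c, hc⟩
    have hg := norm_pos_iff.2 (grad_ne_zero b hd i)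
    set n := ‖grad b i‖⁻¹ • grad b i
    have hn : ‖n‖ = 1 := by simp [n, norm_smul, hg.ne']
    have h1 : c + (ρ / 2) • n ∈ convexHull ℝ (verts b : Set (Pt d)) := by
      apply hc
      simp [norm_smul, hn, abs_of_nonneg h0]
    have h2 : c + (-(ρ / 2)) • n ∈ convexHull ℝ (verts b : Set (Pt d)) := by
      apply hc
      simp [norm_smul, hn, abs_of_nonneg h0]
    rw [hull_verts] at h1 h2
    have h3 := h2 i
    have h4 : b.coord i (c + (ρ / 2) • n) ≤ 1 := by
      rw [← b.sum_coord_apply_eq_one (c + (ρ / 2) • n)]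
      exact Finset.single_le_sum (fun j _ => h1 j) (Finset.mem_univ i)
    have h5 : inner ℝ (grad b i) n = ‖grad b i‖ := by
      rw [inner_smul_right, real_inner_self_eq_norm_sq]
      field_simp
    rw [coord_add, inner_smul_right, h5] at h3 h4
    rw [height, ← one_div, le_div_iff₀ hg]
    linarith

/-- The `i`-th barycentric coordinate as a polynomial. -/
def lamP (i : Fin (d + 1)) : Poly d :=
  MvPolynomial.C (b.coord i 0) + ∑ j, MvPolynomial.C (grad b i j) * MvPolynomial.X j

@[simp] theorem pev_lamP (i : Fin (d + 1)) (y : Pt d) : pev (lamP b i) y = b.coord i y := by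
  have h := coord_add b i 0 y
  rw [zero_add] at h
  rw [h, lamP]
  simp only [pev_add, pev_C, pev_sum, pev_mul, pev_X, PiLp.inner_apply]
  simp [mul_comm]

theorem totalDegree_lamP (i : Fin (d + 1)) : (lamP b i).totalDegree ≤ 1 := by
  refine (MvPolynomial.totalDegree_add _ _).trans (max_le (by simp) ?_)
  refine MvPolynomial.totalDegree_finsetSum_le fun j _ => ?_
  refine (MvPolynomial.totalDegree_mul _ _).trans ?_
  simp

theorem pderiv_lamP (i : Fin (d + 1)) (j : Fin d) :
    MvPolynomial.pderiv j (lamP b i) = MvPolynomial.C (grad b i j) := by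
  simp only [lamP, map_add, MvPolynomial.pderiv_C, map_sum, zero_add, Derivation.leibniz,
    MvPolynomial.pderiv_X, smul_eq_mul, mul_zero, add_zero]
  rw [Finset.sum_eq_single j]
  · simp
  · intro l _ hl; simp [hl]
  · simp

theorem lamP_ne_zero (i : Fin (d + 1)) : lamP b i ≠ 0 := by
  intro h
  have := pev_lamP b i (b i)
  rw [h] at this
  simp at this

/-- A polynomial of degree at most one is an affine function. -/
theorem pev_eq_of_totalDegree_le_one {p : Poly d} (hp : p.totalDegree ≤ 1) (y : Pt d) :
    pev p y = ∑ i, b.coord i y * pev p (b i) := by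
  have hconst : ∀ j, ∃ c, MvPolynomial.pderiv j p = MvPolynomial.C c := by
    intro j
    have h := totalDegree_pderiv_le j p
    exact ⟨_, MvPolynomial.totalDegree_eq_zero_iff_eq_C.1 (by omega)⟩
  choose c hc using hconst
  have haff : ∀ y, pev p y = pev p 0 + ∑ j, c j * y j := by
    intro y
    have hlin : ∀ t : ℝ, HasDerivAt (fun t : ℝ => pev p (t • y) - t * ∑ j, c j * y j) 0 t := by
      intro t
      have h1 : HasDerivAt (fun t : ℝ => pev p (t • y)) (fderiv ℝ (pev p) (t • y) y) t := by
        have h2 := ((contDiff_pev p (n := 1)).differentiable one_ne_zero (t • y)).hasFDerivAt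
        have h3 : HasDerivAt (fun t : ℝ => t • y) y t := by
          simpa using (hasDerivAt_id t).smul_const y
        exact h2.comp_hasDerivAt t h3
      rw [fderiv_pev] at h1
      simp only [hc, pev_C] at h1
      have h4 := h1.sub ((hasDerivAt_id t).mul_const (∑ j, c j * y j))
      refine HasDerivAt.congr_deriv h4 ?_
      rw [one_mul, sub_eq_zero]
      exact Finset.sum_congr rfl fun j _ => mul_comm _ _
    have h5 := is_const_of_deriv_eq_zero (fun t => (hlin t).differentiableAt)
      (fun t => (hlin t).deriv) 1 0
    simp only [one_smul, zero_smul, one_mul, zero_mul, sub_zero] at h5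
    linarith
  have hs := b.sum_coord_apply_eq_one y
  have hy : ∀ j, y j = ∑ i, b.coord i y * b i j := by
    intro j
    calc y j = (∑ i, b.coord i y • b i) j := by rw [sum_coord_smul]
      _ = _ := by rw [WithLp.ofLp_sum, Finset.sum_apply]; rfl
  rw [haff y]
  simp_rw [haff (b _), mul_add, Finset.sum_add_distrib, ← Finset.sum_mul, hs, one_mul]
  congr 1
  simp_rw [hy, Finset.mul_sum]
  rw [Finset.sum_comm]
  exact Finset.sum_congr rfl fun i _ => Finset.sum_congr rfl fun j _ => by ring

theorem bary_verts (i : Fin (d + 1)) : bary (verts b) (b i) = lamP b i := by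
  have hex : ∃ l, IsBary (verts b) (b i) l := by
    refine ⟨lamP b i, totalDegree_lamP b i, by simp, ?_⟩
    intro y hy hne
    have : y ∈ Set.range b := by rw [← coe_verts]; exact hy
    obtain ⟨j, rfl⟩ := this
    have : i ≠ j := fun h => hne (by rw [h])
    simp [b.coord_apply, this]
  have hl : IsBary (verts b) (b i) (bary (verts b) (b i)) := by
    rw [bary, dif_pos hex]; exact hex.choose_spec
  obtain ⟨h1, h2, h3⟩ := hl
  apply poly_ext
  intro y
  rw [pev_eq_of_totalDegree_le_one b h1, pev_lamP, Finset.sum_eq_single i]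
  · rw [h2, mul_one]
  · intro j _ hj
    rw [h3 (b j) _ (fun h => hj (b.ind.injective h)), mul_zero]
    have : b j ∈ (verts b : Set (Pt d)) := by rw [coe_verts]; exact ⟨j, rfl⟩
    exact this
  · simp

theorem bubble_verts : bubble (verts b) = ∏ i, lamP b i := by
  rw [bubble, verts, Finset.prod_map]
  exact Finset.prod_congr rfl fun i _ => bary_verts b i

/-- The substitution that projects orthogonally onto the hyperplane of the `i`-th face. -/
def faceSubst (i : Fin (d + 1)) : Poly d →ₐ[ℝ] Poly d :=
  MvPolynomial.bind₁ fun j =>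
    MvPolynomial.X j - MvPolynomial.C (height b i ^ 2 * grad b i j) * lamP b i

theorem pev_faceSubst (i : Fin (d + 1)) (p : Poly d) (y : Pt d) :
    pev (faceSubst b i p) y = pev p (y - (b.coord i y * height b i ^ 2) • grad b i) := by
  rw [faceSubst, pev_bind₁]
  congr 1
  ext j
  simp only [pev_sub, pev_X, pev_mul, pev_C, pev_lamP, PiLp.sub_apply, PiLp.smul_apply, smul_eq_mul]
  ring

theorem coord_faceSubst (hd : 0 < d) (i : Fin (d + 1)) (y : Pt d) :
    b.coord i (y - (b.coord i y * height b i ^ 2) • grad b i) = 0 := by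
  have h0 := norm_pos_iff.2 (grad_ne_zero b hd i)
  rw [sub_eq_add_neg, coord_add, inner_neg_right, inner_smul_right, real_inner_self_eq_norm_sq,
    height]
  field_simp
  ring

theorem lamP_dvd_sub_faceSubst (i : Fin (d + 1)) (p : Poly d) :
    lamP b i ∣ p - faceSubst b i p := by
  induction p using MvPolynomial.induction_on with
  | C a => simp [faceSubst]
  | add p q hp hq =>
    have : p + q - faceSubst b i (p + q) = (p - faceSubst b i p) + (q - faceSubst b i q) := by
      rw [map_add]; ring
    rw [this]; exact dvd_add hp hq
  | mul_X p j hp =>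
    have hX : faceSubst b i (MvPolynomial.X j) =
        MvPolynomial.X j - MvPolynomial.C (height b i ^ 2 * grad b i j) * lamP b i := by
      rw [faceSubst, MvPolynomial.bind₁_X_right]
    have : p * MvPolynomial.X j - faceSubst b i (p * MvPolynomial.X j) =
        (p - faceSubst b i p) * MvPolynomial.X j +
        lamP b i * (faceSubst b i p * MvPolynomial.C (height b i ^ 2 * grad b i j)) := by
      rw [map_mul, hX]; ring
    rw [this]
    exact dvd_add (hp.mul_right _) (dvd_mul_right _ _)

theorem lamP_dvd_of_faceSubst_eq_zero {i : Fin (d + 1)} {p : Poly d}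
    (h : faceSubst b i p = 0) : lamP b i ∣ p := by
  simpa [h] using lamP_dvd_sub_faceSubst b i p

theorem faceSubst_eq_zero (hd : 0 < d) {i : Fin (d + 1)} {p : Poly d}
    (h : ∀ y ∈ convexHull ℝ (face (verts b) (b i) : Set (Pt d)), pev p y = 0) :
    faceSubst b i p = 0 := by
  have hc : ∀ j, Continuous (b.coord j) := fun j => continuous_barycentric_coord b j
  let U : Set (Pt d) := {y | ∀ j ∈ Finset.univ.erase i,
    0 < b.coord j (y - (b.coord i y * height b i ^ 2) • grad b i)}
  have hU : IsOpen U := by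
    have : U = ⋂ j ∈ Finset.univ.erase i,
        {y | 0 < b.coord j (y - (b.coord i y * height b i ^ 2) • grad b i)} := by
      ext y; simp [U]
    rw [this]
    refine isOpen_biInter_finset fun j _ => isOpen_lt continuous_const ((hc j).comp ?_)
    exact continuous_id.sub (((hc i).mul continuous_const).smul continuous_const)
  have hcoord : ∀ j, b.coord j (∑ l ∈ Finset.univ.erase i, (d : ℝ)⁻¹ • b l) =
      if j = i then 0 else (d : ℝ)⁻¹ := by
    intro j
    have hs : ∑ l ∈ Finset.univ.erase i, (fun _ : Fin (d + 1) => (d : ℝ)⁻¹) l = 1 := by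
      simp [hd.ne']
    have := b.coord_apply_combination_of_mem (s := Finset.univ.erase i) (i := j)
    rw [← Finset.affineCombination_eq_linear_combination _ _ _ hs]
    by_cases hj : j = i
    · rw [if_pos hj, b.coord_apply_combination_of_notMem (by simp [hj]) hs]
    · rw [if_neg hj, b.coord_apply_combination_of_mem (by simp [hj]) hs]
  have hne : U.Nonempty := by
    refine ⟨∑ l ∈ Finset.univ.erase i, (d : ℝ)⁻¹ • b l, fun j hj => ?_⟩
    rw [hcoord i, if_pos rfl, zero_mul, zero_smul, sub_zero, hcoord j,
      if_neg (Finset.mem_erase.1 hj).1]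
    positivity
  refine eq_zero_of_pev_eq_zero_on_open hU hne fun y hy => ?_
  rw [pev_faceSubst]
  apply h
  rw [hull_face_verts]
  refine ⟨fun j => ?_, coord_faceSubst b hd i y⟩
  by_cases hj : j = i
  · rw [hj, coord_faceSubst b hd i y]
  · exact (hy j (by simp [hj])).le

theorem faceSubst_lamP_ne_zero {i j : Fin (d + 1)} (hij : j ≠ i) :
    faceSubst b i (lamP b j) ≠ 0 := by
  intro h
  have := pev_faceSubst b i (lamP b j) (b j)
  rw [h] at this
  simp [b.coord_apply, hij.symm] at this

/-- A polynomial that vanishes on a set of faces is divisible by the product of the respective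
barycentric coordinates. -/
theorem prod_lamP_dvd (s : Finset (Fin (d + 1))) {p : Poly d}
    (h : ∀ i ∈ s, faceSubst b i p = 0) : ∏ i ∈ s, lamP b i ∣ p := by
  induction s using Finset.induction_on generalizing p with
  | empty => simp
  | insert i s hi ih =>
    obtain ⟨q, rfl⟩ := lamP_dvd_of_faceSubst_eq_zero b (h i (by simp))
    rw [Finset.prod_insert hi]
    refine mul_dvd_mul_left _ (ih fun j hj => ?_)
    have := h j (by simp [hj])
    rw [map_mul, mul_eq_zero] at this
    exact this.resolve_left (faceSubst_lamP_ne_zero b (fun h => hi (h ▸ hj)))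

end Geometry

/-! ### Integration over a simplex seen as a cone over one of its faces -/

section Cone

variable {d : ℕ} (b : AffineBasis (Fin (d + 1)) ℝ (Pt d))

theorem volume_restrict_hull (T : Finset (Pt d)) :
    (volume : Measure (Pt d)).restrict (convexHull ℝ (T : Set (Pt d))) =
      volume.restrict (cell T) :=
  (Measure.restrict_congr_set (interior_ae_eq_of_null_frontier
    ((convex_convexHull ℝ _).addHaar_frontier volume))).symm

instance isFiniteMeasure_cell (T : Finset (Pt d)) :
    IsFiniteMeasure ((volume : Measure (Pt d)).restrict (cell T)) := by
  rw [← volume_restrict_hull]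
  exact ⟨by rw [Measure.restrict_apply_univ]; exact (isCompact_hull T).measure_lt_top⟩

theorem ae_mem_hull_cell (T : Finset (Pt d)) :
    ∀ᵐ y ∂(volume : Measure (Pt d)).restrict (cell T), y ∈ convexHull ℝ (T : Set (Pt d)) := by
  filter_upwards [ae_restrict_mem (isOpen_cell T).measurableSet] with y hy
  exact cell_subset_hull T hy

theorem ae_mem_hull_face (F : Finset (Pt d)) :
    ∀ᵐ y ∂faceMeasure F, y ∈ convexHull ℝ (F : Set (Pt d)) :=
  ae_restrict_mem (isCompact_hull F).measurableSet

theorem coord_cone (i j : Fin (d + 1)) (p : Pt d) (s : ℝ) :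
    b.coord j (b i + s • (p - b i)) = b.coord j (b i) + s * (b.coord j p - b.coord j (b i)) := by
  rw [coord_add, inner_smul_right, coord_sub_coord]

theorem mem_slice_iff (hd : 0 < d) (i : Fin (d + 1)) (s : ℝ) (y : Pt d) :
    y ∈ AffineSubspace.mk' (s • (-(height b i) ^ 2 • grad b i) +ᵥ b i)
      (Submodule.span ℝ {-(height b i) ^ 2 • grad b i})ᗮ ↔ b.coord i y = 1 - s := by
  have h0 := norm_pos_iff.2 (grad_ne_zero b hd i)
  rw [AffineSubspace.mem_mk', Submodule.mem_orthogonal_singleton_iff_inner_right]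
  have e : y -ᵥ (s • (-(height b i) ^ 2 • grad b i) +ᵥ b i) =
      (y - b i) - s • (-(height b i) ^ 2 • grad b i) := by
    simp only [vsub_eq_sub, vadd_eq_add]; abel
  have hb : b.coord i (b i) = 1 := by simp
  rw [e, inner_smul_left, inner_sub_right, ← coord_sub_coord, hb, inner_smul_right,
    inner_smul_right, real_inner_self_eq_norm_sq, height]
  have h1 : (‖grad b i‖⁻¹) ^ 2 * ‖grad b i‖ ^ 2 = 1 := by field_simp
  have h2 : -(‖grad b i‖⁻¹) ^ 2 ≠ 0 := neg_ne_zero.2 (by positivity)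
  simp only [conj_trivial, mul_eq_zero, h2, false_or]
  constructor <;> intro h
  · linear_combination h - s * h1
  · linear_combination h + s * h1

theorem slice_eq_image (hd : 0 < d) (i : Fin (d + 1)) {s : ℝ} (hs : 0 < s) (hs1 : s ≤ 1)
    (B : Set (Pt d)) :
    convexHull ℝ (verts b : Set (Pt d)) ∩ B ∩
      AffineSubspace.mk' (s • (-(height b i) ^ 2 • grad b i) +ᵥ b i)
      (Submodule.span ℝ {-(height b i) ^ 2 • grad b i})ᗮ =
    AffineMap.homothety (b i) s '' (convexHull ℝ (face (verts b) (b i) : Set (Pt d)) ∩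
      (fun p => b i + s • (p - b i)) ⁻¹' B) := by
  have hhom : ∀ p, AffineMap.homothety (b i) s p = b i + s • (p - b i) := by
    intro p
    rw [AffineMap.homothety_apply, vsub_eq_sub, vadd_eq_add, add_comm]
  have hb : b.coord i (b i) = 1 := by simp
  have hbj : ∀ j, j ≠ i → b.coord j (b i) = 0 := fun j hj => by simp [b.coord_apply, hj]
  ext y
  rw [hull_face_verts, hull_verts]
  constructor
  · rintro ⟨⟨h1, h2⟩, h3⟩
    have h3 := (mem_slice_iff b hd i s y).1 h3
    refine ⟨b i + s⁻¹ • (y - b i), ⟨⟨fun j => ?_, ?_⟩, ?_⟩, ?_⟩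
    · rw [coord_cone]
      by_cases hj : j = i
      · subst hj; rw [hb, h3]; field_simp; linarith
      · rw [hbj j hj, zero_add, sub_zero]
        exact mul_nonneg (inv_nonneg.2 hs.le) (h1 j)
    · rw [coord_cone, hb, h3]; field_simp; ring
    · simpa [smul_smul, hs.ne'] using h2
    · rw [hhom]; simp [smul_smul, hs.ne']
  · rintro ⟨p, ⟨⟨h1, h2⟩, h3⟩, rfl⟩
    rw [hhom]
    refine ⟨⟨fun j => ?_, h3⟩, ?_⟩
    · rw [coord_cone]
      by_cases hj : j = i
      · subst hj; rw [hb, h2]; linarith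
      · rw [hbj j hj, zero_add, sub_zero]
        exact mul_nonneg hs.le (h1 j)
    · apply (mem_slice_iff b hd i s _).2
      rw [coord_cone, hb, h2]; ring

theorem slice_eq_empty (hd : 0 < d) (i : Fin (d + 1)) {s : ℝ} (hs : s < 0 ∨ 1 < s)
    (B : Set (Pt d)) :
    convexHull ℝ (verts b : Set (Pt d)) ∩ B ∩
      AffineSubspace.mk' (s • (-(height b i) ^ 2 • grad b i) +ᵥ b i)
      (Submodule.span ℝ {-(height b i) ^ 2 • grad b i})ᗮ = ∅ := by
  rw [Set.eq_empty_iff_forall_notMem]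
  rintro y ⟨⟨h1, -⟩, h3⟩
  have h3 := (mem_slice_iff b hd i s y).1 h3
  rw [hull_verts] at h1
  have h4 := h1 i
  have h5 : b.coord i y ≤ 1 := by
    rw [← b.sum_coord_apply_eq_one y]
    exact Finset.single_le_sum (fun j _ => h1 j) (Finset.mem_univ i)
  rcases hs with hs | hs <;> linarith

theorem volume_hull_inter (hd : 0 < d) (i : Fin (d + 1)) {B : Set (Pt d)}
    (hB : MeasurableSet B) :
    volume (convexHull ℝ (verts b : Set (Pt d)) ∩ B) =
      ∫⁻ s in Set.Ioo (0 : ℝ) 1, ENNReal.ofReal (height b i * s ^ (d - 1)) *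
        faceMeasure (face (verts b) (b i)) ((fun p => b i + s • (p - b i)) ⁻¹' B) := by
  have hH := height_pos b hd i
  have hv : -(height b i) ^ 2 • grad b i ≠ 0 :=
    smul_ne_zero (neg_ne_zero.2 (by positivity)) (grad_ne_zero b hd i)
  have hm : MeasurableSet (convexHull ℝ (verts b : Set (Pt d)) ∩ B) :=
    (isCompact_hull _).measurableSet.inter hB
  have key := EuclideanGeometry.euclideanHausdorffMeasure_eq_lintegral (b i) hv hm
  rw [finrank_euclideanSpace_fin, EuclideanSpace.euclideanHausdorffMeasure_eq_volume] at key
  have hn : ‖-(height b i) ^ 2 • grad b i‖ₑ = ENNReal.ofReal (height b i) := by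
    rw [← ofReal_norm, norm_smul, norm_grad, norm_neg, norm_pow,
      Real.norm_of_nonneg hH.le]
    congr 1; field_simp
  rw [key, hn, ← lintegral_const_mul' _ _ ENNReal.ofReal_ne_top,
    ← lintegral_indicator measurableSet_Ioo]
  apply lintegral_congr_ae
  have h0 : ∀ᵐ s : ℝ, s ≠ 0 ∧ s ≠ 1 := by
    have h1 : ∀ᵐ s : ℝ, s ≠ 0 := by simp [ae_iff, measure_singleton]
    have h2 : ∀ᵐ s : ℝ, s ≠ 1 := by simp [ae_iff, measure_singleton]
    exact h1.and h2
  filter_upwards [h0] with s hs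
  by_cases hmem : s ∈ Set.Ioo (0 : ℝ) 1
  · rw [Set.indicator_of_mem hmem, slice_eq_image b hd i hmem.1 hmem.2.le,
      euclideanHausdorffMeasure_homothety_image _ _ hmem.1.ne']
    rw [faceMeasure, Measure.restrict_apply' (isCompact_hull _).measurableSet,
      Set.inter_comm, ENNReal.ofReal_mul hH.le, mul_assoc, ENNReal.smul_def, smul_eq_mul]
    congr 2
    rw [ENNReal.ofReal_pow hmem.1.le, ENNReal.coe_pow]
    congr 1
    exact Real.enorm_eq_ofReal hmem.1.le
  · rw [Set.indicator_of_notMem hmem, slice_eq_empty b hd i]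
    · simp
    · rw [Set.mem_Ioo, not_and_or, not_lt, not_lt] at hmem
      exact hmem.imp (fun h => lt_of_le_of_ne h hs.1) (fun h => lt_of_le_of_ne h hs.2.symm)

/-- The radial measure `H s^{d-1} ds` on `(0, 1)`. -/
def radialMeasure (d : ℕ) (H : ℝ) : Measure ℝ :=
  (volume.restrict (Set.Ioo (0 : ℝ) 1)).withDensity fun s => ENNReal.ofReal (H * s ^ (d - 1))

theorem radialMeasure_univ (hd : 0 < d) {H : ℝ} (hH : 0 < H) :
    radialMeasure d H Set.univ = ENNReal.ofReal (H / d) := by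
  rw [radialMeasure, withDensity_apply _ MeasurableSet.univ, Measure.restrict_univ,
    ← ofReal_integral_eq_lintegral_ofReal]
  · congr 1
    rw [integral_const_mul, ← integral_Ioc_eq_integral_Ioo,
      ← intervalIntegral.integral_of_le zero_le_one, integral_pow, Nat.sub_add_cancel hd]
    have : ((d - 1 : ℕ) : ℝ) + 1 = d := by
      rw [← Nat.cast_add_one, Nat.sub_add_cancel hd]
    rw [this]
    simp [hd.ne']
    field_simp
  · have : Continuous fun s : ℝ => H * s ^ (d - 1) := by fun_prop
    exact (this.integrableOn_Icc (a := 0) (b := 1)).mono_set Set.Ioo_subset_Icc_self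
  · filter_upwards [ae_restrict_mem measurableSet_Ioo] with s hs
    have := hs.1
    positivity

theorem isFiniteMeasure_radialMeasure (hd : 0 < d) {H : ℝ} (hH : 0 < H) :
    IsFiniteMeasure (radialMeasure d H) :=
  ⟨by rw [radialMeasure_univ hd hH]; exact ENNReal.ofReal_lt_top⟩

theorem isFiniteMeasure_face (hd : 0 < d) (i : Fin (d + 1)) :
    IsFiniteMeasure (faceMeasure (face (verts b) (b i))) := by
  have h := volume_hull_inter b hd i MeasurableSet.univ
  simp only [Set.inter_univ, Set.preimage_univ] at h
  rw [lintegral_mul_const _ (by fun_prop)] at h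
  have h2 := radialMeasure_univ hd (height_pos b hd i)
  rw [radialMeasure, withDensity_apply _ MeasurableSet.univ, Measure.restrict_univ] at h2
  rw [h2] at h
  refine ⟨lt_of_le_of_ne le_top fun htop => ?_⟩
  rw [htop, ENNReal.mul_top] at h
  · exact (isCompact_hull (verts b)).measure_lt_top.ne h
  · have := height_pos b hd i
    have hd' : (0 : ℝ) < d := by exact_mod_cast hd
    simp only [ne_eq, ENNReal.ofReal_eq_zero, not_le]
    positivity

/-- A simplex is a cone over each of its faces. -/
theorem volume_cell_eq_map (hd : 0 < d) (i : Fin (d + 1)) :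
    volume.restrict (cell (verts b)) =
      ((radialMeasure d (height b i)).prod (faceMeasure (face (verts b) (b i)))).map
        (fun q => b i + q.1 • (q.2 - b i)) := by
  have := isFiniteMeasure_face b hd i
  have := isFiniteMeasure_radialMeasure (d := d) hd (height_pos b hd i)
  have hmeas : Measurable fun q : ℝ × Pt d => b i + q.1 • (q.2 - b i) := by fun_prop
  ext B hB
  rw [← volume_restrict_hull, Measure.restrict_apply hB, Set.inter_comm,
    volume_hull_inter b hd i hB, Measure.map_apply hmeas hB,
    Measure.prod_apply (hmeas hB), radialMeasure, lintegral_withDensity_eq_lintegral_mul]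
  · rfl
  · fun_prop
  · exact measurable_measure_prodMk_left (hmeas hB)

/-- The projection from the `i`-th vertex onto the opposite face. -/
def faceProjPt (i : Fin (d + 1)) (y : Pt d) : Pt d := b i + (1 - b.coord i y)⁻¹ • (y - b i)

theorem measurable_faceProjPt (i : Fin (d + 1)) : Measurable (faceProjPt b i) := by
  have h : Measurable (b.coord i) := (continuous_barycentric_coord b i).measurable
  unfold faceProjPt
  fun_prop

theorem faceProjPt_cone (i : Fin (d + 1)) {p : Pt d} (hp : b.coord i p = 0) {s : ℝ} (hs : s ≠ 0) :
    faceProjPt b i (b i + s • (p - b i)) = p := by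
  have h : 1 - b.coord i (b i + s • (p - b i)) = s := by
    rw [coord_cone, hp]; simp
  rw [faceProjPt, h]
  simp [smul_smul, hs]

/-- The surface measure of a face as an image of the Lebesgue measure of the simplex. -/
theorem map_faceProjPt (hd : 0 < d) (i : Fin (d + 1)) :
    (volume.restrict (cell (verts b))).map (faceProjPt b i) =
      ENNReal.ofReal (height b i / d) • faceMeasure (face (verts b) (b i)) := by
  have := isFiniteMeasure_face b hd i
  have := isFiniteMeasure_radialMeasure (d := d) hd (height_pos b hd i)
  have hmeas : Measurable fun q : ℝ × Pt d => b i + q.1 • (q.2 - b i) := by fun_prop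
  rw [volume_cell_eq_map b hd i, Measure.map_map (measurable_faceProjPt b i) hmeas]
  have hae : (faceProjPt b i ∘ fun q : ℝ × Pt d => b i + q.1 • (q.2 - b i))
      =ᵐ[(radialMeasure d (height b i)).prod (faceMeasure (face (verts b) (b i)))] Prod.snd := by
    have h1 : ∀ᵐ s ∂radialMeasure d (height b i), s ≠ 0 := by
      have : ∀ᵐ s ∂(volume.restrict (Set.Ioo (0 : ℝ) 1)), s ≠ 0 := by
        filter_upwards [ae_restrict_mem measurableSet_Ioo] with s hs using hs.1.ne'
      exact (withDensity_absolutelyContinuous _ _).ae_le this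
    have h2 := ae_mem_hull_face (face (verts b) (b i))
    filter_upwards [Measure.ae_prod_iff_ae_ae (by
      exact ((measurableSet_singleton (0 : ℝ)).compl.prod
        (isCompact_hull (face (verts b) (b i))).measurableSet)) |>.2
      (h1.mono fun s hs => h2.mono fun p hp => (⟨hs, hp⟩ : (s, p) ∈ _ ×ˢ _))] with q hq
    rw [hull_face_verts] at hq
    exact faceProjPt_cone b i hq.2.2 hq.1
  rw [Measure.map_congr hae, Measure.map_snd_prod,
    radialMeasure_univ hd (height_pos b hd i)]

theorem integral_face_eq (hd : 0 < d) (i : Fin (d + 1)) {g : Pt d → ℝ} (hg : Measurable g) :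
    ∫ p, g p ∂faceMeasure (face (verts b) (b i)) =
      d / height b i * ∫ y in cell (verts b), g (faceProjPt b i y) := by
  have hH := height_pos b hd i
  have hd' : (0 : ℝ) < d := by exact_mod_cast hd
  rw [← integral_map (measurable_faceProjPt b i).aemeasurable hg.aestronglyMeasurable,
    map_faceProjPt b hd i, integral_smul_measure, ENNReal.toReal_ofReal (by positivity), smul_eq_mul]
  field_simp

/-- The divergence theorem for `φ² (y - x)`, `x` a vertex of the simplex. -/
theorem integral_face_sq (hd : 0 < d) (i : Fin (d + 1)) {φ : Pt d → ℝ} (hφ : ContDiff ℝ 1 φ) :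
    height b i * ∫ p, φ p ^ 2 ∂faceMeasure (face (verts b) (b i)) =
      ∫ y in cell (verts b), (d * φ y ^ 2 + 2 * φ y * fderiv ℝ φ y (y - b i)) := by
  have := isFiniteMeasure_face b hd i
  have := isFiniteMeasure_radialMeasure (d := d) hd (height_pos b hd i)
  have hH := height_pos b hd i
  have hmeas : Measurable fun q : ℝ × Pt d => b i + q.1 • (q.2 - b i) := by fun_prop
  set ψ : Pt d → ℝ := fun y => d * φ y ^ 2 + 2 * φ y * fderiv ℝ φ y (y - b i)
  have hφc := hφ.continuous
  have hfd : Continuous fun y => fderiv ℝ φ y (y - b i) :=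
    (hφ.continuous_fderiv one_ne_zero).clm_apply (by fun_prop)
  have hψ : Continuous ψ := by fun_prop
  have hψm : ∀ μ : Measure (Pt d), AEStronglyMeasurable ψ μ := fun μ => hψ.measurable.aestronglyMeasurable
  have hint : Integrable ψ (volume.restrict (cell (verts b))) :=
    (memLp_of_continuous_of_compact (isCompact_hull _) (ae_mem_hull_cell _) hψ).integrable
      (by norm_num)
  rw [volume_cell_eq_map b hd i] at hint
  rw [volume_cell_eq_map b hd i, integral_map hmeas.aemeasurable (hψm _),
    integral_prod_symm (fun q : ℝ × Pt d => ψ (b i + q.1 • (q.2 - b i)))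
      (hint.comp_measurable hmeas), ← integral_const_mul]
  refine integral_congr_ae (Eventually.of_forall fun p => ?_)
  simp only
  rw [radialMeasure, integral_withDensity_eq_integral_toReal_smul (by fun_prop)
    (by simp)]
  have h1 : ∀ s ∈ Set.Ioo (0 : ℝ) 1, (ENNReal.ofReal (height b i * s ^ (d - 1))).toReal •
      ψ (b i + s • (p - b i)) = height b i * (s ^ (d - 1) * ψ (b i + s • (p - b i))) := by
    intro s hs
    have := hs.1
    rw [ENNReal.toReal_ofReal (by positivity), smul_eq_mul, mul_assoc]
  rw [setIntegral_congr_fun measurableSet_Ioo h1, integral_const_mul,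
    ← integral_Ioc_eq_integral_Ioo, ← intervalIntegral.integral_of_le zero_le_one]
  have hder : ∀ s : ℝ, HasDerivAt (fun s : ℝ => s ^ d * φ (b i + s • (p - b i)) ^ 2)
      (s ^ (d - 1) * ψ (b i + s • (p - b i))) s := by
    intro s
    have h2 : HasDerivAt (fun s : ℝ => b i + s • (p - b i)) (p - b i) s := by
      simpa using ((hasDerivAt_id s).smul_const (p - b i)).const_add (b i)
    have h3 := ((hφ.differentiable one_ne_zero (b i + s • (p - b i))).hasFDerivAt).comp_hasDerivAt
      s h2
    have h4 := (hasDerivAt_pow d s).mul (h3.pow 2)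
    refine HasDerivAt.congr_deriv h4 ?_
    simp only [ψ, Function.comp_apply, add_sub_cancel_left, map_smul, smul_eq_mul, Pi.pow_apply]
    obtain ⟨e, rfl⟩ : ∃ e, d = e + 1 := ⟨d - 1, by omega⟩
    simp only [Nat.add_sub_cancel, pow_succ]
    ring
  rw [intervalIntegral.integral_eq_sub_of_hasDerivAt (fun s _ => hder s)]
  · simp [hd.ne']
  · have : Continuous fun s : ℝ => s ^ (d - 1) * ψ (b i + s • (p - b i)) :=
      (continuous_pow _).mul (hψ.comp (by fun_prop))
    exact this.intervalIntegrable _ _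

theorem fderiv_eq_sum_partialD (φ : Pt d → ℝ) (y v : Pt d) :
    fderiv ℝ φ y v = ∑ j, v j * partialD j φ y := by
  have hv : v = ∑ j, v j • EuclideanSpace.single j (1 : ℝ) := by
    conv_lhs => rw [← (EuclideanSpace.basisFun (Fin d) ℝ).sum_repr v]
    simp
  conv_lhs => rw [hv, map_sum]
  exact Finset.sum_congr rfl fun j _ => by rw [map_smul, smul_eq_mul, partialD]

theorem continuous_partialD {φ : Pt d → ℝ} (hφ : ContDiff ℝ 1 φ) (j : Fin d) :
    Continuous (partialD j φ) :=
  (hφ.continuous_fderiv one_ne_zero).clm_apply continuous_const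

theorem memLp_cell (T : Finset (Pt d)) {φ : Pt d → ℝ} (hφ : Continuous φ) :
    MemLp φ 2 (volume.restrict (cell T)) :=
  memLp_of_continuous_of_compact (isCompact_hull _) (ae_mem_hull_cell _) hφ

theorem memLp_face (hd : 0 < d) (i : Fin (d + 1)) {φ : Pt d → ℝ} (hφ : Continuous φ) :
    MemLp φ 2 (faceMeasure (face (verts b) (b i))) :=
  have := isFiniteMeasure_face b hd i
  memLp_of_continuous_of_compact (isCompact_hull _) (ae_mem_hull_face _) hφ

/-- The scaled `H¹` norm of an element, a discrete or smooth function being given together with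
its partial derivatives. -/
def scaledH1 (T : Finset (Pt d)) (f : Pt d → ℝ) (g : Fin d → Pt d → ℝ) : ℝ :=
  nrm (volume.restrict (cell T)) f + diamT T * ∑ j, nrm (volume.restrict (cell T)) (g j)

/-- The trace inequality. -/
theorem sqrt_mul_nrm_face_le (hd : 0 < d) (i : Fin (d + 1)) {σ : ℝ}
    (hσ : diamT (verts b) ≤ σ * height b i) {φ : Pt d → ℝ} (hφ : ContDiff ℝ 1 φ) :
    Real.sqrt (diamT (verts b)) * nrm (faceMeasure (face (verts b) (b i))) φ ≤
      Real.sqrt (σ * (d + 1)) * scaledH1 (verts b) φ (fun j => partialD j φ) := by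
  have hH := height_pos b hd i
  have hh := diamT_pos b hd
  set h := diamT (verts b)
  set H := height b i
  set μ := (volume : Measure (Pt d)).restrict (cell (verts b))
  have hσ0 : 0 < σ := pos_of_mul_pos_left (hh.trans_le hσ) hH.le
  have hφc := hφ.continuous
  have hm := memLp_cell (verts b) hφc
  have hmj := fun j => memLp_cell (verts b) (continuous_partialD hφ j)
  set S := ∑ j, nrm μ (partialD j φ)
  have hS : 0 ≤ S := Finset.sum_nonneg fun _ _ => nrm_nonneg _ _
  have hfd : Continuous fun y => fderiv ℝ φ y (y - b i) :=
    (hφ.continuous_fderiv one_ne_zero).clm_apply (by fun_prop)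
  have hmf := memLp_cell (verts b) hfd
  have h1 : nrm μ (fun y => fderiv ℝ φ y (y - b i)) ≤ h * S := by
    have hmul : ∀ j, MemLp (fun y : Pt d => (y - b i) j * partialD j φ y) 2 μ := fun j =>
      memLp_cell (verts b) (Continuous.mul (by fun_prop) (continuous_partialD hφ j))
    simp_rw [fderiv_eq_sum_partialD]
    refine (nrm_sum_le _ fun j _ => hmul j).trans ?_
    rw [Finset.mul_sum]
    refine Finset.sum_le_sum fun j _ => ?_
    rw [← abs_of_pos hh, ← nrm_const_mul]
    refine nrm_mono ((hmj j).const_mul h) ?_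
    filter_upwards [ae_mem_hull_cell (verts b)] with y hy
    rw [abs_mul, abs_mul, abs_of_pos hh]
    gcongr
    exact (PiLp.norm_apply_le (y - b i) j).trans (dist_le_diamT hy (vertex_mem_hull b i))
  have h2 : H * nrm (faceMeasure (face (verts b) (b i))) φ ^ 2 ≤
      d * nrm μ φ ^ 2 + 2 * (nrm μ φ * (h * S)) := by
    rw [nrm_sq (memLp_face b hd i hφc), integral_face_sq b hd i hφ, nrm_sq hm]
    have i1 := hm.integrable_sq
    have i2 := integrable_mul_of_memLp hm hmf
    have e : (fun y => (d : ℝ) * φ y ^ 2 + 2 * φ y * fderiv ℝ φ y (y - b i)) =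
        fun y => (d : ℝ) * φ y ^ 2 + 2 * (φ y * fderiv ℝ φ y (y - b i)) := by
      funext y; ring
    rw [e, integral_add (i1.const_mul _) (i2.const_mul _), integral_const_mul,
      integral_const_mul]
    have := (le_abs_self _).trans (abs_integral_mul_le hm hmf)
    have := this.trans (mul_le_mul_of_nonneg_left h1 (nrm_nonneg _ _))
    gcongr
  have hA := nrm_nonneg (faceMeasure (face (verts b) (b i))) φ
  have hN := nrm_nonneg μ φ
  have hsc : scaledH1 (verts b) φ (fun j => partialD j φ) = nrm μ φ + h * S := rfl
  have hX : 0 ≤ h * S := mul_nonneg hh.le hS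
  rw [hsc]
  clear_value h H S μ
  refine le_of_abs_le (abs_le_of_sq_le_sq ?_ (by positivity))
  rw [mul_pow, mul_pow, Real.sq_sqrt hh.le, Real.sq_sqrt (by positivity)]
  have hd' : (0 : ℝ) ≤ d := d.cast_nonneg
  have alg : ∀ D N X : ℝ, 0 ≤ D → 0 ≤ N → 0 ≤ X →
      D * N ^ 2 + 2 * (N * X) ≤ (D + 1) * (N + X) ^ 2 := by
    intro D N X hD hN hX
    have : 0 ≤ D * N * X + D * X * X + X * X := by positivity
    nlinarith [mul_nonneg hD (mul_nonneg hN hX), sq_nonneg N]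
  calc h * nrm (faceMeasure (face (verts b) (b i))) φ ^ 2
      ≤ σ * H * nrm (faceMeasure (face (verts b) (b i))) φ ^ 2 := by gcongr
    _ = σ * (H * nrm (faceMeasure (face (verts b) (b i))) φ ^ 2) := by ring
    _ ≤ σ * (d * nrm μ φ ^ 2 + 2 * (nrm μ φ * (h * S))) := by gcongr
    _ ≤ σ * ((d + 1) * (nrm μ φ + h * S) ^ 2) := by
      gcongr
      exact alg _ _ _ hd' hN hX
    _ = _ := by ring

end Cone

/-! ### The Poincaré inequality on convex sets -/

section Poincare

variable {d : ℕ}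

theorem lintegral_comp_homothety (y : Pt d) {t : ℝ} (ht : 0 < t) {g : Pt d → ENNReal}
    (hg : Measurable g) :
    ∫⁻ x, g (y + t • (x - y)) = ENNReal.ofReal ((t ^ d)⁻¹) * ∫⁻ x, g x := by
  have h1 : ∀ x : Pt d, y + t • (x - y) = (y - t • y) + t • x := by
    intro x; rw [smul_sub]; abel
  simp_rw [h1]
  have hm : Measurable fun x : Pt d => g ((y - t • y) + x) := hg.comp (by fun_prop)
  have h2 := lintegral_map hm (measurable_const_smul t (α := Pt d)) (μ := volume)
  rw [← h2, Measure.map_addHaar_smul _ ht.ne', lintegral_smul_measure, finrank_euclideanSpace_fin,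
    abs_of_pos (by positivity), lintegral_add_left_eq_self, smul_eq_mul]

theorem setLIntegral_comp_homothety_le {K : Set (Pt d)} (hK : Convex ℝ K) (hKm : MeasurableSet K)
    {y : Pt d} (hy : y ∈ K) {t : ℝ} (ht : 1 / 2 ≤ t) (ht1 : t ≤ 1) {g : Pt d → ENNReal}
    (hg : Measurable g) :
    ∫⁻ x in K, g (y + t • (x - y)) ≤ 2 ^ d * ∫⁻ x in K, g x := by
  have ht0 : 0 < t := by linarith
  rw [← lintegral_indicator hKm, ← lintegral_indicator hKm]
  calc ∫⁻ x, K.indicator (fun x => g (y + t • (x - y))) x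
      ≤ ∫⁻ x, K.indicator g (y + t • (x - y)) := by
        refine lintegral_mono fun x => ?_
        by_cases hx : x ∈ K
        · rw [Set.indicator_of_mem hx, Set.indicator_of_mem]
          exact hK.add_smul_sub_mem hy hx ⟨ht0.le, ht1⟩
        · rw [Set.indicator_of_notMem hx]; exact zero_le
    _ = ENNReal.ofReal ((t ^ d)⁻¹) * ∫⁻ x, K.indicator g x :=
        lintegral_comp_homothety y ht0 (hg.indicator hKm)
    _ ≤ _ := by
        gcongr
        have : (2 : ENNReal) ^ d = ENNReal.ofReal (2 ^ d) := by
          rw [ENNReal.ofReal_pow (by norm_num)]; simp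
        rw [this]
        apply ENNReal.ofReal_le_ofReal
        rw [← inv_pow]
        gcongr
        rw [inv_le_comm₀ ht0 (by norm_num)]
        linarith

theorem lintegral_lintegral_segment_le {K : Set (Pt d)} (hK : Convex ℝ K) (hKm : MeasurableSet K)
    {t : ℝ} (ht : 0 ≤ t) (ht1 : t ≤ 1) {g : Pt d → ENNReal} (hg : Measurable g) :
    ∫⁻ y in K, ∫⁻ x in K, g (y + t • (x - y)) ≤ volume K * (2 ^ d * ∫⁻ x in K, g x) := by
  have main : ∀ t : ℝ, 1 / 2 ≤ t → t ≤ 1 →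
      ∫⁻ y in K, ∫⁻ x in K, g (y + t • (x - y)) ≤ volume K * (2 ^ d * ∫⁻ x in K, g x) := by
    intro t ht ht1
    calc ∫⁻ y in K, ∫⁻ x in K, g (y + t • (x - y))
        ≤ ∫⁻ _ in K, (2 ^ d * ∫⁻ x in K, g x) :=
          setLIntegral_mono' hKm fun y hy =>
            setLIntegral_comp_homothety_le hK hKm hy ht ht1 hg
      _ = _ := by rw [setLIntegral_const, mul_comm]
  rcases le_total (1 / 2) t with h | h
  · exact main t h ht1
  · rw [lintegral_lintegral_swap]
    · have := main (1 - t) (by linarith) (by linarith)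
      refine le_trans (le_of_eq ?_) this
      refine lintegral_congr fun x => lintegral_congr fun y => ?_
      congr 1
      rw [sub_smul, one_smul, smul_sub, smul_sub]; abel
    · exact (hg.comp (by fun_prop : Measurable fun p : Pt d × Pt d =>
        p.1 + t • (p.2 - p.1))).aemeasurable

theorem sq_sub_le_lintegral_segment {φ : Pt d → ℝ} (hφ : ContDiff ℝ 1 φ) {x y : Pt d} {h : ℝ}
    (hxy : ‖x - y‖ ≤ h) :
    ENNReal.ofReal ((φ x - φ y) ^ 2) ≤ ∫⁻ t in Set.Ioc (0 : ℝ) 1,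
      ENNReal.ofReal (h ^ 2 * (∑ j, |partialD j φ (y + t • (x - y))|) ^ 2) := by
  have hh : 0 ≤ h := (norm_nonneg _).trans hxy
  have hder : ∀ t : ℝ, HasDerivAt (fun t : ℝ => φ (y + t • (x - y)))
      (fderiv ℝ φ (y + t • (x - y)) (x - y)) t := by
    intro t
    have h2 : HasDerivAt (fun s : ℝ => y + s • (x - y)) (x - y) t := by
      simpa using ((hasDerivAt_id t).smul_const (x - y)).const_add y
    exact ((hφ.differentiable one_ne_zero _).hasFDerivAt).comp_hasDerivAt t h2
  have hc : Continuous fun t : ℝ => fderiv ℝ φ (y + t • (x - y)) (x - y) :=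
    ((hφ.continuous_fderiv one_ne_zero).comp (by fun_prop)).clm_apply continuous_const
  have hpc : ∀ j, Continuous fun t : ℝ => partialD j φ (y + t • (x - y)) := fun j =>
    (continuous_partialD hφ j).comp (by fun_prop)
  have hftc : φ x - φ y = ∫ t in Set.Ioc (0 : ℝ) 1, fderiv ℝ φ (y + t • (x - y)) (x - y) * 1 := by
    simp only [mul_one]
    rw [← intervalIntegral.integral_of_le zero_le_one,
      intervalIntegral.integral_eq_sub_of_hasDerivAt (fun t _ => hder t)
      (hc.intervalIntegrable _ _)]
    simp
  have hfin : IsFiniteMeasure ((volume : Measure ℝ).restrict (Set.Ioc 0 1)) := ⟨by simp⟩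
  have hmem : ∀ f : ℝ → ℝ, Continuous f → MemLp f 2 (volume.restrict (Set.Ioc (0 : ℝ) 1)) :=
    fun f hf => memLp_of_continuous_of_compact (isCompact_Icc (a := (0 : ℝ)) (b := 1))
      ((ae_restrict_mem measurableSet_Ioc).mono fun t ht => Set.Ioc_subset_Icc_self ht) hf
  have h1 := abs_integral_mul_le (hmem _ hc) (hmem (fun _ => 1) continuous_const)
  have hone : nrm (volume.restrict (Set.Ioc (0 : ℝ) 1)) (fun _ => (1 : ℝ)) = 1 := by
    rw [nrm_eq_sqrt (hmem _ continuous_const)]; simp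
  rw [← hftc, hone, mul_one] at h1
  have h2 : (φ x - φ y) ^ 2 ≤ ∫ t in Set.Ioc (0 : ℝ) 1,
      h ^ 2 * (∑ j, |partialD j φ (y + t • (x - y))|) ^ 2 := by
    calc (φ x - φ y) ^ 2 = |φ x - φ y| ^ 2 := (sq_abs _).symm
      _ ≤ nrm (volume.restrict (Set.Ioc (0 : ℝ) 1))
            (fun t => fderiv ℝ φ (y + t • (x - y)) (x - y)) ^ 2 := by gcongr
      _ = ∫ t in Set.Ioc (0 : ℝ) 1, fderiv ℝ φ (y + t • (x - y)) (x - y) ^ 2 :=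
          nrm_sq (hmem _ hc)
      _ ≤ _ := by
        refine integral_mono (hmem _ hc).integrable_sq ?_ fun t => ?_
        · exact ((hmem _ (by fun_prop :
            Continuous fun t : ℝ => ∑ j, |partialD j φ (y + t • (x - y))|)).integrable_sq).const_mul _
        · simp only
          rw [← mul_pow, ← sq_abs]
          gcongr
          rw [fderiv_eq_sum_partialD, Finset.mul_sum]
          refine (Finset.abs_sum_le_sum_abs _ _).trans (Finset.sum_le_sum fun j _ => ?_)
          rw [abs_mul]
          gcongr
          exact (PiLp.norm_apply_le (x - y) j).trans hxy
  rw [← ofReal_integral_eq_lintegral_ofReal]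
  · exact ENNReal.ofReal_le_ofReal h2
  · exact ((hmem _ (by fun_prop :
      Continuous fun t : ℝ => ∑ j, |partialD j φ (y + t • (x - y))|)).integrable_sq).const_mul _
  · exact Eventually.of_forall fun t => by positivity

theorem poincare_sq {T : Finset (Pt d)} (hne : (cell T).Nonempty) {φ : Pt d → ℝ}
    (hφ : ContDiff ℝ 1 φ) (hmean : ∫ y in cell T, φ y = 0) :
    ∫ y in cell T, φ y ^ 2 ≤
      2 ^ d * (diamT T ^ 2 * ∫ y in cell T, (∑ j, |partialD j φ y|) ^ 2) := by
  set K := cell T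
  set h := diamT T
  have hK : Convex ℝ K := (convex_convexHull ℝ _).interior
  have hKo : IsOpen K := isOpen_interior
  have hKm := hKo.measurableSet
  have hvol : 0 < volume.real K := by
    rw [measureReal_def]
    refine ENNReal.toReal_pos (hKo.measure_pos volume hne).ne' ?_
    exact ((measure_mono (cell_subset_hull T)).trans_lt (isCompact_hull T).measure_lt_top).ne
  have hvolt : volume K ≠ ⊤ :=
    ((measure_mono (cell_subset_hull T)).trans_lt (isCompact_hull T).measure_lt_top).ne
  have hm : MemLp φ 2 (volume.restrict K) := memLp_cell T hφ.continuous
  set G : Pt d → ℝ := fun y => h ^ 2 * (∑ j, |partialD j φ y|) ^ 2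
  have hpc := fun j => continuous_partialD hφ j
  have hGc : Continuous G := by fun_prop
  have hG0 : ∀ y, 0 ≤ G y := fun y => by positivity
  have hGm : Measurable fun y => ENNReal.ofReal (G y) := hGc.measurable.ennreal_ofReal
  have hGi : Integrable G (volume.restrict K) := (memLp_cell T hGc).integrable (by norm_num)
  have hφi : Integrable φ (volume.restrict K) := hm.integrable (by norm_num)
  have hφc := hφ.continuous
  have h1 : ∫⁻ y in K, ∫⁻ x in K, ENNReal.ofReal ((φ x - φ y) ^ 2) ≤
      volume K * (2 ^ d * ∫⁻ x in K, ENNReal.ofReal (G x)) := by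
    calc ∫⁻ y in K, ∫⁻ x in K, ENNReal.ofReal ((φ x - φ y) ^ 2)
        ≤ ∫⁻ y in K, ∫⁻ x in K, ∫⁻ t in Set.Ioc (0 : ℝ) 1,
            ENNReal.ofReal (G (y + t • (x - y))) := by
          refine setLIntegral_mono' hKm fun y hy => setLIntegral_mono' hKm fun x hx => ?_
          exact sq_sub_le_lintegral_segment hφ
            (dist_le_diamT (cell_subset_hull T hx) (cell_subset_hull T hy))
      _ = ∫⁻ t in Set.Ioc (0 : ℝ) 1, ∫⁻ y in K, ∫⁻ x in K,
            ENNReal.ofReal (G (y + t • (x - y))) := by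
          have hm3 : Measurable fun q : (Pt d × ℝ) × Pt d =>
              ENNReal.ofReal (G (q.1.1 + q.1.2 • (q.2 - q.1.1))) := hGm.comp (by fun_prop)
          have hsw : ∀ y, ∫⁻ x in K, ∫⁻ t in Set.Ioc (0 : ℝ) 1,
              ENNReal.ofReal (G (y + t • (x - y))) = ∫⁻ t in Set.Ioc (0 : ℝ) 1, ∫⁻ x in K,
              ENNReal.ofReal (G (y + t • (x - y))) := fun y =>
            lintegral_lintegral_swap (hGm.comp (by fun_prop :
              Measurable fun q : Pt d × ℝ => y + q.2 • (q.1 - y))).aemeasurable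
          rw [lintegral_congr hsw, lintegral_lintegral_swap]
          exact hm3.lintegral_prod_right'.aemeasurable
      _ ≤ ∫⁻ t in Set.Ioc (0 : ℝ) 1, volume K * (2 ^ d * ∫⁻ x in K, ENNReal.ofReal (G x)) := by
          refine setLIntegral_mono' measurableSet_Ioc fun t ht => ?_
          exact lintegral_lintegral_segment_le hK hKm ht.1.le ht.2 hGm
      _ = _ := by simp
  have h2 : ∫⁻ y in K, ∫⁻ x in K, ENNReal.ofReal ((φ x - φ y) ^ 2) =
      ENNReal.ofReal (2 * volume.real K * ∫ y in K, φ y ^ 2) := by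
    have inner : ∀ y, ∫⁻ x in K, ENNReal.ofReal ((φ x - φ y) ^ 2) =
        ENNReal.ofReal ((∫ x in K, φ x ^ 2) + volume.real K * φ y ^ 2) := by
      intro y
      have hi1 : Integrable (fun x => (-2 * φ y) * φ x + φ y ^ 2) (volume.restrict K) :=
        (hφi.const_mul _).add (integrable_const _)
      rw [← ofReal_integral_eq_lintegral_ofReal]
      · congr 1
        have e : (fun x => (φ x - φ y) ^ 2) =
            fun x => φ x ^ 2 + ((-2 * φ y) * φ x + φ y ^ 2) := by funext x; ring
        rw [e, integral_add hm.integrable_sq hi1, integral_add (hφi.const_mul _)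
          (integrable_const _), integral_const_mul, hmean]
        simp
      · exact (hm.sub (memLp_const _)).integrable_sq
      · exact Eventually.of_forall fun x => sq_nonneg _
    simp_rw [inner]
    have hi2 : Integrable (fun y => volume.real K * φ y ^ 2) (volume.restrict K) :=
      hm.integrable_sq.const_mul _
    have hpos : 0 ≤ ∫ x in K, φ x ^ 2 := integral_nonneg fun x => sq_nonneg _
    rw [← ofReal_integral_eq_lintegral_ofReal]
    · congr 1
      rw [integral_add (integrable_const _) hi2, integral_const_mul]
      simp
      ring
    · exact (integrable_const _).add hi2
    · exact Eventually.of_forall fun x => by positivity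
  rw [h2, ← ofReal_integral_eq_lintegral_ofReal hGi (Eventually.of_forall hG0)] at h1
  have e : volume K * (2 ^ d * ENNReal.ofReal (∫ x in K, G x)) =
      ENNReal.ofReal (volume.real K * (2 ^ d * ∫ x in K, G x)) := by
    rw [ENNReal.ofReal_mul hvol.le, ENNReal.ofReal_mul (by positivity), measureReal_def,
      ENNReal.ofReal_toReal hvolt, ENNReal.ofReal_pow (by norm_num)]
    simp
  have hGn : 0 ≤ ∫ x in K, G x := integral_nonneg hG0
  rw [e, ENNReal.ofReal_le_ofReal_iff (by positivity)] at h1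
  have h3 : 2 * ∫ y in K, φ y ^ 2 ≤ 2 ^ d * ∫ x in K, G x := by
    refine le_of_mul_le_mul_left ?_ hvol
    linarith
  have hpos : 0 ≤ ∫ x in K, φ x ^ 2 := integral_nonneg fun x => sq_nonneg _
  rw [integral_const_mul] at h3
  linarith

/-- The Poincaré inequality for functions of vanishing mean. -/
theorem poincare {T : Finset (Pt d)} (hne : (cell T).Nonempty) {φ : Pt d → ℝ}
    (hφ : ContDiff ℝ 1 φ) (hmean : ∫ y in cell T, φ y = 0) :
    nrm (volume.restrict (cell T)) φ ≤
      2 ^ d * diamT T * ∑ j, nrm (volume.restrict (cell T)) (partialD j φ) := by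
  have hh : 0 ≤ diamT T := Metric.diam_nonneg
  have hpc := fun j => continuous_partialD hφ j
  have hm : MemLp (fun y => ∑ j, |partialD j φ y|) 2 (volume.restrict (cell T)) :=
    memLp_cell T (by fun_prop)
  have h1 : nrm (volume.restrict (cell T)) (fun y => ∑ j, |partialD j φ y|) ≤
      ∑ j, nrm (volume.restrict (cell T)) (partialD j φ) := by
    refine (nrm_sum_le _ fun j _ => memLp_cell T (by fun_prop)).trans
      (Finset.sum_le_sum fun j _ => ?_)
    exact nrm_mono (memLp_cell T (hpc j)) (Eventually.of_forall fun y => by simp)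
  refine le_trans ?_ (mul_le_mul_of_nonneg_left h1 (by positivity))
  have h0 := nrm_nonneg (volume.restrict (cell T)) (fun y => ∑ j, |partialD j φ y|)
  refine nrm_le_of_sq_le (memLp_cell T hφ.continuous) (by positivity) ?_
  refine (poincare_sq hne hφ hmean).trans ?_
  rw [← nrm_sq hm, mul_pow, mul_pow, mul_assoc]
  gcongr
  exact le_self_pow₀ (one_le_pow₀ (by norm_num)) (by norm_num)

end Poincare

/-! ### Iterated partial derivatives indexed by words -/

section Words

variable {d : ℕ}

/-- The iterated partial derivative along a word. -/
def listD (l : List (Fin d)) (φ : Pt d → ℝ) : Pt d → ℝ := l.foldr partialD φ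

/-- The iterated partial derivative of a polynomial along a word. -/
def listP (l : List (Fin d)) (p : Poly d) : Poly d := l.foldr (fun i q => MvPolynomial.pderiv i q) p

theorem listD_cons (i : Fin d) (l : List (Fin d)) (φ : Pt d → ℝ) :
    listD (i :: l) φ = partialD i (listD l φ) := rfl

theorem listP_cons (i : Fin d) (l : List (Fin d)) (p : Poly d) :
    listP (i :: l) p = MvPolynomial.pderiv i (listP l p) := rfl

theorem contDiff_partialD {φ : Pt d → ℝ} (hφ : ContDiff ℝ ∞ φ) (i : Fin d) :
    ContDiff ℝ ∞ (partialD i φ) :=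
  (hφ.fderiv_right (m := ∞) (by simp)).clm_apply contDiff_const

theorem contDiff_listD {φ : Pt d → ℝ} (hφ : ContDiff ℝ ∞ φ) (l : List (Fin d)) :
    ContDiff ℝ ∞ (listD l φ) := by
  induction l with
  | nil => exact hφ
  | cons i l ih => exact contDiff_partialD ih i

theorem ContDiff.one_of_infty {φ : Pt d → ℝ} (hφ : ContDiff ℝ ∞ φ) : ContDiff ℝ 1 φ :=
  hφ.of_le (by exact_mod_cast le_top)

theorem continuous_listD {φ : Pt d → ℝ} (hφ : ContDiff ℝ ∞ φ) (l : List (Fin d)) :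
    Continuous (listD l φ) := (contDiff_listD hφ l).continuous

theorem partialD_comm {φ : Pt d → ℝ} (hφ : ContDiff ℝ ∞ φ) (i j : Fin d) :
    partialD i (partialD j φ) = partialD j (partialD i φ) := by
  have hfd : Differentiable ℝ (fderiv ℝ φ) :=
    (hφ.fderiv_right (m := ∞) (by simp)).differentiable (by simp)
  have key : ∀ (i j : Fin d) x, partialD i (partialD j φ) x =
      fderiv ℝ (fderiv ℝ φ) x (EuclideanSpace.single i 1) (EuclideanSpace.single j 1) := by
    intro i j x
    have : partialD j φ = fun y => fderiv ℝ φ y (EuclideanSpace.single j 1) := rfl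
    rw [this, partialD, fderiv_clm_apply (hfd x) (differentiableAt_const _)]
    simp
  ext x
  rw [key, key]
  exact (hφ.contDiffAt.isSymmSndFDerivAt (by
    rw [minSmoothness_of_isRCLikeNormedField]
    exact WithTop.coe_le_coe.2 le_top)).eq _ _

theorem listD_perm {φ : Pt d → ℝ} (hφ : ContDiff ℝ ∞ φ) {l m : List (Fin d)} (h : l.Perm m) :
    listD l φ = listD m φ := by
  induction h with
  | nil => rfl
  | cons i _ ih => rw [listD_cons, listD_cons, ih]
  | swap i j l =>
    simp only [listD_cons]
    exact partialD_comm (contDiff_listD hφ l) _ _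
  | trans _ _ ih₁ ih₂ => rw [ih₁, ih₂]

theorem partialD_sub {φ ψ : Pt d → ℝ} (hφ : ContDiff ℝ 1 φ) (hψ : ContDiff ℝ 1 ψ) (i : Fin d) :
    partialD i (fun x => φ x - ψ x) = fun x => partialD i φ x - partialD i ψ x := by
  ext x
  rw [partialD, fderiv_fun_sub (hφ.differentiable one_ne_zero x)
    (hψ.differentiable one_ne_zero x)]
  rfl

theorem listD_sub {φ ψ : Pt d → ℝ} (hφ : ContDiff ℝ ∞ φ) (hψ : ContDiff ℝ ∞ ψ)
    (l : List (Fin d)) :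
    listD l (fun x => φ x - ψ x) = fun x => listD l φ x - listD l ψ x := by
  induction l with
  | nil => rfl
  | cons i l ih =>
    rw [listD_cons, ih, partialD_sub (ContDiff.one_of_infty (contDiff_listD hφ l))
      (ContDiff.one_of_infty (contDiff_listD hψ l))]
    rfl

theorem listD_pev (l : List (Fin d)) (p : Poly d) : listD l (pev p) = pev (listP l p) := by
  induction l with
  | nil => rfl
  | cons i l ih => rw [listD_cons, ih, partialD_pev]; rfl

/-- The word of a multi-index. -/
def word (α : Fin d → ℕ) : List (Fin d) :=
  (List.finRange d).flatMap fun i => List.replicate (α i) i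

theorem multiD_eq_listD (α : Fin d → ℕ) (φ : Pt d → ℝ) : multiD α φ = listD (word α) φ := by
  rw [multiD, listD, word]
  induction List.finRange d with
  | nil => rfl
  | cons i l ih =>
    rw [List.foldr_cons, ih, List.flatMap_cons, List.foldr_append]
    generalize List.foldr partialD φ _ = ψ
    induction α i with
    | zero => rfl
    | succ n ihn => rw [Function.iterate_succ_apply', ihn, List.replicate_succ, List.foldr_cons]

theorem count_word (α : Fin d → ℕ) (i : Fin d) : (word α).count i = α i := by
  rw [word, List.count_flatMap]
  have : (List.count i ∘ fun j => List.replicate (α j) j) = fun j => if j = i then α j else 0 := by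
    funext j
    simp [List.count_replicate]
  rw [this, ← Fin.sum_univ_def]
  simp

theorem length_word (α : Fin d → ℕ) : (word α).length = ∑ i, α i := by
  simp [word, List.length_flatMap, Fin.sum_univ_def]

theorem perm_word_count (l : List (Fin d)) : l.Perm (word fun i => l.count i) := by
  rw [List.perm_iff_count]
  intro i
  rw [count_word]

theorem sum_count (l : List (Fin d)) : ∑ i, l.count i = l.length := by
  rw [← length_word fun i => l.count i, (perm_word_count l).length_eq]

theorem listD_eq_multiD {φ : Pt d → ℝ} (hφ : ContDiff ℝ ∞ φ) (l : List (Fin d)) :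
    listD l φ = multiD (fun i => l.count i) φ := by
  rw [multiD_eq_listD, listD_perm hφ (perm_word_count l)]

theorem word_single (i : Fin d) : word (Pi.single i 1) = [i] := by
  apply List.perm_singleton.1
  rw [List.perm_iff_count]
  intro j
  rw [count_word]
  by_cases h : j = i
  · subst h; simp
  · simp [h, Ne.symm h]

theorem multiD_single (i : Fin d) (φ : Pt d → ℝ) : multiD (Pi.single i 1) φ = partialD i φ := by
  rw [multiD_eq_listD, word_single]; rfl

theorem totalDegree_listP_le (l : List (Fin d)) (p : Poly d) :
    (listP l p).totalDegree ≤ p.totalDegree - l.length := by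
  induction l with
  | nil => exact le_rfl
  | cons i l ih =>
    rw [listP_cons, List.length_cons]
    exact (totalDegree_pderiv_le _ _).trans (by omega)

theorem listP_eq_zero (l : List (Fin d)) {p : Poly d} (h : p.totalDegree < l.length) :
    listP l p = 0 := by
  cases l with
  | nil => simp at h
  | cons i l =>
    have h1 := totalDegree_listP_le l p
    rw [List.length_cons] at h
    rw [listP_cons, MvPolynomial.totalDegree_eq_zero_iff_eq_C.1 (by omega : (listP l p).totalDegree = 0),
      MvPolynomial.pderiv_C]

/-- The homogeneous polynomial of degree `n` with prescribed derivatives of order `n`. -/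
def derivPoly : ℕ → (List (Fin d) → ℝ) → Poly d
  | 0, c => MvPolynomial.C (c [])
  | n + 1, c => MvPolynomial.C ((n : ℝ) + 1)⁻¹ *
      ∑ i, MvPolynomial.X i * derivPoly n (fun l => c (i :: l))

theorem totalDegree_derivPoly (n : ℕ) (c : List (Fin d) → ℝ) :
    (derivPoly n c).totalDegree ≤ n := by
  induction n generalizing c with
  | zero => simp [derivPoly]
  | succ n ih =>
    rw [derivPoly]
    refine (MvPolynomial.totalDegree_mul _ _).trans ?_
    rw [MvPolynomial.totalDegree_C, zero_add]
    refine MvPolynomial.totalDegree_finsetSum_le fun i _ => ?_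
    refine (MvPolynomial.totalDegree_mul _ _).trans ?_
    rw [MvPolynomial.totalDegree_X]
    have := ih fun l => c (i :: l)
    omega

theorem pderiv_derivPoly (n : ℕ) {c : List (Fin d) → ℝ}
    (hc : ∀ l m : List (Fin d), l.Perm m → c l = c m) (j : Fin d) :
    MvPolynomial.pderiv j (derivPoly (n + 1) c) = derivPoly n (fun l => c (j :: l)) := by
  have hsum : ∀ q : Fin d → Poly d,
      ∑ i, MvPolynomial.pderiv j (MvPolynomial.X i) * q i = q j := by
    intro q
    rw [Finset.sum_eq_single j]
    · simp
    · intro i _ hi; simp [MvPolynomial.pderiv_X_of_ne hi]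
    · simp
  induction n generalizing c with
  | zero =>
    rw [derivPoly]
    simp only [derivPoly, Derivation.leibniz, MvPolynomial.pderiv_C, smul_eq_mul, map_sum, mul_zero,
      add_zero, zero_add]
    simp_rw [mul_comm (MvPolynomial.C (c _))]
    rw [hsum fun i => MvPolynomial.C (c [i])]
    simp
  | succ n ih =>
    have hn : ((n : ℝ) + 1 + 1) ≠ 0 := by positivity
    have hn' : ((n : ℝ) + 1) ≠ 0 := by positivity
    have h1 : ∀ i, MvPolynomial.pderiv j (derivPoly (n + 1) fun l => c (i :: l)) =
        derivPoly n (fun l => c (j :: i :: l)) := by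
      intro i
      rw [ih fun l m h => hc _ _ (h.cons i)]
      congr 1
      funext l
      exact hc _ _ (List.Perm.swap _ _ _)
    have h2 : ∑ i, MvPolynomial.X i * derivPoly n (fun l => c (j :: i :: l)) =
        MvPolynomial.C ((n : ℝ) + 1) * derivPoly (n + 1) (fun l => c (j :: l)) := by
      conv_rhs => rw [derivPoly]
      rw [← mul_assoc, ← MvPolynomial.C_mul, mul_inv_cancel₀ hn', MvPolynomial.C_1, one_mul]
    rw [derivPoly]
    simp only [Derivation.leibniz, MvPolynomial.pderiv_C, smul_eq_mul, map_sum, mul_zero,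
      add_zero, h1]
    rw [Finset.sum_add_distrib, h2]
    simp_rw [mul_comm (derivPoly _ _)]
    rw [hsum fun i => derivPoly (n + 1) fun l => c (i :: l)]
    have : ∀ q : Poly d, MvPolynomial.C ((n : ℝ) + 1) * q + q =
        MvPolynomial.C ((n : ℝ) + 1 + 1) * q := by
      intro q; rw [MvPolynomial.C_add (a := (n : ℝ) + 1), MvPolynomial.C_1]; ring
    rw [this, ← mul_assoc, ← MvPolynomial.C_mul]
    push_cast
    rw [inv_mul_cancel₀ hn, MvPolynomial.C_1, one_mul]

theorem listP_derivPoly (n : ℕ) {c : List (Fin d) → ℝ}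
    (hc : ∀ l m : List (Fin d), l.Perm m → c l = c m) (l : List (Fin d)) :
    listP l (derivPoly (n + l.length) c) = derivPoly n (fun m => c (l ++ m)) := by
  induction l generalizing n with
  | nil => rfl
  | cons j l ih =>
    have : n + (j :: l).length = (n + 1) + l.length := by rw [List.length_cons]; omega
    rw [this, listP_cons, ih (n + 1), pderiv_derivPoly n fun m m' h => hc _ _ (h.append_left l)]
    congr 1
    funext m
    exact hc _ _ List.perm_middle

theorem listP_derivPoly_self {c : List (Fin d) → ℝ}
    (hc : ∀ l m : List (Fin d), l.Perm m → c l = c m) (l : List (Fin d)) :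
    listP l (derivPoly l.length c) = MvPolynomial.C (c l) := by
  have := listP_derivPoly 0 hc l
  rw [zero_add] at this
  rw [this, derivPoly, List.append_nil]

/-- There is a polynomial of degree less than `n` such that all derivatives of order less than `n`
of the remainder have vanishing mean. -/
theorem exists_poly_integral_listD_eq_zero {T : Finset (Pt d)} (hne : (cell T).Nonempty) (n : ℕ)
    {φ : Pt d → ℝ} (hφ : ContDiff ℝ ∞ φ) :
    ∃ p : Poly d, p.totalDegree ≤ n - 1 ∧ (∀ l : List (Fin d), l.length = n → listP l p = 0) ∧
      ∀ l : List (Fin d), l.length < n →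
        ∫ y in cell T, listD l (fun x => φ x - pev p x) y = 0 := by
  have hvol : 0 < volume.real (cell T) := by
    rw [measureReal_def]
    refine ENNReal.toReal_pos ((isOpen_cell T).measure_pos volume hne).ne' ?_
    exact ((measure_mono (cell_subset_hull T)).trans_lt (isCompact_hull T).measure_lt_top).ne
  have hint : ∀ f : Pt d → ℝ, Continuous f → Integrable f (volume.restrict (cell T)) :=
    fun f hf => (memLp_cell T hf).integrable (by norm_num)
  induction n generalizing φ with
  | zero => exact ⟨0, by simp, fun l hl => by rw [List.length_eq_zero_iff.1 hl]; rfl, by simp⟩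
  | succ n ih =>
    let c : List (Fin d) → ℝ := fun l => (volume.real (cell T))⁻¹ * ∫ y in cell T, listD l φ y
    have hc : ∀ l m : List (Fin d), l.Perm m → c l = c m := by
      intro l m h
      simp only [c, listD_perm hφ h]
    set q := derivPoly n c
    have hq := totalDegree_derivPoly n c
    obtain ⟨p, hp1, hp2, hp3⟩ := ih (φ := fun x => φ x - pev q x) (hφ.sub (contDiff_pev q))
    have hdeg : (q + p).totalDegree ≤ n :=
      (MvPolynomial.totalDegree_add _ _).trans (max_le hq (hp1.trans (by omega)))
    have hfun : (fun x => φ x - pev (q + p) x) = fun x => (φ x - pev q x) - pev p x := by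
      funext x; rw [pev_add]; ring
    refine ⟨q + p, hdeg, fun l hl => listP_eq_zero l (by omega), fun l hl => ?_⟩
    rw [hfun]
    rcases Nat.lt_succ_iff_lt_or_eq.1 hl with h | h
    · exact hp3 l h
    · rw [listD_sub (hφ.sub (contDiff_pev q)) (contDiff_pev p), listD_pev, hp2 l h,
        listD_sub hφ (contDiff_pev q), listD_pev]
      have : listP l q = MvPolynomial.C (c l) := by
        rw [← listP_derivPoly_self hc l, h]
      rw [this]
      simp only [pev_zero, sub_zero, pev_C]
      rw [integral_sub (hint _ (continuous_listD hφ l)) (integrable_const _)]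
      simp only [integral_const, measureReal_restrict_apply_univ, smul_eq_mul, c]
      field_simp
      ring

/-- The Bramble-Hilbert lemma for smooth functions: all derivatives of order at most `m + 1`. -/
theorem exists_poly_nrm_listD_sub_le {T : Finset (Pt d)} (hne : (cell T).Nonempty) (m : ℕ)
    {φ : Pt d → ℝ} (hφ : ContDiff ℝ ∞ φ) {M : ℝ}
    (hM : ∀ l : List (Fin d), l.length = m + 1 →
      nrm (volume.restrict (cell T)) (listD l φ) ≤ M) :
    ∃ p : Poly d, p.totalDegree ≤ m ∧ ∀ (j : ℕ) (l : List (Fin d)), l.length + j = m + 1 →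
      nrm (volume.restrict (cell T)) (fun x => listD l φ x - pev (listP l p) x) ≤
        (2 ^ d * diamT T * d) ^ j * M := by
  obtain ⟨p, hp1, hp2, hp3⟩ := exists_poly_integral_listD_eq_zero hne (m + 1) hφ
  have hs := hφ.sub (contDiff_pev p)
  have hfun : ∀ l, listD l (fun x => φ x - pev p x) =
      fun x => listD l φ x - pev (listP l p) x := by
    intro l
    rw [listD_sub hφ (contDiff_pev p), listD_pev]
  have hh : 0 ≤ diamT T := Metric.diam_nonneg
  refine ⟨p, hp1, fun j => ?_⟩
  induction j with
  | zero =>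
    intro l hl
    have := hM l hl
    rw [hp2 l hl]
    simpa using this
  | succ j ih =>
    intro l hl
    rw [← hfun]
    refine (poincare hne (ContDiff.one_of_infty (contDiff_listD hs l))
      (hp3 l (by omega))).trans ?_
    have : ∀ i ∈ Finset.univ, nrm (volume.restrict (cell T))
        (partialD i (listD l fun x => φ x - pev p x)) ≤ (2 ^ d * diamT T * d) ^ j * M := by
      intro i _
      rw [← listD_cons, hfun]
      exact ih (i :: l) (by rw [List.length_cons]; omega)
    have h2 := Finset.sum_le_sum this
    rw [Finset.sum_const, Finset.card_univ, Fintype.card_fin, nsmul_eq_mul] at h2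
    refine (mul_le_mul_of_nonneg_left h2 (by positivity)).trans (le_of_eq ?_)
    ring

end Words

/-! ### Convergence of dilated mollifications -/

section Mollify

variable {d : ℕ}

theorem eLpNorm_two_sq {α : Type*} [MeasurableSpace α] {μ : Measure α} (f : α → ℝ) :
    eLpNorm f 2 μ ^ 2 = ∫⁻ x, ‖f x‖ₑ ^ 2 ∂μ := by
  have := eLpNorm_nnreal_pow_eq_lintegral (f := f) (μ := μ) (p := 2) (by norm_num)
  simpa using this

theorem eLpNorm_two_le_of_sq_le {α : Type*} [MeasurableSpace α] {μ : Measure α} {f : α → ℝ}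
    {η : ENNReal} (h : ∫⁻ x, ‖f x‖ₑ ^ 2 ∂μ ≤ η ^ 2) : eLpNorm f 2 μ ≤ η := by
  rw [← eLpNorm_two_sq] at h
  exact (ENNReal.pow_le_pow_left_iff two_ne_zero).1 h

theorem enorm_integral_sq_le {α : Type*} [MeasurableSpace α] {P : Measure α}
    [IsProbabilityMeasure P] {f : α → ℝ} (hf : AEStronglyMeasurable f P) :
    ‖∫ x, f x ∂P‖ₑ ^ 2 ≤ ∫⁻ x, ‖f x‖ₑ ^ 2 ∂P := by
  rw [← eLpNorm_two_sq]
  gcongr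
  refine (enorm_integral_le_lintegral_enorm f).trans ?_
  rw [← eLpNorm_one_eq_lintegral_enorm]
  exact eLpNorm_le_eLpNorm_of_exponent_le (by norm_num) hf

/-- The dilation with center `c` and factor `r`, followed by a translation. -/
def dilate (c : Pt d) (r : ℝ) (w x : Pt d) : Pt d := c + r • (x - c) - w

theorem measurable_dilate (c : Pt d) (r : ℝ) :
    Measurable fun q : Pt d × Pt d => dilate c r q.1 q.2 := by
  unfold dilate; fun_prop

theorem eLpNorm_comp_dilate_le (c w : Pt d) {r : ℝ} (hr : 1 / 2 ≤ r) {g : Pt d → ℝ}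
    (hg : Measurable g) :
    eLpNorm (fun x => g (dilate c r w x)) 2 volume ≤ 2 ^ d * eLpNorm g 2 volume := by
  have hr0 : 0 < r := by linarith
  apply eLpNorm_two_le_of_sq_le
  have hm : Measurable fun z : Pt d => ‖g (z - w)‖ₑ ^ 2 := by fun_prop
  have h1 := lintegral_comp_homothety c hr0 hm
  unfold dilate
  rw [h1, lintegral_sub_right_eq_self (fun z => ‖g z‖ₑ ^ 2) w, mul_pow, eLpNorm_two_sq]
  gcongr
  have : (2 : ENNReal) ^ d = ENNReal.ofReal (2 ^ d) := by
    rw [ENNReal.ofReal_pow (by norm_num)]; simp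
  rw [this, ← ENNReal.ofReal_pow (by positivity)]
  apply ENNReal.ofReal_le_ofReal
  refine le_trans ?_ (le_self_pow₀ (one_le_pow₀ (by norm_num)) (by norm_num))
  rw [← inv_pow]
  gcongr
  rw [inv_le_comm₀ hr0 (by norm_num)]
  linarith

theorem exists_eLpNorm_dilate_sub_le {K : Set (Pt d)} (hKm : MeasurableSet K)
    (hKb : Bornology.IsBounded K) (c : Pt d) {g : Pt d → ℝ} (hg : Measurable g)
    (hg2 : MemLp g 2 volume) {η : ENNReal} (hη : η ≠ 0) (hηt : η ≠ ⊤) :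
    ∃ δ > (0 : ℝ), ∀ (r : ℝ) (w : Pt d), 1 / 2 ≤ r → r ≤ 1 → 1 - r ≤ δ → ‖w‖ ≤ δ →
      eLpNorm (fun x => g (dilate c r w x) - g x) 2 (volume.restrict K) ≤ η := by
  have hD : (2 : ENNReal) ^ d + 1 ≠ ⊤ := by simp
  set ε : ENNReal := η / 2 / (2 ^ d + 1)
  have hε : ε ≠ 0 := by simp [ε, hη]
  obtain ⟨ψ, hψs, hψ1, hψc, hψm⟩ := hg2.exists_hasCompactSupport_eLpNorm_sub_le
    (by norm_num) hε
  obtain ⟨R, hR⟩ := hKb.subset_closedBall c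
  have hKfin : volume K ≠ ⊤ := (hKb.measure_lt_top (μ := volume)).ne
  set V : ENNReal := volume K ^ ((2 : ENNReal).toReal⁻¹)
  have hV : V ≠ ⊤ := ENNReal.rpow_ne_top_of_nonneg (by positivity) hKfin
  set C : ℝ := (η / 2).toReal / (V.toReal + 1)
  have hη2 : 0 < (η / 2).toReal := ENNReal.toReal_pos (by simp [hη]) (by simp [hηt, ENNReal.div_eq_top])
  have hC : 0 < C := by positivity
  have huc : UniformContinuous ψ := hψs.uniformContinuous_of_continuous hψc
  obtain ⟨δ, hδ, hδ2⟩ := Metric.uniformContinuous_iff.1 huc C hC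
  refine ⟨δ / (2 * (|R| + 1)), by positivity, fun r w hr hr1 hrδ hw => ?_⟩
  have hb : ∀ x ∈ K, dist (dilate c r w x) x < δ := by
    intro x hx
    have hxR : ‖x - c‖ ≤ |R| := by
      have := hR hx
      rw [Metric.mem_closedBall, dist_eq_norm] at this
      exact this.trans (le_abs_self R)
    have e : dilate c r w x - x = -((1 - r) • (x - c)) - w := by
      rw [dilate, sub_smul, one_smul]; abel
    rw [dist_eq_norm, e]
    have hR0 := abs_nonneg R
    calc ‖-((1 - r) • (x - c)) - w‖ ≤ ‖-((1 - r) • (x - c))‖ + ‖w‖ := norm_sub_le _ _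
      _ = (1 - r) * ‖x - c‖ + ‖w‖ := by
        rw [norm_neg, norm_smul, Real.norm_of_nonneg (by linarith)]
      _ ≤ δ / (2 * (|R| + 1)) * |R| + δ / (2 * (|R| + 1)) := by gcongr
      _ = δ / 2 := by field_simp
      _ < δ := by linarith
  have hgψ : Measurable (fun x => g x - ψ x) := hg.sub hψc.measurable
  have hdm : Measurable (dilate c r w) := by unfold dilate; fun_prop
  have e : (fun x => g (dilate c r w x) - g x) =
      (fun x => (fun x => g x - ψ x) (dilate c r w x)) +
        ((fun x => ψ (dilate c r w x) - ψ x) + fun x => ψ x - g x) := by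
    funext x; simp
  have m1 : AEStronglyMeasurable (fun x => (fun x => g x - ψ x) (dilate c r w x))
      (volume.restrict K) := (hgψ.comp hdm).aestronglyMeasurable
  have m2 : AEStronglyMeasurable (fun x => ψ (dilate c r w x) - ψ x) (volume.restrict K) :=
    ((hψc.measurable.comp hdm).sub hψc.measurable).aestronglyMeasurable
  have m3 : AEStronglyMeasurable (fun x => ψ x - g x) (volume.restrict K) :=
    (hψc.measurable.sub hg).aestronglyMeasurable
  have b1 : eLpNorm (fun x => (fun x => g x - ψ x) (dilate c r w x)) 2 (volume.restrict K) ≤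
      2 ^ d * ε :=
    (eLpNorm_mono_measure _ Measure.restrict_le_self).trans
      ((eLpNorm_comp_dilate_le c w hr hgψ).trans (by gcongr; exact hψ1))
  have b3 : eLpNorm (fun x => ψ x - g x) 2 (volume.restrict K) ≤ ε := by
    refine (eLpNorm_mono_measure _ Measure.restrict_le_self).trans ?_
    have := eLpNorm_sub_comm ψ g 2 volume
    exact (le_of_eq this).trans hψ1
  have b2 : eLpNorm (fun x => ψ (dilate c r w x) - ψ x) 2 (volume.restrict K) ≤ η / 2 := by
    have h := eLpNorm_le_of_ae_bound (p := 2) (μ := volume.restrict K)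
      (f := fun x => ψ (dilate c r w x) - ψ x) (C := C) (by
        filter_upwards [ae_restrict_mem hKm] with x hx
        rw [← dist_eq_norm]
        exact (hδ2 (hb x hx)).le)
    refine h.trans ?_
    rw [Measure.restrict_apply_univ]
    change V * ENNReal.ofReal C ≤ η / 2
    rw [← ENNReal.ofReal_toReal hV, ← ENNReal.ofReal_mul ENNReal.toReal_nonneg,
      ← ENNReal.ofReal_toReal (a := η / 2) (by simp [hηt, ENNReal.div_eq_top])]
    apply ENNReal.ofReal_le_ofReal
    have hV0 : 0 ≤ V.toReal := ENNReal.toReal_nonneg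
    calc V.toReal * C ≤ (V.toReal + 1) * C := by gcongr; linarith
      _ = (η / 2).toReal := by simp only [C]; field_simp
  rw [e]
  calc _ ≤ _ := eLpNorm_add_le m1 (m2.add m3) (by norm_num)
    _ ≤ 2 ^ d * ε + (η / 2 + ε) := by
      gcongr
      exact (eLpNorm_add_le m2 m3 (by norm_num)).trans (by gcongr)
    _ = (2 ^ d + 1) * ε + η / 2 := by ring
    _ = η := by
      rw [ENNReal.mul_div_cancel (by simp) hD, ENNReal.add_halves]

open scoped Convolution in
/-- Convolution of scalar functions. -/
def conv (f g : Pt d → ℝ) : Pt d → ℝ := f ⋆[ContinuousLinearMap.mul ℝ ℝ, volume] g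

theorem conv_apply (f g : Pt d → ℝ) (z : Pt d) : conv f g z = ∫ t, f t * g (z - t) := rfl

theorem conv_apply_swap (f g : Pt d → ℝ) (z : Pt d) : conv f g z = ∫ t, f (z - t) * g t :=
  convolution_eq_swap _

theorem eLpNorm_conv_dilate_sub_le {K : Set (Pt d)} (ρ : ContDiffBump (0 : Pt d)) (c : Pt d)
    (r : ℝ) {g : Pt d → ℝ} (hg : Measurable g) (hg2 : MemLp g 2 volume) {η : ENNReal}
    (h : ∀ w ∈ Metric.ball (0 : Pt d) ρ.rOut,
      eLpNorm (fun x => g (dilate c r w x) - g x) 2 (volume.restrict K) ≤ η) :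
    eLpNorm (fun x => conv g (ρ.normed volume) (c + r • (x - c)) - g x) 2
      (volume.restrict K) ≤ η := by
  have hρm : Measurable fun w => ENNReal.ofReal (ρ.normed volume w) :=
    ρ.continuous_normed.measurable.ennreal_ofReal
  set P : Measure (Pt d) := volume.withDensity fun w => ENNReal.ofReal (ρ.normed volume w)
  have hP : IsProbabilityMeasure P := ⟨by
    rw [withDensity_apply _ MeasurableSet.univ, Measure.restrict_univ,
      ← ofReal_integral_eq_lintegral_ofReal ρ.integrable_normed
        (Eventually.of_forall ρ.nonneg_normed), ρ.integral_normed, ENNReal.ofReal_one]⟩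
  have hPint : ∀ f : Pt d → ℝ, ∫ w, f w ∂P = ∫ w, f w * ρ.normed volume w := by
    intro f
    rw [integral_withDensity_eq_integral_toReal_smul hρm (by simp)]
    refine integral_congr_ae (Eventually.of_forall fun w => ?_)
    simp only [ENNReal.toReal_ofReal (ρ.nonneg_normed w), smul_eq_mul, mul_comm]
  have hPi : ∀ x, Integrable (fun w => g (dilate c r w x)) P := by
    intro x
    rw [integrable_withDensity_iff_integrable_smul' hρm (by simp)]
    have h1 := (ρ.hasCompactSupport_normed (μ := volume)).convolutionExists_right
      (ContinuousLinearMap.mul ℝ ℝ) (hg2.locallyIntegrable (by norm_num)) ρ.continuous_normed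
      (c + r • (x - c))
    have h2 := h1.integrable_swap
    refine h2.congr (Eventually.of_forall fun w => ?_)
    simp only [ENNReal.toReal_ofReal (ρ.nonneg_normed w), smul_eq_mul, dilate,
      ContinuousLinearMap.mul_apply', mul_comm]
  have hval : ∀ x, conv g (ρ.normed volume) (c + r • (x - c)) - g x =
      ∫ w, (g (dilate c r w x) - g x) ∂P := by
    intro x
    rw [integral_sub (hPi x) (integrable_const _), hPint, conv_apply_swap]
    simp [dilate]
  have hjm : Measurable fun q : Pt d × Pt d => g (dilate c r q.1 q.2) - g q.2 :=
    (hg.comp (measurable_dilate c r)).sub (hg.comp measurable_snd)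
  apply eLpNorm_two_le_of_sq_le
  calc ∫⁻ x in K, ‖conv g (ρ.normed volume) (c + r • (x - c)) - g x‖ₑ ^ 2
      ≤ ∫⁻ x in K, ∫⁻ w, ‖g (dilate c r w x) - g x‖ₑ ^ 2 ∂P := by
        refine lintegral_mono fun x => ?_
        simp only [hval]
        exact enorm_integral_sq_le
          (hjm.comp (measurable_id.prodMk measurable_const)).aestronglyMeasurable
    _ = ∫⁻ w, (∫⁻ x in K, ‖g (dilate c r w x) - g x‖ₑ ^ 2) ∂P := by
        rw [lintegral_lintegral_swap]
        exact ((hjm.comp measurable_swap).enorm.pow_const 2).aemeasurable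
    _ ≤ ∫⁻ _, η ^ 2 ∂P := by
        refine lintegral_mono_ae ?_
        have : ∀ᵐ w ∂P, w ∈ Metric.ball (0 : Pt d) ρ.rOut := by
          rw [ae_withDensity_iff hρm]
          refine Eventually.of_forall fun w hw => ?_
          rw [← ρ.support_normed_eq (μ := volume)]
          intro h0
          rw [h0] at hw
          simp at hw
        filter_upwards [this] with w hw
        rw [← eLpNorm_two_sq]
        gcongr
        exact h w hw
    _ = η ^ 2 := by simp

end Mollify

/-! ### Weak derivatives and density of smooth functions -/

section WeakDeriv

variable {d : ℕ}

theorem tsupport_partialD_subset (i : Fin d) (φ : Pt d → ℝ) :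
    tsupport (partialD i φ) ⊆ tsupport φ := by
  have h := tsupport_fderiv_apply_subset ℝ (f := φ) (EuclideanSpace.single i (1 : ℝ))
  exact h

theorem tsupport_listD_subset (l : List (Fin d)) (φ : Pt d → ℝ) :
    tsupport (listD l φ) ⊆ tsupport φ := by
  induction l with
  | nil => exact subset_rfl
  | cons i l ih => exact (tsupport_partialD_subset i _).trans ih

theorem hasCompactSupport_listD {φ : Pt d → ℝ} (hφ : HasCompactSupport φ) (l : List (Fin d)) :
    HasCompactSupport (listD l φ) :=
  hφ.of_isClosed_subset (isClosed_tsupport _) (tsupport_listD_subset l φ)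

theorem setIntegral_eq_integral_of_tsupport_subset {K : Set (Pt d)} {φ : Pt d → ℝ}
    (h : tsupport φ ⊆ K) (f : Pt d → ℝ) : ∫ x in K, f x * φ x = ∫ x, f x * φ x := by
  apply setIntegral_eq_integral_of_forall_compl_eq_zero
  intro x hx
  rw [image_eq_zero_of_notMem_tsupport fun h' => hx (h h'), mul_zero]

theorem IsTestFunction.mono {K Ω : Set (Pt d)} (h : K ⊆ Ω) {φ : Pt d → ℝ}
    (hφ : IsTestFunction K φ) : IsTestFunction Ω φ := ⟨hφ.1, hφ.2.1, hφ.2.2.trans h⟩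

theorem HasWeakDeriv.mono {K Ω : Set (Pt d)} (h : K ⊆ Ω) {α : Fin d → ℕ} {f g : Pt d → ℝ}
    (hw : HasWeakDeriv Ω α f g) : HasWeakDeriv K α f g := by
  refine ⟨hw.1.mono_set h, hw.2.1.mono_set h, fun φ hφ => ?_⟩
  have := hw.2.2 φ (hφ.mono h)
  have hs : tsupport (multiD α φ) ⊆ K := by
    rw [multiD_eq_listD]; exact (tsupport_listD_subset _ _).trans hφ.2.2
  rw [setIntegral_eq_integral_of_tsupport_subset hs,
    setIntegral_eq_integral_of_tsupport_subset hφ.2.2]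
  rwa [setIntegral_eq_integral_of_tsupport_subset (hs.trans h),
    setIntegral_eq_integral_of_tsupport_subset (hφ.2.2.trans h)] at this

theorem HasWeakDeriv.unique {K : Set (Pt d)} (hK : IsOpen K) {α : Fin d → ℕ} {f g g' : Pt d → ℝ}
    (h : HasWeakDeriv K α f g) (h' : HasWeakDeriv K α f g') : g =ᵐ[volume.restrict K] g' := by
  have key := hK.ae_eq_zero_of_integral_contDiff_smul_eq_zero (μ := volume)
    (f := fun x => g x - g' x) (h.2.1.sub h'.2.1) (by
      intro φ hφ hc hs
      have hφt : IsTestFunction K φ := ⟨hφ, hc, hs⟩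
      have e1 := h.2.2 φ hφt
      have e2 := h'.2.2 φ hφt
      rw [e1] at e2
      have e3 : ∫ x in K, g x * φ x = ∫ x in K, g' x * φ x :=
        mul_left_cancel₀ (pow_ne_zero _ (by norm_num)) e2
      rw [setIntegral_eq_integral_of_tsupport_subset hs,
        setIntegral_eq_integral_of_tsupport_subset hs] at e3
      have hint : ∀ g : Pt d → ℝ, LocallyIntegrableOn g K → Integrable (fun x => g x * φ x) := by
        intro g hg
        have h1 : IntegrableOn g (tsupport φ) := hg.integrableOn_compact_subset hs hc
        have h2 : IntegrableOn (fun x => g x * φ x) (tsupport φ) :=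
          h1.mul_continuousOn hφ.continuous.continuousOn hc
        rw [integrableOn_iff_integrable_of_support_subset] at h2
        · exact h2
        · exact (Function.support_mul_subset_right _ _).trans (subset_tsupport φ)
      have e4 : (fun x => φ x • (g x - g' x)) = fun x => g x * φ x - g' x * φ x := by
        funext x; simp; ring
      rw [e4, integral_sub (hint _ h.2.1) (hint _ h'.2.1), e3, sub_self])
  rw [EventuallyEq, ae_restrict_iff' hK.measurableSet]
  filter_upwards [key] with x hx hxK
  linarith [hx hxK]

theorem weakDeriv_spec {Ω : Set (Pt d)} {m : ℕ} {f : Pt d → ℝ} (h : MemH Ω m f) {α : Fin d → ℕ}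
    (hα : ∑ i, α i ≤ m) :
    MemLp (weakDeriv Ω α f) 2 (volume.restrict Ω) ∧ HasWeakDeriv Ω α f (weakDeriv Ω α f) := by
  have hex := h.2 α hα
  rw [weakDeriv, dif_pos hex]
  exact hex.choose_spec

theorem MemH.mono {K Ω : Set (Pt d)} (hKΩ : K ⊆ Ω) {m : ℕ} {f : Pt d → ℝ} (h : MemH Ω m f) :
    MemH K m f := by
  refine ⟨h.1.mono_measure (Measure.restrict_mono_set _ hKΩ), fun α hα => ?_⟩
  obtain ⟨g, hg1, hg2⟩ := h.2 α hα
  exact ⟨g, hg1.mono_measure (Measure.restrict_mono_set _ hKΩ), hg2.mono hKΩ⟩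

theorem weakDeriv_mono {K Ω : Set (Pt d)} (hK : IsOpen K) (hKΩ : K ⊆ Ω) {m : ℕ} {f : Pt d → ℝ}
    (h : MemH Ω m f) {α : Fin d → ℕ} (hα : ∑ i, α i ≤ m) :
    weakDeriv K α f =ᵐ[volume.restrict K] weakDeriv Ω α f :=
  (weakDeriv_spec (h.mono hKΩ) hα).2.unique hK ((weakDeriv_spec h hα).2.mono hKΩ)

theorem partialD_conv {f : Pt d → ℝ} (hf : LocallyIntegrable f volume) {ρ : Pt d → ℝ}
    (hρ : ContDiff ℝ ∞ ρ) (hc : HasCompactSupport ρ) (i : Fin d) :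
    partialD i (conv f ρ) = conv f (partialD i ρ) := by
  ext z
  have h := hc.hasFDerivAt_convolution_right (ContinuousLinearMap.mul ℝ ℝ) hf
    (ContDiff.one_of_infty hρ) z
  rw [partialD]
  have h2 : fderiv ℝ (conv f ρ) z = _ := h.fderiv
  rw [h2, convolution_precompR_apply _ hf (hc.fderiv ℝ)
    ((ContDiff.one_of_infty hρ).continuous_fderiv one_ne_zero)]
  rfl

theorem contDiff_conv {f : Pt d → ℝ} (hf : LocallyIntegrable f volume) {ρ : Pt d → ℝ}
    (hρ : ContDiff ℝ ∞ ρ) (hc : HasCompactSupport ρ) : ContDiff ℝ ∞ (conv f ρ) :=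
  hc.contDiff_convolution_right (ContinuousLinearMap.mul ℝ ℝ) hf hρ

theorem listD_conv {f : Pt d → ℝ} (hf : LocallyIntegrable f volume) {ρ : Pt d → ℝ}
    (hρ : ContDiff ℝ ∞ ρ) (hc : HasCompactSupport ρ) (l : List (Fin d)) :
    listD l (conv f ρ) = conv f (listD l ρ) := by
  induction l with
  | nil => rfl
  | cons i l ih =>
    rw [listD_cons, ih, partialD_conv hf (contDiff_listD hρ l) (hasCompactSupport_listD hc l)]
    rfl

theorem partialD_comp_affine {φ : Pt d → ℝ} (hφ : ContDiff ℝ ∞ φ) (a : Pt d) (r : ℝ) (i : Fin d) :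
    partialD i (fun x => φ (a + r • x)) = fun x => r * partialD i φ (a + r • x) := by
  ext x
  have h1 : HasFDerivAt (fun x : Pt d => a + r • x) (r • ContinuousLinearMap.id ℝ (Pt d)) x :=
    ((hasFDerivAt_id x).const_smul r).const_add a
  have h2 := ((ContDiff.one_of_infty hφ).differentiable one_ne_zero (a + r • x)).hasFDerivAt.comp
    x h1
  rw [partialD]
  have h3 : fderiv ℝ (fun x => φ (a + r • x)) x = _ := h2.fderiv
  rw [h3]
  simp [partialD]

theorem listD_const_mul {φ : Pt d → ℝ} (hφ : ContDiff ℝ ∞ φ) (c : ℝ) (l : List (Fin d)) :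
    listD l (fun x => c * φ x) = fun x => c * listD l φ x := by
  induction l with
  | nil => rfl
  | cons i l ih =>
    ext x
    rw [listD_cons, ih, partialD, fderiv_const_mul
      ((ContDiff.one_of_infty (contDiff_listD hφ l)).differentiable one_ne_zero x)]
    rfl

theorem listD_comp_affine {φ : Pt d → ℝ} (hφ : ContDiff ℝ ∞ φ) (a : Pt d) (r : ℝ)
    (l : List (Fin d)) :
    listD l (fun x => φ (a + r • x)) = fun x => r ^ l.length * listD l φ (a + r • x) := by
  induction l with
  | nil => simp [listD]
  | cons i l ih =>
    have hs : ContDiff ℝ ∞ fun x : Pt d => listD l φ (a + r • x) :=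
      (contDiff_listD hφ l).comp (by fun_prop)
    rw [listD_cons, ih]
    have := listD_const_mul hs (r ^ l.length) [i]
    simp only [listD_cons] at this
    change partialD i (fun x => r ^ l.length * listD l φ (a + r • x)) = _
    refine this.trans ?_
    funext x
    have h3 := congrFun (partialD_comp_affine (contDiff_listD hφ l) a r i) x
    change r ^ l.length * partialD i (fun x => listD l φ (a + r • x)) x = _
    rw [h3, List.length_cons, pow_succ]
    simp only [listD_cons]
    ring

theorem conv_listD_eq {K : Set (Pt d)} {α : Fin d → ℕ} {f g : Pt d → ℝ}
    (hK : MeasurableSet K) (hw : HasWeakDeriv K α f g) {ρ : Pt d → ℝ} (hρ : ContDiff ℝ ∞ ρ)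
    {ε : ℝ} (hs : tsupport ρ ⊆ Metric.closedBall 0 ε) {z : Pt d}
    (hz : Metric.closedBall z ε ⊆ K) :
    conv (K.indicator f) (listD (word α) ρ) z = conv (K.indicator g) ρ z := by
  have hfun : (fun t => ρ (z - t)) = fun t => ρ (z + (-1 : ℝ) • t) := by
    funext t; rw [neg_one_smul, sub_eq_add_neg]
  have hsupp : tsupport (fun t => ρ (z - t)) ⊆ Metric.closedBall z ε := by
    refine closure_minimal (fun t ht => ?_) Metric.isClosed_closedBall
    have : z - t ∈ Metric.closedBall (0 : Pt d) ε := hs (subset_tsupport ρ ht)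
    rw [mem_closedBall_zero_iff] at this
    rwa [Metric.mem_closedBall, dist_eq_norm, norm_sub_rev]
  have htest : IsTestFunction K fun t => ρ (z - t) := by
    refine ⟨hρ.comp (by fun_prop), ?_, hsupp.trans hz⟩
    exact (isCompact_closedBall z ε).of_isClosed_subset (isClosed_tsupport _) hsupp
  have h := hw.2.2 _ htest
  have hmul : multiD α (fun t => ρ (z - t)) =
      fun t => (-1) ^ (∑ i, α i) * listD (word α) ρ (z - t) := by
    rw [multiD_eq_listD, hfun, listD_comp_affine hρ, length_word]
    funext t
    rw [neg_one_smul, sub_eq_add_neg]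
  rw [hmul] at h
  have e : ∀ t, f t * ((-1) ^ (∑ i, α i) * listD (word α) ρ (z - t)) =
      (-1) ^ (∑ i, α i) * (f t * listD (word α) ρ (z - t)) := fun t => by ring
  simp_rw [e] at h
  rw [integral_const_mul] at h
  have h' := mul_left_cancel₀ (pow_ne_zero _ (by norm_num)) h
  rw [conv_apply, conv_apply]
  have ind : ∀ f u : Pt d → ℝ, ∫ t, K.indicator f t * u t = ∫ t in K, f t * u t := by
    intro f u
    rw [← integral_indicator hK]
    refine integral_congr_ae (Eventually.of_forall fun t => ?_)
    by_cases ht : t ∈ K <;> simp [ht]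
  rw [ind f fun t => listD (word α) ρ (z - t), ind g fun t => ρ (z - t), h']

/-- Smooth functions are dense in `H^m(T)`. -/
theorem exists_smooth_seq {T : Finset (Pt d)} (hne : (cell T).Nonempty) {m : ℕ} {f : Pt d → ℝ}
    (hf : MemH (cell T) m f) :
    ∃ φ : ℕ → Pt d → ℝ, (∀ n, ContDiff ℝ ∞ (φ n)) ∧ ∀ α : Fin d → ℕ, ∑ i, α i ≤ m →
      Tendsto (fun n => eLpNorm (multiD α (φ n) - weakDeriv (cell T) α f) 2
        (volume.restrict (cell T))) atTop (𝓝 0) := by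
  set K := cell T
  have hKo : IsOpen K := isOpen_cell T
  have hKm := hKo.measurableSet
  have hKc : Convex ℝ K := (convex_convexHull ℝ _).interior
  have hKb : Bornology.IsBounded K := (isCompact_hull T).isBounded.subset (cell_subset_hull T)
  obtain ⟨c, hc⟩ := hne
  obtain ⟨R, hR, hball⟩ := Metric.isOpen_iff.1 hKo c hc
  let r : ℕ → ℝ := fun n => 1 - 1 / (n + 2 : ℝ)
  have hr1 : ∀ n, r n < 1 := fun n => by simp only [r]; linarith [show (0 : ℝ) < 1 / (n + 2) by positivity]
  have hr2 : ∀ n, 1 / 2 ≤ r n := by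
    intro n
    have : (1 : ℝ) / (n + 2) ≤ 1 / 2 := by
      apply one_div_le_one_div_of_le (by norm_num)
      have : (0 : ℝ) ≤ n := n.cast_nonneg
      linarith
    simp only [r]; linarith
  have hrt : Tendsto (fun n => 1 - r n) atTop (𝓝 0) := by
    have : (fun n => 1 - r n) = fun n : ℕ => 1 / ((n : ℝ) + 2) := by
      funext n; simp only [r]; ring
    rw [this]
    have h2 : Tendsto (fun n : ℕ => (n : ℝ) + 2) atTop atTop :=
      tendsto_atTop_add_const_right _ _ tendsto_natCast_atTop_atTop
    simp only [one_div]
    exact h2.inv_tendsto_atTop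
  let ρ : ℕ → ContDiffBump (0 : Pt d) := fun n =>
    { rIn := (1 - r n) * R / 4
      rOut := (1 - r n) * R / 2
      rIn_pos := by have := hr1 n; have : 0 < 1 - r n := by linarith
                    positivity
      rIn_lt_rOut := by
        have := hr1 n
        have : 0 < (1 - r n) * R := mul_pos (by linarith) hR
        linarith }
  have hdil : ∀ n, ∀ x ∈ K, Metric.closedBall (c + r n • (x - c)) (ρ n).rOut ⊆ K := by
    intro n x hx z hz
    have h1 : 0 < 1 - r n := by linarith [hr1 n]
    have h0 : 0 < r n := by linarith [hr2 n]
    set w := z - (c + r n • (x - c))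
    have hw : ‖w‖ ≤ (1 - r n) * R / 2 := by
      rw [Metric.mem_closedBall, dist_eq_norm] at hz; exact hz
    have hmem : c + (1 - r n)⁻¹ • w ∈ K := by
      apply hball
      rw [Metric.mem_ball, dist_eq_norm, add_sub_cancel_left, norm_smul, norm_inv,
        Real.norm_of_nonneg h1.le, inv_mul_lt_iff₀ h1]
      have : 0 < (1 - r n) * R := mul_pos h1 hR
      linarith
    have hz' : z = r n • x + (1 - r n) • (c + (1 - r n)⁻¹ • w) := by
      have key : ∀ s : ℝ, 1 - s ≠ 0 →
          z = s • x + (1 - s) • (c + (1 - s)⁻¹ • (z - (c + s • (x - c)))) := by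
        intro s hs
        rw [smul_add, smul_smul, mul_inv_cancel₀ hs, one_smul]
        module
      exact key _ h1.ne'
    rw [hz']
    exact hKc hx hmem h0.le h1.le (by ring)
  have hloc : ∀ g : Pt d → ℝ, MemLp g 2 (volume.restrict K) →
      MemLp (K.indicator g) 2 volume := fun g hg => (memLp_indicator_iff_restrict hKm).2 hg
  have hf2 := hloc f hf.1
  have hfl : LocallyIntegrable (K.indicator f) volume := hf2.locallyIntegrable (by norm_num)
  have hρs : ∀ n, ContDiff ℝ ∞ ((ρ n).normed volume) := fun n => (ρ n).contDiff_normed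
  have hρc : ∀ n, HasCompactSupport ((ρ n).normed volume) := fun n => (ρ n).hasCompactSupport_normed
  have haff : ∀ n (x : Pt d), c + r n • (x - c) = (c - r n • c) + r n • x := by
    intro n x; rw [smul_sub]; abel
  let φ : ℕ → Pt d → ℝ := fun n x =>
    conv (K.indicator f) ((ρ n).normed volume) ((c - r n • c) + r n • x)
  have hφ : ∀ n, ContDiff ℝ ∞ (φ n) := fun n =>
    (contDiff_conv hfl (hρs n) (hρc n)).comp (by fun_prop)
  refine ⟨φ, hφ, fun α hα => ?_⟩
  obtain ⟨hg1, hg2⟩ := weakDeriv_spec hf hα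
  set g := weakDeriv K α f
  set a := ∑ i, α i
  have hgK := hloc g hg1
  obtain ⟨g', hg'm, hgg'⟩ : ∃ g' : Pt d → ℝ, Measurable g' ∧ K.indicator g =ᵐ[volume] g' :=
    ⟨hgK.1.aemeasurable.mk _, hgK.1.aemeasurable.measurable_mk, hgK.1.aemeasurable.ae_eq_mk⟩
  have hg'2 : MemLp g' 2 volume := (memLp_congr_ae hgg').1 hgK
  have hconv : ∀ n z, conv (K.indicator g) ((ρ n).normed volume) z =
      conv g' ((ρ n).normed volume) z := by
    intro n z
    rw [conv_apply, conv_apply]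
    refine integral_congr_ae ?_
    filter_upwards [hgg'] with t ht
    rw [ht]
  have hval : ∀ n, ∀ x ∈ K, multiD α (φ n) x =
      r n ^ a * conv g' ((ρ n).normed volume) (c + r n • (x - c)) := by
    intro n x hx
    rw [multiD_eq_listD, listD_comp_affine (contDiff_conv hfl (hρs n) (hρc n)), length_word,
      listD_conv hfl (hρs n) (hρc n)]
    beta_reduce
    rw [← haff, conv_listD_eq hKm hg2 (hρs n) (by rw [(ρ n).tsupport_normed_eq]) (hdil n x hx), hconv]
  have hgae : g =ᵐ[volume.restrict K] g' := by
    have h1 : K.indicator g =ᵐ[volume.restrict K] g' := ae_restrict_of_ae hgg'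
    have h2 : K.indicator g =ᵐ[volume.restrict K] g := indicator_ae_eq_restrict hKm
    exact h2.symm.trans h1
  have hlim1 : Tendsto (fun n => eLpNorm (fun x => conv g' ((ρ n).normed volume)
      (c + r n • (x - c)) - g' x) 2 (volume.restrict K)) atTop (𝓝 0) := by
    rw [ENNReal.tendsto_nhds_zero]
    intro η hη
    by_cases hηt : η = ⊤
    · simp [hηt]
    obtain ⟨δ, hδ, hb⟩ := exists_eLpNorm_dilate_sub_le hKm hKb c hg'm hg'2 hη.ne' hηt
    have hev : ∀ᶠ n in atTop, 1 - r n < min δ (δ / R) :=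
      hrt.eventually (gt_mem_nhds (lt_min hδ (by positivity)))
    filter_upwards [hev] with n hn
    refine eLpNorm_conv_dilate_sub_le (ρ n) c (r n) hg'm hg'2 fun w hw => ?_
    refine hb (r n) w (hr2 n) (hr1 n).le (hn.le.trans (min_le_left _ _)) ?_
    rw [mem_ball_zero_iff] at hw
    have h3 : (1 - r n) * R ≤ δ := by
      have := hn.le.trans (min_le_right _ _)
      rwa [le_div_iff₀ hR] at this
    have h4 : (ρ n).rOut = (1 - r n) * R / 2 := rfl
    rw [h4] at hw
    have : 0 < (1 - r n) * R := mul_pos (by linarith [hr1 n]) hR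
    linarith
  have hmeas : ∀ n, Measurable fun x => conv g' ((ρ n).normed volume) (c + r n • (x - c)) := by
    intro n
    have := (contDiff_conv (hg'2.locallyIntegrable (by norm_num)) (hρs n) (hρc n)).continuous
    exact (this.comp (by fun_prop : Continuous fun x : Pt d => c + r n • (x - c))).measurable
  have hbound : ∀ n, eLpNorm (multiD α (φ n) - g) 2 (volume.restrict K) ≤
      eLpNorm (fun x => conv g' ((ρ n).normed volume) (c + r n • (x - c)) - g' x) 2
        (volume.restrict K) + ENNReal.ofReal (1 - r n ^ a) * eLpNorm g' 2 (volume.restrict K) := by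
    intro n
    have h0 : 0 < r n := by linarith [hr2 n]
    have hra : r n ^ a ≤ 1 := pow_le_one₀ h0.le (hr1 n).le
    have hra0 : 0 ≤ r n ^ a := by positivity
    have e : (multiD α (φ n) - g) =ᵐ[volume.restrict K]
        (r n ^ a • fun x => conv g' ((ρ n).normed volume) (c + r n • (x - c)) - g' x) -
          ((1 - r n ^ a) • g') := by
      filter_upwards [ae_restrict_mem hKm, hgae] with x hx hgx
      simp only [Pi.sub_apply, Pi.smul_apply, smul_eq_mul, hval n x hx, hgx]
      ring
    rw [eLpNorm_congr_ae e]
    refine (eLpNorm_sub_le ?_ ?_ (by norm_num)).trans ?_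
    · exact (((hmeas n).sub hg'm).const_smul _).aestronglyMeasurable
    · exact (hg'm.const_smul _).aestronglyMeasurable
    · rw [eLpNorm_const_smul, eLpNorm_const_smul]
      gcongr
      · refine mul_le_of_le_one_left zero_le ?_
        rw [Real.enorm_eq_ofReal hra0]
        exact ENNReal.ofReal_le_one.2 hra
      · rw [Real.enorm_eq_ofReal (by linarith)]
  have hlim2 : Tendsto (fun n => ENNReal.ofReal (1 - r n ^ a) *
      eLpNorm g' 2 (volume.restrict K)) atTop (𝓝 0) := by
    have h1 : Tendsto r atTop (𝓝 1) := by
      have := (tendsto_const_nhds (x := (1 : ℝ))).sub hrt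
      simpa using this
    have h2 : Tendsto (fun n => 1 - r n ^ a) atTop (𝓝 0) := by
      have := (tendsto_const_nhds (x := (1 : ℝ))).sub (h1.pow a)
      simpa using this
    have h3 := ENNReal.tendsto_ofReal h2
    rw [ENNReal.ofReal_zero] at h3
    have h4 := ENNReal.Tendsto.mul_const h3 (b := eLpNorm g' 2 (volume.restrict K))
      (Or.inr (hg'2.restrict K).2.ne)
    simpa using h4
  have hlim := hlim1.add hlim2
  rw [add_zero] at hlim
  exact tendsto_of_tendsto_of_tendsto_of_le_of_le tendsto_const_nhds hlim
    (fun _ => zero_le) hbound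

end WeakDeriv

/-! ### Traces -/

section Traces

variable {d : ℕ}

theorem memLp_locallyIntegrableOn {K : Set (Pt d)} (hK : IsOpen K) {f : Pt d → ℝ}
    (hf : MemLp f 2 (volume.restrict K)) : LocallyIntegrableOn f K := by
  have h1 := (hf.locallyIntegrable (by norm_num))
  intro x hx
  obtain ⟨U, hU, hi⟩ := h1 x
  refine ⟨U ∩ K, inter_mem (mem_nhdsWithin_of_mem_nhds hU) self_mem_nhdsWithin, ?_⟩
  rw [IntegrableOn, Measure.restrict_restrict' hK.measurableSet] at hi
  exact hi

theorem hasWeakDeriv_zero {K : Set (Pt d)} (hK : IsOpen K) {f : Pt d → ℝ}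
    (hf : MemLp f 2 (volume.restrict K)) : HasWeakDeriv K 0 f f := by
  refine ⟨memLp_locallyIntegrableOn hK hf, memLp_locallyIntegrableOn hK hf, fun φ _ => ?_⟩
  have : word (0 : Fin d → ℕ) = [] := by
    apply List.eq_nil_of_length_eq_zero
    rw [length_word]; simp
  simp [multiD_eq_listD, this, listD]

theorem weakDeriv_zero {K : Set (Pt d)} (hK : IsOpen K) {m : ℕ} {f : Pt d → ℝ}
    (hf : MemH K m f) : weakDeriv K 0 f =ᵐ[volume.restrict K] f :=
  (weakDeriv_spec hf (by simp)).2.unique hK (hasWeakDeriv_zero hK hf.1)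

theorem HasWeakDeriv.const_mul {K : Set (Pt d)} {α : Fin d → ℕ} {f g : Pt d → ℝ}
    (h : HasWeakDeriv K α f g) (c : ℝ) :
    HasWeakDeriv K α (fun x => c * f x) (fun x => c * g x) := by
  refine ⟨h.1.smul c, h.2.1.smul c, fun φ hφ => ?_⟩
  have := h.2.2 φ hφ
  simp_rw [mul_assoc, integral_const_mul]
  rw [this]; ring

theorem HasWeakDeriv.congr_left {K : Set (Pt d)} {α : Fin d → ℕ}
    {f f' g : Pt d → ℝ} (h : HasWeakDeriv K α f g) (hff' : f =ᵐ[volume.restrict K] f')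
    (hf' : LocallyIntegrableOn f' K) : HasWeakDeriv K α f' g := by
  refine ⟨hf', h.2.1, fun φ hφ => ?_⟩
  rw [← h.2.2 φ hφ]
  refine integral_congr_ae ?_
  filter_upwards [hff'] with x hx
  rw [hx]

theorem count_pair_eq (j l : Fin d) :
    (fun i => [j, l].count i) = (Pi.single j 1 + Pi.single l 1 : Fin d → ℕ) := by
  funext i
  simp only [List.count_cons, List.count_nil, Pi.add_apply, Pi.single_apply, beq_iff_eq, zero_add]
  rw [add_comm]
  congr 1 <;> simp [eq_comm]

theorem multiD_single_add_single {φ : Pt d → ℝ} (hφ : ContDiff ℝ ∞ φ) (j l : Fin d) :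
    multiD (Pi.single j 1 + Pi.single l 1) φ = partialD j (partialD l φ) := by
  have : listD [j, l] φ = multiD (fun i => [j, l].count i) φ := listD_eq_multiD hφ _
  rw [← count_pair_eq, ← this]; rfl

theorem HasWeakDeriv.single_of_add {K : Set (Pt d)} {j l : Fin d} {f g w : Pt d → ℝ}
    (hg : HasWeakDeriv K (Pi.single j 1) f g)
    (hw : HasWeakDeriv K (Pi.single j 1 + Pi.single l 1) f w) :
    HasWeakDeriv K (Pi.single l 1) g w := by
  refine ⟨hg.2.1, hw.2.1, fun φ hφ => ?_⟩
  have ht : IsTestFunction K (partialD l φ) :=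
    ⟨contDiff_partialD hφ.1 l, hasCompactSupport_listD hφ.2.1 [l],
      (tsupport_partialD_subset l φ).trans hφ.2.2⟩
  have h1 := hg.2.2 _ ht
  have h2 := hw.2.2 φ hφ
  rw [multiD_single] at h1
  rw [multiD_single_add_single hφ.1, h1] at h2
  rw [multiD_single]
  simp only [Pi.add_apply, Finset.sum_add_distrib, Finset.sum_pi_single', Finset.mem_univ,
    if_true] at h2 ⊢
  norm_num at h2 ⊢
  linarith

theorem scaledH1_sub_le {T : Finset (Pt d)} {f g h : Pt d → ℝ} {f' g' h' : Fin d → Pt d → ℝ}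
    (hf : MemLp f 2 (volume.restrict (cell T))) (hg : MemLp g 2 (volume.restrict (cell T)))
    (hh : MemLp h 2 (volume.restrict (cell T)))
    (hf' : ∀ j, MemLp (f' j) 2 (volume.restrict (cell T)))
    (hg' : ∀ j, MemLp (g' j) 2 (volume.restrict (cell T)))
    (hh' : ∀ j, MemLp (h' j) 2 (volume.restrict (cell T))) :
    scaledH1 T (fun x => f x - h x) (fun j x => f' j x - h' j x) ≤
      scaledH1 T (fun x => f x - g x) (fun j x => f' j x - g' j x) +
      scaledH1 T (fun x => g x - h x) (fun j x => g' j x - h' j x) := by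
  have hs := Finset.sum_le_sum fun j (_ : j ∈ Finset.univ) =>
    nrm_sub_le_add (hf' j) (hg' j) (hh' j)
  rw [Finset.sum_add_distrib] at hs
  have hT : 0 ≤ diamT T := Metric.diam_nonneg
  have hs' := mul_le_mul_of_nonneg_left hs hT
  have h0 := nrm_sub_le_add hf hg hh
  simp only [scaledH1]
  linarith

theorem scaledH1_sub_comm {T : Finset (Pt d)} (f g : Pt d → ℝ) (f' g' : Fin d → Pt d → ℝ) :
    scaledH1 T (fun x => f x - g x) (fun j x => f' j x - g' j x) =
      scaledH1 T (fun x => g x - f x) (fun j x => g' j x - f' j x) := by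
  simp only [scaledH1]
  rw [nrm_sub_comm]
  congr 2
  exact Finset.sum_congr rfl fun j _ => nrm_sub_comm _ _

theorem tendsto_scaledH1 {T : Finset (Pt d)} {φ : ℕ → Pt d → ℝ} {f : Pt d → ℝ}
    (h0 : Tendsto (fun n => eLpNorm (φ n - f) 2 (volume.restrict (cell T))) atTop (𝓝 0))
    {g : Fin d → Pt d → ℝ} (h1 : ∀ j, Tendsto (fun n => eLpNorm (partialD j (φ n) - g j) 2
      (volume.restrict (cell T))) atTop (𝓝 0)) :
    Tendsto (fun n => scaledH1 T (fun x => φ n x - f x) (fun j x => partialD j (φ n) x - g j x))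
      atTop (𝓝 0) := by
  have e0 := tendsto_nrm_of_tendsto_eLpNorm h0
  have e1 := tendsto_finsetSum Finset.univ fun j _ => tendsto_nrm_of_tendsto_eLpNorm (h1 j)
  have := e0.add (e1.const_mul (diamT T))
  simp only [Finset.sum_const_zero, mul_zero, add_zero] at this
  exact this

variable (b : AffineBasis (Fin (d + 1)) ℝ (Pt d))

theorem exists_isTrace (hd : 0 < d) (i : Fin (d + 1)) {f : Pt d → ℝ}
    (hf : MemH (cell (verts b)) 1 f) :
    ∃ τ, IsTrace (verts b) (face (verts b) (b i)) f τ := by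
  set T := verts b
  set F := face T (b i)
  obtain ⟨φ, hφ, hlim⟩ := exists_smooth_seq (cell_nonempty b) hf
  have hφ1 := fun n => ContDiff.one_of_infty (hφ n)
  have hc := fun n => (hφ n).continuous
  have h0 : Tendsto (fun n => eLpNorm (φ n - f) 2 (volume.restrict (cell T))) atTop (𝓝 0) := by
    have h := hlim 0 (by simp)
    refine h.congr fun n => eLpNorm_congr_ae ?_
    have e : multiD 0 (φ n) = φ n := by
      have : word (0 : Fin d → ℕ) = [] := by
        apply List.eq_nil_of_length_eq_zero
        rw [length_word]; simp
      rw [multiD_eq_listD, this]; rfl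
    filter_upwards [weakDeriv_zero (isOpen_cell T) hf] with x hx
    rw [Pi.sub_apply, Pi.sub_apply, e, hx]
  have h1 : ∀ j, Tendsto (fun n => eLpNorm (partialD j (φ n) -
      weakDeriv (cell T) (Pi.single j 1) f) 2 (volume.restrict (cell T))) atTop (𝓝 0) := by
    intro j
    have h := hlim (Pi.single j 1) (by simp)
    simpa only [multiD_single] using h
  have hg : ∀ j, MemLp (weakDeriv (cell T) (Pi.single j 1) f) 2 (volume.restrict (cell T)) :=
    fun j => (weakDeriv_spec hf (by simp)).1
  have ha := tendsto_scaledH1 h0 h1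
  set a : ℕ → ℝ := fun n => scaledH1 T (fun x => φ n x - f x)
    (fun j x => partialD j (φ n) x - weakDeriv (cell T) (Pi.single j 1) f x)
  obtain ⟨σ, hσ⟩ : ∃ σ, diamT T ≤ σ * height b i :=
    ⟨diamT T / height b i, by rw [div_mul_cancel₀ _ (height_pos b hd i).ne']⟩
  have hh := diamT_pos b hd
  have key : ∀ n m, nrm (faceMeasure F) (fun x => φ n x - φ m x) ≤
      (Real.sqrt (diamT T))⁻¹ * (Real.sqrt (σ * (d + 1)) * (a n + a m)) := by
    intro n m
    have h2 := sqrt_mul_nrm_face_le b hd i hσ ((hφ1 n).sub (hφ1 m))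
    rw [← div_eq_inv_mul, le_div_iff₀ (Real.sqrt_pos.2 hh), mul_comm]
    refine h2.trans ?_
    gcongr
    simp only [a]
    rw [scaledH1_sub_comm (φ m)]
    simp_rw [partialD_sub (hφ1 n) (hφ1 m)]
    exact scaledH1_sub_le (memLp_cell T (hc n)) hf.1 (memLp_cell T (hc m))
      (fun j => memLp_cell T (continuous_partialD (hφ1 n) j)) hg
      (fun j => memLp_cell T (continuous_partialD (hφ1 m) j))
  have hmF : ∀ n, MemLp (φ n) 2 (faceMeasure F) := fun n => memLp_face b hd i (hc n)
  have hcau : CauchySeq fun n => (hmF n).toLp (φ n) := by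
    rw [Metric.cauchySeq_iff]
    intro ε hε
    have hB : Tendsto (fun p : ℕ × ℕ => (Real.sqrt (diamT T))⁻¹ *
        (Real.sqrt (σ * (d + 1)) * (a p.1 + a p.2))) (atTop ×ˢ atTop) (𝓝 0) := by
      have := (((ha.comp tendsto_fst).add (ha.comp tendsto_snd)).const_mul
        (Real.sqrt (σ * (d + 1)))).const_mul (Real.sqrt (diamT T))⁻¹
      simp only [add_zero, mul_zero] at this
      exact this
    rw [prod_atTop_atTop_eq] at hB
    obtain ⟨N, hN⟩ := eventually_atTop.1 (hB.eventually_lt_const hε)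
    refine ⟨max N.1 N.2, fun m hm n hn => ?_⟩
    rw [Lp.dist_def]
    have e : nrm (faceMeasure F) (fun x => φ m x - φ n x) =
        (eLpNorm (⇑((hmF m).toLp (φ m)) - ⇑((hmF n).toLp (φ n))) 2 (faceMeasure F)).toReal := by
      rw [nrm]
      congr 1
      refine eLpNorm_congr_ae ?_
      filter_upwards [(hmF m).coeFn_toLp, (hmF n).coeFn_toLp] with x hx hy
      rw [Pi.sub_apply, hx, hy]
    rw [← e]
    exact (key m n).trans_lt (hN (m, n)
      ⟨(le_max_left _ _).trans hm, (le_max_right _ _).trans hn⟩)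
  obtain ⟨τ, hτ⟩ := cauchySeq_tendsto_of_complete hcau
  refine ⟨τ, hf, Lp.memLp τ, φ, hφ, h0, h1, ?_⟩
  rw [Lp.tendsto_Lp_iff_tendsto_eLpNorm'] at hτ
  refine hτ.congr fun n => eLpNorm_congr_ae ?_
  filter_upwards [(hmF n).coeFn_toLp] with x hx
  rw [Pi.sub_apply, Pi.sub_apply, hx]

theorem isTrace_trace (hd : 0 < d) (i : Fin (d + 1)) {f : Pt d → ℝ}
    (hf : MemH (cell (verts b)) 1 f) :
    IsTrace (verts b) (face (verts b) (b i)) f (trace (verts b) (face (verts b) (b i)) f) := by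
  have h := exists_isTrace b hd i hf
  rw [trace, dif_pos h]
  exact h.choose_spec

theorem sqrt_mul_nrm_trace_sub_le (hd : 0 < d) (i : Fin (d + 1)) {σ : ℝ}
    (hσ : diamT (verts b) ≤ σ * height b i) {f : Pt d → ℝ} (hf : MemH (cell (verts b)) 1 f)
    {ψ : Pt d → ℝ} (hψ : ContDiff ℝ 1 ψ) :
    Real.sqrt (diamT (verts b)) * nrm (faceMeasure (face (verts b) (b i)))
        (fun x => trace (verts b) (face (verts b) (b i)) f x - ψ x) ≤
      Real.sqrt (σ * (d + 1)) * scaledH1 (verts b) (fun x => f x - ψ x)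
        (fun j x => weakDeriv (cell (verts b)) (Pi.single j 1) f x - partialD j ψ x) := by
  obtain ⟨-, hτ, φ, hφ, h0, h1, h2⟩ := isTrace_trace b hd i hf
  set T := verts b
  set F := face T (b i)
  set τ := trace T F f
  have ha := tendsto_scaledH1 h0 h1
  have e2 := tendsto_nrm_of_tendsto_eLpNorm h2
  have hφ1 := fun n => ContDiff.one_of_infty (hφ n)
  have hg : ∀ j, MemLp (weakDeriv (cell T) (Pi.single j 1) f) 2 (volume.restrict (cell T)) :=
    fun j => (weakDeriv_spec hf (by simp)).1
  have hlim := (e2.const_mul (Real.sqrt (diamT T))).add ((ha.add_const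
    (scaledH1 T (fun x => f x - ψ x) (fun j x => weakDeriv (cell T) (Pi.single j 1) f x -
      partialD j ψ x))).const_mul (Real.sqrt (σ * (d + 1))))
  rw [mul_zero, zero_add, zero_add] at hlim
  refine ge_of_tendsto' hlim fun n => ?_
  have t1 := nrm_sub_le_add (μ := faceMeasure F) hτ (memLp_face b hd i (hφ n).continuous)
    (memLp_face b hd i hψ.continuous)
  rw [nrm_sub_comm τ (φ n)] at t1
  have t2 := sqrt_mul_nrm_face_le b hd i hσ ((hφ1 n).sub hψ)
  simp_rw [partialD_sub (hφ1 n) hψ] at t2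
  have t3 := scaledH1_sub_le (memLp_cell T (hφ n).continuous) hf.1 (memLp_cell T hψ.continuous)
      (fun j => memLp_cell T (continuous_partialD (hφ1 n) j)) hg
      (fun j => memLp_cell T (continuous_partialD hψ j))
  have t4 := mul_le_mul_of_nonneg_left t1 (Real.sqrt_nonneg (diamT T))
  have t5 := mul_le_mul_of_nonneg_left t3 (Real.sqrt_nonneg (σ * (d + 1)))
  rw [mul_add] at t4
  exact t4.trans (add_le_add le_rfl (t2.trans t5))

end Traces

/-! ### Gram forms -/

section Gram

variable {V ι α : Type*} [AddCommGroup V] [Module ℝ V] [Fintype ι] [MeasurableSpace α]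

/-- The form `(v, w) ↦ ∑_i ∫ S_i v · S_i w`. -/
def gram (μ : Measure α) (S : ι → V →ₗ[ℝ] (α → ℝ)) (hS : ∀ i v, MemLp (S i v) 2 μ) :
    V →ₗ[ℝ] V →ₗ[ℝ] ℝ :=
  LinearMap.mk₂ ℝ (fun v w => ∑ i, ∫ x, S i v x * S i w x ∂μ)
    (fun u v w => by
      rw [← Finset.sum_add_distrib]
      refine Finset.sum_congr rfl fun i _ => ?_
      rw [← integral_add (integrable_mul_of_memLp (hS i u) (hS i w))
        (integrable_mul_of_memLp (hS i v) (hS i w))]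
      simp only [map_add, Pi.add_apply, add_mul])
    (fun c u w => by
      rw [smul_eq_mul, Finset.mul_sum]
      refine Finset.sum_congr rfl fun i _ => ?_
      rw [← integral_const_mul]
      simp only [map_smul, Pi.smul_apply, smul_eq_mul, mul_assoc])
    (fun u v w => by
      rw [← Finset.sum_add_distrib]
      refine Finset.sum_congr rfl fun i _ => ?_
      rw [← integral_add (integrable_mul_of_memLp (hS i u) (hS i v))
        (integrable_mul_of_memLp (hS i u) (hS i w))]
      simp only [map_add, Pi.add_apply, mul_add])
    (fun c u w => by
      rw [smul_eq_mul, Finset.mul_sum]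
      refine Finset.sum_congr rfl fun i _ => ?_
      rw [← integral_const_mul]
      simp only [map_smul, Pi.smul_apply, smul_eq_mul, mul_left_comm])

variable {μ : Measure α} {S : ι → V →ₗ[ℝ] (α → ℝ)} (hS : ∀ i v, MemLp (S i v) 2 μ)

theorem gram_apply (v w : V) : gram μ S hS v w = ∑ i, ∫ x, S i v x * S i w x ∂μ := rfl

theorem gram_symm (v w : V) : gram μ S hS v w = gram μ S hS w v := by
  simp only [gram_apply, mul_comm]

theorem gram_self (v : V) : gram μ S hS v v = ∑ i, nrm μ (S i v) ^ 2 := by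
  simp only [gram_apply, nrm_sq (hS _ v), sq]

theorem gram_self_nonneg (v : V) : 0 ≤ gram μ S hS v v := by
  rw [gram_self]; positivity

theorem nrm_eq_zero_of_gram_self {v : V} (h : gram μ S hS v v = 0) (i : ι) :
    nrm μ (S i v) = 0 := by
  rw [gram_self, Finset.sum_eq_zero_iff_of_nonneg fun _ _ => sq_nonneg _] at h
  exact pow_eq_zero_iff two_ne_zero |>.1 (h i (Finset.mem_univ i))

theorem ae_eq_zero_of_nrm {f : α → ℝ} (hf : MemLp f 2 μ) (h : nrm μ f = 0) : f =ᵐ[μ] 0 := by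
  rw [nrm, ENNReal.toReal_eq_zero_iff] at h
  exact (eLpNorm_eq_zero_iff hf.1 (by norm_num)).1 (h.resolve_right hf.2.ne)

/-- The functional `v ↦ ∑_i ∫ f_i · S_i v`. -/
def gramFun (f : ι → α → ℝ) (hf : ∀ i, MemLp (f i) 2 μ) (hS : ∀ i v, MemLp (S i v) 2 μ) :
    V →ₗ[ℝ] ℝ where
  toFun v := ∑ i, ∫ x, f i x * S i v x ∂μ
  map_add' u v := by
    rw [← Finset.sum_add_distrib]
    refine Finset.sum_congr rfl fun i _ => ?_
    rw [← integral_add (integrable_mul_of_memLp (hf i) (hS i u))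
      (integrable_mul_of_memLp (hf i) (hS i v))]
    simp only [map_add, Pi.add_apply, mul_add]
  map_smul' c u := by
    rw [RingHom.id_apply, smul_eq_mul, Finset.mul_sum]
    refine Finset.sum_congr rfl fun i _ => ?_
    rw [← integral_const_mul]
    simp only [map_smul, Pi.smul_apply, smul_eq_mul, mul_left_comm]

theorem gramFun_apply (f : ι → α → ℝ) (hf : ∀ i, MemLp (f i) 2 μ) (v : V) :
    gramFun f hf hS v = ∑ i, ∫ x, f i x * S i v x ∂μ := rfl

theorem gramFun_eq_zero (f : ι → α → ℝ) (hf : ∀ i, MemLp (f i) 2 μ) {v : V}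
    (h : gram μ S hS v v = 0) : gramFun f hf hS v = 0 := by
  rw [gramFun_apply]
  refine Finset.sum_eq_zero fun i _ => ?_
  refine integral_eq_zero_of_ae ?_
  filter_upwards [ae_eq_zero_of_nrm (hS i v) (nrm_eq_zero_of_gram_self hS h i)] with x hx
  rw [hx]; simp

end Gram

/-! ### The divergence theorem on a simplex -/

section Divergence

variable {d : ℕ} (b : AffineBasis (Fin (d + 1)) ℝ (Pt d))

theorem integrable_cell (T : Finset (Pt d)) {φ : Pt d → ℝ} (hφ : Continuous φ) :
    Integrable φ (volume.restrict (cell T)) := (memLp_cell T hφ).integrable (by norm_num)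

theorem integrable_face (hd : 0 < d) (i : Fin (d + 1)) {φ : Pt d → ℝ} (hφ : Continuous φ) :
    Integrable φ (faceMeasure (face (verts b) (b i))) :=
  have := isFiniteMeasure_face b hd i
  (memLp_face b hd i hφ).integrable (by norm_num)

theorem height_mul_integral_face (hd : 0 < d) (i : Fin (d + 1)) (g : Poly d) :
    height b i * ∫ y, pev g y ∂faceMeasure (face (verts b) (b i)) =
      ∫ y in cell (verts b), ∑ j, pev (MvPolynomial.pderiv j
        (g * (MvPolynomial.X j - MvPolynomial.C (b i j)))) y := by
  have h1 := integral_face_sq b hd i (contDiff_pev (g + 1))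
  have h2 := integral_face_sq b hd i (contDiff_pev g)
  have h3 := integral_face_sq b hd i (contDiff_pev 1)
  simp only [fderiv_pev] at h1 h2 h3
  have key : height b i * ∫ y, ((pev (g + 1) y ^ 2 - pev g y ^ 2) - pev 1 y ^ 2)
      ∂faceMeasure (face (verts b) (b i)) =
      ∫ y in cell (verts b), 2 * ∑ j, pev (MvPolynomial.pderiv j
        (g * (MvPolynomial.X j - MvPolynomial.C (b i j)))) y := by
    rw [integral_sub, integral_sub, mul_sub, mul_sub, h1, h2, h3, ← integral_sub, ← integral_sub]
    · congr 1
      ext y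
      have e : ∀ j, pev (MvPolynomial.pderiv j (g * (MvPolynomial.X j - MvPolynomial.C (b i j)))) y
          = (y j - b i j) * pev (MvPolynomial.pderiv j g) y + pev g y := by
        intro j
        simp [Derivation.leibniz]
        ring
      simp only [e, Finset.sum_add_distrib, Finset.sum_const, Finset.card_univ, Fintype.card_fin,
        nsmul_eq_mul, map_add, pev_add, pev_one, mul_add, PiLp.sub_apply]
      simp
      ring
    all_goals first
      | exact integrable_cell _ (by fun_prop)
      | exact integrable_face b hd i (by fun_prop)
  rw [integral_const_mul] at key
  have e : ∀ y, ((pev (g + 1) y ^ 2 - pev g y ^ 2) - pev 1 y ^ 2) = 2 * pev g y := by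
    intro y; simp only [pev_add, pev_one]; ring
  simp_rw [e] at key
  rw [integral_const_mul] at key
  linarith

theorem integral_div (hd : 0 < d) (f : Fin d → Poly d) :
    ∫ y in cell (verts b), ∑ j, pev (MvPolynomial.pderiv j (f j)) y =
      -∑ i, height b i * ∫ y, ∑ j, grad b i j * pev (f j) y
        ∂faceMeasure (face (verts b) (b i)) := by
  let g : Fin (d + 1) → Poly d := fun i => ∑ l, grad b i l • f l
  have hg : ∀ i y, pev (g i) y = ∑ l, grad b i l * pev (f l) y := fun i y => by simp [g]
  have hf : ∀ j, f j = -∑ i, g i * (MvPolynomial.X j - MvPolynomial.C (b i j)) := by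
    intro j
    refine poly_ext fun y => ?_
    have h1 : ∀ i, pev (g i) y = inner ℝ (grad b i) (WithLp.toLp 2 fun l => pev (f l) y) := by
      intro i
      rw [hg]
      simp [PiLp.inner_apply, mul_comm]
    have h2 := congrArg (fun v : Pt d => v j)
      (sum_inner_grad_smul_sub b (WithLp.toLp 2 fun l => pev (f l) y) y)
    simp only [← h1] at h2
    simp only [WithLp.ofLp_sum, Finset.sum_apply, PiLp.smul_apply, PiLp.sub_apply,
      smul_eq_mul] at h2
    rw [← h2]
    simp only [pev_neg, pev_sum, pev_mul, pev_sub, pev_X, pev_C, ← Finset.sum_neg_distrib]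
    exact Finset.sum_congr rfl fun i _ => by ring
  have h3 : ∀ y, ∑ j, pev (MvPolynomial.pderiv j (f j)) y = -∑ i, ∑ j,
      pev (MvPolynomial.pderiv j (g i * (MvPolynomial.X j - MvPolynomial.C (b i j)))) y := by
    intro y
    rw [Finset.sum_comm, ← Finset.sum_neg_distrib]
    refine Finset.sum_congr rfl fun j _ => ?_
    conv_lhs => rw [hf j]
    rw [map_neg, map_sum, pev_neg, pev_sum]
  simp_rw [h3, integral_neg]
  rw [integral_finsetSum _ fun i _ => integrable_cell _ (by fun_prop)]
  congr 1
  refine Finset.sum_congr rfl fun i _ => ?_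
  rw [← height_mul_integral_face b hd]
  simp_rw [hg]

theorem sum_mul_normal (hd : 0 < d) (i : Fin (d + 1)) (f : Fin d → ℝ) :
    ∑ j, f j * normal (verts b) (b i) j = -(height b i * ∑ j, grad b i j * f j) := by
  rw [normal_verts b hd, Finset.mul_sum, ← Finset.sum_neg_distrib]
  refine Finset.sum_congr rfl fun j _ => ?_
  simp only [PiLp.smul_apply, smul_eq_mul]
  ring

theorem integral_div_eq_zero (hd : 0 < d) (f : Fin d → Poly d)
    (hf : ∀ i, ∀ y ∈ convexHull ℝ (face (verts b) (b i) : Set (Pt d)),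
      ∑ j, grad b i j * pev (f j) y = 0) :
    ∫ y in cell (verts b), ∑ j, pev (MvPolynomial.pderiv j (f j)) y = 0 := by
  rw [integral_div b hd, neg_eq_zero]
  refine Finset.sum_eq_zero fun i _ => ?_
  rw [integral_eq_zero_of_ae, mul_zero]
  filter_upwards [ae_mem_hull_face (face (verts b) (b i))] with y hy using hf i y hy

theorem poly_eq_zero_of_ae_cell {p : Poly d}
    (h : pev p =ᵐ[volume.restrict (cell (verts b))] 0) : p = 0 :=
  eq_zero_of_pev_eq_zero_on_open (isOpen_cell _) (cell_nonempty b)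
    (Measure.eqOn_open_of_ae_eq h (isOpen_cell _) (continuous_pev p).continuousOn
      continuousOn_const)

theorem coord_lt_one (hd : 0 < d) (i : Fin (d + 1)) {y : Pt d} (hy : y ∈ cell (verts b)) :
    b.coord i y < 1 := by
  rw [cell_verts] at hy
  have : Nontrivial (Fin (d + 1)) := Fin.nontrivial_iff_two_le.2 (by omega)
  obtain ⟨j, hj⟩ := exists_ne i
  have h1 := b.sum_coord_apply_eq_one y
  have h2 : b.coord i y + b.coord j y ≤ ∑ l, b.coord l y := by
    rw [← Finset.sum_pair (f := fun l => b.coord l y) hj.symm]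
    exact Finset.sum_le_sum_of_subset_of_nonneg (Finset.subset_univ _) fun l _ _ => (hy l).le
  linarith [hy j]

theorem continuousAt_faceProjPt (i : Fin (d + 1)) {y : Pt d} (hy : b.coord i y < 1) :
    ContinuousAt (faceProjPt b i) y := by
  have h := (continuous_barycentric_coord b i).continuousAt (x := y)
  unfold faceProjPt
  exact continuousAt_const.add (((continuousAt_const.sub h).inv₀ (sub_pos.2 hy).ne').smul
    (continuousAt_id.sub continuousAt_const))

theorem pev_eq_zero_of_ae_faceProjPt (hd : 0 < d) (i : Fin (d + 1)) {p : Poly d}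
    (h : (fun y => pev p (faceProjPt b i y)) =ᵐ[volume.restrict (cell (verts b))] 0) {y : Pt d}
    (hy : y ∈ convexHull ℝ (face (verts b) (b i) : Set (Pt d))) : pev p y = 0 := by
  have h0 := Measure.eqOn_open_of_ae_eq h (isOpen_cell _)
    (fun z hz => ((continuous_pev p).continuousAt.comp
      (continuousAt_faceProjPt b i (coord_lt_one b hd i hz))).continuousWithinAt)
    continuousOn_const
  rw [hull_face_verts] at hy
  obtain ⟨c, hc⟩ := cell_nonempty b
  have hcell : ∀ t ∈ Set.Ioo (0 : ℝ) 1, y + t • (c - y) ∈ cell (verts b) := by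
    intro t ht
    rw [cell_verts] at hc ⊢
    intro j
    have h1 := hc j
    have h2 := hy.1 j
    rw [coord_add, inner_smul_right, ← coord_sub_coord]
    nlinarith [mul_pos ht.1 h1, mul_nonneg (sub_nonneg.2 ht.2.le) h2]
  have hπ : faceProjPt b i y = y := by simp [faceProjPt, hy.2]
  have hlim : Tendsto (fun t : ℝ => pev p (faceProjPt b i (y + t • (c - y)))) (𝓝[>] 0)
      (𝓝 (pev p y)) := by
    have h1 : Tendsto (fun t : ℝ => y + t • (c - y)) (𝓝[>] 0) (𝓝 y) := by
      have : Continuous fun t : ℝ => y + t • (c - y) := by fun_prop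
      have := (this.tendsto 0).mono_left (nhdsWithin_le_nhds (s := Set.Ioi 0))
      simpa using this
    have h2 := (continuousAt_faceProjPt b i (y := y) (by rw [hy.2]; norm_num)).tendsto.comp h1
    rw [hπ] at h2
    exact ((continuous_pev p).tendsto y).comp h2
  refine tendsto_nhds_unique hlim (tendsto_const_nhds.congr' ?_)
  filter_upwards [Ioo_mem_nhdsGT (zero_lt_one (α := ℝ))] with t ht
  exact (h0 (hcell t ht)).symm

theorem integral_face_eq' (hd : 0 < d) (i : Fin (d + 1)) {g : Pt d → ℝ} (hg : Measurable g) :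
    ∫ y in cell (verts b), g (faceProjPt b i y) =
      height b i / d * ∫ p, g p ∂faceMeasure (face (verts b) (b i)) := by
  have := height_pos b hd i
  have : (d : ℝ) ≠ 0 := by exact_mod_cast hd.ne'
  rw [integral_face_eq b hd i hg]
  field_simp

theorem faceProjPt_mem_hull (hd : 0 < d) (i : Fin (d + 1)) {y : Pt d}
    (hy : y ∈ cell (verts b)) :
    faceProjPt b i y ∈ convexHull ℝ (face (verts b) (b i) : Set (Pt d)) := by
  have h1 := coord_lt_one b hd i hy
  have h2 : 0 < 1 - b.coord i y := by linarith
  rw [cell_verts] at hy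
  rw [hull_face_verts]
  have e : ∀ j, b.coord j (faceProjPt b i y) = b.coord j (b i) +
      (1 - b.coord i y)⁻¹ * (b.coord j y - b.coord j (b i)) := by
    intro j
    rw [faceProjPt, coord_add, inner_smul_right, ← coord_sub_coord]
  have ei : b.coord i (faceProjPt b i y) = 0 := by
    rw [e, b.coord_apply_eq]
    field_simp
    ring
  refine ⟨fun j => ?_, ei⟩
  by_cases hj : j = i
  · rw [hj, ei]
  · rw [e, b.coord_apply_ne hj, zero_add, sub_zero]
    exact mul_nonneg (inv_nonneg.2 h2.le) (hy j).le

theorem memLp_faceProjPt (hd : 0 < d) (i : Fin (d + 1)) {g : Pt d → ℝ} (hg : Continuous g) :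
    MemLp (fun y => g (faceProjPt b i y)) 2 (volume.restrict (cell (verts b))) := by
  obtain ⟨C, hC⟩ := (isCompact_hull (face (verts b) (b i))).exists_bound_of_continuousOn
    hg.continuousOn
  refine MemLp.of_bound (hg.measurable.comp (measurable_faceProjPt b i)).aestronglyMeasurable C ?_
  filter_upwards [ae_restrict_mem (isOpen_cell _).measurableSet] with y hy
  exact hC _ (faceProjPt_mem_hull b hd i hy)

end Divergence

/-! ### Affine maps between simplices -/

section Reference

variable {d : ℕ} (a b : AffineBasis (Fin (d + 1)) ℝ (Pt d))

/-- The affine map that takes the vertices of the simplex `a` to those of `b`. -/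
def refMap (y : Pt d) : Pt d := ∑ i, a.coord i y • b i

/-- The linear part of `refMap`. -/
def refLin : Pt d →ₗ[ℝ] Pt d :=
  ∑ i, (innerₛₗ ℝ (grad a i)).smulRight (b i)

theorem refLin_apply (v : Pt d) : refLin a b v = ∑ i, inner ℝ (grad a i) v • b i := by
  simp [refLin]

theorem refMap_eq_add (y : Pt d) : refMap a b y = refMap a b 0 + refLin a b y := by
  rw [refMap, refMap, refLin_apply, ← Finset.sum_add_distrib]
  refine Finset.sum_congr rfl fun i _ => ?_
  rw [← add_smul]
  congr 1
  simpa using coord_add a i 0 y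

theorem eq_of_coord_eq {x y : Pt d} (h : ∀ i, b.coord i x = b.coord i y) : x = y := by
  rw [← sum_coord_smul b x, ← sum_coord_smul b y]
  simp only [h]

theorem coord_refMap (i : Fin (d + 1)) (y : Pt d) :
    b.coord i (refMap a b y) = a.coord i y := by
  have h : refMap a b y = b i + ∑ j, a.coord j y • (b j - b i) := by
    simp only [smul_sub, Finset.sum_sub_distrib, ← Finset.sum_smul, a.sum_coord_apply_eq_one]
    simp [refMap]
  rw [h, coord_add, inner_sum]
  simp only [inner_smul_right, inner_grad_vertex_sub]
  simp [b.coord_apply, mul_sub, Finset.sum_sub_distrib, a.sum_coord_apply_eq_one]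

theorem refMap_refMap (y : Pt d) : refMap b a (refMap a b y) = y :=
  eq_of_coord_eq a fun i => by rw [coord_refMap, coord_refMap]

theorem continuous_refMap : Continuous (refMap a b) := by
  have : ∀ i, Continuous (a.coord i) := fun i => continuous_barycentric_coord a i
  unfold refMap
  fun_prop

theorem refLin_injective : Function.Injective (refLin a b) := by
  intro x y h
  have : refMap a b x = refMap a b y := by rw [refMap_eq_add, h, ← refMap_eq_add]
  rw [← refMap_refMap a b x, this, refMap_refMap]

/-- The Jacobian of `refMap`. -/
def jac : ℝ := |LinearMap.det (refLin a b)|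

theorem jac_pos : 0 < jac a b := by
  have : IsUnit (refLin a b) := (LinearMap.isUnit_iff_ker_eq_bot _).2
    (LinearMap.ker_eq_bot.2 (refLin_injective a b))
  exact abs_pos.2 (this.map LinearMap.det).ne_zero

theorem map_refMap_cell : (volume.restrict (cell (verts a))).map (refMap a b) =
    ENNReal.ofReal (jac a b)⁻¹ • volume.restrict (cell (verts b)) := by
  have hm : Measurable (refMap a b) := (continuous_refMap a b).measurable
  have hpre : cell (verts a) = refMap a b ⁻¹' cell (verts b) := by
    rw [cell_verts, cell_verts]
    ext y
    simp only [Set.mem_ofPred_eq, Set.mem_preimage, coord_refMap]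
  have hmap : (volume : Measure (Pt d)).map (refMap a b) =
      ENNReal.ofReal (jac a b)⁻¹ • volume := by
    have e : refMap a b = (fun x => refMap a b 0 + x) ∘ refLin a b :=
      funext fun y => refMap_eq_add a b y
    have hl : Measurable (refLin a b) := (LinearMap.continuous_of_finiteDimensional _).measurable
    rw [e, ← Measure.map_map (by fun_prop) hl,
      Measure.map_linearMap_addHaar_eq_smul_addHaar _ (by
        have := jac_pos a b; exact abs_pos.1 this), Measure.map_smul, map_add_left_eq_self, jac,
      abs_inv]
  rw [hpre, ← Measure.restrict_map hm (isOpen_cell _).measurableSet, hmap,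
    Measure.restrict_smul]

theorem integral_refMap {g : Pt d → ℝ} (hg : Measurable g) :
    ∫ y in cell (verts b), g y = jac a b * ∫ y in cell (verts a), g (refMap a b y) := by
  have hj := jac_pos a b
  rw [← integral_map (continuous_refMap a b).measurable.aemeasurable hg.aestronglyMeasurable,
    map_refMap_cell, integral_smul_measure, ENNReal.toReal_ofReal (by positivity), smul_eq_mul]
  field_simp

theorem nrm_refMap {g : Pt d → ℝ} (hg : Continuous g) :
    nrm (volume.restrict (cell (verts b))) g ^ 2 =
      jac a b * nrm (volume.restrict (cell (verts a))) (fun y => g (refMap a b y)) ^ 2 := by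
  rw [nrm_sq (memLp_cell _ hg), nrm_sq (f := fun y => g (refMap a b y)) (memLp_cell _ (hg.comp (continuous_refMap a b))),
    integral_refMap a b (hg.measurable.pow_const 2)]

/-- The polynomial `p ∘ refMap a b`. -/
def pull : Poly d →ₐ[ℝ] Poly d :=
  MvPolynomial.bind₁ fun j => ∑ i, (b i j) • lamP a i

theorem pev_pull (p : Poly d) (y : Pt d) : pev (pull a b p) y = pev p (refMap a b y) := by
  rw [pull, pev_bind₁]
  congr 1
  ext j
  simp [refMap, mul_comm]

theorem pull_pull (p : Poly d) : pull b a (pull a b p) = p :=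
  poly_ext fun y => by rw [pev_pull, pev_pull, refMap_refMap]

theorem totalDegree_pull_le (p : Poly d) : (pull a b p).totalDegree ≤ p.totalDegree :=
  totalDegree_bind₁_le (fun _ => MvPolynomial.totalDegree_finsetSum_le fun i _ =>
    (MvPolynomial.totalDegree_smul_le _ _).trans (totalDegree_lamP a i)) p

theorem pev_pderiv_eq (p : Poly d) (j : Fin d) (x : Pt d) :
    pev (MvPolynomial.pderiv j p) x = ∑ l, (∑ i, grad b i j * a i l) *
      pev (MvPolynomial.pderiv l (pull a b p)) (refMap b a x) := by
  have h1 : pev p = fun x => pev (pull a b p) (refMap b a x) :=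
    funext fun x => by rw [pev_pull, refMap_refMap]
  have h2 : HasFDerivAt (refMap b a) (refLin b a).toContinuousLinearMap x := by
    have e : refMap b a = fun x => refMap b a 0 + (refLin b a).toContinuousLinearMap x :=
      funext fun y => refMap_eq_add b a y
    rw [e]
    exact (ContinuousLinearMap.hasFDerivAt _).const_add _
  have h3 : HasFDerivAt (pev (pull a b p)) (fderiv ℝ (pev (pull a b p)) (refMap b a x))
      (refMap b a x) :=
    ((contDiff_pev (n := 1) _).differentiable one_ne_zero _).hasFDerivAt
  have h4 := (h3.comp x h2).fderiv
  have h5 : partialD j (pev p) x = fderiv ℝ (pev (pull a b p)) (refMap b a x)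
      (refLin b a (EuclideanSpace.single j 1)) := by
    rw [partialD]
    conv_lhs => rw [h1]
    exact congrArg (fun A => A (EuclideanSpace.single j 1)) h4
  rw [← partialD_pev, h5, fderiv_pev]
  refine Finset.sum_congr rfl fun l _ => ?_
  congr 1
  rw [refLin_apply]
  simp [PiLp.inner_apply]

theorem coord_faceProjPt (i j : Fin (d + 1)) (y : Pt d) :
    b.coord j (faceProjPt b i y) = b.coord j (b i) +
      (1 - b.coord i y)⁻¹ * (b.coord j y - b.coord j (b i)) := by
  rw [faceProjPt, coord_add, inner_smul_right, ← coord_sub_coord]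

theorem faceProjPt_refMap (i : Fin (d + 1)) (y : Pt d) :
    faceProjPt b i (refMap a b y) = refMap a b (faceProjPt a i y) := by
  refine eq_of_coord_eq b fun j => ?_
  rw [coord_refMap, coord_faceProjPt, coord_faceProjPt, coord_refMap, coord_refMap]
  simp only [AffineBasis.coord_apply]

end Reference

/-! ### Norm equivalences for polynomials on a simplex -/

section Equivalence

variable {d : ℕ}

/-- Evaluation as a linear map. -/
def pevL (d : ℕ) : Poly d →ₗ[ℝ] (Pt d → ℝ) where
  toFun := pev
  map_add' p q := funext fun x => pev_add p q x
  map_smul' c p := funext fun x => pev_smul c p x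

theorem le_sum_choose {ι : Type*} [Fintype ι] {C : ι → ℝ} (hC : ∀ i, 0 < C i) (i : ι) :
    C i ≤ ∑ j, C j :=
  Finset.single_le_sum (f := C) (fun j _ => (hC j).le) (Finset.mem_univ i)

theorem exists_ref_deriv_bound (a : AffineBasis (Fin (d + 1)) ℝ (Pt d)) (m : ℕ) : ∃ C > (0 : ℝ), ∀ p : Poly d, p.totalDegree ≤ m → ∀ j,
    nrm (volume.restrict (cell (verts a))) (pev (MvPolynomial.pderiv j p)) ^ 2 ≤
      C * nrm (volume.restrict (cell (verts a))) (pev p) ^ 2 := by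
  let S₁ : Fin d → PolyLE d m →ₗ[ℝ] (Pt d → ℝ) := fun j =>
    (pevL d ∘ₗ (MvPolynomial.pderiv j).toLinearMap) ∘ₗ (PolyLE d m).subtype
  let S₂ : Unit → PolyLE d m →ₗ[ℝ] (Pt d → ℝ) := fun _ => pevL d ∘ₗ (PolyLE d m).subtype
  have h₁ : ∀ j p, MemLp (S₁ j p) 2 (volume.restrict (cell (verts a))) := fun j p =>
    memLp_cell _ (continuous_pev _)
  have h₂ : ∀ j p, MemLp (S₂ j p) 2 (volume.restrict (cell (verts a))) := fun j p =>
    memLp_cell _ (continuous_pev _)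
  obtain ⟨C, hC, h⟩ := exists_bound_of_posDef (gram _ S₁ h₁) (gram _ S₂ h₂) (by
    intro p hp
    refine lt_of_le_of_ne (gram_self_nonneg h₂ p) fun h0 => hp ?_
    exact Subtype.ext (poly_eq_zero_of_ae_cell a
      (ae_eq_zero_of_nrm (h₂ () p) (nrm_eq_zero_of_gram_self h₂ h0.symm ()))))
  refine ⟨C, hC, fun p hp j => ?_⟩
  have := h ⟨p, mem_polyLE.2 hp⟩
  rw [gram_self, gram_self h₂, Fintype.sum_unique (ι := Unit)] at this
  refine le_trans ?_ this
  exact Finset.single_le_sum (f := fun j => nrm (volume.restrict (cell (verts a)))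
    (S₁ j ⟨p, mem_polyLE.2 hp⟩) ^ 2) (fun _ _ => sq_nonneg _) (Finset.mem_univ j)

theorem abs_grad_le (b : AffineBasis (Fin (d + 1)) ℝ (Pt d)) {σ : ℝ} (hd : 0 < d) {i : Fin (d + 1)}
    (hσ : diamT (verts b) ≤ σ * height b i) (j : Fin d) :
    diamT (verts b) * |grad b i j| ≤ σ := by
  have hH := height_pos b hd i
  have h1 : |grad b i j| ≤ (height b i)⁻¹ := by
    rw [← norm_grad]
    simpa using PiLp.norm_apply_le (grad b i) j
  calc _ ≤ (σ * height b i) * (height b i)⁻¹ := by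
        gcongr
        exact (diamT_pos b hd).le.trans hσ
    _ = σ := by field_simp

/-- The inverse inequality. -/
theorem exists_inverse_bound (a : AffineBasis (Fin (d + 1)) ℝ (Pt d)) (hd : 0 < d) (m : ℕ) : ∃ C > (0 : ℝ),
    ∀ (b : AffineBasis (Fin (d + 1)) ℝ (Pt d)) (σ : ℝ),
      (∀ i, diamT (verts b) ≤ σ * height b i) → ∀ p : Poly d, p.totalDegree ≤ m → ∀ j,
      diamT (verts b) * nrm (volume.restrict (cell (verts b))) (pev (MvPolynomial.pderiv j p)) ≤
        C * σ * nrm (volume.restrict (cell (verts b))) (pev p) := by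
  obtain ⟨C, hC, h⟩ := exists_ref_deriv_bound a m
  set M : ℝ := ∑ l, ∑ i, |a i l|
  have hM : 0 ≤ M := Finset.sum_nonneg fun l _ => Finset.sum_nonneg fun i _ => abs_nonneg _
  refine ⟨M * Real.sqrt C + 1, by positivity, fun b σ hσ p hp j => ?_⟩
  have hh := diamT_pos b hd
  have hσ0 : 0 < σ := pos_of_mul_pos_left (hh.trans_le (hσ 0)) (height_pos b hd 0).le
  set μ := (volume : Measure (Pt d)).restrict (cell (verts b))
  set q := pull a b p
  have hq : q.totalDegree ≤ m := (totalDegree_pull_le a b p).trans hp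
  have hl : ∀ l, nrm μ (fun x => pev (MvPolynomial.pderiv l q) (refMap b a x)) ≤
      Real.sqrt C * nrm μ (pev p) := by
    intro l
    have hc : Continuous fun x => pev (MvPolynomial.pderiv l q) (refMap b a x) :=
      (continuous_pev _).comp (continuous_refMap b a)
    have e1 := nrm_refMap a b hc
    have e2 := nrm_refMap a b (continuous_pev p)
    simp only [refMap_refMap] at e1
    simp only [← pev_pull] at e2
    refine abs_le_of_sq_le_sq ?_ (by have := nrm_nonneg μ (pev p); positivity) |> le_of_abs_le
    rw [mul_pow, Real.sq_sqrt hC.le]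
    rw [e1, e2]
    have := mul_le_mul_of_nonneg_left (h q hq l) (jac_pos a b).le
    calc _ ≤ _ := this
      _ = _ := by ring
  have e : pev (MvPolynomial.pderiv j p) = fun x => ∑ l, (∑ i, grad b i j * a i l) *
      pev (MvPolynomial.pderiv l q) (refMap b a x) := funext fun x => pev_pderiv_eq a b p j x
  have hcoef : ∀ l, diamT (verts b) * |∑ i, grad b i j * a i l| ≤ σ * ∑ i, |a i l| := by
    intro l
    calc _ ≤ diamT (verts b) * ∑ i, |grad b i j * a i l| := by
          gcongr; exact Finset.abs_sum_le_sum_abs _ _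
      _ = ∑ i, (diamT (verts b) * |grad b i j|) * |a i l| := by
          rw [Finset.mul_sum]
          exact Finset.sum_congr rfl fun i _ => by rw [abs_mul, mul_assoc]
      _ ≤ ∑ i, σ * |a i l| := by
          gcongr with i
          exact abs_grad_le b hd (hσ i) j
      _ = _ := by rw [Finset.mul_sum]
  rw [e]
  calc _ ≤ diamT (verts b) * ∑ l, |∑ i, grad b i j * a i l| *
        nrm μ (fun x => pev (MvPolynomial.pderiv l q) (refMap b a x)) := by
        gcongr
        refine (nrm_sum_le Finset.univ fun l _ => ?_).trans (le_of_eq ?_)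
        · exact memLp_cell _ (continuous_const.mul
            ((continuous_pev _).comp (continuous_refMap b a)))
        · exact Finset.sum_congr rfl fun l _ => nrm_const_mul _ _
    _ = ∑ l, (diamT (verts b) * |∑ i, grad b i j * a i l|) *
        nrm μ (fun x => pev (MvPolynomial.pderiv l q) (refMap b a x)) := by
        rw [Finset.mul_sum]
        exact Finset.sum_congr rfl fun i _ => by rw [mul_assoc]
    _ ≤ ∑ l, (σ * ∑ i, |a i l|) * (Real.sqrt C * nrm μ (pev p)) := by
        refine Finset.sum_le_sum fun l _ => mul_le_mul (hcoef l) (hl l) (nrm_nonneg _ _) ?_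
        exact mul_nonneg hσ0.le (Finset.sum_nonneg fun i _ => abs_nonneg _)
    _ = M * Real.sqrt C * σ * nrm μ (pev p) := by
        rw [← Finset.sum_mul, ← Finset.mul_sum]; ring
    _ ≤ _ := by
        have := nrm_nonneg μ (pev p)
        gcongr
        linarith

/-- The form `∫ λ_i λ_j p q` is equivalent to the `L²` inner product. -/
theorem exists_weighted_bound (a : AffineBasis (Fin (d + 1)) ℝ (Pt d)) (m : ℕ) : ∃ C > (0 : ℝ),
    ∀ (b : AffineBasis (Fin (d + 1)) ℝ (Pt d)) (i j : Fin (d + 1)) (p : Poly d),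
      p.totalDegree ≤ m →
      nrm (volume.restrict (cell (verts b))) (pev p) ^ 2 ≤
        C * ∫ y in cell (verts b), b.coord i y * b.coord j y * pev p y ^ 2 := by
  have hcc := fun i => continuous_barycentric_coord a i
  have href : ∀ ij : Fin (d + 1) × Fin (d + 1), ∃ C > (0 : ℝ), ∀ p : Poly d, p.totalDegree ≤ m →
      nrm (volume.restrict (cell (verts a))) (pev p) ^ 2 ≤
        C * ∫ y in cell (verts a), a.coord ij.1 y * a.coord ij.2 y * pev p y ^ 2 := by
    rintro ⟨i, j⟩
    let S₁ : Unit → PolyLE d m →ₗ[ℝ] (Pt d → ℝ) := fun _ => pevL d ∘ₗ (PolyLE d m).subtype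
    let S₂ : Unit → PolyLE d m →ₗ[ℝ] (Pt d → ℝ) := fun _ =>
      (LinearMap.mulLeft ℝ fun y => Real.sqrt (a.coord i y * a.coord j y)) ∘ₗ
        pevL d ∘ₗ (PolyLE d m).subtype
    have h₁ : ∀ j p, MemLp (S₁ j p) 2 (volume.restrict (cell (verts a))) := fun j p =>
      memLp_cell _ (continuous_pev _)
    have h₂ : ∀ j p, MemLp (S₂ j p) 2 (volume.restrict (cell (verts a))) := fun _ p =>
      memLp_cell _ ((((hcc i).mul (hcc j)).sqrt).mul (continuous_pev _))
    have hpos : ∀ y ∈ cell (verts a), 0 < a.coord i y * a.coord j y := by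
      intro y hy
      rw [cell_verts] at hy
      exact mul_pos (hy i) (hy j)
    have hae : ∀ᵐ y ∂volume.restrict (cell (verts a)), y ∈ cell (verts a) :=
      ae_restrict_mem (isOpen_cell _).measurableSet
    obtain ⟨C, hC, h⟩ := exists_bound_of_posDef (gram _ S₁ h₁) (gram _ S₂ h₂) (by
      intro p hp
      refine lt_of_le_of_ne (gram_self_nonneg h₂ p) fun h0 => hp ?_
      refine Subtype.ext (poly_eq_zero_of_ae_cell a ?_)
      filter_upwards [ae_eq_zero_of_nrm (h₂ () p) (nrm_eq_zero_of_gram_self h₂ h0.symm ()), hae]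
        with y hy hyc
      exact (mul_eq_zero.1 hy).resolve_left (Real.sqrt_pos.2 (hpos y hyc)).ne')
    refine ⟨C, hC, fun p hp => ?_⟩
    have := h ⟨p, mem_polyLE.2 hp⟩
    rw [gram_self, gram_self, Fintype.sum_unique, Fintype.sum_unique, nrm_sq (h₂ () _)] at this
    refine this.trans (le_of_eq ?_)
    congr 1
    refine integral_congr_ae ?_
    filter_upwards [hae] with y hy
    change (Real.sqrt (a.coord i y * a.coord j y) * pev p y) ^ 2 = _
    rw [mul_pow, Real.sq_sqrt (hpos y hy).le]
  choose C hC h using href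
  refine ⟨∑ ij, C ij, Finset.sum_pos (fun ij _ => hC ij) ⟨(0, 0), Finset.mem_univ _⟩,
    fun b i j p hp => ?_⟩
  have hcb := fun i => continuous_barycentric_coord b i
  have e1 := nrm_refMap a b (continuous_pev p)
  simp only [← pev_pull] at e1
  have hm : Measurable fun y => b.coord i y * b.coord j y * pev p y ^ 2 :=
    (((hcb i).mul (hcb j)).mul ((continuous_pev p).pow 2)).measurable
  rw [e1, integral_refMap a b hm]
  simp only [coord_refMap, ← pev_pull]
  have h1 := h (i, j) (pull a b p) ((totalDegree_pull_le a b p).trans hp)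
  have h2 : 0 ≤ ∫ y in cell (verts a), a.coord i y * a.coord j y * pev (pull a b p) y ^ 2 := by
    refine setIntegral_nonneg (isOpen_cell _).measurableSet fun y hy => ?_
    rw [cell_verts] at hy
    exact mul_nonneg (mul_pos (hy i) (hy j)).le (sq_nonneg _)
  have h3 := mul_le_mul_of_nonneg_right (le_sum_choose hC (i, j)) h2
  have h4 := mul_le_mul_of_nonneg_left (h1.trans h3) (jac_pos a b).le
  calc _ ≤ _ := h4
    _ = _ := by ring

end Equivalence

/-! ### Lifting of normal components -/

section Lifting

variable {d : ℕ} (a b : AffineBasis (Fin (d + 1)) ℝ (Pt d))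

/-- The polynomial `∇λ_i · w`, a multiple of the normal component of `w` on the `i`-th face. -/
def nflux (i : Fin (d + 1)) : (Fin d → Poly d) →ₗ[ℝ] Poly d :=
  ∑ j, grad b i j • LinearMap.proj j

theorem nflux_apply (i : Fin (d + 1)) (w : Fin d → Poly d) :
    nflux b i w = ∑ j, grad b i j • w j := by simp [nflux]

theorem pev_nflux (i : Fin (d + 1)) (w : Fin d → Poly d) (y : Pt d) :
    pev (nflux b i w) y = ∑ j, grad b i j * pev (w j) y := by simp [nflux_apply]

theorem pev_nflux_eq_inner (i : Fin (d + 1)) (w : Fin d → Poly d) (y : Pt d) :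
    pev (nflux b i w) y = inner ℝ (grad b i) (WithLp.toLp 2 fun j => pev (w j) y) := by
  simp [pev_nflux, PiLp.inner_apply, mul_comm]

theorem totalDegree_nflux_le {m : ℕ} (i : Fin (d + 1)) {w : Fin d → Poly d}
    (hw : ∀ j, (w j).totalDegree ≤ m) : (nflux b i w).totalDegree ≤ m := by
  rw [nflux_apply]
  exact MvPolynomial.totalDegree_finsetSum_le fun j _ =>
    (MvPolynomial.totalDegree_smul_le _ _).trans (hw j)

theorem eq_sum_nflux (w : Fin d → Poly d) (x : Pt d) (j : Fin d) :
    w j = ∑ i, (b i j - x j) • nflux b i w := by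
  refine poly_ext fun y => ?_
  have h2 := congrArg (fun v : Pt d => v j)
    (sum_inner_grad_smul_sub b (WithLp.toLp 2 fun l => pev (w l) y) x)
  simp only [← pev_nflux_eq_inner, WithLp.ofLp_sum, Finset.sum_apply, PiLp.smul_apply,
    PiLp.sub_apply, smul_eq_mul] at h2
  rw [← h2]
  simp [mul_comm]

theorem sum_nflux (w : Fin d → Poly d) : ∑ i, nflux b i w = 0 := by
  refine poly_ext fun y => ?_
  simp only [pev_sum, pev_nflux_eq_inner, sum_inner_grad, pev_zero]

/-- The Piola transform of a field on the simplex `b` to the simplex `a`. -/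
def piola (w : Fin d → Poly d) (l : Fin d) : Poly d :=
  ∑ i, a i l • pull a b (nflux b i w)

theorem nflux_piola (m : Fin (d + 1)) (w : Fin d → Poly d) :
    nflux a m (piola a b w) = pull a b (nflux b m w) := by
  have h0 : ∑ i, pull a b (nflux b i w) = 0 := by rw [← map_sum, sum_nflux, map_zero]
  have h1 : nflux a m (piola a b w) =
      ∑ i, inner ℝ (grad a m) (a i) • pull a b (nflux b i w) := by
    simp only [nflux_apply, piola, Finset.smul_sum, smul_smul]
    rw [Finset.sum_comm]
    refine Finset.sum_congr rfl fun i _ => ?_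
    rw [← Finset.sum_smul]
    simp [PiLp.inner_apply, mul_comm]
  have h2 : ∀ i, inner ℝ (grad a m) (a i) • pull a b (nflux b i w) =
      (if m = i then pull a b (nflux b i w) else 0) +
        (inner ℝ (grad a m) (a m) - 1) • pull a b (nflux b i w) := by
    intro i
    have := inner_grad_vertex_sub a m i m
    rw [inner_sub_right, if_pos rfl] at this
    have e : inner ℝ (grad a m) (a i) = (if m = i then (1 : ℝ) else 0) +
      (inner ℝ (grad a m) (a m) - 1) := by linarith
    rw [e, add_smul]
    split_ifs <;> simp
  rw [h1, Finset.sum_congr rfl fun i _ => h2 i, Finset.sum_add_distrib, ← Finset.smul_sum, h0]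
  simp

theorem totalDegree_piola_le {m : ℕ} {w : Fin d → Poly d} (hw : ∀ j, (w j).totalDegree ≤ m)
    (l : Fin d) : (piola a b w l).totalDegree ≤ m :=
  MvPolynomial.totalDegree_finsetSum_le fun i _ => (MvPolynomial.totalDegree_smul_le _ _).trans
    ((totalDegree_pull_le a b _).trans (totalDegree_nflux_le b i hw))

/-- Normal components can be lifted to the element in a stable way. -/
theorem exists_normal_lift {d : ℕ} (a : AffineBasis (Fin (d + 1)) ℝ (Pt d)) (hd : 0 < d) (m : ℕ) : ∃ C > (0 : ℝ),
    ∀ (b : AffineBasis (Fin (d + 1)) ℝ (Pt d)) (w : Fin d → Poly d),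
      (∀ j, (w j).totalDegree ≤ m) → ∃ w₁ : Fin d → Poly d, (∀ j, (w₁ j).totalDegree ≤ m) ∧
      (∀ i, ∀ y ∈ convexHull ℝ (face (verts b) (b i) : Set (Pt d)),
        pev (nflux b i w₁) y = pev (nflux b i w) y) ∧
      ∀ i, nrm (volume.restrict (cell (verts b))) (pev (nflux b i w₁)) ^ 2 ≤
        C * ∑ l, height b l * nrm (faceMeasure (face (verts b) (b l))) (pev (nflux b l w)) ^ 2 := by
  let ιP : (Fin d → PolyLE d m) →ₗ[ℝ] (Fin d → Poly d) :=
    LinearMap.pi fun j => (PolyLE d m).subtype ∘ₗ LinearMap.proj j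
  have hιP : ∀ w j, ιP w j = w j := fun _ _ => rfl
  let S₁ : Fin (d + 1) → (Fin d → PolyLE d m) →ₗ[ℝ] (Pt d → ℝ) := fun i =>
    pevL d ∘ₗ nflux a i ∘ₗ ιP
  let S₂ : Fin (d + 1) → (Fin d → PolyLE d m) →ₗ[ℝ] (Pt d → ℝ) := fun i =>
    LinearMap.funLeft ℝ ℝ (faceProjPt a i) ∘ₗ pevL d ∘ₗ nflux a i ∘ₗ ιP
  have h₁ : ∀ j p, MemLp (S₁ j p) 2 (volume.restrict (cell (verts a))) := fun j p =>
    memLp_cell _ (continuous_pev _)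
  have h₂ : ∀ j p, MemLp (S₂ j p) 2 (volume.restrict (cell (verts a))) := fun j p =>
    memLp_faceProjPt a hd j (continuous_pev _)
  obtain ⟨C, hC, h⟩ := exists_lift_bound (gram _ S₁ h₁) (gram _ S₂ h₂) (gram_symm h₂)
    (gram_self_nonneg h₂)
  refine ⟨C, hC, fun b w hw => ?_⟩
  let w' : Fin d → PolyLE d m := fun j =>
    ⟨piola a b w j, mem_polyLE.2 (totalDegree_piola_le a b hw j)⟩
  obtain ⟨v, hv0, hv⟩ := h w'
  have hdv : ∀ j, (ιP v j).totalDegree ≤ m := fun j => mem_polyLE.1 (v j).2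
  have hw' : ιP w' = piola a b w := rfl
  refine ⟨piola b a (ιP v), totalDegree_piola_le b a hdv, fun i y hy => ?_, fun i => ?_⟩
  · have hz := ae_eq_zero_of_nrm (h₂ i (w' - v)) (nrm_eq_zero_of_gram_self h₂ hv0 i)
    have hz' := fun y hy => pev_eq_zero_of_ae_faceProjPt a hd i (p := nflux a i (ιP (w' - v))) hz
      (y := y) hy
    have hy' : refMap b a y ∈ convexHull ℝ (face (verts a) (a i) : Set (Pt d)) := by
      rw [hull_face_verts] at hy ⊢
      exact ⟨fun j => by rw [coord_refMap]; exact hy.1 j, by rw [coord_refMap]; exact hy.2⟩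
    have h3 := hz' _ hy'
    rw [map_sub, map_sub, pev_sub, hw', nflux_piola, pev_pull, refMap_refMap] at h3
    rw [nflux_piola, pev_pull]
    linarith
  · rw [gram_self, gram_self] at hv
    have e1 := nrm_refMap a b (continuous_pev (nflux b i (piola b a (ιP v))))
    simp only [← pev_pull, nflux_piola, pull_pull] at e1
    have e2 : nrm (volume.restrict (cell (verts a))) (S₁ i v) ^ 2 ≤
        ∑ i, nrm (volume.restrict (cell (verts a))) (S₁ i v) ^ 2 :=
      Finset.single_le_sum (f := fun i => nrm (volume.restrict (cell (verts a))) (S₁ i v) ^ 2)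
        (fun _ _ => sq_nonneg _) (Finset.mem_univ i)
    have e3 : ∀ l, jac a b * nrm (volume.restrict (cell (verts a))) (S₂ l w') ^ 2 ≤
        height b l * nrm (faceMeasure (face (verts b) (b l))) (pev (nflux b l w)) ^ 2 := by
      intro l
      have hms : Measurable fun y => pev (nflux b l w) y ^ 2 :=
        ((continuous_pev _).pow 2).measurable
      rw [nrm_sq (h₂ l w')]
      have e4 : ∀ y, S₂ l w' y ^ 2 = pev (nflux b l w) (faceProjPt b l (refMap a b y)) ^ 2 := by
        intro y
        change pev (nflux a l (ιP w')) (faceProjPt a l y) ^ 2 = _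
        rw [hw', nflux_piola, pev_pull, faceProjPt_refMap]
      simp_rw [e4]
      rw [← integral_refMap a b (g := fun y => pev (nflux b l w) (faceProjPt b l y) ^ 2)
        (hms.comp (measurable_faceProjPt b l)),
        integral_face_eq' b hd l hms, nrm_sq (memLp_face b hd l (continuous_pev _))]
      have hd1 : (1 : ℝ) ≤ d := by exact_mod_cast hd
      have hi : 0 ≤ ∫ y, pev (nflux b l w) y ^ 2 ∂faceMeasure (face (verts b) (b l)) :=
        integral_nonneg fun y => sq_nonneg _
      gcongr
      exact div_le_self (height_pos b hd l).le hd1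
    calc _ = jac a b * nrm (volume.restrict (cell (verts a))) (S₁ i v) ^ 2 := by
          rw [nflux_piola, e1]; rfl
      _ ≤ jac a b * (C * ∑ l, nrm (volume.restrict (cell (verts a))) (S₂ l w') ^ 2) := by
          have := (jac_pos a b).le
          gcongr
          exact e2.trans hv
      _ = C * ∑ l, jac a b * nrm (volume.restrict (cell (verts a))) (S₂ l w') ^ 2 := by
          rw [← Finset.mul_sum]; ring
      _ ≤ _ := mul_le_mul_of_nonneg_left (Finset.sum_le_sum fun l _ => e3 l) hC.le

end Lifting

/-! ### Existence of the moments that define the BDM projection -/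

section Moments

theorem exists_riesz_submodule {V : Type*} [AddCommGroup V] [Module ℝ V] [FiniteDimensional ℝ V]
    (W : Submodule ℝ V) (B : V →ₗ[ℝ] V →ₗ[ℝ] ℝ) (hs : ∀ p q, B p q = B q p) (l : V →ₗ[ℝ] ℝ)
    (hl : ∀ p, B p p = 0 → l p = 0) : ∃ w ∈ W, ∀ p ∈ W, B w p = l p := by
  obtain ⟨w, hw⟩ := exists_riesz (B.compl₁₂ W.subtype W.subtype) (fun p q => hs p q)
    (l ∘ₗ W.subtype) (fun p h => hl p h)
  exact ⟨w, w.2, fun p hp => hw ⟨p, hp⟩⟩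

variable {d : ℕ} (b : AffineBasis (Fin (d + 1)) ℝ (Pt d))

theorem exists_isL2Proj {μ : Measure (Pt d)} (hμ : ∀ p : Poly d, MemLp (pev p) 2 μ) (m : ℕ)
    {f : Pt d → ℝ} (hf : MemLp f 2 μ) : ∃ p, IsL2Proj μ m f p := by
  let S : Unit → PolyLE d m →ₗ[ℝ] (Pt d → ℝ) := fun _ => pevL d ∘ₗ (PolyLE d m).subtype
  have hS : ∀ j p, MemLp (S j p) 2 μ := fun j p => hμ _
  obtain ⟨p, hp⟩ := exists_riesz (gram μ S hS) (gram_symm hS) (gramFun (fun _ => f) (fun _ => hf) hS)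
    fun p h => gramFun_eq_zero hS _ _ h
  refine ⟨p, mem_polyLE.1 p.2, fun q hq => ?_⟩
  have := hp ⟨q, mem_polyLE.2 hq⟩
  rw [gram_apply, gramFun_apply, Fintype.sum_unique, Fintype.sum_unique] at this
  exact this

theorem IsL2Proj.nrm_le {μ : Measure (Pt d)} (hμ : ∀ p : Poly d, MemLp (pev p) 2 μ) {m : ℕ}
    {f : Pt d → ℝ} (hf : MemLp f 2 μ) {p : Poly d} (h : IsL2Proj μ m f p) :
    nrm μ (pev p) ≤ nrm μ f := by
  have h1 := h.2 p h.1
  have h2 := abs_integral_mul_le hf (hμ p)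
  rw [← h1] at h2
  have h3 := nrm_sq (hμ p)
  simp only [sq] at h3
  rw [← h3, abs_of_nonneg (by have := nrm_nonneg μ (pev p); positivity)] at h2
  by_contra hlt
  push Not at hlt
  have := nrm_nonneg μ f
  nlinarith

theorem exists_eq_sum_lamP_mul {k : ℕ} (hk : 1 ≤ k) {p : Poly d} (hp : p.totalDegree ≤ k) :
    ∃ r : Fin (d + 1) → Poly d, (∀ i, (r i).totalDegree ≤ k - 1) ∧ p = ∑ i, lamP b i * r i := by
  have hone : (1 : Poly d) = ∑ i, lamP b i := poly_ext fun y => by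
    simp [b.sum_coord_apply_eq_one]
  have hX : ∀ j, (MvPolynomial.X j : Poly d) = ∑ i, b i j • lamP b i := fun j => poly_ext fun y => by
    have := congrArg (fun v : Pt d => v j) (sum_coord_smul b y)
    simp only [WithLp.ofLp_sum, Finset.sum_apply, PiLp.smul_apply, smul_eq_mul] at this
    simp [← this, mul_comm]
  have hmon : ∀ s : p.support, ∃ r : Fin (d + 1) → Poly d, (∀ i, (r i).totalDegree ≤ k - 1) ∧
      MvPolynomial.monomial s.1 (p.coeff s.1) = ∑ i, lamP b i * r i := by
    rintro ⟨s, hs⟩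
    have hsk : (s.sum fun _ e => e) ≤ k := (MvPolynomial.le_totalDegree hs).trans hp
    by_cases h0 : s = 0
    · refine ⟨fun _ => MvPolynomial.C (p.coeff s), fun i => by simp, ?_⟩
      rw [← Finset.sum_mul, ← hone, one_mul]
      change MvPolynomial.monomial s (p.coeff s) = _
      rw [h0]; rfl
    · obtain ⟨j, hj⟩ := Finsupp.support_nonempty_iff.2 h0
      have hj1 : 1 ≤ s j := Nat.one_le_iff_ne_zero.2 (Finsupp.mem_support_iff.1 hj)
      have hs' : s = Finsupp.single j 1 + (s - Finsupp.single j 1) := by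
        rw [add_tsub_cancel_of_le (Finsupp.single_le_iff.2 hj1)]
      set t := s - Finsupp.single j 1
      have ht : (t.sum fun _ e => e) ≤ k - 1 := by
        rw [hs', Finsupp.sum_add_index' (fun _ => rfl) (fun _ _ _ => rfl),
          Finsupp.sum_single_index rfl] at hsk
        omega
      refine ⟨fun i => b i j • MvPolynomial.monomial t (p.coeff s), fun i => ?_, ?_⟩
      · exact (MvPolynomial.totalDegree_smul_le _ _).trans
          ((MvPolynomial.totalDegree_monomial_le _ _).trans ht)
      · have : MvPolynomial.monomial s (p.coeff s) =
            MvPolynomial.X j * MvPolynomial.monomial t (p.coeff s) := by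
          rw [MvPolynomial.X, MvPolynomial.monomial_mul, one_mul, ← hs']
        simp only [this, hX j, Finset.sum_mul, smul_mul_assoc, mul_smul_comm]
  choose r hr hr' using hmon
  refine ⟨fun i => ∑ s, r s i, fun i => MvPolynomial.totalDegree_finsetSum_le fun s _ => hr s i, ?_⟩
  conv_lhs => rw [p.as_sum, ← Finset.sum_coe_sort]
  simp only [hr', Finset.mul_sum]
  exact Finset.sum_comm

theorem nflux_vertex_sub (m i j : Fin (d + 1)) (p : Poly d) :
    nflux b m (fun l => (b i l - b j l) • p) =
      ((if m = i then 1 else 0) - (if m = j then 1 else 0) : ℝ) • p := by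
  rw [nflux_apply, ← inner_grad_vertex_sub b m i j]
  simp only [smul_smul, ← Finset.sum_smul]
  simp [PiLp.inner_apply, mul_comm]

/-- Any polynomials on the faces are normal components of a polynomial field. -/
theorem exists_nflux_eq {k : ℕ} (hk : 1 ≤ k) (q : Fin (d + 1) → Poly d)
    (hq : ∀ i, (q i).totalDegree ≤ k) : ∃ w : Fin d → Poly d, (∀ l, (w l).totalDegree ≤ k) ∧
      ∀ i, ∀ y ∈ convexHull ℝ (face (verts b) (b i) : Set (Pt d)),
        pev (nflux b i w) y = pev (q i) y := by
  choose r hr hqr using fun i => exists_eq_sum_lamP_mul b hk (hq i)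
  let c : Fin (d + 1) → Fin (d + 1) → Fin d → Poly d := fun i j l =>
    (b i l - b j l) • (lamP b j * r i j)
  refine ⟨∑ i, ∑ j, c i j, fun l => ?_, fun m y hy => ?_⟩
  · simp only [Finset.sum_apply]
    refine MvPolynomial.totalDegree_finsetSum_le fun i _ =>
      MvPolynomial.totalDegree_finsetSum_le fun j _ =>
      (MvPolynomial.totalDegree_smul_le _ _).trans
      ((MvPolynomial.totalDegree_mul _ _).trans ?_)
    have h1 := totalDegree_lamP b j
    have h2 := hr i j
    omega
  · rw [hull_face_verts] at hy
    have h1 : ∀ i j, pev (nflux b m (c i j)) y = if m = i then pev (lamP b j * r i j) y else 0 := by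
      intro i j
      rw [nflux_vertex_sub, pev_smul, pev_mul, pev_lamP]
      by_cases hj : m = j
      · subst hj
        rw [hy.2]; simp
      · by_cases hi : m = i <;> simp [hi, hj]
        simp [← hi, hj]
    simp only [map_sum, pev_sum, h1]
    rw [Finset.sum_comm]
    simp only [Finset.sum_ite_eq, Finset.mem_univ, if_true]
    rw [← pev_sum, ← hqr m]

/-- The derivative in the direction of the edge from `b j` to `b i`. -/
def dirD (i j : Fin (d + 1)) : Poly d →ₗ[ℝ] Poly d :=
  ∑ l, (b i l - b j l) • (MvPolynomial.pderiv l).toLinearMap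

theorem dirD_apply (i j : Fin (d + 1)) (p : Poly d) :
    dirD b i j p = ∑ l, (b i l - b j l) • MvPolynomial.pderiv l p := by
  simp [dirD]

theorem totalDegree_dirD_le (i j : Fin (d + 1)) (p : Poly d) :
    (dirD b i j p).totalDegree ≤ p.totalDegree - 1 := by
  rw [dirD_apply]
  exact MvPolynomial.totalDegree_finsetSum_le fun l _ =>
    (MvPolynomial.totalDegree_smul_le _ _).trans (totalDegree_pderiv_le l p)

theorem pderiv_eq_sum_dirD (p : Poly d) (j : Fin (d + 1)) (l : Fin d) :
    MvPolynomial.pderiv l p = ∑ i, grad b i l • dirD b i j p := by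
  refine poly_ext fun y => ?_
  have h := congrArg (fun v : Pt d => v l)
    (sum_inner_smul_grad b (WithLp.toLp 2 fun l => pev (MvPolynomial.pderiv l p) y) (b j))
  simp only [WithLp.ofLp_sum, Finset.sum_apply, PiLp.smul_apply, smul_eq_mul] at h
  rw [← h]
  simp only [pev_sum, pev_smul, dirD_apply]
  refine Finset.sum_congr rfl fun i _ => ?_
  rw [mul_comm]
  congr 1

/-- The field `∑_{i,j} λ_i λ_j (t_ij · ∇ψ) t_ij`, where the `t_ij` are the edge vectors. -/
def bubbleField (ψ : Poly d) : Fin d → Poly d :=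
  ∑ i, ∑ j, fun l => (b i l - b j l) • (lamP b i * lamP b j * dirD b i j ψ)

theorem bubbleField_apply (ψ : Poly d) (l : Fin d) : bubbleField b ψ l =
    ∑ i, ∑ j, (b i l - b j l) • (lamP b i * lamP b j * dirD b i j ψ) := by
  simp [bubbleField]

theorem totalDegree_bubbleField_le {k : ℕ} (hk : 1 ≤ k) {ψ : Poly d} (hψ : ψ.totalDegree ≤ k - 1)
    (l : Fin d) : (bubbleField b ψ l).totalDegree ≤ k := by
  rw [bubbleField_apply]
  refine MvPolynomial.totalDegree_finsetSum_le fun i _ =>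
    MvPolynomial.totalDegree_finsetSum_le fun j _ =>
    (MvPolynomial.totalDegree_smul_le _ _).trans ?_
  by_cases h0 : ψ.totalDegree = 0
  · have : dirD b i j ψ = 0 := by
      rw [MvPolynomial.totalDegree_eq_zero_iff_eq_C.1 h0, dirD_apply]; simp
    rw [this]; simp
  · have h1 := MvPolynomial.totalDegree_mul (lamP b i * lamP b j) (dirD b i j ψ)
    have h2 := MvPolynomial.totalDegree_mul (lamP b i) (lamP b j)
    have h3 := totalDegree_lamP b i
    have h4 := totalDegree_lamP b j
    have h5 := totalDegree_dirD_le b i j ψ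
    omega

theorem pev_nflux_bubbleField (ψ : Poly d) (m : Fin (d + 1)) {y : Pt d}
    (hy : y ∈ convexHull ℝ (face (verts b) (b m) : Set (Pt d))) :
    pev (nflux b m (bubbleField b ψ)) y = 0 := by
  rw [hull_face_verts] at hy
  simp only [bubbleField, map_sum, pev_sum]
  refine Finset.sum_eq_zero fun i _ => Finset.sum_eq_zero fun j _ => ?_
  rw [nflux_vertex_sub, pev_smul, pev_mul, pev_mul, pev_lamP, pev_lamP]
  by_cases hi : m = i
  · rw [← hi, hy.2]; simp
  · by_cases hj : m = j
    · rw [← hj, hy.2]; simp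
    · simp [hi, hj]

/-- The factors `√(λ_i λ_j) (t_ij · ∇ψ)` of the energy of `bubbleField`. -/
def bubbleS (m : ℕ) (ij : Fin (d + 1) × Fin (d + 1)) : PolyLE d m →ₗ[ℝ] (Pt d → ℝ) :=
  (LinearMap.mulLeft ℝ fun y => Real.sqrt (b.coord ij.1 y * b.coord ij.2 y)) ∘ₗ
    pevL d ∘ₗ dirD b ij.1 ij.2 ∘ₗ (PolyLE d m).subtype

theorem bubbleS_apply (m : ℕ) (ij : Fin (d + 1) × Fin (d + 1)) (p : PolyLE d m) (y : Pt d) :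
    bubbleS b m ij p y =
      Real.sqrt (b.coord ij.1 y * b.coord ij.2 y) * pev (dirD b ij.1 ij.2 p) y := rfl

theorem memLp_bubbleS (m : ℕ) (ij : Fin (d + 1) × Fin (d + 1)) (p : PolyLE d m) :
    MemLp (bubbleS b m ij p) 2 (volume.restrict (cell (verts b))) :=
  memLp_cell _ ((((continuous_barycentric_coord b _).mul (continuous_barycentric_coord b _)).sqrt).mul
    (continuous_pev _))

theorem ae_mem_cell (T : Finset (Pt d)) : ∀ᵐ y ∂volume.restrict (cell T), y ∈ cell T :=
  ae_restrict_mem (isOpen_cell _).measurableSet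

theorem coord_mul_coord_pos {y : Pt d} (hy : y ∈ cell (verts b)) (i j : Fin (d + 1)) :
    0 < b.coord i y * b.coord j y := by
  rw [cell_verts] at hy
  exact mul_pos (hy i) (hy j)

theorem integral_bubbleField (m : ℕ) (ψ p : PolyLE d m) :
    ∫ y in cell (verts b), ∑ l, pev (bubbleField b ψ l) y * pev (MvPolynomial.pderiv l p.1) y =
      gram _ (bubbleS b m) (memLp_bubbleS b m) ψ p := by
  rw [gram_apply, ← integral_finsetSum _ fun ij _ =>
    integrable_mul_of_memLp (memLp_bubbleS b m ij ψ) (memLp_bubbleS b m ij p)]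
  refine integral_congr_ae ?_
  filter_upwards [ae_mem_cell (verts b)] with y hy
  have h1 : ∀ ij, bubbleS b m ij ψ y * bubbleS b m ij p y =
      b.coord ij.1 y * b.coord ij.2 y * pev (dirD b ij.1 ij.2 ψ) y *
        ∑ l, (b ij.1 l - b ij.2 l) * pev (MvPolynomial.pderiv l p.1) y := by
    intro ij
    rw [bubbleS_apply, bubbleS_apply, mul_mul_mul_comm,
      Real.mul_self_sqrt (coord_mul_coord_pos b hy _ _).le, dirD_apply b _ _ p.1, pev_sum, ← mul_assoc]
    simp only [pev_smul]
  simp only [h1, Fintype.sum_prod_type, bubbleField_apply, pev_sum, pev_smul, pev_mul, pev_lamP,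
    Finset.sum_mul, Finset.mul_sum]
  rw [Finset.sum_comm]
  refine Finset.sum_congr rfl fun i _ => ?_
  rw [Finset.sum_comm]
  refine Finset.sum_congr rfl fun j _ => Finset.sum_congr rfl fun l _ => ?_
  ring

theorem dirD_eq_zero_of_gram {m : ℕ} {p : PolyLE d m}
    (h : gram _ (bubbleS b m) (memLp_bubbleS b m) p p = 0) (i j : Fin (d + 1)) :
    dirD b i j p = 0 := by
  refine poly_eq_zero_of_ae_cell b ?_
  filter_upwards [ae_mem_cell (verts b), ae_eq_zero_of_nrm (memLp_bubbleS b m (i, j) p)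
    (nrm_eq_zero_of_gram_self _ h (i, j))] with y hy h0
  rw [bubbleS_apply] at h0
  exact (mul_eq_zero.1 h0).resolve_left (Real.sqrt_pos.2 (coord_mul_coord_pos b hy _ _)).ne'

theorem integral_sum_mul {μ : Measure (Pt d)} {f g : Fin d → Pt d → ℝ}
    (hf : ∀ i, MemLp (f i) 2 μ) (hg : ∀ i, MemLp (g i) 2 μ) :
    ∫ y, ∑ i, f i y * g i y ∂μ = ∑ i, ∫ y, f i y * g i y ∂μ :=
  integral_finsetSum _ fun i _ => integrable_mul_of_memLp (hf i) (hg i)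

/-- Gradient moments can be prescribed by a field without normal components. -/
theorem exists_bubbleField {m : ℕ} {f : Fin d → Pt d → ℝ}
    (hf : ∀ i, MemLp (f i) 2 (volume.restrict (cell (verts b)))) :
    ∃ ψ : PolyLE d m, ∀ p : PolyLE d m, gram _ (bubbleS b m) (memLp_bubbleS b m) ψ p =
      ∫ y in cell (verts b), ∑ l, f l y * pev (MvPolynomial.pderiv l p.1) y := by
  let S : Fin d → PolyLE d m →ₗ[ℝ] (Pt d → ℝ) := fun j =>
    (pevL d ∘ₗ (MvPolynomial.pderiv j).toLinearMap) ∘ₗ (PolyLE d m).subtype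
  have hS : ∀ j p, MemLp (S j p) 2 (volume.restrict (cell (verts b))) := fun j p =>
    memLp_cell _ (continuous_pev _)
  obtain ⟨ψ, hψ⟩ := exists_riesz (gram _ (bubbleS b m) (memLp_bubbleS b m)) (gram_symm _)
    (gramFun f hf hS) (fun p h => by
      rw [gramFun_apply]
      refine Finset.sum_eq_zero fun l _ => ?_
      have : MvPolynomial.pderiv l p.1 = 0 := by
        rw [pderiv_eq_sum_dirD b p.1 0 l]
        exact Finset.sum_eq_zero fun i _ => by rw [dirD_eq_zero_of_gram b h, smul_zero]
      have e : S l p = 0 := by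
        change pev (MvPolynomial.pderiv l p.1) = 0
        rw [this]; exact funext fun y => pev_zero y
      simp [e])
  refine ⟨ψ, fun p => ?_⟩
  rw [hψ p, gramFun_apply]
  exact (integral_sum_mul (g := fun l => pev (MvPolynomial.pderiv l p.1)) hf
    fun l => memLp_cell _ (continuous_pev _)).symm

theorem memPStar_iff (hd : 0 < d) {k : ℕ} {z : Fin d → Poly d} : MemPStar (verts b) k z ↔
    (∀ i, (z i).totalDegree ≤ k) ∧ ∑ i, MvPolynomial.pderiv i (z i) = 0 ∧
    ∀ i, ∀ y ∈ convexHull ℝ (face (verts b) (b i) : Set (Pt d)), pev (nflux b i z) y = 0 := by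
  have h : ∀ i y, ∑ l, pev (z l) y * normal (verts b) (b i) l = 0 ↔ pev (nflux b i z) y = 0 := by
    intro i y
    rw [sum_mul_normal b hd i (fun l => pev (z l) y), ← pev_nflux]
    simp [(height_pos b hd i).ne']
  refine and_congr Iff.rfl (and_congr Iff.rfl ?_)
  simp only [verts, Finset.mem_map, Finset.mem_univ, true_and, Function.Embedding.coeFn_mk,
    forall_exists_index, forall_apply_eq_imp_iff]
  exact forall_congr' fun i => forall₂_congr fun y _ => h i y

/-- The space `P_k^*` of divergence-free fields without normal components. -/
def pStar (hd : 0 < d) (k : ℕ) : Submodule ℝ (Fin d → PolyLE d k) where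
  carrier := {z | MemPStar (verts b) k fun i => z i}
  zero_mem' := by
    refine (memPStar_iff b hd).2 ⟨fun i => by simp, by simp, fun i y _ => ?_⟩
    simp [pev_nflux]
  add_mem' {z w} hz hw := by
    obtain ⟨h1, h2, h3⟩ := (memPStar_iff b hd).1 hz
    obtain ⟨g1, g2, g3⟩ := (memPStar_iff b hd).1 hw
    refine (memPStar_iff b hd).2 ⟨fun i => mem_polyLE.1 (z i + w i).2, ?_, fun i y hy => ?_⟩
    · simp [Finset.sum_add_distrib, h2, g2]
    · have := h3 i y hy
      have := g3 i y hy
      simp only [pev_nflux] at *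
      simp [mul_add, Finset.sum_add_distrib, *]
  smul_mem' c z hz := by
    obtain ⟨h1, h2, h3⟩ := (memPStar_iff b hd).1 hz
    refine (memPStar_iff b hd).2 ⟨fun i => mem_polyLE.1 (c • z i).2, ?_, fun i y hy => ?_⟩
    · simp [← Finset.smul_sum, h2]
    · have := h3 i y hy
      simp only [pev_nflux] at *
      simp [mul_left_comm, ← Finset.mul_sum, *]

/-- The BDM moments of the polynomial field `w` agree with those of `f` in the element, and its
fluxes `∇λ_i · w` with the data `g i` on the faces. -/
structure BDMMoments (k : ℕ) (f : Fin d → Pt d → ℝ) (g : Fin (d + 1) → Pt d → ℝ)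
    (w : Fin d → Poly d) : Prop where
  totalDegree_le : ∀ l, (w l).totalDegree ≤ k
  face_moment : ∀ i, IsL2Proj (faceMeasure (face (verts b) (b i))) k (g i) (nflux b i w)
  grad_moment : ∀ p : Poly d, p.totalDegree ≤ k - 1 →
    ∫ y in cell (verts b), ∑ l, pev (w l) y * pev (MvPolynomial.pderiv l p) y =
      ∫ y in cell (verts b), ∑ l, f l y * pev (MvPolynomial.pderiv l p) y
  pStar_moment : ∀ z, MemPStar (verts b) k z →
    ∫ y in cell (verts b), ∑ l, pev (w l) y * pev (z l) y =
      ∫ y in cell (verts b), ∑ l, f l y * pev (z l) y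

theorem integral_mul_grad_add (hd : 0 < d) {z : Fin d → Poly d}
    (hz : ∀ i, ∀ y ∈ convexHull ℝ (face (verts b) (b i) : Set (Pt d)), pev (nflux b i z) y = 0)
    (p : Poly d) :
    ∫ y in cell (verts b), ∑ l, pev (z l) y * pev (MvPolynomial.pderiv l p) y =
      -∫ y in cell (verts b), pev (∑ l, MvPolynomial.pderiv l (z l)) y * pev p y := by
  have h := integral_div_eq_zero b hd (fun l => p * z l) fun i y hy => by
    have := hz i y hy
    rw [pev_nflux] at this
    simp only [pev_mul, mul_left_comm _ (pev p y), ← Finset.mul_sum, this, mul_zero]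
  rw [eq_neg_iff_add_eq_zero, ← integral_add (integrable_cell _ (by fun_prop))
    (integrable_cell _ (by fun_prop)), ← h]
  congr 1
  ext y
  simp only [pev_sum, Finset.sum_mul, ← Finset.sum_add_distrib]
  refine Finset.sum_congr rfl fun l _ => ?_
  simp [Derivation.leibniz]
  ring

/-- Riesz representation in `P_k^*`. -/
theorem exists_pStar_moment (hd : 0 < d) (k : ℕ) {f : Fin d → Pt d → ℝ}
    (hf : ∀ l, MemLp (f l) 2 (volume.restrict (cell (verts b)))) :
    ∃ w, MemPStar (verts b) k w ∧ ∀ z, MemPStar (verts b) k z →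
      ∫ y in cell (verts b), ∑ l, pev (w l) y * pev (z l) y =
        ∫ y in cell (verts b), ∑ l, f l y * pev (z l) y := by
  have hpC : ∀ p : Poly d, MemLp (pev p) 2 (volume.restrict (cell (verts b))) :=
    fun p => memLp_cell _ (continuous_pev p)
  let S : Fin d → (Fin d → PolyLE d k) →ₗ[ℝ] (Pt d → ℝ) := fun l =>
    pevL d ∘ₗ (PolyLE d k).subtype ∘ₗ LinearMap.proj l
  have hS : ∀ l z, MemLp (S l z) 2 (volume.restrict (cell (verts b))) := fun l z => hpC _
  obtain ⟨w, hwW, hw⟩ := exists_riesz_submodule (pStar b hd k) (gram _ S hS) (gram_symm hS)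
    (gramFun f hf hS) fun p h => gramFun_eq_zero hS _ _ h
  refine ⟨fun l => w l, hwW, fun z hz => ?_⟩
  have h1 := hw (fun l => ⟨z l, mem_polyLE.2 (((memPStar_iff b hd).1 hz).1 l)⟩) hz
  rw [gram_apply, gramFun_apply] at h1
  rw [integral_sum_mul (f := fun l => pev (w l : Poly d)) (g := fun l => pev (z l))
      (fun l => hpC _) fun l => hpC _, integral_sum_mul (g := fun l => pev (z l)) hf fun l => hpC _]
  exact h1

theorem exists_bdmMoments (hd : 0 < d) {k : ℕ} (hk : 1 ≤ k) {f : Fin d → Pt d → ℝ}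
    (hf : ∀ l, MemLp (f l) 2 (volume.restrict (cell (verts b)))) {g : Fin (d + 1) → Pt d → ℝ}
    (hg : ∀ i, MemLp (g i) 2 (faceMeasure (face (verts b) (b i)))) :
    ∃ w, BDMMoments b k f g w := by
  have hpF : ∀ i (p : Poly d), MemLp (pev p) 2 (faceMeasure (face (verts b) (b i))) :=
    fun i p => memLp_face b hd i (continuous_pev p)
  have hpC : ∀ p : Poly d, MemLp (pev p) 2 (volume.restrict (cell (verts b))) :=
    fun p => memLp_cell _ (continuous_pev p)
  choose q hq using fun i => exists_isL2Proj (hpF i) k (hg i)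
  obtain ⟨w₁, hw₁, hn₁⟩ := exists_nflux_eq b hk q fun i => (hq i).1
  have hf₁ : ∀ l, MemLp (fun y => f l y - pev (w₁ l) y) 2 (volume.restrict (cell (verts b))) :=
    fun l => (hf l).sub (hpC _)
  obtain ⟨ψ, hψ⟩ := exists_bubbleField b (m := k - 1) hf₁
  set w₂ := bubbleField b ψ
  have hw₂ : ∀ l, (w₂ l).totalDegree ≤ k :=
    totalDegree_bubbleField_le b hk (mem_polyLE.1 ψ.2)
  have hf₂ : ∀ l, MemLp (fun y => f l y - pev (w₁ l) y - pev (w₂ l) y) 2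
    (volume.restrict (cell (verts b))) := fun l => (hf₁ l).sub (hpC _)
  obtain ⟨w₃, hzP, hz⟩ := exists_pStar_moment b hd k hf₂
  obtain ⟨hz1, hz2, hz3⟩ := (memPStar_iff b hd).1 hzP
  refine ⟨w₁ + w₂ + w₃, fun l => ?_, fun i => ⟨?_, fun p hp => ?_⟩, fun p hp => ?_,
    fun y hy => ?_⟩
  · exact mem_polyLE.1 (add_mem (add_mem (mem_polyLE.2 (hw₁ l)) (mem_polyLE.2 (hw₂ l)))
      (mem_polyLE.2 (hz1 l)))
  · refine totalDegree_nflux_le b i fun l => ?_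
    exact mem_polyLE.1 (add_mem (add_mem (mem_polyLE.2 (hw₁ l)) (mem_polyLE.2 (hw₂ l)))
      (mem_polyLE.2 (hz1 l)))
  · rw [← (hq i).2 p hp]
    refine integral_congr_ae ?_
    filter_upwards [ae_mem_hull_face (face (verts b) (b i))] with y hy
    rw [map_add, map_add, pev_add, pev_add, hn₁ i y hy, pev_nflux_bubbleField b _ i hy, hz3 i y hy,
      add_zero, add_zero]
  · have h1 := hψ ⟨p, mem_polyLE.2 hp⟩
    rw [← integral_bubbleField] at h1
    have h2 := integral_mul_grad_add b hd hz3 p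
    rw [hz2] at h2
    simp only [pev_zero, zero_mul, integral_zero, neg_zero] at h2
    have e : ∀ y, ∑ l, pev ((w₁ + w₂ + w₃) l) y * pev (MvPolynomial.pderiv l p) y =
        ∑ l, pev (w₁ l) y * pev (MvPolynomial.pderiv l p) y +
        (∑ l, pev (w₂ l) y * pev (MvPolynomial.pderiv l p) y +
        ∑ l, pev (w₃ l) y * pev (MvPolynomial.pderiv l p) y) := by
      intro y
      simp only [← Finset.sum_add_distrib]
      exact Finset.sum_congr rfl fun l _ => by simp; ring
    have e' : ∀ y, ∑ l, (f l y - pev (w₁ l) y) * pev (MvPolynomial.pderiv l p) y =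
        ∑ l, f l y * pev (MvPolynomial.pderiv l p) y -
        ∑ l, pev (w₁ l) y * pev (MvPolynomial.pderiv l p) y := by
      intro y
      simp only [← Finset.sum_sub_distrib, sub_mul]
    have i1 : Integrable (fun y => ∑ l, f l y * pev (MvPolynomial.pderiv l p) y)
        (volume.restrict (cell (verts b))) :=
      integrable_finsetSum _ fun l _ => integrable_mul_of_memLp (hf l) (hpC _)
    simp_rw [e'] at h1
    rw [integral_sub i1 (integrable_cell _ (by fun_prop))] at h1
    simp_rw [e]
    rw [integral_add (integrable_cell _ (by fun_prop)) (integrable_cell _ (by fun_prop)),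
      integral_add (integrable_cell _ (by fun_prop)) (integrable_cell _ (by fun_prop)), h2, h1]
    ring
  · have h1 := hz y hy
    have e1 : ∀ x, ∑ l, pev ((w₁ + w₂ + w₃) l) x * pev (y l) x =
        ∑ l, (pev (w₁ l) x + pev (w₂ l) x) * pev (y l) x + ∑ l, pev (w₃ l) x * pev (y l) x := by
      intro x
      simp only [← Finset.sum_add_distrib]
      exact Finset.sum_congr rfl fun l _ => by simp only [Pi.add_apply, pev_add]; ring
    have e2 : ∀ x, ∑ l, (f l x - pev (w₁ l) x - pev (w₂ l) x) * pev (y l) x =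
        ∑ l, f l x * pev (y l) x - ∑ l, (pev (w₁ l) x + pev (w₂ l) x) * pev (y l) x := by
      intro x
      simp only [← Finset.sum_sub_distrib]
      exact Finset.sum_congr rfl fun l _ => by ring
    have i1 : Integrable (fun x => ∑ l, f l x * pev (y l) x)
        (volume.restrict (cell (verts b))) :=
      integrable_finsetSum _ fun l _ => integrable_mul_of_memLp (hf l) (hpC _)
    simp_rw [e2] at h1
    rw [integral_sub i1 (integrable_cell _ (by fun_prop))] at h1
    simp_rw [e1]
    rw [integral_add (integrable_cell _ (by fun_prop)) (integrable_cell _ (by fun_prop)), h1]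
    ring

end Moments

/-! ### Stability of the BDM projection -/

section Stability

variable {d : ℕ}

/-- The sum of the `L²` norms of the components of a field. -/
def vnrm (μ : Measure (Pt d)) (f : Fin d → Pt d → ℝ) : ℝ := ∑ l, nrm μ (f l)

theorem vnrm_nonneg (μ : Measure (Pt d)) (f : Fin d → Pt d → ℝ) : 0 ≤ vnrm μ f :=
  Finset.sum_nonneg fun _ _ => nrm_nonneg _ _

theorem nrm_le_vnrm (μ : Measure (Pt d)) (f : Fin d → Pt d → ℝ) (l : Fin d) :
    nrm μ (f l) ≤ vnrm μ f :=
  Finset.single_le_sum (f := fun l => nrm μ (f l)) (fun _ _ => nrm_nonneg _ _) (Finset.mem_univ l)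

theorem vnrm_le {μ : Measure (Pt d)} {f : Fin d → Pt d → ℝ} {M : ℝ} (h : ∀ l, nrm μ (f l) ≤ M) :
    vnrm μ f ≤ d * M := by
  refine (Finset.sum_le_sum fun l _ => h l).trans ?_
  simp

theorem abs_integral_sum_mul_le {μ : Measure (Pt d)} {f g : Fin d → Pt d → ℝ}
    (hf : ∀ i, MemLp (f i) 2 μ) (hg : ∀ i, MemLp (g i) 2 μ) :
    |∫ y, ∑ i, f i y * g i y ∂μ| ≤ vnrm μ f * vnrm μ g := by
  rw [integral_sum_mul hf hg]
  calc _ ≤ ∑ i, |∫ y, f i y * g i y ∂μ| := Finset.abs_sum_le_sum_abs _ _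
    _ ≤ ∑ i, nrm μ (f i) * vnrm μ g := by
        refine Finset.sum_le_sum fun i _ => (abs_integral_mul_le (hf i) (hg i)).trans ?_
        exact mul_le_mul_of_nonneg_left (nrm_le_vnrm μ g i) (nrm_nonneg _ _)
    _ = _ := by rw [← Finset.sum_mul]; rfl

theorem vnrm_sub_le {μ : Measure (Pt d)} {f g : Fin d → Pt d → ℝ}
    (hf : ∀ i, MemLp (f i) 2 μ) (hg : ∀ i, MemLp (g i) 2 μ) :
    vnrm μ (fun l y => f l y - g l y) ≤ vnrm μ f + vnrm μ g := by
  rw [vnrm, vnrm, vnrm, ← Finset.sum_add_distrib]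
  exact Finset.sum_le_sum fun l _ => nrm_sub_le (hf l) (hg l)

theorem vnrm_add_le {μ : Measure (Pt d)} {f g : Fin d → Pt d → ℝ}
    (hf : ∀ i, MemLp (f i) 2 μ) (hg : ∀ i, MemLp (g i) 2 μ) :
    vnrm μ (fun l y => f l y + g l y) ≤ vnrm μ f + vnrm μ g := by
  rw [vnrm, vnrm, vnrm, ← Finset.sum_add_distrib]
  exact Finset.sum_le_sum fun l _ => nrm_add_le (hf l) (hg l)

theorem vnrm_sq_le {μ : Measure (Pt d)} {f : Fin d → Pt d → ℝ} (hf : ∀ i, MemLp (f i) 2 μ) :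
    vnrm μ f ^ 2 ≤ d * ∫ y, ∑ i, f i y * f i y ∂μ := by
  rw [integral_sum_mul hf hf]
  have h := sq_sum_le_card_mul_sum_sq (s := Finset.univ) (f := fun l => nrm μ (f l))
  simp only [nrm_sq (hf _), Finset.card_univ, Fintype.card_fin, sq] at h
  simpa only [vnrm, sq] using h

variable (b : AffineBasis (Fin (d + 1)) ℝ (Pt d))

theorem abs_vertex_sub_le (i j : Fin (d + 1)) (l : Fin d) : |b i l - b j l| ≤ diamT (verts b) := by
  have h1 : |b i l - b j l| ≤ ‖b i - b j‖ := by
    simpa using PiLp.norm_apply_le (b i - b j) l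
  rw [← dist_eq_norm] at h1
  exact h1.trans (dist_le_diamT (vertex_mem_hull b i) (vertex_mem_hull b j))

theorem nrm_le_sum_nflux (w : Fin d → Poly d) (l : Fin d) :
    nrm (volume.restrict (cell (verts b))) (pev (w l)) ≤
      diamT (verts b) * ∑ i, nrm (volume.restrict (cell (verts b))) (pev (nflux b i w)) := by
  have e : pev (w l) = fun y => ∑ i, (b i l - b 0 l) * pev (nflux b i w) y := by
    funext y
    conv_lhs => rw [eq_sum_nflux b w (b 0) l]
    simp
  rw [e, Finset.mul_sum]
  refine (nrm_sum_le _ fun i _ => memLp_cell _ (by fun_prop)).trans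
    (Finset.sum_le_sum fun i _ => ?_)
  rw [nrm_const_mul]
  exact mul_le_mul_of_nonneg_right (abs_vertex_sub_le b i 0 l) (nrm_nonneg _ _)

theorem coord_mul_coord_le_one {y : Pt d} (hy : y ∈ cell (verts b)) (i j : Fin (d + 1)) :
    b.coord i y * b.coord j y ≤ 1 := by
  rw [cell_verts] at hy
  have h : ∀ i, b.coord i y ≤ 1 := fun i => by
    rw [← b.sum_coord_apply_eq_one y]
    exact Finset.single_le_sum (f := fun i => b.coord i y) (fun j _ => (hy j).le)
      (Finset.mem_univ i)
  have h1 := mul_le_mul (h i) (h j) (hy j).le zero_le_one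
  simpa using h1

theorem integral_weighted_dirD_le {m : ℕ} (ψ : PolyLE d m) (i j : Fin (d + 1)) :
    ∫ y in cell (verts b), b.coord i y * b.coord j y * pev (dirD b i j ψ) y ^ 2 ≤
      gram _ (bubbleS b m) (memLp_bubbleS b m) ψ ψ := by
  rw [gram_self]
  refine le_trans (le_of_eq ?_) (Finset.single_le_sum
    (f := fun ij => nrm (volume.restrict (cell (verts b))) (bubbleS b m ij ψ) ^ 2)
    (fun _ _ => sq_nonneg _) (Finset.mem_univ (i, j)))
  rw [nrm_sq (memLp_bubbleS b m (i, j) ψ)]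
  refine integral_congr_ae ?_
  filter_upwards [ae_mem_cell (verts b)] with y hy
  rw [bubbleS_apply, mul_pow, Real.sq_sqrt (coord_mul_coord_pos b hy _ _).le]

theorem nrm_bubbleField_le {m : ℕ} (ψ : PolyLE d m) (l : Fin d) :
    nrm (volume.restrict (cell (verts b))) (pev (bubbleField b ψ l)) ≤
      (d + 1) ^ 2 * diamT (verts b) *
        Real.sqrt (gram _ (bubbleS b m) (memLp_bubbleS b m) ψ ψ) := by
  set μ := (volume : Measure (Pt d)).restrict (cell (verts b))
  set E := gram _ (bubbleS b m) (memLp_bubbleS b m) ψ ψ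
  have hE : 0 ≤ E := gram_self_nonneg _ _
  have h1 : ∀ i j, nrm μ (pev (lamP b i * lamP b j * dirD b i j ψ)) ≤ Real.sqrt E := by
    intro i j
    refine nrm_le_of_sq_le (memLp_cell _ (continuous_pev _)) (Real.sqrt_nonneg _) ?_
    rw [Real.sq_sqrt hE]
    refine le_trans ?_ (integral_weighted_dirD_le b ψ i j)
    have hc : Continuous fun y => b.coord i y * b.coord j y * pev (dirD b i j ψ) y ^ 2 :=
      ((continuous_barycentric_coord b i).mul (continuous_barycentric_coord b j)).mul (by fun_prop)
    refine integral_mono_ae (integrable_cell _ (by fun_prop)) (integrable_cell _ hc) ?_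
    filter_upwards [ae_mem_cell (verts b)] with y hy
    have e1 := coord_mul_coord_pos b hy i j
    have e2 := coord_mul_coord_le_one b hy i j
    simp only [pev_mul, pev_lamP, mul_pow]
    rw [← mul_pow]
    have := mul_le_mul_of_nonneg_left e2 e1.le
    have e3 : (b.coord i y * b.coord j y) ^ 2 ≤ b.coord i y * b.coord j y := by
      rw [sq]; simpa using this
    exact mul_le_mul_of_nonneg_right e3 (sq_nonneg _)
  have e : pev (bubbleField b ψ l) = fun y => ∑ ij : Fin (d + 1) × Fin (d + 1),
      (b ij.1 l - b ij.2 l) * pev (lamP b ij.1 * lamP b ij.2 * dirD b ij.1 ij.2 ψ) y := by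
    funext y
    rw [bubbleField_apply, Fintype.sum_prod_type]
    simp only [pev_sum, pev_smul]
  rw [e]
  calc _ ≤ ∑ ij : Fin (d + 1) × Fin (d + 1), diamT (verts b) * Real.sqrt E := by
        refine (nrm_sum_le _ fun i _ => memLp_cell _ (by fun_prop)).trans
          (Finset.sum_le_sum fun ij _ => ?_)
        rw [nrm_const_mul]
        exact mul_le_mul (abs_vertex_sub_le b _ _ l) (h1 _ _) (nrm_nonneg _ _) Metric.diam_nonneg
    _ = _ := by
        simp [Finset.card_univ]
        ring

theorem diamT_mul_nrm_pderiv_le (hd : 0 < d) {σ C : ℝ}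
    (hσ : ∀ i, diamT (verts b) ≤ σ * height b i) (hC : 0 ≤ C) {m : ℕ} (ψ : PolyLE d m)
    (h : ∀ (i j : Fin (d + 1)) (p : Poly d), p.totalDegree ≤ m →
      nrm (volume.restrict (cell (verts b))) (pev p) ^ 2 ≤
        C * ∫ y in cell (verts b), b.coord i y * b.coord j y * pev p y ^ 2) (l : Fin d) :
    diamT (verts b) * nrm (volume.restrict (cell (verts b))) (pev (MvPolynomial.pderiv l ψ.1)) ≤
      (d + 1) * σ * Real.sqrt C *
        Real.sqrt (gram _ (bubbleS b m) (memLp_bubbleS b m) ψ ψ) := by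
  set μ := (volume : Measure (Pt d)).restrict (cell (verts b))
  set E := gram _ (bubbleS b m) (memLp_bubbleS b m) ψ ψ
  have hE : 0 ≤ E := gram_self_nonneg _ _
  have hh := diamT_pos b hd
  have hσ0 : 0 < σ := pos_of_mul_pos_left (hh.trans_le (hσ 0)) (height_pos b hd 0).le
  have h1 : ∀ i, nrm μ (pev (dirD b i 0 ψ)) ≤ Real.sqrt C * Real.sqrt E := by
    intro i
    refine le_of_abs_le (abs_le_of_sq_le_sq ?_ (by positivity))
    rw [mul_pow, Real.sq_sqrt hC, Real.sq_sqrt hE]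
    refine (h i 0 _ ((totalDegree_dirD_le b i 0 _).trans
      ((Nat.sub_le _ _).trans (mem_polyLE.1 ψ.2)))).trans ?_
    exact mul_le_mul_of_nonneg_left (integral_weighted_dirD_le b ψ i 0) hC
  have e : pev (MvPolynomial.pderiv l ψ.1) = fun y => ∑ i, grad b i l * pev (dirD b i 0 ψ) y := by
    funext y
    rw [pderiv_eq_sum_dirD b ψ.1 0 l]
    simp
  rw [e]
  calc _ ≤ diamT (verts b) * ∑ i, |grad b i l| * nrm μ (pev (dirD b i 0 ψ)) := by
        gcongr
        refine (nrm_sum_le _ fun i _ => memLp_cell _ (by fun_prop)).trans (le_of_eq ?_)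
        exact Finset.sum_congr rfl fun i _ => nrm_const_mul _ _
    _ = ∑ i, (diamT (verts b) * |grad b i l|) * nrm μ (pev (dirD b i 0 ψ)) := by
        rw [Finset.mul_sum]
        exact Finset.sum_congr rfl fun i _ => by ring
    _ ≤ ∑ _i : Fin (d + 1), σ * (Real.sqrt C * Real.sqrt E) :=
        Finset.sum_le_sum fun i _ => mul_le_mul (abs_grad_le b hd (hσ i) l) (h1 i)
          (nrm_nonneg _ _) hσ0.le
    _ = _ := by
        simp
        ring

/-- A polynomial field without normal components and gradient moments belongs to `P_k^*`. -/
theorem memPStar_of_moments (hd : 0 < d) {k : ℕ} {z : Fin d → Poly d}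
    (hz : ∀ l, (z l).totalDegree ≤ k)
    (hn : ∀ i, ∀ y ∈ convexHull ℝ (face (verts b) (b i) : Set (Pt d)), pev (nflux b i z) y = 0)
    (hg : ∀ p : Poly d, p.totalDegree ≤ k - 1 →
      ∫ y in cell (verts b), ∑ l, pev (z l) y * pev (MvPolynomial.pderiv l p) y = 0) :
    MemPStar (verts b) k z := by
  refine (memPStar_iff b hd).2 ⟨hz, ?_, hn⟩
  set p := ∑ i, MvPolynomial.pderiv i (z i)
  have hp : p.totalDegree ≤ k - 1 := MvPolynomial.totalDegree_finsetSum_le fun l _ =>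
    (totalDegree_pderiv_le l _).trans (Nat.sub_le_sub_right (hz l) 1)
  have h1 := integral_mul_grad_add b hd hn p
  rw [hg p hp, eq_comm, neg_eq_zero] at h1
  have hm : MemLp (pev p) 2 (volume.restrict (cell (verts b))) := memLp_cell _ (continuous_pev p)
  have h2 := nrm_sq hm
  simp only [sq] at h2
  change ∫ y in cell (verts b), pev p y * pev p y = 0 at h1
  rw [h1] at h2
  exact poly_eq_zero_of_ae_cell b (ae_eq_zero_of_nrm hm (mul_self_eq_zero.1 h2))

theorem nrm_nflux_lift_le (hd : 0 < d) {C : ℝ} (hC : 0 ≤ C) {w : Fin d → Poly d}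
    {g : Fin (d + 1) → ℝ} {t : ℝ}
    (hg : ∀ l, nrm (faceMeasure (face (verts b) (b l))) (pev (nflux b l w)) ≤ g l)
    (h : t ^ 2 ≤ C * ∑ l, height b l *
      nrm (faceMeasure (face (verts b) (b l))) (pev (nflux b l w)) ^ 2) :
    t ≤ Real.sqrt C * (Real.sqrt (diamT (verts b)) * ∑ l, g l) := by
  have hh := diamT_pos b hd
  have hg0 : ∀ l, 0 ≤ g l := fun l => (nrm_nonneg _ _).trans (hg l)
  have hG := Finset.sum_nonneg fun l (_ : l ∈ Finset.univ) => hg0 l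
  refine le_of_abs_le (abs_le_of_sq_le_sq ?_ (by positivity))
  rw [mul_pow, mul_pow, Real.sq_sqrt hC, Real.sq_sqrt hh.le]
  refine h.trans (mul_le_mul_of_nonneg_left ?_ hC)
  calc _ ≤ ∑ l, diamT (verts b) * g l ^ 2 := by
        refine Finset.sum_le_sum fun l _ => mul_le_mul (height_le_diamT b hd l) ?_
          (sq_nonneg _) hh.le
        exact pow_le_pow_left₀ (nrm_nonneg _ _) (hg l) 2
    _ ≤ _ := by
        rw [← Finset.mul_sum]
        exact mul_le_mul_of_nonneg_left (Finset.sum_sq_le_sq_sum_of_nonneg fun l _ => hg0 l) hh.le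

/-- Stability of the projection defined by the BDM moments. -/
theorem exists_bdm_stability (a : AffineBasis (Fin (d + 1)) ℝ (Pt d)) (hd : 0 < d) {k : ℕ}
    (hk : 1 ≤ k) (σ : ℝ) : ∃ C > (0 : ℝ), ∀ b : AffineBasis (Fin (d + 1)) ℝ (Pt d),
      (∀ i, diamT (verts b) ≤ σ * height b i) → ∀ (f : Fin d → Pt d → ℝ)
      (g : Fin (d + 1) → Pt d → ℝ) (w : Fin d → Poly d),
      (∀ l, MemLp (f l) 2 (volume.restrict (cell (verts b)))) →
      (∀ i, MemLp (g i) 2 (faceMeasure (face (verts b) (b i)))) → BDMMoments b k f g w →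
      vnrm (volume.restrict (cell (verts b))) (fun l => pev (w l)) ≤
        C * (vnrm (volume.restrict (cell (verts b))) f + diamT (verts b) *
          (Real.sqrt (diamT (verts b)) * ∑ i, nrm (faceMeasure (face (verts b) (b i))) (g i))) := by
  obtain ⟨C₁, hC₁, hlift⟩ := exists_normal_lift a hd k
  obtain ⟨C₂, hC₂, hwt⟩ := exists_weighted_bound a (k - 1)
  set A₁ : ℝ := d * ((d + 1) * Real.sqrt C₁)
  set A₂ : ℝ := d * ((d + 1) * |σ| * Real.sqrt C₂)
  set A₃ : ℝ := d * ((d + 1) ^ 2 * A₂)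
  refine ⟨(1 + d) * (A₁ + A₃ * (1 + A₁)) + d, by positivity, fun b hσ f g w hf hg hw => ?_⟩
  have hh := diamT_pos b hd
  have hσ0 : 0 < σ := pos_of_mul_pos_left (hh.trans_le (hσ 0)) (height_pos b hd 0).le
  set μ := (volume : Measure (Pt d)).restrict (cell (verts b))
  set h := diamT (verts b)
  set G := ∑ i, nrm (faceMeasure (face (verts b) (b i))) (g i)
  have hG : 0 ≤ G := Finset.sum_nonneg fun i _ => nrm_nonneg _ _
  set R := vnrm μ f + h * (Real.sqrt h * G)
  have hf0 := vnrm_nonneg μ f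
  have hpC : ∀ p : Poly d, MemLp (pev p) 2 μ := fun p => memLp_cell _ (continuous_pev p)
  have hfR : vnrm μ f ≤ R := le_add_of_nonneg_right (by positivity)
  have hR : 0 ≤ R := hf0.trans hfR
  obtain ⟨w₁, hw₁, hn₁, hb₁⟩ := hlift b w hw.totalDegree_le
  -- the lifting of the normal components
  have hv₁ : vnrm μ (fun l => pev (w₁ l)) ≤ A₁ * R := by
    have hgl : ∀ l, nrm (faceMeasure (face (verts b) (b l))) (pev (nflux b l w)) ≤
        nrm (faceMeasure (face (verts b) (b l))) (g l) := fun l =>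
      (hw.face_moment l).nrm_le (fun p => memLp_face b hd l (continuous_pev p)) (hg l)
    have h1 : ∀ i, nrm μ (pev (nflux b i w₁)) ≤ Real.sqrt C₁ * (Real.sqrt h * G) := fun i =>
      nrm_nflux_lift_le b hd hC₁.le hgl (hb₁ i)
    have h2 : ∀ l, nrm μ (pev (w₁ l)) ≤
        (d + 1) * Real.sqrt C₁ * (h * (Real.sqrt h * G)) := by
      intro l
      refine (nrm_le_sum_nflux b w₁ l).trans ?_
      have h3 := Finset.sum_le_sum fun i (_ : i ∈ Finset.univ) => h1 i
      simp only [Finset.sum_const, Finset.card_univ, Fintype.card_fin, nsmul_eq_mul] at h3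
      refine (mul_le_mul_of_nonneg_left h3 hh.le).trans (le_of_eq ?_)
      push_cast
      ring
    have h4 : h * (Real.sqrt h * G) ≤ R := le_add_of_nonneg_left hf0
    refine (vnrm_le h2).trans ?_
    rw [← mul_assoc]
    exact mul_le_mul_of_nonneg_left h4 (by positivity)
  have hf₁ : ∀ l, MemLp (fun y => f l y - pev (w₁ l) y) 2 μ := fun l => (hf l).sub (hpC _)
  have hF₁ : vnrm μ (fun l y => f l y - pev (w₁ l) y) ≤ (1 + A₁) * R := by
    have := vnrm_sub_le hf (fun l => hpC (w₁ l))
    linarith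
  -- the gradient moments
  obtain ⟨ψ, hψ⟩ := exists_bubbleField b (m := k - 1) hf₁
  set E := gram _ (bubbleS b (k - 1)) (memLp_bubbleS b (k - 1)) ψ ψ
  have hE : 0 ≤ E := gram_self_nonneg _ _
  set s := Real.sqrt E
  have hs : 0 ≤ s := Real.sqrt_nonneg E
  have hgrad : h * vnrm μ (fun l => pev (MvPolynomial.pderiv l ψ.1)) ≤ A₂ * s := by
    have h1 := fun l => diamT_mul_nrm_pderiv_le b hd hσ hC₂.le ψ (hwt b) l
    have h2 := Finset.sum_le_sum fun l (_ : l ∈ Finset.univ) => h1 l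
    rw [← Finset.mul_sum] at h2
    refine h2.trans (le_of_eq ?_)
    simp only [Finset.sum_const, Finset.card_univ, Fintype.card_fin, nsmul_eq_mul, A₂,
      abs_of_pos hσ0]
    ring
  have hsb : h * s ≤ A₂ * ((1 + A₁) * R) := by
    have h1 := hψ ψ
    have h2 := abs_integral_sum_mul_le (g := fun l => pev (MvPolynomial.pderiv l ψ.1)) hf₁
      fun l => hpC _
    rw [← h1, abs_of_nonneg hE, ← Real.mul_self_sqrt hE] at h2
    rcases hs.eq_or_lt with h0 | h0
    · rw [← h0, mul_zero]
      positivity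
    · refine le_of_mul_le_mul_right ?_ h0
      calc h * s * s = h * (s * s) := by ring
        _ ≤ h * (vnrm μ (fun l y => f l y - pev (w₁ l) y) *
            vnrm μ (fun l => pev (MvPolynomial.pderiv l ψ.1))) :=
            mul_le_mul_of_nonneg_left h2 hh.le
        _ = vnrm μ (fun l y => f l y - pev (w₁ l) y) *
            (h * vnrm μ (fun l => pev (MvPolynomial.pderiv l ψ.1))) := by ring
        _ ≤ ((1 + A₁) * R) * (A₂ * s) := mul_le_mul hF₁ hgrad
            (mul_nonneg hh.le (vnrm_nonneg _ _)) (by positivity)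
        _ = _ := by ring
  set w₂ := bubbleField b ψ
  have hv₂ : vnrm μ (fun l => pev (w₂ l)) ≤ A₃ * (1 + A₁) * R := by
    refine (vnrm_le fun l => nrm_bubbleField_le b ψ l).trans ?_
    calc (d : ℝ) * ((d + 1) ^ 2 * h * s) = d * (d + 1) ^ 2 * (h * s) := by ring
      _ ≤ d * (d + 1) ^ 2 * (A₂ * ((1 + A₁) * R)) := by gcongr
      _ = _ := by simp only [A₃]; ring
  -- the remainder belongs to `P_k^*`
  set z : Fin d → Poly d := fun l => w l - w₁ l - w₂ l
  have hzP : MemPStar (verts b) k z := by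
    refine memPStar_of_moments b hd (fun l => ?_) (fun i y hy => ?_) fun p hp => ?_
    · exact mem_polyLE.1 (sub_mem (sub_mem (mem_polyLE.2 (hw.totalDegree_le l))
        (mem_polyLE.2 (hw₁ l))) (mem_polyLE.2
          (totalDegree_bubbleField_le b hk (mem_polyLE.1 ψ.2) l)))
    · have e : z = w - w₁ - w₂ := rfl
      rw [e, map_sub, map_sub, pev_sub, pev_sub, hn₁ i y hy, pev_nflux_bubbleField b _ i hy]
      ring
    · have h1 := hψ ⟨p, mem_polyLE.2 hp⟩
      rw [← integral_bubbleField] at h1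
      have h2 := hw.grad_moment p hp
      have e : ∀ y, ∑ l, pev (z l) y * pev (MvPolynomial.pderiv l p) y =
          ∑ l, pev (w l) y * pev (MvPolynomial.pderiv l p) y -
          (∑ l, pev (w₁ l) y * pev (MvPolynomial.pderiv l p) y +
          ∑ l, pev (w₂ l) y * pev (MvPolynomial.pderiv l p) y) := by
        intro y
        simp only [← Finset.sum_add_distrib, ← Finset.sum_sub_distrib]
        exact Finset.sum_congr rfl fun l _ => by simp only [z, pev_sub]; ring
      have e' : ∀ y, ∑ l, (f l y - pev (w₁ l) y) * pev (MvPolynomial.pderiv l p) y =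
          ∑ l, f l y * pev (MvPolynomial.pderiv l p) y -
          ∑ l, pev (w₁ l) y * pev (MvPolynomial.pderiv l p) y := by
        intro y
        simp only [← Finset.sum_sub_distrib, sub_mul]
      have i1 : Integrable (fun y => ∑ l, f l y * pev (MvPolynomial.pderiv l p) y) μ :=
        integrable_finsetSum _ fun l _ => integrable_mul_of_memLp (hf l) (hpC _)
      simp_rw [e'] at h1
      rw [integral_sub i1 (integrable_cell _ (by fun_prop))] at h1
      simp_rw [e]
      rw [integral_sub (integrable_cell _ (by fun_prop)) (integrable_cell _ (by fun_prop)),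
        integral_add (integrable_cell _ (by fun_prop)) (integrable_cell _ (by fun_prop)), h2, h1]
      ring
  have hv₃ : vnrm μ (fun l => pev (z l)) ≤ d * (R + A₁ * R + A₃ * (1 + A₁) * R) := by
    have hf₂ : ∀ l, MemLp (fun y => f l y - pev (w₁ l) y - pev (w₂ l) y) 2 μ :=
      fun l => (hf₁ l).sub (hpC _)
    have h1 := hw.pStar_moment z hzP
    have e1 : ∫ y in cell (verts b), ∑ l, pev (z l) y * pev (z l) y =
        ∫ y in cell (verts b), ∑ l, (f l y - pev (w₁ l) y - pev (w₂ l) y) * pev (z l) y := by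
      have i1 : Integrable (fun y => ∑ l, f l y * pev (z l) y) μ :=
        integrable_finsetSum _ fun l _ => integrable_mul_of_memLp (hf l) (hpC _)
      have e2 : ∀ y, ∑ l, pev (z l) y * pev (z l) y = ∑ l, pev (w l) y * pev (z l) y -
          ∑ l, (pev (w₁ l) y + pev (w₂ l) y) * pev (z l) y := by
        intro y
        simp only [← Finset.sum_sub_distrib]
        exact Finset.sum_congr rfl fun l _ => by
          have : pev (z l) y = pev (w l) y - pev (w₁ l) y - pev (w₂ l) y := by
            simp only [z, pev_sub]
          rw [← sub_mul, this]; ring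
      have e3 : ∀ y, ∑ l, (f l y - pev (w₁ l) y - pev (w₂ l) y) * pev (z l) y =
          ∑ l, f l y * pev (z l) y - ∑ l, (pev (w₁ l) y + pev (w₂ l) y) * pev (z l) y := by
        intro y
        simp only [← Finset.sum_sub_distrib]
        exact Finset.sum_congr rfl fun l _ => by ring
      simp_rw [e2, e3]
      rw [integral_sub (integrable_cell _ (by fun_prop)) (integrable_cell _ (by fun_prop)),
        integral_sub i1 (integrable_cell _ (by fun_prop)), h1]
    have h2 := vnrm_sq_le (fun l => hpC (z l))
    have h3 := abs_integral_sum_mul_le (g := fun l => pev (z l)) hf₂ fun l => hpC _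
    rw [e1] at h2
    have h4 : vnrm μ (fun l y => f l y - pev (w₁ l) y - pev (w₂ l) y) ≤
        R + A₁ * R + A₃ * (1 + A₁) * R := by
      have := vnrm_sub_le hf₁ (fun l => hpC (w₂ l))
      linarith
    have hz0 := vnrm_nonneg μ (fun l => pev (z l))
    have h5 : vnrm μ (fun l => pev (z l)) ^ 2 ≤
        d * ((R + A₁ * R + A₃ * (1 + A₁) * R) * vnrm μ (fun l => pev (z l))) := by
      refine h2.trans (mul_le_mul_of_nonneg_left ?_ (Nat.cast_nonneg d))
      exact (le_abs_self _).trans (h3.trans (mul_le_mul_of_nonneg_right h4 hz0))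
    rcases hz0.eq_or_lt with h0 | h0
    · rw [← h0]; positivity
    · refine le_of_mul_le_mul_right ?_ h0
      rw [← sq]
      refine h5.trans (le_of_eq (by ring))
  have hsum : vnrm μ (fun l => pev (w l)) ≤ vnrm μ (fun l => pev (w₁ l)) +
      vnrm μ (fun l => pev (w₂ l)) + vnrm μ (fun l => pev (z l)) := by
    have e : (fun l => pev (w l)) = fun l y => (pev (w₁ l) y + pev (w₂ l) y) + pev (z l) y := by
      funext l y
      simp [z]
    rw [e]
    have h1 := vnrm_add_le (μ := μ) (f := fun l y => pev (w₁ l) y + pev (w₂ l) y)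
      (fun l => (hpC (w₁ l)).add (hpC (w₂ l))) fun l => hpC (z l)
    have h2 := vnrm_add_le (fun l => hpC (w₁ l)) fun l => hpC (w₂ l)
    linarith
  calc _ ≤ _ := hsum
    _ ≤ A₁ * R + A₃ * (1 + A₁) * R + d * (R + A₁ * R + A₃ * (1 + A₁) * R) := by linarith
    _ = _ := by ring

end Stability

/-! ### Divergence-free polynomial fields in the plane -/

section Planar

theorem pderiv_pderiv_comm {d : ℕ} (i j : Fin d) (p : Poly d) :
    MvPolynomial.pderiv i (MvPolynomial.pderiv j p) =
      MvPolynomial.pderiv j (MvPolynomial.pderiv i p) := by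
  refine poly_ext fun y => ?_
  rw [← partialD_pev, ← partialD_pev, ← partialD_pev, ← partialD_pev,
    partialD_comm (contDiff_pev p)]

/-- The operator that divides the monomials of degree `n` by `n + c`. -/
def degDiv (d c : ℕ) : Poly d →ₗ[ℝ] Poly d :=
  (MvPolynomial.basisMonomials (Fin d) ℝ).constr ℝ fun s =>
    MvPolynomial.monomial s ((s.degree + c : ℝ)⁻¹)

theorem degDiv_monomial (d c : ℕ) (s : Fin d →₀ ℕ) (r : ℝ) :
    degDiv d c (MvPolynomial.monomial s r) =
      MvPolynomial.monomial s (r * (s.degree + c : ℝ)⁻¹) := by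
  have h : degDiv d c (MvPolynomial.monomial s 1) =
      MvPolynomial.monomial s ((s.degree + c : ℝ)⁻¹) := by
    have := (MvPolynomial.basisMonomials (Fin d) ℝ).constr_basis ℝ (fun s =>
      MvPolynomial.monomial s ((s.degree + c : ℝ)⁻¹)) s
    rwa [MvPolynomial.coe_basisMonomials] at this
  have h2 : (MvPolynomial.monomial s r : Poly d) = r • MvPolynomial.monomial s 1 := by
    rw [MvPolynomial.smul_monomial, smul_eq_mul, mul_one]
  rw [h2, map_smul, h, MvPolynomial.smul_monomial, smul_eq_mul]

theorem totalDegree_degDiv_le {d c : ℕ} (p : Poly d) :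
    (degDiv d c p).totalDegree ≤ p.totalDegree := by
  conv_lhs => rw [p.as_sum, map_sum]
  refine MvPolynomial.totalDegree_finsetSum_le fun s hs => ?_
  rw [degDiv_monomial]
  exact (MvPolynomial.totalDegree_monomial_le _ _).trans (MvPolynomial.le_totalDegree hs)

theorem pderiv_degDiv {d c : ℕ} (i : Fin d) (p : Poly d) :
    MvPolynomial.pderiv i (degDiv d c p) = degDiv d (c + 1) (MvPolynomial.pderiv i p) := by
  rw [p.as_sum]
  simp only [map_sum]
  refine Finset.sum_congr rfl fun s _ => ?_
  rw [degDiv_monomial, MvPolynomial.pderiv_monomial, MvPolynomial.pderiv_monomial, degDiv_monomial]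
  rcases Nat.eq_zero_or_pos (s i) with h | h
  · simp [h]
  · have hs : s = Finsupp.single i 1 + (s - Finsupp.single i 1) := by
      rw [add_tsub_cancel_of_le (Finsupp.single_le_iff.2 h)]
    have hdeg : s.degree = 1 + (s - Finsupp.single i 1).degree := by
      conv_lhs => rw [hs, map_add, Finsupp.degree_single]
    congr 1
    rw [hdeg]
    push_cast
    ring

theorem euler_degDiv {d : ℕ} (p : Poly d) :
    degDiv d 1 p + ∑ i, MvPolynomial.X i * MvPolynomial.pderiv i (degDiv d 1 p) = p := by
  conv_rhs => rw [p.as_sum]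
  conv_lhs => rw [p.as_sum]
  simp only [map_sum, Finset.mul_sum]
  rw [Finset.sum_comm, ← Finset.sum_add_distrib]
  refine Finset.sum_congr rfl fun s _ => ?_
  rw [degDiv_monomial]
  have h1 : ∀ i, (MvPolynomial.X i : Poly d) * MvPolynomial.pderiv i (MvPolynomial.monomial s
      (p.coeff s * (s.degree + (1 : ℕ) : ℝ)⁻¹)) =
      (s i : ℝ) • MvPolynomial.monomial s (p.coeff s * (s.degree + (1 : ℕ) : ℝ)⁻¹) := by
    intro i
    rw [MvPolynomial.X_mul_pderiv_monomial, Nat.cast_smul_eq_nsmul]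
  simp only [h1, ← Finset.sum_smul]
  have h2 : ∑ i, (s i : ℝ) = s.degree := by
    rw [Finsupp.degree_eq_sum]; push_cast; rfl
  rw [h2, MvPolynomial.smul_monomial, ← map_add]
  congr 1
  have : (s.degree + (1 : ℕ) : ℝ) ≠ 0 := by positivity
  rw [smul_eq_mul]
  field_simp
  push_cast
  ring

theorem curl2_zero (φ : Poly 2) : curl2 φ 0 = MvPolynomial.pderiv 1 φ := by
  simp [curl2, Fin.sum_univ_two]

theorem curl2_one (φ : Poly 2) : curl2 φ 1 = -MvPolynomial.pderiv 0 φ := by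
  simp [curl2, Fin.sum_univ_two]

theorem exists_potential {k : ℕ} {z : Fin 2 → Poly 2} (hz : ∀ i, (z i).totalDegree ≤ k)
    (hdiv : ∑ i, MvPolynomial.pderiv i (z i) = 0) :
    ∃ φ : Poly 2, φ.totalDegree ≤ k + 1 ∧ z = curl2 φ := by
  have h0 : MvPolynomial.pderiv 0 (degDiv 2 1 (z 0)) +
      MvPolynomial.pderiv 1 (degDiv 2 1 (z 1)) = 0 := by
    rw [pderiv_degDiv, pderiv_degDiv, ← map_add, ← Fin.sum_univ_two (fun i =>
      MvPolynomial.pderiv i (z i)), hdiv, map_zero]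
  have e0 := euler_degDiv (z 0)
  have e1 := euler_degDiv (z 1)
  rw [Fin.sum_univ_two] at e0 e1
  set J0 := degDiv 2 1 (z 0)
  set J1 := degDiv 2 1 (z 1)
  have hX : ∀ (i j : Fin 2), (MvPolynomial.X i * degDiv 2 1 (z j)).totalDegree ≤ k + 1 := by
    intro i j
    have h1 := MvPolynomial.totalDegree_mul (MvPolynomial.X i : Poly 2) (degDiv 2 1 (z j))
    rw [MvPolynomial.totalDegree_X] at h1
    have h2 := totalDegree_degDiv_le (c := 1) (z j)
    have h3 := hz j
    omega
  refine ⟨MvPolynomial.X 1 * J0 - MvPolynomial.X 0 * J1, ?_, funext fun i => ?_⟩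
  · exact (MvPolynomial.totalDegree_sub _ _).trans (max_le (hX 1 0) (hX 0 1))
  · fin_cases i
    · simp only [Fin.zero_eta, curl2_zero, map_sub, Derivation.leibniz, smul_eq_mul,
        MvPolynomial.pderiv_X_self, MvPolynomial.pderiv_X_of_ne (show (0 : Fin 2) ≠ 1 by decide)]
      linear_combination -e0 + MvPolynomial.X 0 * h0
    · simp only [Fin.mk_one, curl2_one, map_sub, Derivation.leibniz, smul_eq_mul,
        MvPolynomial.pderiv_X_self, MvPolynomial.pderiv_X_of_ne (show (1 : Fin 2) ≠ 0 by decide)]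
      linear_combination -e1 + MvPolynomial.X 1 * h0

variable (b : AffineBasis (Fin 3) ℝ (Pt 2))

theorem totalDegree_lamP_eq (i : Fin 3) : (lamP b i).totalDegree = 1 := by
  refine le_antisymm (totalDegree_lamP b i) (Nat.one_le_iff_ne_zero.2 fun h => ?_)
  refine grad_ne_zero b (by norm_num) i ?_
  ext j
  have h1 := pderiv_lamP b i j
  rw [MvPolynomial.totalDegree_eq_zero_iff_eq_C.1 h, MvPolynomial.pderiv_C] at h1
  have := (MvPolynomial.C_injective (Fin 2) ℝ) ((map_zero MvPolynomial.C).trans h1)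
  simpa using this.symm

theorem totalDegree_bubble : (bubble (verts b)).totalDegree = 3 := by
  have hne := fun i => lamP_ne_zero b i
  rw [bubble_verts, Fin.prod_univ_three,
    MvPolynomial.totalDegree_mul_of_isDomain (mul_ne_zero (hne 0) (hne 1)) (hne 2),
    MvPolynomial.totalDegree_mul_of_isDomain (hne 0) (hne 1), totalDegree_lamP_eq,
    totalDegree_lamP_eq, totalDegree_lamP_eq]

theorem memPStar_curl2 {k : ℕ} (hk : 2 ≤ k) {p : Poly 2} (hp : p.totalDegree ≤ k - 2) :
    MemPStar (verts b) k (curl2 (bubble (verts b) * p)) := by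
  have hdeg : (bubble (verts b) * p).totalDegree ≤ k + 1 := by
    have h1 := MvPolynomial.totalDegree_mul (bubble (verts b)) p
    have h2 := totalDegree_bubble b
    omega
  refine (memPStar_iff b (by norm_num)).2 ⟨fun i => ?_, ?_, fun m y hy => ?_⟩
  · have h1 := fun j => totalDegree_pderiv_le j (bubble (verts b) * p)
    fin_cases i
    · rw [Fin.zero_eta, curl2_zero]
      have := h1 1
      omega
    · rw [Fin.mk_one, curl2_one, MvPolynomial.totalDegree_neg]
      have := h1 0
      omega
  · rw [Fin.sum_univ_two, curl2_zero, curl2_one, map_neg, pderiv_pderiv_comm]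
    ring
  · rw [hull_face_verts] at hy
    obtain ⟨q, hq⟩ : lamP b m ∣ bubble (verts b) * p := by
      rw [bubble_verts]
      exact Dvd.dvd.mul_right (Finset.dvd_prod_of_mem _ (Finset.mem_univ m)) p
    rw [hq, pev_nflux, Fin.sum_univ_two, curl2_zero, curl2_one]
    simp only [Derivation.leibniz, pderiv_lamP, smul_eq_mul, pev_add, pev_mul, pev_lamP, pev_C,
      pev_neg, hy.2]
    ring

theorem pev_eq_of_dirD_eq_zero {d : ℕ} (b : AffineBasis (Fin (d + 1)) ℝ (Pt d)) {φ : Poly d}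
    {m j : Fin (d + 1)} (hj : j ≠ m)
    (h : ∀ i, i ≠ m → ∀ y ∈ convexHull ℝ (face (verts b) (b m) : Set (Pt d)),
      pev (dirD b i j φ) y = 0) {y : Pt d}
    (hy : y ∈ convexHull ℝ (face (verts b) (b m) : Set (Pt d))) : pev φ y = pev φ (b j) := by
  have hjm : b j ∈ convexHull ℝ (face (verts b) (b m) : Set (Pt d)) :=
    subset_convexHull ℝ _ ((mem_face_verts b).2 ⟨j, hj, rfl⟩)
  have hy' := hy
  rw [hull_face_verts] at hy'
  have hdir : ∀ x ∈ convexHull ℝ (face (verts b) (b m) : Set (Pt d)),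
      fderiv ℝ (pev φ) x (y - b j) = 0 := by
    intro x hx
    have e : ∀ l, (y - b j) l = ∑ i, b.coord i y * (b i l - b j l) := by
      intro l
      have h1 := congrArg (fun v : Pt d => v l) (sum_coord_smul b y)
      simp only [WithLp.ofLp_sum, Finset.sum_apply, PiLp.smul_apply, smul_eq_mul] at h1
      simp only [mul_sub, Finset.sum_sub_distrib, ← Finset.sum_mul, b.sum_coord_apply_eq_one, h1,
        PiLp.sub_apply, one_mul]
    rw [fderiv_pev]
    simp only [e, Finset.sum_mul]
    rw [Finset.sum_comm]
    refine Finset.sum_eq_zero fun i _ => ?_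
    simp only [mul_assoc, ← Finset.mul_sum]
    by_cases hi : i = m
    · rw [hi, hy'.2, zero_mul]
    · have := h i hi x hx
      rw [dirD_apply] at this
      simp only [pev_sum, pev_smul] at this
      rw [this, mul_zero]
  have key := constant_of_has_deriv_right_zero (f := fun t : ℝ => pev φ (b j + t • (y - b j)))
    (a := 0) (b := 1) (by
      have := continuous_pev φ
      exact (by fun_prop : Continuous fun t : ℝ => pev φ (b j + t • (y - b j))).continuousOn) (by
      intro t ht
      have h2 : HasDerivAt (fun s : ℝ => b j + s • (y - b j)) (y - b j) t := by
        simpa using ((hasDerivAt_id t).smul_const (y - b j)).const_add (b j)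
      have h3 := (((contDiff_pev (n := 1) φ).differentiable one_ne_zero
        (b j + t • (y - b j))).hasFDerivAt).comp_hasDerivAt t h2
      rw [hdir] at h3
      · exact h3.hasDerivWithinAt
      · exact (convex_convexHull ℝ _).add_smul_sub_mem hjm hy ⟨ht.1, ht.2.le⟩)
  have := key 1 ⟨zero_le_one, le_rfl⟩
  simpa using this

theorem exists_eq_curl2_bubble {k : ℕ} {z : Fin 2 → Poly 2} (hz : MemPStar (verts b) k z) :
    (k < 2 ∧ z = 0) ∨ (2 ≤ k ∧ ∃ p : Poly 2, p.totalDegree ≤ k - 2 ∧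
      z = curl2 (bubble (verts b) * p)) := by
  obtain ⟨hd1, hd2, hn⟩ := (memPStar_iff b (by norm_num)).1 hz
  obtain ⟨φ, hφ, hzφ⟩ := exists_potential hd1 hd2
  have hdir : ∀ m i j, i ≠ m → j ≠ m →
      ∀ y ∈ convexHull ℝ (face (verts b) (b m) : Set (Pt 2)), pev (dirD b i j φ) y = 0 := by
    intro m i j hi hj y hy
    have h1 := hn m y hy
    rw [hzφ, pev_nflux, Fin.sum_univ_two, curl2_zero, curl2_one, pev_neg] at h1
    have h2 := inner_grad_vertex_sub b m i j
    rw [if_neg hi.symm, if_neg hj.symm, sub_zero] at h2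
    simp only [PiLp.inner_apply, Fin.sum_univ_two, RCLike.inner_apply, conj_trivial,
      PiLp.sub_apply] at h2
    rw [dirD_apply, Fin.sum_univ_two, pev_add, pev_smul, pev_smul]
    have h3 : grad b m 0 ^ 2 + grad b m 1 ^ 2 ≠ 0 := by
      intro h0
      refine grad_ne_zero b (by norm_num) m ?_
      ext l
      fin_cases l
      · simp only [Fin.zero_eta, PiLp.zero_apply]
        nlinarith [sq_nonneg (grad b m 0), sq_nonneg (grad b m 1)]
      · simp only [Fin.mk_one, PiLp.zero_apply]
        nlinarith [sq_nonneg (grad b m 0), sq_nonneg (grad b m 1)]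
    refine (mul_eq_zero.1 ?_).resolve_left h3
    linear_combination
      (grad b m 0 * pev (MvPolynomial.pderiv 0 φ) y + grad b m 1 * pev (MvPolynomial.pderiv 1 φ) y)
        * h2 + ((b i 1 - b j 1) * grad b m 0 - (b i 0 - b j 0) * grad b m 1) * h1
  have hface : ∀ m j, j ≠ m → ∀ y ∈ convexHull ℝ (face (verts b) (b m) : Set (Pt 2)),
      pev φ y = pev φ (b j) := fun m j hj y hy =>
    pev_eq_of_dirD_eq_zero b hj (fun i hi => hdir m i j hi hj) hy
  have hthird : ∀ i j : Fin 3, ∃ m, i ≠ m ∧ j ≠ m := by decide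
  have hvert : ∀ j, pev φ (b j) = pev φ (b 0) := by
    intro j
    obtain ⟨m, h1, h2⟩ := hthird j 0
    exact hface m 0 h2 _ (subset_convexHull ℝ _ ((mem_face_verts b).2 ⟨j, h1, rfl⟩))
  set φ' := φ - MvPolynomial.C (pev φ (b 0))
  have hzφ' : z = curl2 φ' := by
    rw [hzφ]
    funext i
    fin_cases i
    · simp [curl2_zero, φ']
    · simp [curl2_one, φ']
  have hφ' : φ'.totalDegree ≤ k + 1 := by
    refine (MvPolynomial.totalDegree_sub _ _).trans (max_le hφ ?_)
    rw [MvPolynomial.totalDegree_C]; omega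
  obtain ⟨p, hp⟩ : bubble (verts b) ∣ φ' := by
    rw [bubble_verts]
    refine prod_lamP_dvd b _ fun m _ => faceSubst_eq_zero b (by norm_num) fun y hy => ?_
    obtain ⟨j, hj, -⟩ := hthird m m
    simp only [φ', pev_sub, pev_C]
    rw [hface m j hj.symm y hy, hvert j, sub_self]
  have hb0 : bubble (verts b) ≠ 0 := by
    rw [bubble_verts]
    exact Finset.prod_ne_zero_iff.2 fun i _ => lamP_ne_zero b i
  by_cases hp0 : p = 0
  · have hz0 : z = 0 := by
      rw [hzφ', hp, hp0, mul_zero]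
      funext i
      fin_cases i
      · simp [curl2_zero]
      · simp [curl2_one]
    rcases lt_or_ge k 2 with hk | hk
    · exact Or.inl ⟨hk, hz0⟩
    · exact Or.inr ⟨hk, 0, by simp, by rw [hzφ', hp, hp0]⟩
  · rw [hp, MvPolynomial.totalDegree_mul_of_isDomain hb0 hp0, totalDegree_bubble] at hφ'
    exact Or.inr ⟨by omega, p, by omega, by rw [hzφ', hp]⟩

end Planar

/-! ### The BDM projection -/

section BDM

variable {d : ℕ} (b : AffineBasis (Fin (d + 1)) ℝ (Pt d))

/-- The flux `∇λ_i · v` of a field of class `H¹` on the `i`-th face. -/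
def traceFlux (v : Fin d → Pt d → ℝ) (i : Fin (d + 1)) (y : Pt d) : ℝ :=
  ∑ l, grad b i l * trace (verts b) (face (verts b) (b i)) (v l) y

theorem isBDM_face_iff (hd : 0 < d) {k : ℕ} {v : Fin d → Pt d → ℝ} {w : Fin d → Poly d}
    (hw : ∀ l, (w l).totalDegree ≤ k) :
    (∀ x ∈ verts b, ∀ q : Poly d, q.totalDegree ≤ k →
      ∫ y, (∑ i, pev (w i) y * normal (verts b) x i) * pev q y ∂faceMeasure (face (verts b) x) =
        ∫ y, (∑ i, trace (verts b) (face (verts b) x) (v i) y * normal (verts b) x i) * pev q y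
          ∂faceMeasure (face (verts b) x)) ↔
    ∀ i, IsL2Proj (faceMeasure (face (verts b) (b i))) k (traceFlux b v i) (nflux b i w) := by
  simp only [verts, Finset.mem_map, Finset.mem_univ, true_and, Function.Embedding.coeFn_mk,
    forall_exists_index, forall_apply_eq_imp_iff]
  simp only [← verts.eq_1]
  refine forall_congr' fun i => ?_
  rw [IsL2Proj, and_iff_right (totalDegree_nflux_le b i hw)]
  refine forall₂_congr fun q _ => ?_
  have hH := (height_pos b hd i).ne'
  have e1 : ∀ y, (∑ l, pev (w l) y * normal (verts b) (b i) l) * pev q y =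
      -height b i * (pev (nflux b i w) y * pev q y) := by
    intro y
    rw [sum_mul_normal b hd i fun l => pev (w l) y, ← pev_nflux]; ring
  have e2 : ∀ y, (∑ l, trace (verts b) (face (verts b) (b i)) (v l) y *
      normal (verts b) (b i) l) * pev q y = -height b i * (traceFlux b v i y * pev q y) := by
    intro y
    rw [sum_mul_normal b hd i fun l => trace (verts b) (face (verts b) (b i)) (v l) y]
    simp only [traceFlux]; ring
  simp_rw [e1, e2, integral_const_mul]
  simp [hH]

theorem isBDM_iff (hd : d = 2 ∨ d = 3) {k : ℕ} {v : Fin d → Pt d → ℝ} {w : Fin d → Poly d} :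
    IsBDM (verts b) k v w ↔ BDMMoments b k v (traceFlux b v) w := by
  have hd0 : 0 < d := by omega
  constructor
  · rintro ⟨h1, h2, h3, h4, h5⟩
    refine ⟨h1, (isBDM_face_iff b hd0 h1).1 h2, h3, fun z hz => ?_⟩
    rcases hd with rfl | rfl
    · rcases exists_eq_curl2_bubble b hz with ⟨-, rfl⟩ | ⟨hk, p, hp, rfl⟩
      · simp
      · exact h4 rfl hk p hp
    · exact h5 rfl z hz
  · rintro ⟨h1, h2, h3, h4⟩
    refine ⟨h1, (isBDM_face_iff b hd0 h1).2 h2, h3, ?_, fun _ z hz => h4 z hz⟩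
    rintro rfl hk p hp
    exact h4 _ (memPStar_curl2 b hk hp)

theorem memLp_traceFlux (hd : 0 < d) {v : Fin d → Pt d → ℝ} (hv : ∀ l, MemH (cell (verts b)) 1 (v l))
    (i : Fin (d + 1)) : MemLp (traceFlux b v i) 2 (faceMeasure (face (verts b) (b i))) :=
  memLp_finsetSum _ fun l _ => (isTrace_trace b hd i (hv l)).2.1.const_mul _

theorem bdmMoments_bdm (hd : d = 2 ∨ d = 3) {k : ℕ} (hk : 1 ≤ k) {v : Fin d → Pt d → ℝ}
    (hv : ∀ l, MemH (cell (verts b)) 1 (v l)) :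
    BDMMoments b k v (traceFlux b v) (bdm (verts b) k v) := by
  have hd0 : 0 < d := by omega
  obtain ⟨w, hw⟩ := exists_bdmMoments b hd0 hk (fun l => (hv l).1) (memLp_traceFlux b hd0 hv)
  have h : ∃ w, IsBDM (verts b) k v w := ⟨w, (isBDM_iff b hd).2 hw⟩
  rw [← isBDM_iff b hd, bdm, dif_pos h]
  exact h.choose_spec

theorem BDMMoments.sub_poly (hd : 0 < d) {k : ℕ} {f : Fin d → Pt d → ℝ}
    {g : Fin (d + 1) → Pt d → ℝ} {w : Fin d → Poly d} (h : BDMMoments b k f g w)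
    (hf : ∀ l, MemLp (f l) 2 (volume.restrict (cell (verts b))))
    (hg : ∀ i, MemLp (g i) 2 (faceMeasure (face (verts b) (b i)))) {p : Fin d → Poly d}
    (hp : ∀ l, (p l).totalDegree ≤ k) :
    BDMMoments b k (fun l y => f l y - pev (p l) y) (fun i y => g i y - pev (nflux b i p) y)
      (w - p) := by
  have hdeg : ∀ l, ((w - p) l).totalDegree ≤ k := fun l =>
    mem_polyLE.1 (sub_mem (mem_polyLE.2 (h.totalDegree_le l)) (mem_polyLE.2 (hp l)))
  have hcell : ∀ r : Fin d → Poly d, ∫ y in cell (verts b), ∑ l, pev (w l) y * pev (r l) y =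
      ∫ y in cell (verts b), ∑ l, f l y * pev (r l) y →
      ∫ y in cell (verts b), ∑ l, pev ((w - p) l) y * pev (r l) y =
      ∫ y in cell (verts b), ∑ l, (f l y - pev (p l) y) * pev (r l) y := by
    intro r hr
    have i1 : Integrable (fun y => ∑ l, f l y * pev (r l) y) (volume.restrict (cell (verts b))) :=
      integrable_finsetSum _ fun l _ =>
        integrable_mul_of_memLp (hf l) (memLp_cell _ (continuous_pev _))
    simp only [Pi.sub_apply, pev_sub, sub_mul, Finset.sum_sub_distrib]
    rw [integral_sub (integrable_cell _ (by fun_prop)) (integrable_cell _ (by fun_prop)),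
      integral_sub i1 (integrable_cell _ (by fun_prop)), hr]
  refine ⟨hdeg, fun i => ⟨totalDegree_nflux_le b i hdeg, fun q hq => ?_⟩,
    fun q hq => hcell _ (h.grad_moment q hq), fun z hz => hcell _ (h.pStar_moment z hz)⟩
  have := (h.face_moment i).2 q hq
  simp only [map_sub, pev_sub, sub_mul]
  rw [integral_sub (integrable_face b hd i (by fun_prop)) (integrable_face b hd i (by fun_prop)),
    integral_sub (integrable_mul_of_memLp (hg i) (memLp_face b hd i (continuous_pev _)))
      (integrable_face b hd i (by fun_prop)), this]

end BDM

/-! ### Geometry of the mesh -/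

section Mesh

variable {d : ℕ} {Ω : Set (Pt d)}

/-- A Lipschitz domain has no slits. -/
theorem interior_closure_subset_of_isLipschitzDomain (hΩ : IsLipschitzDomain Ω) :
    interior (closure Ω) ⊆ Ω := by
  intro x hx
  by_contra hxΩ
  have hfr : x ∈ frontier Ω := by
    rw [frontier, hΩ.1.interior_eq]
    exact ⟨interior_subset hx, hxΩ⟩
  obtain ⟨e, r, K, γ, he, hr, hγ, hloc⟩ := hΩ.2 x hfr
  have h0 : γ (x - inner ℝ e x • e) ≤ inner ℝ e x := by
    have := (hloc x (Metric.mem_ball_self hr)).not.1 hxΩ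
    exact not_lt.1 this
  have hcont : Continuous fun t : ℝ => x + t • e := by fun_prop
  have hnhds : ∀ᶠ t : ℝ in 𝓝 0, x + t • e ∈ interior (closure Ω) ∩ Metric.ball x r := by
    refine hcont.continuousAt.eventually_mem ?_
    simp only [zero_smul, add_zero]
    exact inter_mem (isOpen_interior.mem_nhds hx) (Metric.ball_mem_nhds x hr)
  obtain ⟨t, ht, ht0⟩ := ((hnhds.filter_mono nhdsWithin_le_nhds).and
    (self_mem_nhdsWithin : Set.Ioi (0 : ℝ) ∈ 𝓝[>] 0)).exists
  set y := x + t • e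
  have hey : inner ℝ e y = inner ℝ e x + t := by
    simp [y, inner_add_right, inner_smul_right, he]
  have hy1 : γ (y - inner ℝ e y • e) < inner ℝ e y := by
    have : y - inner ℝ e y • e = x - inner ℝ e x • e := by
      rw [hey]; simp only [y, add_smul]; abel
    rw [this, hey]
    have : (0 : ℝ) < t := ht0
    linarith
  have hop : IsOpen {z : Pt d | γ (z - inner ℝ e z • e) < inner ℝ e z} := by
    have := hγ.continuous
    exact isOpen_lt (by fun_prop) (by fun_prop)
  obtain ⟨z, hz, hzΩ⟩ := mem_closure_iff.1 (interior_subset ht.1) _ (hop.inter Metric.isOpen_ball)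
    ⟨hy1, ht.2⟩
  exact lt_asymm hz.1 ((hloc z hz.2).1 hzΩ)

namespace Triangulation

variable (𝒯 : Triangulation Ω)

theorem mem_elems {T : Finset (Pt d)} : T ∈ 𝒯.elems ↔ T ∈ 𝒯.faces ∧ T.card = d + 1 := by
  simp [elems]

theorem exists_affineBasis {T : Finset (Pt d)} (hT : T ∈ 𝒯.elems) :
    ∃ b : AffineBasis (Fin (d + 1)) ℝ (Pt d), verts b = T := by
  obtain ⟨h1, h2⟩ := 𝒯.mem_elems.1 hT
  exact exists_affineBasis_verts_eq (𝒯.indep h1) h2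

theorem cell_subset (hΩ : IsLipschitzDomain Ω) {T : Finset (Pt d)} (hT : T ∈ 𝒯.elems) :
    cell T ⊆ Ω := by
  refine subset_trans (interior_mono ?_) (interior_closure_subset_of_isLipschitzDomain hΩ)
  rw [← 𝒯.space_eq]
  exact 𝒯.convexHull_subset_space (𝒯.mem_elems.1 hT).1

theorem disjoint_cell {T T' : Finset (Pt d)} (hT : T ∈ 𝒯.elems) (hT' : T' ∈ 𝒯.elems)
    (hne : T ≠ T') : Disjoint (cell T) (cell T') := by
  rw [Set.disjoint_left]
  intro y hy hy'
  obtain ⟨h1, h2⟩ := 𝒯.mem_elems.1 hT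
  obtain ⟨h1', h2'⟩ := 𝒯.mem_elems.1 hT'
  obtain ⟨b, rfl⟩ := 𝒯.exists_affineBasis hT
  obtain ⟨x, hx, hx'⟩ : ∃ x ∈ verts b, x ∉ T' := by
    by_contra! h
    exact hne (Finset.eq_of_subset_of_card_le h (by omega))
  obtain ⟨i, -, rfl⟩ := Finset.mem_map.1 hx
  change b i ∉ T' at hx'
  have hin := 𝒯.inter_subset_convexHull h1 h1' ⟨cell_subset_hull _ hy, cell_subset_hull _ hy'⟩
  have hsub : ((verts b : Set (Pt d)) ∩ (T' : Set (Pt d))) ⊆ (face (verts b) (b i) : Set (Pt d)) := by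
    rintro z ⟨hz, hz'⟩
    rw [face, Finset.coe_erase]
    exact ⟨hz, fun h => hx' (by rw [Set.mem_singleton_iff] at h; rw [← h]; exact hz')⟩
  have := convexHull_mono hsub hin
  rw [hull_face_verts] at this
  rw [cell_verts] at hy
  exact (hy i).ne' this.2

theorem sum_nrm_cell_sq_le (hΩ : IsLipschitzDomain Ω) {f : Pt d → ℝ}
    (hf : MemLp f 2 (volume.restrict Ω)) :
    ∑ T ∈ 𝒯.elems, nrm (volume.restrict (cell T)) f ^ 2 ≤ ∫ x in Ω, f x ^ 2 := by
  have hsub : (⋃ T ∈ 𝒯.elems, cell T) ⊆ Ω := Set.iUnion₂_subset fun T hT => 𝒯.cell_subset hΩ hT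
  have hint : IntegrableOn (fun x => f x ^ 2) Ω := hf.integrable_sq
  have h1 : ∀ T ∈ 𝒯.elems, nrm (volume.restrict (cell T)) f ^ 2 = ∫ x in cell T, f x ^ 2 :=
    fun T hT => nrm_sq (hf.mono_measure (Measure.restrict_mono (𝒯.cell_subset hΩ hT) le_rfl))
  rw [Finset.sum_congr rfl h1, ← integral_biUnion_finset _
    (fun T _ => (isOpen_cell T).measurableSet)
    (fun T hT T' hT' hne => 𝒯.disjoint_cell hT hT' hne)
    (fun T hT => hint.mono_set (𝒯.cell_subset hΩ hT))]
  exact setIntegral_mono_set hint (Eventually.of_forall fun x => sq_nonneg _)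
    hsub.eventuallyLE

theorem diamT_le_meshSize {T : Finset (Pt d)} (hT : T ∈ 𝒯.elems) : diamT T ≤ 𝒯.meshSize :=
  le_ciSup (f := fun T : {T // T ∈ 𝒯.elems} => diamT T.1) (Set.finite_range _).bddAbove ⟨T, hT⟩

theorem ShapeRegular.diamT_le {σ : ℝ} (h : 𝒯.ShapeRegular σ) (hd : 0 < d)
    {b : AffineBasis (Fin (d + 1)) ℝ (Pt d)} (hb : verts b ∈ 𝒯.elems) (i : Fin (d + 1)) :
    diamT (verts b) ≤ σ * height b i := by
  have h1 := h _ hb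
  have h2 := diamT_pos b hd
  have h3 : 0 ≤ inDiam (verts b) := Real.sSup_nonneg fun ρ hρ => hρ.1
  have hσ : 0 ≤ σ := by
    by_contra hneg
    nlinarith [mul_nonneg (neg_nonneg.2 (not_le.1 hneg).le) h3]
  exact h1.trans (mul_le_mul_of_nonneg_left (inDiam_le_height b hd i) hσ)

end Triangulation

end Mesh

/-! ### Polynomial approximation -/

section Approximation

variable {d : ℕ}

theorem exists_smooth_nrm_lt {T : Finset (Pt d)} (hne : (cell T).Nonempty) {m : ℕ} {f : Pt d → ℝ}
    (hf : MemH (cell T) m f) {ε : ℝ} (hε : 0 < ε) :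
    ∃ φ : Pt d → ℝ, ContDiff ℝ ∞ φ ∧ ∀ α : Fin d → ℕ, ∑ i, α i ≤ m →
      nrm (volume.restrict (cell T)) (fun x => multiD α φ x - weakDeriv (cell T) α f x) < ε := by
  obtain ⟨φ, hφ, hlim⟩ := exists_smooth_seq hne hf
  have hfin : {α : Fin d → ℕ | ∑ i, α i ≤ m}.Finite := by
    refine (Set.finite_Iic (fun _ : Fin d => m)).subset fun α hα i => ?_
    exact (Finset.single_le_sum (f := α) (fun _ _ => Nat.zero_le _) (Finset.mem_univ i)).trans hα
  have hev := (eventually_all_finite hfin).2 fun α hα =>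
    (tendsto_nrm_of_tendsto_eLpNorm (hlim α hα)).eventually_lt_const hε
  obtain ⟨n, hn⟩ := hev.exists
  exact ⟨φ n, hφ n, hn⟩

theorem exists_poly_approx {T : Finset (Pt d)} (hd : 0 < d) (hne : (cell T).Nonempty)
    (hT : 0 < diamT T) {m : ℕ} {f : Pt d → ℝ} (hf : MemH (cell T) (m + 1) f) {M : ℝ}
    (hM : ∀ α : Fin d → ℕ, ∑ i, α i = m + 1 →
      nrm (volume.restrict (cell T)) (weakDeriv (cell T) α f) ≤ M) {ε : ℝ} (hε : 0 < ε) :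
    ∃ p : Poly d, p.totalDegree ≤ m ∧ ∀ (j : ℕ) (l : List (Fin d)), l.length + j = m + 1 →
      nrm (volume.restrict (cell T)) (fun x => weakDeriv (cell T) (fun i => l.count i) f x -
        pev (listP l p) x) ≤ ((2 ^ d * d) ^ (m + 1) + 1) * (diamT T ^ j * (M + ε)) := by
  set h := diamT T
  set μ := (volume : Measure (Pt d)).restrict (cell T)
  set c := min 1 h
  have hc : 0 < c := lt_min one_pos hT
  have hcj : ∀ j, j ≤ m + 1 → c ^ (m + 1) ≤ h ^ j := by
    intro j hj
    calc c ^ (m + 1) ≤ c ^ j := pow_le_pow_of_le_one hc.le (min_le_left _ _) hj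
      _ ≤ h ^ j := pow_le_pow_left₀ hc.le (min_le_right _ _) j
  have hc1 : c ^ (m + 1) ≤ 1 := pow_le_one₀ hc.le (min_le_left _ _)
  set δ := ε * c ^ (m + 1)
  have hδ : 0 < δ := by positivity
  have hδε : δ ≤ ε := mul_le_of_le_one_right hε.le hc1
  obtain ⟨φ, hφ, hφf⟩ := exists_smooth_nrm_lt hne hf hδ
  have hwD : ∀ l : List (Fin d), l.length ≤ m + 1 →
      MemLp (weakDeriv (cell T) (fun i => l.count i) f) 2 μ := fun l hl =>
    (weakDeriv_spec hf (by rw [sum_count]; exact hl)).1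
  have hlD : ∀ l, MemLp (listD l φ) 2 μ := fun l => memLp_cell T (continuous_listD hφ l)
  have hcl : ∀ l : List (Fin d), l.length ≤ m + 1 →
      nrm μ (fun x => listD l φ x - weakDeriv (cell T) (fun i => l.count i) f x) ≤ δ := by
    intro l hl
    rw [listD_eq_multiD hφ]
    exact (hφf _ (by rw [sum_count]; exact hl)).le
  obtain ⟨p, hp, happ⟩ := exists_poly_nrm_listD_sub_le hne m hφ (M := M + δ) fun l hl => by
    have h1 := nrm_add_le ((hlD l).sub (hwD l hl.le)) (hwD l hl.le)
    simp only [Pi.sub_apply, sub_add_cancel] at h1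
    have h2 := hM (fun i => l.count i) (by rw [sum_count]; exact hl)
    have h3 := hcl l hl.le
    exact h1.trans (by rw [add_comm M]; exact add_le_add h3 h2)
  have hM0 : 0 ≤ M := (nrm_nonneg _ _).trans (hM (Pi.single ⟨0, hd⟩ (m + 1)) (by simp))
  refine ⟨p, hp, fun j l hl => ?_⟩
  have h1 := nrm_sub_le_add (hwD l (by omega)) (hlD l)
    (memLp_cell T (continuous_pev (listP l p)) : MemLp _ 2 μ)
  rw [nrm_sub_comm] at h1
  have h2 := hcl l (by omega)
  rw [nrm_sub_comm] at h2
  rw [nrm_sub_comm] at h1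
  have h3 := happ j l hl
  have hd1 : (1 : ℝ) ≤ 2 ^ d * d := by
    have : (1 : ℝ) ≤ d := by exact_mod_cast hd
    have : (1 : ℝ) ≤ 2 ^ d := one_le_pow₀ (by norm_num)
    nlinarith
  calc _ ≤ δ + (2 ^ d * h * d) ^ j * (M + δ) := h1.trans (add_le_add h2 h3)
    _ ≤ ε * h ^ j + (2 ^ d * d) ^ (m + 1) * h ^ j * (M + ε) := by
        have e1 : (2 ^ d * h * d) ^ j = (2 ^ d * d : ℝ) ^ j * h ^ j := by rw [← mul_pow]; ring
        have e2 : (2 ^ d * d : ℝ) ^ j ≤ (2 ^ d * d) ^ (m + 1) := pow_le_pow_right₀ hd1 (by omega)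
        rw [e1]
        gcongr
        exact mul_le_mul_of_nonneg_left (hcj j (by omega)) hε.le
    _ ≤ _ := by
        have : 0 ≤ h ^ j * M := by positivity
        nlinarith

theorem count_singleton_eq (j : Fin d) : (fun i => [j].count i) = (Pi.single j 1 : Fin d → ℕ) := by
  funext i
  by_cases h : i = j
  · simp [h]
  · simp [h, Ne.symm h]

theorem le_mul_of_forall_pos_add {x D s : ℝ} (hD : 0 ≤ D)
    (h : ∀ ε > 0, x ≤ D * (s + ε)) : x ≤ D * s := by
  refine le_of_forall_pos_le_add fun ε hε => ?_
  have h1 := h (ε / (D + 1)) (by positivity)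
  have h2 : D * (ε / (D + 1)) ≤ ε := by
    rw [mul_div_assoc']
    rw [div_le_iff₀ (by positivity)]
    nlinarith
  linarith [mul_add D s (ε / (D + 1))]

end Approximation

/-! ### Local estimates -/

section Local

variable {d : ℕ} (b : AffineBasis (Fin (d + 1)) ℝ (Pt d))

/-- The trace inequality and the inverse inequality for polynomials. -/
theorem sqrt_mul_nrm_face_pev_le (hd : 0 < d) {σ C : ℝ} {m : ℕ}
    (hσ : ∀ i, diamT (verts b) ≤ σ * height b i)
    (hinv : ∀ p : Poly d, p.totalDegree ≤ m → ∀ j, diamT (verts b) *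
      nrm (volume.restrict (cell (verts b))) (pev (MvPolynomial.pderiv j p)) ≤
        C * σ * nrm (volume.restrict (cell (verts b))) (pev p)) (i : Fin (d + 1)) {p : Poly d}
    (hp : p.totalDegree ≤ m) :
    Real.sqrt (diamT (verts b)) * nrm (faceMeasure (face (verts b) (b i))) (pev p) ≤
      Real.sqrt (σ * (d + 1)) * (1 + d * (C * σ)) *
        nrm (volume.restrict (cell (verts b))) (pev p) := by
  refine (sqrt_mul_nrm_face_le b hd i (hσ i) (contDiff_pev p)).trans ?_
  rw [mul_assoc]
  refine mul_le_mul_of_nonneg_left ?_ (Real.sqrt_nonneg _)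
  simp only [scaledH1, partialD_pev]
  rw [Finset.mul_sum]
  have := Finset.sum_le_sum fun j (_ : j ∈ Finset.univ) => hinv p hp j
  simp only [Finset.sum_const, Finset.card_univ, Fintype.card_fin, nsmul_eq_mul] at this
  linarith

theorem isL2Proj_l2Proj {μ : Measure (Pt d)} (hμ : ∀ p : Poly d, MemLp (pev p) 2 μ) (m : ℕ)
    {f : Pt d → ℝ} (hf : MemLp f 2 μ) : IsL2Proj μ m f (l2Proj μ m f) := by
  have h := exists_isL2Proj hμ m hf
  rw [l2Proj, dif_pos h]
  exact h.choose_spec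

theorem IsL2Proj.sub_poly {μ : Measure (Pt d)} (hμ : ∀ p : Poly d, MemLp (pev p) 2 μ) {m : ℕ}
    {f : Pt d → ℝ} (hf : MemLp f 2 μ) {p q : Poly d} (h : IsL2Proj μ m f p)
    (hq : q.totalDegree ≤ m) : IsL2Proj μ m (fun y => f y - pev q y) (p - q) := by
  refine ⟨mem_polyLE.1 (sub_mem (mem_polyLE.2 h.1) (mem_polyLE.2 hq)), fun r hr => ?_⟩
  simp only [pev_sub, sub_mul]
  rw [integral_sub (integrable_mul_of_memLp (hμ _) (hμ _))
    (integrable_mul_of_memLp (hμ _) (hμ _)), integral_sub (integrable_mul_of_memLp hf (hμ _))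
    (integrable_mul_of_memLp (hμ _) (hμ _)), h.2 r hr]

/-- The error of the facewise projection of a polynomial. -/
theorem nrm_sub_faceProj_le (hd : 0 < d) {σ : ℝ} (hσ : ∀ i, diamT (verts b) ≤ σ * height b i)
    (m : ℕ) (p : Poly d) (i : Fin (d + 1)) :
    nrm (faceMeasure (face (verts b) (b i)))
        (fun y => pev p y - pev (faceProj (face (verts b) (b i)) m (pev p)) y) ≤
      2 * (Real.sqrt (σ * (d + 1)) * (2 ^ d + 1)) * (Real.sqrt (diamT (verts b)) *
        ∑ j, nrm (volume.restrict (cell (verts b))) (pev (MvPolynomial.pderiv j p))) := by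
  set ν := faceMeasure (face (verts b) (b i))
  set μ := (volume : Measure (Pt d)).restrict (cell (verts b))
  set h := diamT (verts b)
  have hh : 0 < h := diamT_pos b hd
  have hF : ∀ p : Poly d, MemLp (pev p) 2 ν := fun p => memLp_face b hd i (continuous_pev p)
  set c : ℝ := (∫ y in cell (verts b), pev p y) / (volume.real (cell (verts b)))
  set q := p - MvPolynomial.C c
  have hvol : volume.real (cell (verts b)) ≠ 0 := by
    have h1 : 0 < volume (cell (verts b)) :=
      (isOpen_cell _).measure_pos volume (cell_nonempty b)
    have h2 : volume (cell (verts b)) ≠ ⊤ := by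
      have := measure_ne_top μ Set.univ
      simpa [μ] using this
    exact (ENNReal.toReal_pos h1.ne' h2).ne'
  have hmean : ∫ y in cell (verts b), pev q y = 0 := by
    simp only [q, pev_sub, pev_C]
    rw [integral_sub (integrable_cell _ (continuous_pev p)) (integrable_const _), integral_const]
    simp only [smul_eq_mul, measureReal_restrict_apply_univ, c]
    field_simp
    ring
  have hpd : ∀ j, MvPolynomial.pderiv j q = MvPolynomial.pderiv j p := fun j => by simp [q]
  have h1 := poincare (cell_nonempty b) (contDiff_pev q) hmean
  have h2 := sqrt_mul_nrm_face_le b hd i (hσ i) (contDiff_pev q)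
  simp only [partialD_pev, hpd, scaledH1] at h1 h2
  set S := ∑ j, nrm μ (pev (MvPolynomial.pderiv j p))
  have hproj := isL2Proj_l2Proj hF m (hF p)
  have h3 := (hproj.sub_poly hF (hF p) (q := MvPolynomial.C c)
    (by rw [MvPolynomial.totalDegree_C]; omega))
  have h4 := h3.nrm_le hF ((hF p).sub (hF _))
  have e1 : pev p - pev (MvPolynomial.C c) = pev q := by
    funext y; simp [q]
  rw [e1] at h4
  have h5 := nrm_sub_le (hF q) (hF (l2Proj ν m (pev p) - MvPolynomial.C c))
  have e2 : (fun y => pev q y - pev (l2Proj ν m (pev p) - MvPolynomial.C c) y) =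
      fun y => pev p y - pev (faceProj (face (verts b) (b i)) m (pev p)) y := by
    funext y; simp [q, faceProj, ν]
  rw [e2] at h5
  have h6 : nrm ν (pev q) ≤ Real.sqrt (σ * (d + 1)) * (2 ^ d + 1) * (Real.sqrt h * S) := by
    have hsq : 0 < Real.sqrt h := Real.sqrt_pos.2 hh
    refine le_of_mul_le_mul_left ?_ hsq
    calc _ ≤ _ := h2
      _ ≤ Real.sqrt (σ * (d + 1)) * ((2 ^ d + 1) * h * S) := by
          refine mul_le_mul_of_nonneg_left ?_ (Real.sqrt_nonneg _)
          linarith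
      _ = Real.sqrt (σ * (d + 1)) * ((2 ^ d + 1) * (Real.sqrt h * Real.sqrt h) * S) := by
          rw [Real.mul_self_sqrt hh.le]
      _ = _ := by ring
  calc _ ≤ 2 * nrm ν (pev q) := by linarith
    _ ≤ _ := by linarith

end Local

/-! ### Approximation properties of the projections -/

section ProjectionErrors

variable {d : ℕ}

theorem MemH.of_le {K : Set (Pt d)} {m n : ℕ} (hmn : m ≤ n) {f : Pt d → ℝ} (h : MemH K n f) :
    MemH K m f :=
  ⟨h.1, fun α hα => h.2 α (hα.trans hmn)⟩

/-- The constant of polynomial approximation. -/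
def approxC (d k : ℕ) : ℝ := (2 ^ d * d) ^ (k + 1) + 1

theorem approxC_pos (d k : ℕ) : 0 < approxC d k := by
  unfold approxC; positivity

variable (b : AffineBasis (Fin (d + 1)) ℝ (Pt d))

theorem exists_poly_approx_of_memH (hd : 0 < d) {k : ℕ} (hk : 1 ≤ k) {f : Pt d → ℝ}
    (hf : MemH (cell (verts b)) (k + 1) f) {s : ℝ}
    (hs : ∀ α : Fin d → ℕ, ∑ i, α i = k + 1 →
      nrm (volume.restrict (cell (verts b))) (weakDeriv (cell (verts b)) α f) ≤ s)
    {ε : ℝ} (hε : 0 < ε) :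
    ∃ p : Poly d, p.totalDegree ≤ k ∧
      nrm (volume.restrict (cell (verts b))) (fun x => f x - pev p x) ≤
        approxC d k * (diamT (verts b) ^ (k + 1) * (s + ε)) ∧
      (∀ j, nrm (volume.restrict (cell (verts b))) (fun x =>
        weakDeriv (cell (verts b)) (Pi.single j 1) f x - pev (MvPolynomial.pderiv j p) x) ≤
          approxC d k * (diamT (verts b) ^ k * (s + ε))) ∧
      ∀ j l, nrm (volume.restrict (cell (verts b))) (fun x =>
        weakDeriv (cell (verts b)) (Pi.single j 1 + Pi.single l 1) f x -
          pev (MvPolynomial.pderiv j (MvPolynomial.pderiv l p)) x) ≤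
          approxC d k * (diamT (verts b) ^ (k - 1) * (s + ε)) := by
  obtain ⟨p, hp, h⟩ := exists_poly_approx hd (cell_nonempty b) (diamT_pos b hd) hf hs hε
  refine ⟨p, hp, ?_, fun j => ?_, fun j l => ?_⟩
  · refine le_trans (le_of_eq (nrm_congr ?_)) (h (k + 1) [] (by simp))
    have e : (fun i : Fin d => ([] : List (Fin d)).count i) = 0 := by funext i; simp
    filter_upwards [weakDeriv_zero (isOpen_cell _) hf] with x hx
    rw [e, hx]; rfl
  · have := h k [j] (by simp; omega)
    rw [count_singleton_eq] at this
    exact this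
  · have := h (k - 1) [j, l] (by simp; omega)
    rw [count_pair_eq] at this
    exact this

theorem scaledH1_le {f : Pt d → ℝ} {g : Fin d → Pt d → ℝ} {X M : ℝ}
    (h0 : nrm (volume.restrict (cell (verts b))) f ≤ diamT (verts b) * X * M)
    (h1 : ∀ j, nrm (volume.restrict (cell (verts b))) (g j) ≤ X * M) :
    scaledH1 (verts b) f g ≤ (1 + d) * (diamT (verts b) * X * M) := by
  have h2 := Finset.sum_le_sum fun j (_ : j ∈ Finset.univ) => h1 j
  simp only [Finset.sum_const, Finset.card_univ, Fintype.card_fin, nsmul_eq_mul] at h2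
  have hT : 0 ≤ diamT (verts b) := Metric.diam_nonneg
  have h3 := mul_le_mul_of_nonneg_left h2 hT
  rw [scaledH1]
  linarith

/-- Approximation by the BDM projection, in the element and on its boundary. -/
theorem exists_bdm_error_bound (a : AffineBasis (Fin (d + 1)) ℝ (Pt d)) (hd : d = 2 ∨ d = 3)
    {k : ℕ} (hk : 1 ≤ k) {σ : ℝ} (hσ0 : 0 < σ) : ∃ D > (0 : ℝ),
    ∀ b : AffineBasis (Fin (d + 1)) ℝ (Pt d), (∀ i, diamT (verts b) ≤ σ * height b i) →
    ∀ u : Fin d → Pt d → ℝ, (∀ i, MemH (cell (verts b)) (k + 1) (u i)) → ∀ s : ℝ,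
      (∀ i, ∀ α : Fin d → ℕ, ∑ j, α j = k + 1 →
        nrm (volume.restrict (cell (verts b))) (weakDeriv (cell (verts b)) α (u i)) ≤ s) →
      ∀ i, nrm (volume.restrict (cell (verts b)))
          (fun y => pev (bdm (verts b) k u i) y - u i y) ≤ D * diamT (verts b) ^ (k + 1) * s ∧
        ∀ m, Real.sqrt (diamT (verts b)) * nrm (faceMeasure (face (verts b) (b m)))
          (fun y => pev (bdm (verts b) k u i) y -
            trace (verts b) (face (verts b) (b m)) (u i) y) ≤
              D * diamT (verts b) ^ (k + 1) * s := by
  have hd0 : 0 < d := by omega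
  obtain ⟨Cs, hCs, hstab⟩ := exists_bdm_stability a hd0 hk σ
  obtain ⟨Ci, hCi, hinv⟩ := exists_inverse_bound a hd0 k
  set A := approxC d k
  have hA : 0 < A := approxC_pos d k
  set R := Real.sqrt (σ * (d + 1))
  have hR : 0 ≤ R := Real.sqrt_nonneg _
  set K : ℝ := Cs * (d * A + (d + 1) * (d * (σ * (R * ((1 + d) * A)))))
  have hK : 0 ≤ K := by positivity
  set D : ℝ := K + A + (R * (1 + d * (Ci * σ)) * K + R * ((1 + d) * A))
  have hD : 0 < D := by positivity
  refine ⟨D, hD, fun b hσ u hu s hs => ?_⟩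
  set h := diamT (verts b)
  have hh : 0 < h := diamT_pos b hd0
  set μ := (volume : Measure (Pt d)).restrict (cell (verts b))
  set w := bdm (verts b) k u
  have hu1 : ∀ i, MemH (cell (verts b)) 1 (u i) := fun i => (hu i).of_le (by omega)
  have hpC : ∀ p : Poly d, MemLp (pev p) 2 μ := fun p => memLp_cell _ (continuous_pev p)
  have hpF : ∀ m (p : Poly d), MemLp (pev p) 2 (faceMeasure (face (verts b) (b m))) :=
    fun m p => memLp_face b hd0 m (continuous_pev p)
  have htr : ∀ i m, MemLp (trace (verts b) (face (verts b) (b m)) (u i)) 2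
    (faceMeasure (face (verts b) (b m))) := fun i m => (isTrace_trace b hd0 m (hu1 i)).2.1
  have key : ∀ ε > 0, ∀ i, nrm μ (fun y => pev (w i) y - u i y) ≤ D * h ^ (k + 1) * (s + ε) ∧
      ∀ m, Real.sqrt h * nrm (faceMeasure (face (verts b) (b m)))
        (fun y => pev (w i) y - trace (verts b) (face (verts b) (b m)) (u i) y) ≤
          D * h ^ (k + 1) * (s + ε) := by
    intro ε hε
    choose p hp hp0 hp1 _ using fun i => exists_poly_approx_of_memH b hd0 hk (hu i) (hs i) hε
    set X := h ^ (k + 1) * (s + ε)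
    have hs0 : 0 ≤ s := (nrm_nonneg _ _).trans
      (hs ⟨0, hd0⟩ (Pi.single ⟨0, hd0⟩ (k + 1)) (by simp))
    have hX : 0 ≤ X := by positivity
    have hH1 : ∀ i, scaledH1 (verts b) (fun x => u i x - pev (p i) x) (fun j x =>
        weakDeriv (cell (verts b)) (Pi.single j 1) (u i) x - partialD j (pev (p i)) x) ≤
        (1 + d) * A * X := by
      intro i
      refine (scaledH1_le b (X := h ^ k) (M := A * (s + ε)) ?_ fun j => ?_).trans (le_of_eq ?_)
      · refine (hp0 i).trans (le_of_eq ?_)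
        change A * (h ^ (k + 1) * (s + ε)) = h * h ^ k * (A * (s + ε))
        rw [pow_succ]; ring
      · rw [partialD_pev]
        exact (hp1 i j).trans (le_of_eq (by ring))
      · simp only [X, pow_succ, h]; ring
    have htr1 : ∀ i m, Real.sqrt h * nrm (faceMeasure (face (verts b) (b m)))
        (fun y => trace (verts b) (face (verts b) (b m)) (u i) y - pev (p i) y) ≤
        R * ((1 + d) * A) * X := by
      intro i m
      refine (sqrt_mul_nrm_trace_sub_le b hd0 m (hσ m) (hu1 i) (contDiff_pev (p i))).trans ?_
      rw [mul_assoc]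
      exact mul_le_mul_of_nonneg_left (hH1 i) hR
    have hflux : ∀ m, h * (Real.sqrt h * nrm (faceMeasure (face (verts b) (b m)))
        (fun y => traceFlux b u m y - pev (nflux b m p) y)) ≤
        d * (σ * (R * ((1 + d) * A))) * X := by
      intro m
      have e : (fun y => traceFlux b u m y - pev (nflux b m p) y) = fun y => ∑ l, grad b m l *
          (trace (verts b) (face (verts b) (b m)) (u l) y - pev (p l) y) := by
        funext y
        simp only [traceFlux, pev_nflux, ← Finset.sum_sub_distrib, mul_sub]
      rw [e]
      calc _ ≤ h * (Real.sqrt h * ∑ l, |grad b m l| * nrm (faceMeasure (face (verts b) (b m)))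
            (fun y => trace (verts b) (face (verts b) (b m)) (u l) y - pev (p l) y)) := by
            gcongr
            refine (nrm_sum_le _ fun l _ =>
              ((htr l m).sub (hpF m (p l))).const_mul _).trans (le_of_eq ?_)
            exact Finset.sum_congr rfl fun l _ => nrm_const_mul _ _
        _ = ∑ l, (h * |grad b m l|) * (Real.sqrt h * nrm (faceMeasure (face (verts b) (b m)))
            (fun y => trace (verts b) (face (verts b) (b m)) (u l) y - pev (p l) y)) := by
            simp only [Finset.mul_sum]
            exact Finset.sum_congr rfl fun l _ => by ring
        _ ≤ ∑ _l : Fin d, σ * (R * ((1 + d) * A) * X) :=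
            Finset.sum_le_sum fun l _ => mul_le_mul (abs_grad_le b hd0 (hσ m) l) (htr1 l m)
              (mul_nonneg (Real.sqrt_nonneg _) (nrm_nonneg _ _)) hσ0.le
        _ = _ := by simp; ring
    have hwp : vnrm μ (fun l => pev ((w - p) l)) ≤ K * X := by
      refine (hstab b hσ _ _ _ (fun l => (hu l).1.sub (hpC _))
        (fun m => (memLp_traceFlux b hd0 hu1 m).sub (hpF m _))
        ((bdmMoments_bdm b hd hk hu1).sub_poly b hd0 (fun l => (hu l).1)
          (memLp_traceFlux b hd0 hu1) hp)).trans ?_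
      have e1 : vnrm μ (fun l y => u l y - pev (p l) y) ≤ d * A * X := by
        rw [mul_assoc]; exact vnrm_le hp0
      have e2 := Finset.sum_le_sum fun m (_ : m ∈ Finset.univ) => hflux m
      simp only [Finset.sum_const, Finset.card_univ, Fintype.card_fin, nsmul_eq_mul,
        ← Finset.mul_sum] at e2
      push_cast at e2
      calc _ ≤ Cs * (d * A * X + (d + 1) * (d * (σ * (R * ((1 + d) * A))) * X)) := by
            refine mul_le_mul_of_nonneg_left (add_le_add e1 e2) hCs.le
        _ = _ := by simp only [K]; ring
    have hwpi : ∀ i, nrm μ (pev (w i - p i)) ≤ K * X := fun i =>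
      (nrm_le_vnrm μ (fun l => pev ((w - p) l)) i).trans hwp
    have hdeg : ∀ i, (w i - p i).totalDegree ≤ k := fun i => mem_polyLE.1 (sub_mem
      (mem_polyLE.2 ((bdmMoments_bdm b hd hk hu1).totalDegree_le i)) (mem_polyLE.2 (hp i)))
    have ewp : ∀ i, pev (w i - p i) = fun y => pev (w i) y - pev (p i) y := fun i =>
      funext fun y => pev_sub _ _ _
    intro i
    constructor
    · have t := nrm_sub_le_add (hpC (w i)) (hpC (p i)) (hu i).1
      rw [← ewp, nrm_sub_comm (pev (p i))] at t
      have : K * X + A * X ≤ D * X := by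
        rw [← add_mul]
        refine mul_le_mul_of_nonneg_right (le_add_of_nonneg_right (by positivity)) hX
      have t2 := hp0 i
      have t3 := hwpi i
      rw [mul_assoc D]
      linarith
    · intro m
      have t := nrm_sub_le_add (hpF m (w i)) (hpF m (p i)) (htr i m)
      rw [← ewp, nrm_sub_comm (pev (p i))] at t
      have t1 := mul_le_mul_of_nonneg_left t (Real.sqrt_nonneg h)
      rw [mul_add] at t1
      have t2 := sqrt_mul_nrm_face_pev_le b hd0 hσ (hinv b σ hσ) m (hdeg i)
      have t3 := mul_le_mul_of_nonneg_left (hwpi i)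
        (show 0 ≤ R * (1 + d * (Ci * σ)) by positivity)
      have t4 := htr1 i m
      have : (R * (1 + d * (Ci * σ)) * K + R * ((1 + d) * A)) * X ≤ D * X :=
        mul_le_mul_of_nonneg_right (le_add_of_nonneg_left (by positivity)) hX
      rw [mul_assoc D]
      linarith
  intro i
  have hDh : 0 ≤ D * h ^ (k + 1) := by positivity
  exact ⟨le_mul_of_forall_pos_add hDh fun ε hε => (key ε hε i).1,
    fun m => le_mul_of_forall_pos_add hDh fun ε hε => (key ε hε i).2 m⟩

/-- Approximation of `ν ∂_j f` by the elementwise `L²` projection on the boundary. -/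
theorem exists_elemProj_error_bound (a : AffineBasis (Fin (d + 1)) ℝ (Pt d)) (hd0 : 0 < d)
    {k : ℕ} (hk : 1 ≤ k) {σ : ℝ} (hσ0 : 0 < σ) : ∃ D > (0 : ℝ),
    ∀ b : AffineBasis (Fin (d + 1)) ℝ (Pt d), (∀ i, diamT (verts b) ≤ σ * height b i) →
    ∀ f : Pt d → ℝ, MemH (cell (verts b)) (k + 1) f → ∀ s : ℝ,
      (∀ α : Fin d → ℕ, ∑ j, α j = k + 1 →
        nrm (volume.restrict (cell (verts b))) (weakDeriv (cell (verts b)) α f) ≤ s) →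
      ∀ (ν : ℝ), 0 < ν → ∀ (j : Fin d) (g : Pt d → ℝ), MemH (cell (verts b)) 1 g →
      (g =ᵐ[volume.restrict (cell (verts b))]
        fun x => ν * weakDeriv (cell (verts b)) (Pi.single j 1) f x) →
      ∀ m, Real.sqrt (diamT (verts b)) * nrm (faceMeasure (face (verts b) (b m)))
        (fun y => pev (elemProj (verts b) (k - 1) g) y -
          trace (verts b) (face (verts b) (b m)) g y) ≤ D * ν * diamT (verts b) ^ k * s := by
  obtain ⟨Ci, hCi, hinv⟩ := exists_inverse_bound a hd0 (k - 1)
  set A := approxC d k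
  have hA : 0 < A := approxC_pos d k
  set R := Real.sqrt (σ * (d + 1))
  have hR : 0 < R := Real.sqrt_pos.2 (by positivity)
  set D : ℝ := R * (1 + d * (Ci * σ)) * A + R * ((1 + d) * A)
  have hD : 0 < D := by positivity
  refine ⟨D, hD, fun b hσ f hf s hs ν hν j g hg hgf m => ?_⟩
  set h := diamT (verts b)
  have hh : 0 < h := diamT_pos b hd0
  set μ := (volume : Measure (Pt d)).restrict (cell (verts b))
  have hpC : ∀ p : Poly d, MemLp (pev p) 2 μ := fun p => memLp_cell _ (continuous_pev p)
  have hpF : ∀ p : Poly d, MemLp (pev p) 2 (faceMeasure (face (verts b) (b m))) :=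
    fun p => memLp_face b hd0 m (continuous_pev p)
  have htr : MemLp (trace (verts b) (face (verts b) (b m)) g) 2
    (faceMeasure (face (verts b) (b m))) := (isTrace_trace b hd0 m hg).2.1
  have hf1 := weakDeriv_spec hf (α := Pi.single j 1) (by simp)
  have hgl : ∀ l, weakDeriv (cell (verts b)) (Pi.single l 1) g =ᵐ[μ]
      fun x => ν * weakDeriv (cell (verts b)) (Pi.single j 1 + Pi.single l 1) f x := by
    intro l
    have h2 := (weakDeriv_spec hf (α := Pi.single j 1 + Pi.single l 1)
      (by simp [Finset.sum_add_distrib]; omega)).2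
    have h3 := ((hf1.2.single_of_add h2).const_mul ν).congr_left hgf.symm
      (memLp_locallyIntegrableOn (isOpen_cell _) hg.1)
    exact (weakDeriv_spec hg (by simp)).2.unique (isOpen_cell _) h3
  refine le_mul_of_forall_pos_add (by positivity) fun ε hε => ?_
  obtain ⟨p, hp, -, hp1, hp2⟩ := exists_poly_approx_of_memH b hd0 hk hf hs hε
  set q := ν • MvPolynomial.pderiv j p
  have hq : q.totalDegree ≤ k - 1 := (MvPolynomial.totalDegree_smul_le _ _).trans
    ((totalDegree_pderiv_le j p).trans (Nat.sub_le_sub_right hp 1))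
  have hs0 : 0 ≤ s := (nrm_nonneg _ _).trans (hs (Pi.single ⟨0, hd0⟩ (k + 1)) (by simp))
  set X := ν * (h ^ k * (s + ε))
  have hX : 0 ≤ X := by positivity
  have hg0 : nrm μ (fun x => g x - pev q x) ≤ A * X := by
    have e : nrm μ (fun x => g x - pev q x) = nrm μ (fun x => ν *
        (weakDeriv (cell (verts b)) (Pi.single j 1) f x - pev (MvPolynomial.pderiv j p) x)) := by
      refine nrm_congr ?_
      filter_upwards [hgf] with x hx
      rw [hx, pev_smul, mul_sub]
    rw [e, nrm_const_mul, abs_of_pos hν]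
    refine (mul_le_mul_of_nonneg_left (hp1 j) hν.le).trans (le_of_eq ?_)
    simp only [X]; ring
  have hg1 : ∀ l, nrm μ (fun x => weakDeriv (cell (verts b)) (Pi.single l 1) g x -
      partialD l (pev q) x) ≤ h ^ (k - 1) * (A * (ν * (s + ε))) := by
    intro l
    have e : nrm μ (fun x => weakDeriv (cell (verts b)) (Pi.single l 1) g x -
        partialD l (pev q) x) = nrm μ (fun x => ν *
        (weakDeriv (cell (verts b)) (Pi.single j 1 + Pi.single l 1) f x -
          pev (MvPolynomial.pderiv j (MvPolynomial.pderiv l p)) x)) := by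
      refine nrm_congr ?_
      filter_upwards [hgl l] with x hx
      have hql : MvPolynomial.pderiv l q =
          ν • MvPolynomial.pderiv j (MvPolynomial.pderiv l p) := by
        rw [pderiv_pderiv_comm j l]
        exact Derivation.map_smul _ _ _
      rw [hx, partialD_pev, mul_sub, hql, pev_smul]
    rw [e, nrm_const_mul, abs_of_pos hν]
    refine (mul_le_mul_of_nonneg_left (hp2 j l) hν.le).trans (le_of_eq ?_)
    ring
  have hk' : h * h ^ (k - 1) = h ^ k := by
    rw [← pow_succ']; congr 1; omega
  have hsc : scaledH1 (verts b) (fun x => g x - pev q x) (fun l x =>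
      weakDeriv (cell (verts b)) (Pi.single l 1) g x - partialD l (pev q) x) ≤
      (1 + d) * A * X := by
    refine (scaledH1_le b (X := h ^ (k - 1)) (M := A * (ν * (s + ε))) ?_ hg1).trans (le_of_eq ?_)
    · refine hg0.trans (le_of_eq ?_)
      change _ = h * h ^ (k - 1) * _
      rw [hk']; simp only [X]; ring
    · change (1 + (d : ℝ)) * (h * h ^ (k - 1) * _) = _
      rw [hk']; simp only [X]; ring
  have t4 := sqrt_mul_nrm_trace_sub_le b hd0 m (hσ m) hg (contDiff_pev q)
  have t5 := mul_le_mul_of_nonneg_left hsc hR.le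
  have hproj := isL2Proj_l2Proj hpC (k - 1) hg.1
  have hpq := hproj.sub_poly hpC hg.1 hq
  have t1 : nrm μ (pev (elemProj (verts b) (k - 1) g - q)) ≤ A * X :=
    (hpq.nrm_le hpC (hg.1.sub (hpC q))).trans hg0
  have t2 := sqrt_mul_nrm_face_pev_le b hd0 hσ (hinv b σ hσ) m hpq.1
  have t3 := mul_le_mul_of_nonneg_left t1 (show 0 ≤ R * (1 + d * (Ci * σ)) by positivity)
  have t := nrm_sub_le_add (hpF (elemProj (verts b) (k - 1) g)) (hpF q) htr
  rw [nrm_sub_comm (pev q)] at t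
  have ewp : pev (elemProj (verts b) (k - 1) g - q) = fun y =>
    pev (elemProj (verts b) (k - 1) g) y - pev q y := funext fun y => pev_sub _ _ _
  rw [← ewp] at t
  have t6 := mul_le_mul_of_nonneg_left t (Real.sqrt_nonneg h)
  rw [mul_add] at t6
  change Real.sqrt h * nrm _ (pev (elemProj (verts b) (k - 1) g - q)) ≤
    R * (1 + d * (Ci * σ)) * nrm μ (pev (elemProj (verts b) (k - 1) g - q)) at t2
  calc _ ≤ _ := t6
    _ ≤ R * (1 + d * (Ci * σ)) * (A * X) + R * ((1 + d) * A * X) :=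
        add_le_add (t2.trans t3) (t4.trans t5)
    _ = _ := by simp only [D, X]; ring

end ProjectionErrors

variable {d : ℕ}

/-- The contribution of the element `T` to the consistency error. -/
def localError (k : ℕ) (ν : ℝ) (L : Fin d → Fin d → Pt d → ℝ) (u : Fin d → Pt d → ℝ)
    (G : Finset (Pt d) → Fin d → Fin d → Poly d) (v vhat : Finset (Pt d) → Fin d → Poly d)
    (T : Finset (Pt d)) : ℝ :=
  (∑ x ∈ T, ∫ y,
      ∑ i, (∑ j, (pev (elemProj T (k - 1) (L i j)) y - trace T (face T x) (L i j) y)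
          * normal T x j)
        * (pev (vhat (face T x) i) y - pev (v T i) y) ∂faceMeasure (face T x))
  + ν * (∑ x ∈ T, (diamT T)⁻¹ * ∫ y,
      ∑ i, (pev (bdm T k u i) y - trace T (face T x) (u i) y)
        * Triangulation.jump k v vhat T x i y ∂faceMeasure (face T x))
  + ∫ y in cell T,
      ∑ i, (pev (bdm T k u i) y - u i y) * ∑ j, pev (MvPolynomial.pderiv j (G T i j)) y

/-- The contribution of the element `T` to the square of the triple norm. -/
def localTripleSq (k : ℕ) (ν : ℝ) (G : Finset (Pt d) → Fin d → Fin d → Poly d)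
    (v vhat : Finset (Pt d) → Fin d → Poly d) (T : Finset (Pt d)) : ℝ :=
  ν⁻¹ * (∫ y in cell T, ∑ i, ∑ j, pev (G T i j) y ^ 2)
    + ν * (∫ y in cell T, ∑ i, ∑ j, pev (MvPolynomial.pderiv j (v T i)) y ^ 2)
    + ν * ∑ x ∈ T, (diamT T)⁻¹ *
        ∫ y, ∑ i, Triangulation.jump k v vhat T x i y ^ 2 ∂faceMeasure (face T x)

/-- A sum of unsquared norms on `T` that dominates the discrete factor of the local error. -/
def localWeight (k : ℕ) (ν : ℝ) (G : Finset (Pt d) → Fin d → Fin d → Poly d)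
    (v vhat : Finset (Pt d) → Fin d → Poly d) (T : Finset (Pt d)) : ℝ :=
  (∑ i, ∑ j, nrm (volume.restrict (cell T)) (pev (G T i j)))
    + ν * (∑ i, ∑ j, nrm (volume.restrict (cell T)) (pev (MvPolynomial.pderiv j (v T i))))
    + ν * ((Real.sqrt (diamT T))⁻¹ * ∑ x ∈ T,
        vnrm (faceMeasure (face T x)) (Triangulation.jump k v vhat T x))

namespace Triangulation

variable {Ω : Set (Pt d)} (𝒯 : Triangulation Ω)

theorem consistencyError_eq_sum (k : ℕ) (ν : ℝ) (L : Fin d → Fin d → Pt d → ℝ)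
    (u : Fin d → Pt d → ℝ) (G : Finset (Pt d) → Fin d → Fin d → Poly d)
    (v vhat : Finset (Pt d) → Fin d → Poly d) :
    𝒯.consistencyError k ν L u G v vhat =
      ∑ T ∈ 𝒯.elems, localError k ν L u G v vhat T := by
  simp only [consistencyError, localError, Finset.sum_add_distrib, Finset.mul_sum]

theorem tripleNorm_eq_sqrt_sum (k : ℕ) (ν : ℝ) (G : Finset (Pt d) → Fin d → Fin d → Poly d)
    (v vhat : Finset (Pt d) → Fin d → Poly d) :
    𝒯.tripleNorm k ν G v vhat =
      Real.sqrt (∑ T ∈ 𝒯.elems, localTripleSq k ν G v vhat T) := by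
  simp only [tripleNorm, localTripleSq, Finset.sum_add_distrib, Finset.mul_sum]

end Triangulation

theorem sq_sum_nrm_le {α ι : Type*} [MeasurableSpace α] {μ : Measure α} (s : Finset ι)
    {f : ι → α → ℝ} (hf : ∀ i, MemLp (f i) 2 μ) :
    (∑ i ∈ s, nrm μ (f i)) ^ 2 ≤ s.card * ∫ y, ∑ i ∈ s, f i y ^ 2 ∂μ := by
  rw [integral_finsetSum _ fun i _ => (hf i).integrable_sq]
  simpa only [nrm_sq (hf _)] using sq_sum_le_card_mul_sum_sq (s := s) (f := fun l => nrm μ (f l))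

theorem sq_sum_sum_nrm_le {μ : Measure (Pt d)} {f : Fin d → Fin d → Pt d → ℝ}
    (hf : ∀ i j, MemLp (f i j) 2 μ) :
    (∑ i, ∑ j, nrm μ (f i j)) ^ 2 ≤ d ^ 2 * ∫ y, ∑ i, ∑ j, f i j y ^ 2 ∂μ := by
  have h := sq_sum_nrm_le (Finset.univ : Finset (Fin d × Fin d)) (f := fun p => f p.1 p.2)
    (μ := μ) fun p => hf p.1 p.2
  simpa [Fintype.sum_prod_type, sq] using h

theorem abs_normal_le_one (b : AffineBasis (Fin (d + 1)) ℝ (Pt d)) (hd : 0 < d) (m : Fin (d + 1))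
    (j : Fin d) : |normal (verts b) (b m) j| ≤ 1 := by
  have h := (isOutwardNormal_verts b hd m).1
  rw [← normal_verts b hd m] at h
  rw [← h]
  simpa using PiLp.norm_apply_le (normal (verts b) (b m)) j

theorem localWeight_sq_le (b : AffineBasis (Fin (d + 1)) ℝ (Pt d)) (hd : 0 < d) (k : ℕ) {ν : ℝ}
    (hν : 0 < ν) (G : Finset (Pt d) → Fin d → Fin d → Poly d)
    (v vhat : Finset (Pt d) → Fin d → Poly d) :
    localWeight k ν G v vhat (verts b) ^ 2 ≤
      3 * (d + 1) ^ 2 * ν * localTripleSq k ν G v vhat (verts b) := by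
  have hh := diamT_pos b hd
  rw [localWeight, localTripleSq, sum_verts, sum_verts]
  set h := diamT (verts b)
  have hC : ∀ p : Poly d, MemLp (pev p) 2 (volume.restrict (cell (verts b))) :=
    fun p => memLp_cell _ (continuous_pev p)
  have hJ : ∀ m i, MemLp (Triangulation.jump k v vhat (verts b) (b m) i) 2
      (faceMeasure (face (verts b) (b m))) := fun m i =>
    (memLp_face b hd m (continuous_pev _)).sub (memLp_face b hd m (continuous_pev _))
  have h1 := sq_sum_sum_nrm_le (μ := volume.restrict (cell (verts b)))
    (f := fun i j => pev (G (verts b) i j)) fun i j => hC _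
  have h2 := sq_sum_sum_nrm_le (μ := volume.restrict (cell (verts b)))
    (f := fun i j => pev (MvPolynomial.pderiv j (v (verts b) i))) fun i j => hC _
  have h3 : (∑ m, vnrm (faceMeasure (face (verts b) (b m)))
      (Triangulation.jump k v vhat (verts b) (b m))) ^ 2 ≤ (d + 1) * d * ∑ m, ∫ y, ∑ i,
        Triangulation.jump k v vhat (verts b) (b m) i y ^ 2
          ∂faceMeasure (face (verts b) (b m)) := by
    refine (sq_sum_le_card_mul_sum_sq (s := Finset.univ)).trans ?_
    rw [Finset.card_univ, Fintype.card_fin, mul_assoc, Finset.mul_sum _ _ (d : ℝ)]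
    push_cast
    refine mul_le_mul_of_nonneg_left (Finset.sum_le_sum fun m _ => ?_)
      (show (0 : ℝ) ≤ (d : ℝ) + 1 by positivity)
    simpa [vnrm] using sq_sum_nrm_le (Finset.univ : Finset (Fin d)) (hJ m)
  rw [← Finset.mul_sum]
  set g := ∑ i, ∑ j, nrm (volume.restrict (cell (verts b))) (pev (G (verts b) i j))
  set w := ∑ i, ∑ j, nrm (volume.restrict (cell (verts b)))
    (pev (MvPolynomial.pderiv j (v (verts b) i)))
  set z := ∑ m, vnrm (faceMeasure (face (verts b) (b m)))
      (Triangulation.jump k v vhat (verts b) (b m))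
  set g' := ∫ y in cell (verts b), ∑ i, ∑ j, pev (G (verts b) i j) y ^ 2
  set w' := ∫ y in cell (verts b), ∑ i, ∑ j, pev (MvPolynomial.pderiv j (v (verts b) i)) y ^ 2
  set z' := ∑ m, ∫ y, ∑ i, Triangulation.jump k v vhat (verts b) (b m) i y ^ 2
    ∂faceMeasure (face (verts b) (b m))
  have hg' : 0 ≤ g' := integral_nonneg fun y => by positivity
  have hw' : 0 ≤ w' := integral_nonneg fun y => by positivity
  have hz' : 0 ≤ z' := Finset.sum_nonneg fun m _ => integral_nonneg fun y => by positivity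
  have hd1 : (d : ℝ) ^ 2 ≤ (d + 1) ^ 2 := by gcongr; linarith
  have hd2 : ((d : ℝ) + 1) * d ≤ (d + 1) ^ 2 := by nlinarith
  have k1 := h1.trans (mul_le_mul_of_nonneg_right hd1 hg')
  have k2 := h2.trans (mul_le_mul_of_nonneg_right hd1 hw')
  have k3 := h3.trans (mul_le_mul_of_nonneg_right hd2 hz')
  have hs : ((Real.sqrt h)⁻¹) ^ 2 = h⁻¹ := by rw [inv_pow, Real.sq_sqrt hh.le]
  calc (g + ν * w + ν * ((Real.sqrt h)⁻¹ * z)) ^ 2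
      ≤ 3 * (g ^ 2 + ν ^ 2 * w ^ 2 + ν ^ 2 * (((Real.sqrt h)⁻¹) ^ 2 * z ^ 2)) := by
        nlinarith [sq_nonneg (g - ν * w), sq_nonneg (g - ν * ((Real.sqrt h)⁻¹ * z)),
          sq_nonneg (ν * w - ν * ((Real.sqrt h)⁻¹ * z))]
    _ ≤ 3 * ((d + 1) ^ 2 * g' + ν ^ 2 * ((d + 1) ^ 2 * w') +
          ν ^ 2 * (h⁻¹ * ((d + 1) ^ 2 * z'))) := by
        rw [hs]; gcongr
    _ = 3 * (d + 1) ^ 2 * ν * (ν⁻¹ * g' + ν * w' + ν * (h⁻¹ * z')) := by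
        field_simp

theorem exists_localError_bound (a : AffineBasis (Fin (d + 1)) ℝ (Pt d)) (hd : d = 2 ∨ d = 3)
    {k : ℕ} (hk : 1 ≤ k) {σ : ℝ} (hσ0 : 0 < σ) :
    ∃ K > 0, ∀ b : AffineBasis (Fin (d + 1)) ℝ (Pt d),
      (∀ i, diamT (verts b) ≤ σ * height b i) →
      ∀ (ν : ℝ), 0 < ν → ∀ (L : Fin d → Fin d → Pt d → ℝ) (u : Fin d → Pt d → ℝ) (s : ℝ),
        (∀ i j, MemH (cell (verts b)) 1 (L i j)) → (∀ i, MemH (cell (verts b)) (k + 1) (u i)) →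
        (∀ i j, L i j =ᵐ[volume.restrict (cell (verts b))]
          fun x => ν * weakDeriv (cell (verts b)) (Pi.single j 1) (u i) x) →
        (∀ i (α : Fin d → ℕ), ∑ l, α l = k + 1 → nrm (volume.restrict (cell (verts b)))
          (weakDeriv (cell (verts b)) α (u i)) ≤ s) →
        ∀ (G : Finset (Pt d) → Fin d → Fin d → Poly d) (v vhat : Finset (Pt d) → Fin d → Poly d),
          (∀ i j, (G (verts b) i j).totalDegree ≤ k - 1) →
          |localError k ν L u G v vhat (verts b)| ≤
            K * (diamT (verts b) ^ k * s * localWeight k ν G v vhat (verts b)) := by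
  have hd0 : 0 < d := by omega
  obtain ⟨D, hD, hbdm⟩ := exists_bdm_error_bound a hd hk hσ0
  obtain ⟨D', hD', hproj⟩ := exists_elemProj_error_bound a hd0 hk hσ0
  obtain ⟨Ci, hCi, hinv⟩ := exists_inverse_bound a hd0 (k - 1)
  set R : ℝ := 2 * (Real.sqrt (σ * (d + 1)) * (2 ^ d + 1))
  have hR : 0 ≤ R := by positivity
  refine ⟨d * d * D' * (1 + (d + 1) * R) + d * D + d * D * (Ci * σ), by positivity, ?_⟩
  intro b hσ ν hν L u s hL hu hLu hs G v vhat hG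
  have hh := diamT_pos b hd0
  rw [localError, localWeight, sum_verts, sum_verts, sum_verts, ← Finset.mul_sum]
  set h := diamT (verts b)
  set δ := Real.sqrt h
  have hδ : 0 < δ := Real.sqrt_pos.2 hh
  have hδ2 : δ * δ = h := Real.mul_self_sqrt hh.le
  have hs0 : 0 ≤ s := (nrm_nonneg _ _).trans
    (hs ⟨0, hd0⟩ (Pi.single ⟨0, hd0⟩ (k + 1)) (by simp))
  set μ := volume.restrict (cell (verts b))
  set F := fun m => faceMeasure (face (verts b) (b m))
  set J := fun m => Triangulation.jump k v vhat (verts b) (b m)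
  have hC : ∀ p : Poly d, MemLp (pev p) 2 μ := fun p => memLp_cell _ (continuous_pev p)
  have hF : ∀ m (p : Poly d), MemLp (pev p) 2 (F m) :=
    fun m p => memLp_face b hd0 m (continuous_pev p)
  have hJ : ∀ m i, MemLp (J m i) 2 (F m) := fun m i => (hF m _).sub (hF m _)
  have hu1 : ∀ i, MemH (cell (verts b)) 1 (u i) := fun i => (hu i).of_le (by omega)
  have htr : ∀ m {f : Pt d → ℝ}, MemH (cell (verts b)) 1 f →
      MemLp (trace (verts b) (face (verts b) (b m)) f) 2 (F m) :=
    fun m f hf => (isTrace_trace b hd0 m hf).2.1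
  set g := ∑ i, ∑ j, nrm μ (pev (G (verts b) i j))
  set w := ∑ i, ∑ j, nrm μ (pev (MvPolynomial.pderiv j (v (verts b) i)))
  set z := ∑ m, vnrm (F m) (J m)
  have hg0 : 0 ≤ g := Finset.sum_nonneg fun i _ => Finset.sum_nonneg fun j _ => nrm_nonneg _ _
  have hw0 : 0 ≤ w := Finset.sum_nonneg fun i _ => Finset.sum_nonneg fun j _ => nrm_nonneg _ _
  have hz0 : 0 ≤ z := Finset.sum_nonneg fun m _ => vnrm_nonneg _ _
  have flux : ∀ m, |∫ y, ∑ i, (∑ j, (pev (elemProj (verts b) (k - 1) (L i j)) y -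
      trace (verts b) (face (verts b) (b m)) (L i j) y) * normal (verts b) (b m) j) *
      (pev (vhat (face (verts b) (b m)) i) y - pev (v (verts b) i) y) ∂F m| ≤
      d * d * D' * (ν * h ^ k * s) * (δ⁻¹ * vnrm (F m) (J m) + R * w) := by
    intro m
    set e : Fin d → Fin d → Pt d → ℝ := fun i j y => pev (elemProj (verts b) (k - 1) (L i j)) y -
      trace (verts b) (face (verts b) (b m)) (L i j) y
    have he : ∀ i j, MemLp (e i j) 2 (F m) := fun i j => (hF m _).sub (htr m (hL i j))
    have hen : ∀ i j, MemLp (fun y => e i j y * normal (verts b) (b m) j) 2 (F m) :=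
      fun i j => (he i j).mul_const _
    have h1 : vnrm (F m) (fun i y => ∑ j, e i j y * normal (verts b) (b m) j) ≤
        d * (d * (δ⁻¹ * (D' * ν * h ^ k * s))) := by
      refine vnrm_le fun i => (nrm_sum_le _ fun j _ => hen i j).trans ?_
      have : ∀ j, nrm (F m) (fun y => e i j y * normal (verts b) (b m) j) ≤
          δ⁻¹ * (D' * ν * h ^ k * s) := by
        intro j
        simp_rw [mul_comm (e i j _)]
        rw [nrm_const_mul]
        refine (mul_le_of_le_one_left (nrm_nonneg _ _) (abs_normal_le_one b hd0 m j)).trans ?_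
        rw [← div_eq_inv_mul, le_div_iff₀' hδ]
        exact hproj b hσ (u i) (hu i) s (hs i) ν hν j (L i j) (hL i j) (hLu i j) m
      refine (Finset.sum_le_sum fun j _ => this j).trans (le_of_eq ?_)
      simp
    have h2 : vnrm (F m) (fun i y => pev (vhat (face (verts b) (b m)) i) y -
        pev (v (verts b) i) y) ≤ vnrm (F m) (J m) + R * (δ * w) := by
      have h3 : vnrm (F m) (fun i y => pev (v (verts b) i) y -
          pev (faceProj (face (verts b) (b m)) (k - 1) (pev (v (verts b) i))) y) ≤
            R * (δ * w) := by
        rw [Finset.mul_sum, Finset.mul_sum, vnrm]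
        exact Finset.sum_le_sum fun i _ => nrm_sub_faceProj_le b hd0 hσ (k - 1) (v (verts b) i) m
      have h4 : ∀ i, nrm (F m) (fun y => pev (vhat (face (verts b) (b m)) i) y -
          pev (v (verts b) i) y) ≤ nrm (F m) (J m i) + nrm (F m) (fun y => pev (v (verts b) i) y -
          pev (faceProj (face (verts b) (b m)) (k - 1) (pev (v (verts b) i))) y) := by
        intro i
        have := nrm_sub_le_add (hF m (vhat (face (verts b) (b m)) i))
          (hF m (faceProj (face (verts b) (b m)) (k - 1) (pev (v (verts b) i))))
          (hF m (v (verts b) i))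
        rw [nrm_sub_comm (pev (vhat (face (verts b) (b m)) i))
            (pev (faceProj (face (verts b) (b m)) (k - 1) (pev (v (verts b) i)))),
          nrm_sub_comm (pev (faceProj (face (verts b) (b m)) (k - 1) (pev (v (verts b) i))))
            (pev (v (verts b) i))] at this
        exact this
      refine le_trans ?_ (add_le_add_right h3 _)
      simp only [vnrm]
      rw [← Finset.sum_add_distrib]
      exact Finset.sum_le_sum fun i _ => h4 i
    refine (abs_integral_sum_mul_le (fun i => memLp_finsetSum _ fun j _ => hen i j)
      fun i => (hF m _).sub (hF m _)).trans ?_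
    refine (mul_le_mul h1 h2 (vnrm_nonneg _ _) (by positivity)).trans (le_of_eq ?_)
    field_simp
  have stab : ∀ m, |∫ y, ∑ i, (pev (bdm (verts b) k u i) y -
      trace (verts b) (face (verts b) (b m)) (u i) y) * J m i y ∂F m| ≤
      d * D * (h * h ^ k * s) * (δ⁻¹ * vnrm (F m) (J m)) := by
    intro m
    refine (abs_integral_sum_mul_le (fun i => (hF m _).sub (htr m (hu1 i))) (hJ m)).trans ?_
    have h1 : vnrm (F m) (fun i y => pev (bdm (verts b) k u i) y -
        trace (verts b) (face (verts b) (b m)) (u i) y) ≤ d * (δ⁻¹ * (D * h ^ (k + 1) * s)) := by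
      refine vnrm_le fun i => ?_
      rw [← div_eq_inv_mul, le_div_iff₀' hδ]
      exact (hbdm b hσ u hu s hs i).2 m
    refine (mul_le_mul_of_nonneg_right h1 (vnrm_nonneg _ _)).trans (le_of_eq ?_)
    rw [pow_succ]; ring
  have vol : |∫ y in cell (verts b), ∑ i, (pev (bdm (verts b) k u i) y - u i y) *
      ∑ j, pev (MvPolynomial.pderiv j (G (verts b) i j)) y| ≤
      d * D * (Ci * σ) * (h ^ k * s * g) := by
    have hdiv : ∀ i, MemLp (fun y => ∑ j, pev (MvPolynomial.pderiv j (G (verts b) i j)) y) 2 μ :=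
      fun i => memLp_finsetSum _ fun j _ => hC _
    refine (abs_integral_sum_mul_le (fun i => (hC _).sub (hu i).1) hdiv).trans ?_
    have h1 : vnrm μ (fun i y => pev (bdm (verts b) k u i) y - u i y) ≤
        d * (D * h ^ (k + 1) * s) := vnrm_le fun i => (hbdm b hσ u hu s hs i).1
    have h2 : vnrm μ (fun i y => ∑ j, pev (MvPolynomial.pderiv j (G (verts b) i j)) y) ≤
        h⁻¹ * (Ci * σ * g) := by
      rw [← div_eq_inv_mul, le_div_iff₀' hh, vnrm, Finset.mul_sum, Finset.mul_sum]
      refine Finset.sum_le_sum fun i _ => ?_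
      refine (mul_le_mul_of_nonneg_left (nrm_sum_le _ fun j _ => hC _) hh.le).trans ?_
      rw [Finset.mul_sum, Finset.mul_sum]
      exact Finset.sum_le_sum fun j _ => hinv b σ hσ _ (hG i j) j
    refine (mul_le_mul h1 h2 (vnrm_nonneg _ _) (by positivity)).trans (le_of_eq ?_)
    rw [pow_succ]; field_simp
  have t1 : |∑ m, ∫ y, ∑ i, (∑ j, (pev (elemProj (verts b) (k - 1) (L i j)) y -
      trace (verts b) (face (verts b) (b m)) (L i j) y) * normal (verts b) (b m) j) *
      (pev (vhat (face (verts b) (b m)) i) y - pev (v (verts b) i) y) ∂F m| ≤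
      d * d * D' * (ν * h ^ k * s) * (δ⁻¹ * z + (d + 1) * R * w) := by
    refine (Finset.abs_sum_le_sum_abs _ _).trans ((Finset.sum_le_sum fun m _ => flux m).trans
      (le_of_eq ?_))
    rw [← Finset.mul_sum, Finset.sum_add_distrib, ← Finset.mul_sum]
    simp only [Finset.sum_const, Finset.card_univ, Fintype.card_fin, nsmul_eq_mul]
    push_cast
    ring
  have t2 : |ν * (h⁻¹ * ∑ m, ∫ y, ∑ i, (pev (bdm (verts b) k u i) y -
      trace (verts b) (face (verts b) (b m)) (u i) y) * J m i y ∂F m)| ≤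
      d * D * (ν * h ^ k * s) * (δ⁻¹ * z) := by
    rw [abs_mul, abs_mul, abs_of_pos hν, abs_of_pos (inv_pos.2 hh)]
    have := (Finset.abs_sum_le_sum_abs _ _).trans (Finset.sum_le_sum fun m (_ : m ∈ Finset.univ) =>
      stab m)
    rw [← Finset.mul_sum, ← Finset.mul_sum] at this
    refine (mul_le_mul_of_nonneg_left (mul_le_mul_of_nonneg_left this (inv_pos.2 hh).le)
      hν.le).trans (le_of_eq ?_)
    field_simp
    rfl
  refine (abs_add_three _ _ _).trans ((add_le_add (add_le_add t1 t2) vol).trans ?_)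
  have hy : 0 ≤ δ⁻¹ * z := by positivity
  set y := δ⁻¹ * z
  have hP : 0 ≤ h ^ k * s := by positivity
  set P := h ^ k * s
  have e1 : ν * h ^ k * s = ν * P := mul_assoc _ _ _
  rw [e1]
  have c1 : y + (d + 1) * R * w ≤ (1 + (d + 1) * R) * (w + y) := by
    have : 0 ≤ (d + 1) * R * y := by positivity
    linarith
  have c2 : d * d * D' * (ν * P) * (y + (d + 1) * R * w) ≤
      d * d * D' * (1 + (d + 1) * R) * (P * (g + ν * w + ν * y)) := by
    calc _ ≤ d * d * D' * (ν * P) * ((1 + (d + 1) * R) * (w + y)) := by gcongr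
      _ = d * d * D' * (1 + (d + 1) * R) * (P * (0 + ν * w + ν * y)) := by ring
      _ ≤ _ := by gcongr
  have c3 : d * D * (ν * P) * y ≤ d * D * (P * (g + ν * w + ν * y)) := by
    calc _ = d * D * (P * (0 + ν * 0 + ν * y)) := by ring
      _ ≤ _ := by gcongr
  have c4 : d * D * (Ci * σ) * (P * g) ≤ d * D * (Ci * σ) * (P * (g + ν * w + ν * y)) := by
    calc _ = d * D * (Ci * σ) * (P * (g + ν * 0 + ν * 0)) := by ring
      _ ≤ _ := by gcongr
  refine (add_le_add (add_le_add c2 c3) c4).trans (le_of_eq ?_)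
  ring

variable {d : ℕ} {Ω : Set (Pt d)}

/-- The sum of the unsquared `L²(T)` norms of the weak derivatives of order `m` on `Ω`. -/
def derivSum (Ω : Set (Pt d)) (m : ℕ) (u : Fin d → Pt d → ℝ) (T : Finset (Pt d)) : ℝ :=
  ∑ i, ∑ α ∈ Finset.piAntidiag (Finset.univ : Finset (Fin d)) m,
    nrm (volume.restrict (cell T)) (weakDeriv Ω α (u i))

theorem nrm_weakDeriv_le_derivSum {m : ℕ} (u : Fin d → Pt d → ℝ) (T : Finset (Pt d)) (i : Fin d)
    {α : Fin d → ℕ} (hα : ∑ l, α l = m) :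
    nrm (volume.restrict (cell T)) (weakDeriv Ω α (u i)) ≤ derivSum Ω m u T := by
  have h1 := Finset.single_le_sum
    (f := fun α => nrm (volume.restrict (cell T)) (weakDeriv Ω α (u i)))
    (fun _ _ => nrm_nonneg _ _)
    (show α ∈ Finset.piAntidiag (Finset.univ : Finset (Fin d)) m by simp [hα])
  exact h1.trans (Finset.single_le_sum (f := fun i => ∑ α ∈ Finset.piAntidiag Finset.univ m,
    nrm (volume.restrict (cell T)) (weakDeriv Ω α (u i)))
    (fun _ _ => Finset.sum_nonneg fun _ _ => nrm_nonneg _ _) (Finset.mem_univ i))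

theorem derivSum_nonneg (m : ℕ) (u : Fin d → Pt d → ℝ) (T : Finset (Pt d)) :
    0 ≤ derivSum Ω m u T :=
  Finset.sum_nonneg fun _ _ => Finset.sum_nonneg fun _ _ => nrm_nonneg _ _

namespace Triangulation

variable (𝒯 : Triangulation Ω)

theorem sum_derivSum_sq_le (hΩ : IsLipschitzDomain Ω) {m : ℕ} {u : Fin d → Pt d → ℝ}
    (hu : ∀ i, MemH Ω m (u i)) :
    ∑ T ∈ 𝒯.elems, derivSum Ω m u T ^ 2 ≤
      (d * (Finset.piAntidiag (Finset.univ : Finset (Fin d)) m).card : ℕ) *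
        seminormH Ω m u ^ 2 := by
  set A := Finset.piAntidiag (Finset.univ : Finset (Fin d)) m
  have hsq : seminormH Ω m u ^ 2 = ∑ p ∈ (Finset.univ : Finset (Fin d)) ×ˢ A,
      ∫ x in Ω, weakDeriv Ω p.2 (u p.1) x ^ 2 := by
    rw [seminormH, Real.sq_sqrt (Finset.sum_nonneg fun _ _ => Finset.sum_nonneg fun _ _ =>
      integral_nonneg fun _ => sq_nonneg _), Finset.sum_product]
  have h1 : ∀ T, derivSum Ω m u T ^ 2 ≤ (d * A.card : ℕ) *
      ∑ p ∈ (Finset.univ : Finset (Fin d)) ×ˢ A,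
        nrm (volume.restrict (cell T)) (weakDeriv Ω p.2 (u p.1)) ^ 2 := by
    intro T
    have h := sq_sum_le_card_mul_sum_sq (s := (Finset.univ : Finset (Fin d)) ×ˢ A)
      (f := fun p => nrm (volume.restrict (cell T)) (weakDeriv Ω p.2 (u p.1)))
    rw [Finset.card_product, Finset.card_univ, Fintype.card_fin] at h
    rw [derivSum, ← Finset.sum_product']
    exact h
  refine (Finset.sum_le_sum fun T _ => h1 T).trans ?_
  rw [← Finset.mul_sum, Finset.sum_comm, hsq]
  refine mul_le_mul_of_nonneg_left (Finset.sum_le_sum fun p hp => ?_) (Nat.cast_nonneg _)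
  have hα : ∑ l, p.2 l = m := by
    have := (Finset.mem_product.1 hp).2
    simpa [A] using this
  exact 𝒯.sum_nrm_cell_sq_le hΩ (weakDeriv_spec (hu p.1) hα.le).1

theorem abs_consistencyError_le (hΩ : IsLipschitzDomain Ω) {k : ℕ} {ν K : ℝ} (hd : 0 < d)
    (hν : 0 < ν) (hK : 0 < K) {L : Fin d → Fin d → Pt d → ℝ} {u : Fin d → Pt d → ℝ}
    (hu : ∀ i, MemH Ω (k + 1) (u i))
    {G : Finset (Pt d) → Fin d → Fin d → Poly d} {v vhat : Finset (Pt d) → Fin d → Poly d}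
    (hloc : ∀ T ∈ 𝒯.elems, |localError k ν L u G v vhat T| ≤
      K * (diamT T ^ k * derivSum Ω (k + 1) u T * localWeight k ν G v vhat T)) :
    |𝒯.consistencyError k ν L u G v vhat| ≤
      K * Real.sqrt ((d * (Finset.piAntidiag (Finset.univ : Finset (Fin d)) (k + 1)).card : ℕ)) *
        Real.sqrt (3 * (d + 1) ^ 2) * Real.sqrt ν * 𝒯.meshSize ^ k * seminormH Ω (k + 1) u *
          𝒯.tripleNorm k ν G v vhat := by
  have hM : 0 ≤ 𝒯.meshSize := Real.iSup_nonneg fun _ => Metric.diam_nonneg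
  have hS : 0 ≤ seminormH Ω (k + 1) u := Real.sqrt_nonneg _
  have hW : ∀ T ∈ 𝒯.elems, 0 ≤ localWeight k ν G v vhat T := fun T _ => by
    have h1 : ∀ f : Fin d → Fin d → Pt d → ℝ,
        0 ≤ ∑ i, ∑ j, nrm (volume.restrict (cell T)) (f i j) := fun f =>
      Finset.sum_nonneg fun i _ => Finset.sum_nonneg fun j _ => nrm_nonneg _ _
    have h2 : 0 ≤ ∑ x ∈ T, vnrm (faceMeasure (face T x)) (jump k v vhat T x) :=
      Finset.sum_nonneg fun _ _ => vnrm_nonneg _ _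
    have h3 := h1 fun i j => pev (G T i j)
    have h4 := h1 fun i j => pev (MvPolynomial.pderiv j (v T i))
    rw [localWeight]
    positivity
  have hWsq : ∑ T ∈ 𝒯.elems, localWeight k ν G v vhat T ^ 2 ≤
      3 * (d + 1) ^ 2 * ν * ∑ T ∈ 𝒯.elems, localTripleSq k ν G v vhat T := by
    rw [Finset.mul_sum]
    refine Finset.sum_le_sum fun T hT => ?_
    obtain ⟨b, rfl⟩ := 𝒯.exists_affineBasis hT
    exact localWeight_sq_le b hd k hν G v vhat
  rw [consistencyError_eq_sum, tripleNorm_eq_sqrt_sum]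
  calc |∑ T ∈ 𝒯.elems, localError k ν L u G v vhat T|
      ≤ ∑ T ∈ 𝒯.elems, K * 𝒯.meshSize ^ k *
          (derivSum Ω (k + 1) u T * localWeight k ν G v vhat T) := by
        refine (Finset.abs_sum_le_sum_abs _ _).trans (Finset.sum_le_sum fun T hT => ?_)
        refine (hloc T hT).trans ?_
        rw [mul_assoc, mul_assoc]
        have h1 := 𝒯.diamT_le_meshSize hT
        have h2 := mul_nonneg (derivSum_nonneg (Ω := Ω) (k + 1) u T) (hW T hT)
        have h3 : 0 ≤ diamT T := Metric.diam_nonneg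
        gcongr
    _ = K * 𝒯.meshSize ^ k *
          ∑ T ∈ 𝒯.elems, derivSum Ω (k + 1) u T * localWeight k ν G v vhat T := by
        rw [Finset.mul_sum]
    _ ≤ K * 𝒯.meshSize ^ k * (Real.sqrt (∑ T ∈ 𝒯.elems, derivSum Ω (k + 1) u T ^ 2) *
          Real.sqrt (∑ T ∈ 𝒯.elems, localWeight k ν G v vhat T ^ 2)) := by
        gcongr
        exact Real.sum_mul_le_sqrt_mul_sqrt _ _ _
    _ ≤ K * 𝒯.meshSize ^ k * (Real.sqrt ((d * (Finset.piAntidiag (Finset.univ :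
            Finset (Fin d)) (k + 1)).card : ℕ) * seminormH Ω (k + 1) u ^ 2) *
          Real.sqrt (3 * (d + 1) ^ 2 * ν * ∑ T ∈ 𝒯.elems, localTripleSq k ν G v vhat T)) := by
        gcongr
        exact 𝒯.sum_derivSum_sq_le hΩ hu
    _ = _ := by
        rw [Real.sqrt_mul (Nat.cast_nonneg _), Real.sqrt_sq hS, Real.sqrt_mul (by positivity),
          Real.sqrt_mul (by positivity)]
        ring

end Triangulation

end HDG

end

theorem BDM_consistency_error_bound
    (d : ℕ) (hd : d = 2 ∨ d = 3) (k : ℕ) (hk : 1 ≤ k)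
    (Ω : Set (HDG.Pt d)) (hΩ : HDG.IsLipschitzDomain Ω)
    (ι : Type*) (𝒯 : ι → HDG.Triangulation Ω)
    (hreg : ∃ σ : ℝ, ∀ h : ι, (𝒯 h).ShapeRegular σ) :
    ∃ C > (0 : ℝ), ∀ (h : ι) (ν : ℝ), 0 < ν →
      ∀ (L : Fin d → Fin d → HDG.Pt d → ℝ) (u : Fin d → HDG.Pt d → ℝ),
        (∀ i j, HDG.MemH Ω k (L i j)) → (∀ i, HDG.MemH Ω (k + 1) (u i)) →
        (∀ i j, L i j =ᵐ[volume.restrict Ω]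
          fun x => ν * HDG.weakDeriv Ω (Pi.single j 1) (u i) x) →
        ∀ (G : Finset (HDG.Pt d) → Fin d → Fin d → HDG.Poly d)
          (v vhat : Finset (HDG.Pt d) → Fin d → HDG.Poly d),
          (𝒯 h).MemSigma k G → (𝒯 h).MemV0 k v → (𝒯 h).MemVhat0 k vhat →
          |(𝒯 h).consistencyError k ν L u G v vhat| ≤
            C * Real.sqrt ν * (𝒯 h).meshSize ^ k * HDG.seminormH Ω (k + 1) u *
              (𝒯 h).tripleNorm k ν G v vhat := by
  have hd0 : 0 < d := by omega
  obtain ⟨σ, hσ⟩ := hreg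
  obtain ⟨a⟩ : Nonempty (AffineBasis (Fin (d + 1)) ℝ (HDG.Pt d)) :=
    AffineBasis.exists_affineBasis_of_finiteDimensional (by simp)
  obtain ⟨K, hK, hloc⟩ := HDG.exists_localError_bound a hd hk (σ := |σ| + 1) (by positivity)
  have hcard : 0 < d * (Finset.piAntidiag (Finset.univ : Finset (Fin d)) (k + 1)).card :=
    Nat.mul_pos hd0 (Finset.card_pos.2 ⟨Pi.single ⟨0, hd0⟩ (k + 1), by simp⟩)
  refine ⟨_, mul_pos (mul_pos hK (Real.sqrt_pos.2 (Nat.cast_pos.2 hcard)))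
    (Real.sqrt_pos.2 (show (0 : ℝ) < 3 * ((d : ℝ) + 1) ^ 2 by positivity)), ?_⟩
  intro h ν hν L u hL hu hLu G v vhat hG _ _
  refine (𝒯 h).abs_consistencyError_le hΩ hd0 hν hK hu fun T hT => ?_
  have hsub := (𝒯 h).cell_subset hΩ hT
  have hG' := hG T hT
  obtain ⟨b, rfl⟩ := (𝒯 h).exists_affineBasis hT
  have hder : ∀ i (α : Fin d → ℕ), ∑ l, α l ≤ k + 1 →
      HDG.weakDeriv (HDG.cell (HDG.verts b)) α (u i)
        =ᵐ[volume.restrict (HDG.cell (HDG.verts b))] HDG.weakDeriv Ω α (u i) :=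
    fun i α hα => HDG.weakDeriv_mono (HDG.isOpen_cell _) hsub (hu i) hα
  refine hloc b (fun i => ?_) ν hν L u _ (fun i j => ((hL i j).mono hsub).of_le hk)
    (fun i => (hu i).mono hsub) (fun i j => ?_) (fun i α hα => ?_) G v vhat hG'
  · refine ((hσ h).diamT_le (𝒯 h) hd0 hT i).trans ?_
    exact mul_le_mul_of_nonneg_right ((le_abs_self σ).trans (by linarith))
      (HDG.height_pos b hd0 i).le
  · filter_upwards [hder i (Pi.single j 1) (by simp),
      ae_mono (Measure.restrict_mono_set _ hsub) (hLu i j)] with x h1 h2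
    rw [h2, h1]
  · rw [HDG.nrm_congr (hder i α hα.le)]
    exact HDG.nrm_weakDeriv_le_derivSum u _ i hα
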